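/- Assume the dilations are isotropic, a_j = α_j I with α_j real nonzero and |α_j| → ∞. Suppose ψ ∈ L¹(ℝ^d) with ∫_{ℝ^d} ψ dx = 1 and ‖ψ − ψ(·−y)‖_{H¹} → 0 as y → 0. Then for all f ∈ H¹(ℝ^d), ‖f‖_{H¹} ≈ inf { ‖c‖_{ℓ¹(h¹)} : c ∈ ℓ¹(h¹) and f = Sc, where for each j the sum over k converges absolutely in L¹ to a function in H¹ and the sum over j converges absolutely in H¹ }, with implied constants independent of f. -/

import Mathlib

open MeasureTheory Filter Matrix Set
open scoped ENNReal NNReal Topology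

noncomputable section

namespace AffinePaper

/-- Embed an integer lattice point `k ∈ ℤ^d` into `ℝ^d`. -/
def intVec {d : ℕ} (k : Fin d → ℤ) : Fin d → ℝ := fun i => (k i : ℝ)

/-- Euclidean norm `|x|` on `ℝ^d`. -/
def eucNorm {d : ℕ} (x : Fin d → ℝ) : ℝ := Real.sqrt (∑ i, x i ^ 2)

/-- The constant `C_d = Γ((d+1)/2) π^{-(d+1)/2}` of the Riesz kernel. -/
def rieszConst (d : ℕ) : ℝ :=
  Real.Gamma (((d : ℝ) + 1) / 2) / Real.pi ^ (((d : ℝ) + 1) / 2)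

/-- The (vector-valued) Riesz kernel `Z(x) = C_d x / |x|^{d+1}`, with `Z(0) = 0`. -/
def rieszKernel (d : ℕ) (x : Fin d → ℝ) : Fin d → ℝ :=
  if x = 0 then 0 else fun i => rieszConst d * x i / eucNorm x ^ (d + 1)

/-- The truncated singular integral `∫_{|y| > ε} f(x-y) Z(y) dy` (vector-valued). -/
def truncRiesz {d : ℕ} (f : (Fin d → ℝ) → ℂ) (x : Fin d → ℝ) (ε : ℝ) : Fin d → ℂ :=
  ∫ y in {y : Fin d → ℝ | ε < eucNorm y}, (fun i => f (x - y) * ((rieszKernel d y i : ℝ) : ℂ))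

/-- `g` is the Riesz transform `Rf = f * Z` of `f`, in the principal value sense:
for a.e. `x` the truncated integrals converge to `g(x)` as `ε → 0+`. -/
def HasRiesz {d : ℕ} (f : (Fin d → ℝ) → ℂ) (g : (Fin d → ℝ) → Fin d → ℂ) : Prop :=
  ∀ᵐ x : Fin d → ℝ, Tendsto (fun ε : ℝ => truncRiesz f x ε) (𝓝[>] 0) (𝓝 (g x))

/-- Membership in the Hardy space `H¹(ℝ^d) = { f ∈ L¹ : Rf ∈ L¹ }`. -/
def MemH1 {d : ℕ} (f : (Fin d → ℝ) → ℂ) : Prop :=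
  Integrable f volume ∧ ∃ g : (Fin d → ℝ) → Fin d → ℂ, Integrable g volume ∧ HasRiesz f g

/-- The Hardy norm `‖f‖_{H¹} = ‖f‖₁ + ‖Rf‖₁`, as a value in `[0,∞]` (equal to `∞` when
`f` admits no integrable Riesz transform; the Riesz transform is a.e. unique, so the
infimum below is over a set of at most one value). -/
def hardyNorm {d : ℕ} (f : (Fin d → ℝ) → ℂ) : ℝ≥0∞ :=
  ENNReal.ofReal (∫ x : Fin d → ℝ, ‖f x‖) +
    sInf {r : ℝ≥0∞ | ∃ g : (Fin d → ℝ) → Fin d → ℂ,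
      Integrable g volume ∧ HasRiesz f g ∧ r = ENNReal.ofReal (∫ x : Fin d → ℝ, ‖g x‖)}

/-- The centered open unit cube `C₀ = (-1/2, 1/2)^d`. -/
def centeredCube (d : ℕ) : Set (Fin d → ℝ) :=
  Set.univ.pi fun _ => Set.Ioo (-(1/2) : ℝ) (1/2)

/-- `ν` is a smooth cut-off function: supported in the centered unit cube `C₀` and
identically `1` near the origin. -/
structure IsCutoff (d : ℕ) (ν : (Fin d → ℝ) → ℝ) : Prop where
  smooth : ContDiff ℝ (⊤ : ℕ∞) ν
  supp : tsupport ν ⊆ centeredCube d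
  one_near_zero : ∀ᶠ ξ in 𝓝 0, ν ξ = 1

/-- The periodic function `ζ(ξ) = -i (ξ b⁻¹ / |ξ b⁻¹|) ν(ξ)` (vector-valued), whose Fourier
coefficients define the discrete Riesz kernel. -/
def zetaFn {d : ℕ} (b : Matrix (Fin d) (Fin d) ℝ) (ν : (Fin d → ℝ) → ℝ)
    (ξ : Fin d → ℝ) : Fin d → ℂ :=
  fun i => -Complex.I * ((((ξ ᵥ* b⁻¹) i / eucNorm (ξ ᵥ* b⁻¹) : ℝ)) : ℂ) * ((ν ξ : ℝ) : ℂ)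

/-- The discrete Riesz kernel `z = {z_k}`, defined through its Fourier series
`Σ_k z_k e^{-2πi ξ k} = ζ(ξ)`, `ξ ∈ C₀`; that is, `z_k = ∫_{C₀} ζ(ξ) e^{2πi ξ k} dξ`. -/
def zKernel {d : ℕ} (b : Matrix (Fin d) (Fin d) ℝ) (ν : (Fin d → ℝ) → ℝ)
    (k : Fin d → ℤ) : Fin d → ℂ :=
  ∫ ξ in centeredCube d,
    Complex.exp (((2 * Real.pi * ∑ i, ξ i * (k i : ℝ) : ℝ)) * Complex.I) • zetaFn b ν ξ

/-- Discrete convolution `(s * z)_k = Σ_l s_{k-l} z_l` of a scalar sequence with the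
(vector-valued) kernel `z`, in the `k`-index. -/
def dConv {d : ℕ} (s : (Fin d → ℤ) → ℂ) (z : (Fin d → ℤ) → Fin d → ℂ)
    (k : Fin d → ℤ) : Fin d → ℂ :=
  ∑' l : Fin d → ℤ, s (k - l) • z l

/-- The discrete Hardy norm `‖s‖_{h¹} = ‖s‖_{ℓ¹} + ‖s * z‖_{ℓ¹}` (value in `[0,∞]`). -/
def h1Norm {d : ℕ} (b : Matrix (Fin d) (Fin d) ℝ) (ν : (Fin d → ℝ) → ℝ)
    (s : (Fin d → ℤ) → ℂ) : ℝ≥0∞ :=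
  (∑' k : Fin d → ℤ, (‖s k‖₊ : ℝ≥0∞)) +
    ∑' k : Fin d → ℤ, (‖dConv s (zKernel b ν) k‖₊ : ℝ≥0∞)

/-- The mixed norm `‖c‖_{ℓ¹(h¹)} = Σ_j ‖c_j‖_{h¹}` (value in `[0,∞]`). -/
def l1h1Norm {d : ℕ} (b : Matrix (Fin d) (Fin d) ℝ) (ν : (Fin d → ℝ) → ℝ)
    (c : ℕ → (Fin d → ℤ) → ℂ) : ℝ≥0∞ :=
  ∑' j : ℕ, h1Norm b ν (c j)

/-- `ψ_{j,k}(x) = |det a_j| ψ(a_j x - bk)` for isotropic dilations `a_j = α_j I`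
(Hardy-space normalization, `p = 1`). -/
def rescH {d : ℕ} (α : ℕ → ℝ) (b : Matrix (Fin d) (Fin d) ℝ) (ψ : (Fin d → ℝ) → ℂ)
    (j : ℕ) (k : Fin d → ℤ) (x : Fin d → ℝ) : ℂ :=
  ((|α j| ^ d : ℝ) : ℂ) * ψ (α j • x - b *ᵥ intVec k)

/-- The synthesis series `Sc = Σ_j Σ_k c_{j,k} ψ_{j,k}` converges to `f` in `H¹`:
for each `j` the sum over `k` converges absolutely in `L¹` to a function belonging to
`H¹`, and the sum over `j` converges absolutely in `H¹`, with limit `f`. -/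
def H1SynthesisTo {d : ℕ} (α : ℕ → ℝ) (b : Matrix (Fin d) (Fin d) ℝ)
    (ψ : (Fin d → ℝ) → ℂ) (c : ℕ → (Fin d → ℤ) → ℂ) (f : (Fin d → ℝ) → ℂ) : Prop :=
  (∀ j : ℕ, Summable fun k : Fin d → ℤ => ∫ x : Fin d → ℝ, ‖c j k * rescH α b ψ j k x‖) ∧
  (∀ j : ℕ, MemH1 (fun x => ∑' k : Fin d → ℤ, c j k * rescH α b ψ j k x)) ∧
  Summable (fun j : ℕ =>
    (hardyNorm (fun x => ∑' k : Fin d → ℤ, c j k * rescH α b ψ j k x)).toReal) ∧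
  Tendsto (fun J : ℕ => hardyNorm
      (fun x => f x - ∑ j ∈ Finset.range J, ∑' k : Fin d → ℤ, c j k * rescH α b ψ j k x))
    atTop (𝓝 0)

/-- Analysis operator at scale `j` in the Hardy-space setting (`p = 1`, `q = ∞`):
`(T_j f)_k = |det b| ⟨f, φ_{j,k}⟩` with `φ_{j,k}(x) = φ(α_j x - bk)`. -/
def TjH {d : ℕ} (α : ℕ → ℝ) (b : Matrix (Fin d) (Fin d) ℝ) (φ : (Fin d → ℝ) → ℂ)
    (f : (Fin d → ℝ) → ℂ) (j : ℕ) (k : Fin d → ℤ) : ℂ :=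
  ((|b.det| : ℝ) : ℂ) *
    ∫ x : Fin d → ℝ, f x * (starRingEnd ℂ) (φ (α j • x - b *ᵥ intVec k))

/-- Dot product of row vector `ξ` and column vector `x`. -/
def dotP {d : ℕ} (ξ x : Fin d → ℝ) : ℝ := ∑ i, ξ i * x i

/-- Fourier transform `f̂(ξ) = ∫ f(x) e^{-2πi ξ x} dx`. -/
def ft {d : ℕ} (f : (Fin d → ℝ) → ℂ) (ξ : Fin d → ℝ) : ℂ :=
  ∫ x : Fin d → ℝ, Complex.exp ((-(2 * Real.pi * dotP ξ x) : ℝ) * Complex.I) * f x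

/-- Inverse Fourier transform `ǧ(x) = ∫ g(ξ) e^{2πi ξ x} dξ`. -/
def ftInv {d : ℕ} (g : (Fin d → ℝ) → ℂ) (x : Fin d → ℝ) : ℂ :=
  ∫ ξ : Fin d → ℝ, Complex.exp (((2 * Real.pi * dotP ξ x) : ℝ) * Complex.I) * g ξ

/-- `f` is a Schwartz function. -/
def IsSchwartz {d : ℕ} (f : (Fin d → ℝ) → ℂ) : Prop :=
  ∃ Φ : SchwartzMap (Fin d → ℝ) ℂ, ∀ x, f x = Φ x

/-- Convolution `(f * g)(x) = ∫ f(y) g(x - y) dy`. -/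
def conv {d : ℕ} (f g : (Fin d → ℝ) → ℂ) (x : Fin d → ℝ) : ℂ :=
  ∫ y : Fin d → ℝ, f y * g (x - y)

/-- The periodization `Pg(x) = |det b| Σ_{k ∈ ℤ^d} g(x - bk)` of a real-valued function. -/
def periodization {d : ℕ} (b : Matrix (Fin d) (Fin d) ℝ) (g : (Fin d → ℝ) → ℝ)
    (x : Fin d → ℝ) : ℝ :=
  |b.det| * ∑' k : Fin d → ℤ, g (x - b *ᵥ intVec k)

open Real in
/-- The character `t ↦ e^{2πit}`. -/
def ech (t : ℝ) : ℂ := Complex.exp ((2 * π * t : ℝ) * Complex.I)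

lemma norm_ech (t : ℝ) : ‖ech t‖ = 1 := Complex.norm_exp_ofReal_mul_I _

lemma ech_add (s t : ℝ) : ech (s + t) = ech s * ech t := by
  rw [ech, ech, ech, ← Complex.exp_add]; congr 1; push_cast; ring

lemma ech_zero : ech 0 = 1 := by simp [ech]

lemma ech_neg (t : ℝ) : ech (-t) = (starRingEnd ℂ) (ech t) := by
  rw [ech, ech, ← Complex.exp_conj, map_mul, Complex.conj_ofReal, Complex.conj_I]; congr 1
  push_cast; ring

@[fun_prop] lemma continuous_ech : Continuous ech := by unfold ech; fun_prop

section dot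
variable {d : ℕ}

lemma dotP_comm (ξ x : Fin d → ℝ) : dotP ξ x = dotP x ξ := by simp [dotP, mul_comm]
lemma dotP_add (ξ x y : Fin d → ℝ) : dotP ξ (x + y) = dotP ξ x + dotP ξ y := by
  simp [dotP, mul_add, Finset.sum_add_distrib]
lemma dotP_sub (ξ x y : Fin d → ℝ) : dotP ξ (x - y) = dotP ξ x - dotP ξ y := by
  simp [dotP, mul_sub, Finset.sum_sub_distrib]
lemma dotP_neg (ξ x : Fin d → ℝ) : dotP ξ (-x) = -dotP ξ x := by
  simp [dotP, Finset.sum_neg_distrib]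
lemma neg_dotP (ξ x : Fin d → ℝ) : dotP (-ξ) x = -dotP ξ x := by
  simp [dotP, Finset.sum_neg_distrib]
lemma dotP_smul (ξ x : Fin d → ℝ) (a : ℝ) : dotP ξ (a • x) = a * dotP ξ x := by
  simp only [dotP, Finset.mul_sum, Pi.smul_apply, smul_eq_mul]; congr 1; ext; ring
lemma smul_dotP (ξ x : Fin d → ℝ) (a : ℝ) : dotP (a • ξ) x = a * dotP ξ x := by
  rw [dotP_comm, dotP_smul, dotP_comm]
lemma dotP_zero (ξ : Fin d → ℝ) : dotP ξ 0 = 0 := by simp [dotP]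
lemma zero_dotP (ξ : Fin d → ℝ) : dotP 0 ξ = 0 := by simp [dotP]
lemma dotP_mulVec (ξ x : Fin d → ℝ) (b : Matrix (Fin d) (Fin d) ℝ) :
    dotP ξ (b *ᵥ x) = dotP (ξ ᵥ* b) x := by
  change ξ ⬝ᵥ (b *ᵥ x) = (ξ ᵥ* b) ⬝ᵥ x
  exact dotProduct_mulVec _ _ _

@[fun_prop] lemma continuous_dotP {X : Type*} [TopologicalSpace X] {f g : X → Fin d → ℝ}
    (hf : Continuous f) (hg : Continuous g) : Continuous fun x => dotP (f x) (g x) := by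
  unfold dotP; fun_prop


lemma dotP_eq_inner (ξ x : Fin d → ℝ) :
    dotP ξ x = inner ℝ (WithLp.toLp 2 ξ : EuclideanSpace ℝ (Fin d)) (WithLp.toLp 2 x) := by
  simp [dotP, PiLp.inner_apply, mul_comm]

lemma eucNorm_eq_norm (x : Fin d → ℝ) :
    eucNorm x = ‖(WithLp.toLp 2 x : EuclideanSpace ℝ (Fin d))‖ := by
  simp [eucNorm, EuclideanSpace.norm_eq]

lemma eucNorm_nonneg (x : Fin d → ℝ) : 0 ≤ eucNorm x := Real.sqrt_nonneg _

lemma eucNorm_sq (x : Fin d → ℝ) : eucNorm x ^ 2 = ∑ i, x i ^ 2 :=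
  Real.sq_sqrt (Finset.sum_nonneg fun _ _ => sq_nonneg _)

lemma eucNorm_zero : eucNorm (0 : Fin d → ℝ) = 0 := by simp [eucNorm]

lemma eucNorm_eq_zero {x : Fin d → ℝ} : eucNorm x = 0 ↔ x = 0 := by
  rw [eucNorm_eq_norm, norm_eq_zero]; simp

lemma eucNorm_pos {x : Fin d → ℝ} (hx : x ≠ 0) : 0 < eucNorm x :=
  lt_of_le_of_ne (eucNorm_nonneg x) fun h => hx (eucNorm_eq_zero.1 h.symm)

lemma eucNorm_smul (a : ℝ) (x : Fin d → ℝ) : eucNorm (a • x) = |a| * eucNorm x := by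
  rw [eucNorm_eq_norm, eucNorm_eq_norm, WithLp.toLp_smul, norm_smul, Real.norm_eq_abs]

lemma eucNorm_neg (x : Fin d → ℝ) : eucNorm (-x) = eucNorm x := by
  rw [eucNorm_eq_norm, eucNorm_eq_norm, WithLp.toLp_neg, norm_neg]

lemma abs_eucNorm_sub_le (x y : Fin d → ℝ) : |eucNorm x - eucNorm y| ≤ eucNorm (x - y) := by
  simp only [eucNorm_eq_norm, WithLp.toLp_sub]; exact abs_norm_sub_norm_le _ _

lemma abs_le_eucNorm (x : Fin d → ℝ) (i : Fin d) : |x i| ≤ eucNorm x := by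
  rw [eucNorm_eq_norm]
  simpa using PiLp.norm_apply_le (WithLp.toLp 2 x : EuclideanSpace ℝ (Fin d)) i

lemma norm_le_eucNorm (x : Fin d → ℝ) : ‖x‖ ≤ eucNorm x :=
  (pi_norm_le_iff_of_nonneg (eucNorm_nonneg x)).2 fun i => by
    simpa using abs_le_eucNorm x i

lemma eucNorm_le_norm (x : Fin d → ℝ) : eucNorm x ≤ (d + 1) * ‖x‖ := by
  have h : eucNorm x ^ 2 ≤ d * ‖x‖ ^ 2 := by
    rw [eucNorm_sq]
    calc ∑ i, x i ^ 2 ≤ ∑ _i : Fin d, ‖x‖ ^ 2 := Finset.sum_le_sum fun i _ => by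
          rw [← sq_abs]; gcongr; simpa using norm_le_pi_norm x i
      _ = _ := by simp
  refine le_of_sq_le_sq ?_ (by positivity)
  have : (0 : ℝ) ≤ d := by positivity
  nlinarith [sq_nonneg ‖x‖, mul_nonneg this (sq_nonneg ‖x‖), mul_nonneg (mul_nonneg this this) (sq_nonneg ‖x‖)]

@[fun_prop] lemma continuous_eucNorm : Continuous (eucNorm : (Fin d → ℝ) → ℝ) := by
  unfold eucNorm; fun_prop

end dot

section fourier
open FourierTransform
variable {d : ℕ}

lemma ft_eq (f : (Fin d → ℝ) → ℂ) (ξ : Fin d → ℝ) :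
    ft f ξ = ∫ x, ech (-dotP ξ x) * f x := by
  unfold ft ech; congr 1; ext x; congr 3; ring_nf

lemma ftInv_eq (f : (Fin d → ℝ) → ℂ) (x : Fin d → ℝ) :
    ftInv f x = ∫ ξ, ech (dotP ξ x) * f ξ := rfl

lemma ftInv_eq_ft_neg (f : (Fin d → ℝ) → ℂ) (x : Fin d → ℝ) : ftInv f x = ft f (-x) := by
  rw [ft_eq, ftInv_eq]; congr 1; ext y; rw [neg_dotP, neg_neg, dotP_comm]

lemma ft_eq_fourier (f : (Fin d → ℝ) → ℂ) (ξ : Fin d → ℝ) :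
    ft f ξ = 𝓕 (fun v : EuclideanSpace ℝ (Fin d) => f (WithLp.ofLp v)) (WithLp.toLp 2 ξ) := by
  rw [Real.fourier_eq', ft]
  rw [← (PiLp.volume_preserving_ofLp (Fin d)).integral_comp
    (MeasurableEquiv.toLp 2 (Fin d → ℝ)).symm.measurableEmbedding]
  congr 1; ext v
  rw [dotP_eq_inner, real_inner_comm, smul_eq_mul]
  congr 3
  ring_nf

lemma integrable_comp_ofLp {f : (Fin d → ℝ) → ℂ} :
    Integrable (fun v : EuclideanSpace ℝ (Fin d) => f (WithLp.ofLp v)) ↔ Integrable f :=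
  (PiLp.volume_preserving_ofLp (Fin d)).integrable_comp_emb
    (MeasurableEquiv.toLp 2 (Fin d → ℝ)).symm.measurableEmbedding

lemma ftInv_eq_fourierInv (f : (Fin d → ℝ) → ℂ) (x : Fin d → ℝ) :
    ftInv f x = 𝓕⁻ (fun v : EuclideanSpace ℝ (Fin d) => f (WithLp.ofLp v)) (WithLp.toLp 2 x) := by
  rw [ftInv_eq_ft_neg, ft_eq_fourier, Real.fourierInv_eq_fourier_neg, WithLp.toLp_neg]

lemma integrable_ech_mul {f : (Fin d → ℝ) → ℂ} (hf : Integrable f) (ξ : Fin d → ℝ) :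
    Integrable fun x => ech (dotP ξ x) * f x :=
  hf.bdd_mul (c := 1) (Continuous.aestronglyMeasurable (by fun_prop))
    (Eventually.of_forall fun x => (norm_ech _).le)

lemma integrable_ech_neg_mul {f : (Fin d → ℝ) → ℂ} (hf : Integrable f) (ξ : Fin d → ℝ) :
    Integrable fun x => ech (-dotP ξ x) * f x := by
  simpa [neg_dotP] using integrable_ech_mul hf (-ξ)

lemma norm_ft_le (f : (Fin d → ℝ) → ℂ) (ξ : Fin d → ℝ) : ‖ft f ξ‖ ≤ ∫ x, ‖f x‖ := by
  rw [ft_eq]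
  refine (norm_integral_le_integral_norm _).trans (le_of_eq ?_)
  simp [norm_ech]

lemma norm_ftInv_le (f : (Fin d → ℝ) → ℂ) (ξ : Fin d → ℝ) : ‖ftInv f ξ‖ ≤ ∫ x, ‖f x‖ := by
  rw [ftInv_eq_ft_neg]; exact norm_ft_le _ _

lemma continuous_ft {f : (Fin d → ℝ) → ℂ} (hf : Integrable f) : Continuous (ft f) := by
  have : ft f = fun ξ => ∫ x, ech (-dotP ξ x) * f x := funext (ft_eq f)
  rw [this]
  refine continuous_of_dominated (fun ξ => (integrable_ech_neg_mul hf ξ).aestronglyMeasurable)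
    (fun ξ => Eventually.of_forall fun x => ?_) hf.norm (Eventually.of_forall fun x => by fun_prop)
  simp [norm_ech]

lemma continuous_ftInv {f : (Fin d → ℝ) → ℂ} (hf : Integrable f) : Continuous (ftInv f) := by
  rw [funext (ftInv_eq_ft_neg f)]; exact (continuous_ft hf).comp continuous_neg

lemma ft_sub {f g : (Fin d → ℝ) → ℂ} (hf : Integrable f) (hg : Integrable g) (ξ : Fin d → ℝ) :
    ft (fun x => f x - g x) ξ = ft f ξ - ft g ξ := by
  simp only [ft_eq, mul_sub]
  exact integral_sub (integrable_ech_neg_mul hf ξ) (integrable_ech_neg_mul hg ξ)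

lemma ft_const_mul (c : ℂ) (f : (Fin d → ℝ) → ℂ) (ξ : Fin d → ℝ) :
    ft (fun x => c * f x) ξ = c * ft f ξ := by
  simp only [ft_eq, ← integral_const_mul]; congr 1; ext; ring

lemma ft_congr_ae {f g : (Fin d → ℝ) → ℂ} (h : f =ᵐ[volume] g) (ξ : Fin d → ℝ) :
    ft f ξ = ft g ξ := by
  simp only [ft_eq]; refine integral_congr_ae ?_; filter_upwards [h] with x hx; rw [hx]

lemma ft_zero (f : (Fin d → ℝ) → ℂ) : ft f 0 = ∫ x, f x := by
  simp [ft_eq, zero_dotP, ech_zero]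

lemma ft_translate (f : (Fin d → ℝ) → ℂ) (y ξ : Fin d → ℝ) :
    ft (fun x => f (x - y)) ξ = ech (-dotP ξ y) * ft f ξ := by
  rw [ft_eq, ft_eq, ← integral_add_right_eq_self _ y, ← integral_const_mul]
  congr 1; ext x
  rw [dotP_add, neg_add, ech_add, add_sub_cancel_right]; ring

lemma ft_dilate (f : (Fin d → ℝ) → ℂ) {a : ℝ} (ha : a ≠ 0) (ξ : Fin d → ℝ) :
    ft (fun x => ((|a| ^ d : ℝ) : ℂ) * f (a • x)) ξ = ft f (a⁻¹ • ξ) := by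
  rw [ft_eq, ft_eq]
  have := Measure.integral_comp_smul (volume : Measure (Fin d → ℝ))
    (fun x => ech (-dotP (a⁻¹ • ξ) x) * f x) a
  simp only [smul_dotP, dotP_smul] at this
  have h2 : ∀ t : ℝ, a * (a⁻¹ * t) = t := fun t => by field_simp
  simp only [h2] at this
  calc _ = ∫ x, ((|a| ^ d : ℝ) : ℂ) * (ech (-dotP ξ x) * f (a • x)) := by
        congr 1; ext; ring
    _ = ((|a| ^ d : ℝ) : ℂ) * (|(a ^ d)⁻¹| • ∫ x, ech (-dotP (a⁻¹ • ξ) x) * f x) := by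
        rw [integral_const_mul, this, Module.finrank_fin_fun]; simp only [smul_dotP]
    _ = _ := by
        rw [Complex.real_smul, ← mul_assoc, ← Complex.ofReal_mul]
        have : |a| ^ d * |(a ^ d)⁻¹| = 1 := by
          rw [abs_inv, abs_pow]; exact mul_inv_cancel₀ (by positivity)
        rw [this]; simp

lemma integral_ft_mul {f g : (Fin d → ℝ) → ℂ} (hf : Integrable f) (hg : Integrable g) :
    ∫ ξ, ft f ξ * g ξ = ∫ x, f x * ft g x := by
  have h1 : ∀ ξ, ft f ξ * g ξ = ∫ x, ech (-dotP ξ x) * (f x * g ξ) := fun ξ => by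
    rw [ft_eq, ← integral_mul_const]; congr 1; ext; ring
  have h2 : ∀ x, f x * ft g x = ∫ ξ, ech (-dotP ξ x) * (f x * g ξ) := fun x => by
    rw [ft_eq, ← integral_const_mul]; congr 1; ext; rw [dotP_comm]; ring
  simp_rw [h1, h2]
  refine integral_integral_swap ?_
  have := (hg.mul_prod hf)
  refine (this.bdd_mul (c := 1) (f := fun p : (Fin d → ℝ) × (Fin d → ℝ) => ech (-dotP p.1 p.2))
    (Continuous.aestronglyMeasurable (by fun_prop))
    (Eventually.of_forall fun x => (norm_ech _).le)).congr (Eventually.of_forall fun p => ?_)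
  simp only [Function.uncurry]; ring

lemma integral_ftInv_mul {f g : (Fin d → ℝ) → ℂ} (hf : Integrable f) (hg : Integrable g) :
    ∫ ξ, ftInv f ξ * g ξ = ∫ x, f x * ftInv g x := by
  simp_rw [ftInv_eq_ft_neg]
  rw [← integral_neg_eq_self]
  simp only [neg_neg]
  rw [integral_ft_mul hf hg.comp_neg]
  congr 1; ext x; congr 1
  rw [ft_eq, ft_eq, ← integral_neg_eq_self]
  congr 1; ext y; simp [dotP_neg, neg_dotP]

lemma ftInv_ft {f : (Fin d → ℝ) → ℂ} (hc : Continuous f) (hf : Integrable f)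
    (hf' : Integrable (ft f)) (x : Fin d → ℝ) : ftInv (ft f) x = f x := by
  rw [ftInv_eq_fourierInv]
  have : (fun v : EuclideanSpace ℝ (Fin d) => ft f (WithLp.ofLp v)) =
      𝓕 (fun v : EuclideanSpace ℝ (Fin d) => f (WithLp.ofLp v)) := by
    ext v; rw [ft_eq_fourier]
  rw [this, Continuous.fourierInv_fourier_eq]
  · exact hc.comp (PiLp.continuous_ofLp 2 _)
  · exact integrable_comp_ofLp.2 hf
  · rw [← this]; exact integrable_comp_ofLp.2 hf'

lemma ft_ftInv {f : (Fin d → ℝ) → ℂ} (hc : Continuous f) (hf : Integrable f)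
    (hf' : Integrable (ftInv f)) (x : Fin d → ℝ) : ft (ftInv f) x = f x := by
  have hi : Integrable (ft f) := by
    have := hf'.comp_neg
    simpa only [ftInv_eq_ft_neg, neg_neg] using this
  rw [← ftInv_ft hc hf hi x, ftInv_eq_ft_neg]
  rw [ft_eq, ft_eq, ← integral_neg_eq_self]
  simp [ftInv_eq_ft_neg, neg_dotP, dotP_neg]

lemma ae_eq_zero_of_ft_eq_zero {f : (Fin d → ℝ) → ℂ} (hf : Integrable f)
    (h : ∀ᵐ ξ, ft f ξ = 0) : f =ᵐ[volume] 0 := by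
  suffices H : ∀ᵐ v : EuclideanSpace ℝ (Fin d), f (WithLp.ofLp v) = 0 by
    have := (PiLp.volume_preserving_toLp (Fin d)).quasiMeasurePreserving.ae H
    filter_upwards [this] with x hx using by simpa using hx
  have hF := integrable_comp_ofLp.2 hf
  refine ae_eq_zero_of_integral_contDiff_smul_eq_zero hF.locallyIntegrable fun g hg hgs => ?_
  set gc : EuclideanSpace ℝ (Fin d) → ℂ := fun v => (g v : ℂ) with hgc
  have hgcs : HasCompactSupport gc := hgs.comp_left (g := fun t : ℝ => (t : ℂ)) (by simp)
  have hgcd : ContDiff ℝ ((⊤ : ℕ∞) : WithTop ℕ∞) gc := Complex.ofRealCLM.contDiff.comp hg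
  let Φ : SchwartzMap (EuclideanSpace ℝ (Fin d)) ℂ := hgcs.toSchwartzMap hgcd
  have e1 : ∫ v, 𝓕 (fun v : EuclideanSpace ℝ (Fin d) => f (WithLp.ofLp v)) v • (𝓕⁻ Φ) v
      = ∫ v, f (WithLp.ofLp v) • (𝓕 (𝓕⁻ Φ)) v := by
    have := VectorFourier.integral_fourierIntegral_smul_eq_flip (μ := volume) (ν := volume)
      (L := innerₗ (EuclideanSpace ℝ (Fin d))) Real.continuous_fourierChar continuous_inner hF
      (𝓕⁻ Φ).integrable
    rw [flip_innerₗ] at this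
    rw [SchwartzMap.fourier_coe]
    exact this
  rw [FourierTransform.fourier_fourierInv_eq] at e1
  have e2 : ∀ᵐ v, 𝓕 (fun v : EuclideanSpace ℝ (Fin d) => f (WithLp.ofLp v)) v = 0 := by
    have := (PiLp.volume_preserving_ofLp (Fin d)).quasiMeasurePreserving.ae h
    filter_upwards [this] with v hv
    rw [ft_eq_fourier] at hv; simpa using hv
  rw [integral_congr_ae (g := fun _ => (0 : ℂ)) (by
    filter_upwards [e2] with v hv; simp [hv])] at e1
  rw [integral_zero] at e1
  rw [e1]; congr 1; ext v
  simp [Φ, gc, mul_comm]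

lemma ae_eq_of_ft_eq {f g : (Fin d → ℝ) → ℂ} (hf : Integrable f) (hg : Integrable g)
    (h : ∀ᵐ ξ, ft f ξ = ft g ξ) : f =ᵐ[volume] g := by
  have := ae_eq_zero_of_ft_eq_zero (hf.sub hg) (by
    filter_upwards [h] with ξ hξ
    have := ft_sub hf hg ξ
    rw [hξ, sub_self] at this; exact this)
  filter_upwards [this] with x hx
  simpa [sub_eq_zero] using hx

end fourier

section gaussian
open Real

/-- The one-dimensional Gaussian `e^{-πτt²}`. -/
def gauss (τ t : ℝ) : ℝ := rexp (-(π * τ * t ^ 2))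

lemma integrable_gauss {τ : ℝ} (hτ : 0 < τ) : Integrable (gauss τ) := by
  have := integrable_exp_neg_mul_sq (b := π * τ) (by positivity)
  refine this.congr (Eventually.of_forall fun x => ?_)
  simp only [gauss]; congr 1; ring

lemma integrable_mul_gauss {τ : ℝ} (hτ : 0 < τ) : Integrable fun t => t * gauss τ t := by
  have := integrable_mul_exp_neg_mul_sq (b := π * τ) (by positivity)
  refine this.congr (Eventually.of_forall fun x => ?_)
  simp only [gauss]; congr 2; ring

lemma integrable_ech_mul_of_integrable {f : ℝ → ℝ} (hf : Integrable f) (x : ℝ) :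
    Integrable fun t => ech (t * x) * (f t : ℂ) :=
  hf.ofReal.bdd_mul (c := 1) (Continuous.aestronglyMeasurable (by fun_prop))
    (Eventually.of_forall fun x => (norm_ech _).le)

lemma integral_ech_gauss {τ : ℝ} (hτ : 0 < τ) (x : ℝ) :
    ∫ t : ℝ, ech (t * x) * (gauss τ t : ℂ) = ((τ ^ (-(1 / 2) : ℝ) * rexp (-(π * x ^ 2 / τ)) : ℝ) : ℂ) := by
  have h := fourierIntegral_gaussian (b := ((π * τ : ℝ) : ℂ)) (by
    rw [Complex.ofReal_re]; positivity) ((2 * π * x : ℝ) : ℂ)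
  have e1 : ∀ t : ℝ, ech (t * x) * (gauss τ t : ℂ) =
      Complex.exp (Complex.I * ((2 * π * x : ℝ) : ℂ) * t) *
        Complex.exp (-((π * τ : ℝ) : ℂ) * t ^ 2) := fun t => by
    rw [ech, gauss, Complex.ofReal_exp]; congr 2 <;> (push_cast; ring)
  simp_rw [e1, h]
  rw [Complex.ofReal_mul (τ ^ _)]
  congr 1
  · rw [← Complex.ofReal_div, show (π / (π * τ) : ℝ) = τ⁻¹ by field_simp]
    rw [show (1 / 2 : ℂ) = ((1 / 2 : ℝ) : ℂ) by push_cast; rfl, ← Complex.ofReal_cpow (by positivity)]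
    rw [Real.rpow_neg hτ.le, Real.inv_rpow hτ.le]
  · rw [Complex.ofReal_exp]; congr 1; push_cast
    have : (π : ℂ) ≠ 0 := by exact_mod_cast pi_ne_zero
    have : (τ : ℂ) ≠ 0 := by exact_mod_cast hτ.ne'
    field_simp
    try ring

lemma integral_ech_mul_gauss {τ : ℝ} (hτ : 0 < τ) (x : ℝ) :
    ∫ t : ℝ, ech (t * x) * ((t * gauss τ t : ℝ) : ℂ) =
      Complex.I * ((x / τ * (τ ^ (-(1 / 2) : ℝ) * rexp (-(π * x ^ 2 / τ))) : ℝ) : ℂ) := by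
  have hd : ∀ t : ℝ, HasDerivAt (fun t : ℝ => ech (t * x) * (gauss τ t : ℂ))
      (2 * π * Complex.I * x * (ech (t * x) * (gauss τ t : ℂ)) -
        2 * π * τ * (ech (t * x) * ((t * gauss τ t : ℝ) : ℂ))) t := fun t => by
    have h1 : HasDerivAt (fun t : ℝ => ech (t * x)) (2 * π * Complex.I * x * ech (t * x)) t := by
      unfold ech
      have : HasDerivAt (fun t : ℝ => ((2 * π * (t * x) : ℝ) : ℂ) * Complex.I)
          (((2 * π * (1 * x) : ℝ) : ℂ) * Complex.I) t :=
        ((((hasDerivAt_id t).mul_const x).const_mul (2 * π)).ofReal_comp).mul_const _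
      convert this.cexp using 1
      push_cast; ring
    have h2 : HasDerivAt (fun t : ℝ => (gauss τ t : ℂ)) ((-(2 * π * τ * t) * gauss τ t : ℝ) : ℂ) t := by
      refine HasDerivAt.ofReal_comp ?_
      unfold gauss
      have : HasDerivAt (fun t : ℝ => -(π * τ * t ^ 2)) (-(π * τ * (2 * t))) t := by
        simpa using (((hasDerivAt_pow 2 t).const_mul (π * τ)).fun_neg)
      convert this.exp using 1; ring
    have h3 := h1.mul h2
    refine h3.congr_deriv ?_
    push_cast; ring
  have i1 := integrable_ech_mul_of_integrable (integrable_gauss hτ) x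
  have i2 := integrable_ech_mul_of_integrable (integrable_mul_gauss hτ) x
  have := integral_eq_zero_of_hasDerivAt_of_integrable hd
    ((i1.const_mul _).sub (i2.const_mul _)) i1
  rw [integral_sub (i1.const_mul _) (i2.const_mul _), integral_const_mul, integral_const_mul,
    integral_ech_gauss hτ] at this
  have hpi : (π : ℂ) ≠ 0 := by exact_mod_cast pi_ne_zero
  have hτ' : (τ : ℂ) ≠ 0 := by exact_mod_cast hτ.ne'
  rw [sub_eq_zero] at this
  apply mul_left_cancel₀ (show (2 * π * τ : ℂ) ≠ 0 by simp [hpi, hτ'])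
  rw [← this]; push_cast; field_simp

variable {d : ℕ}

/-- The kernel `x_i τ^{-d/2-1} e^{-π|x|²/τ}`. -/
def heatK (i : Fin d) (τ : ℝ) (x : Fin d → ℝ) : ℝ :=
  x i * (τ ^ (-((d : ℝ) / 2 + 1)) * rexp (-(π * eucNorm x ^ 2 / τ)))

/-- The Gaussian `e^{-πτ|ξ|²}` on `ℝ^d`. -/
def gaussD (τ : ℝ) (ξ : Fin d → ℝ) : ℝ := rexp (-(π * τ * eucNorm ξ ^ 2))

@[fun_prop] lemma continuous_gaussD (τ : ℝ) : Continuous (gaussD τ : (Fin d → ℝ) → ℝ) := by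
  unfold gaussD; fun_prop

lemma gaussD_eq_prod (τ : ℝ) (ξ : Fin d → ℝ) : gaussD τ ξ = ∏ j, gauss τ (ξ j) := by
  simp only [gaussD, gauss, ← Real.exp_sum, eucNorm_sq, Finset.mul_sum, Finset.sum_neg_distrib]

lemma ech_sum {ι : Type*} (s : Finset ι) (f : ι → ℝ) : ech (∑ j ∈ s, f j) = ∏ j ∈ s, ech (f j) := by
  classical
  induction s using Finset.induction_on with
  | empty => simp [ech_zero]
  | insert a s ha ih => rw [Finset.sum_insert ha, Finset.prod_insert ha, ech_add, ih]

lemma integrable_gaussD {τ : ℝ} (hτ : 0 < τ) : Integrable (gaussD τ : (Fin d → ℝ) → ℝ) := by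
  rw [funext (gaussD_eq_prod (d := d) τ)]
  exact Integrable.fintype_prod (f := fun _ => gauss τ) fun _ => integrable_gauss hτ

lemma prod_gauss_dual {τ : ℝ} (hτ : 0 < τ) (x : Fin d → ℝ) :
    ∏ j, (τ ^ (-(1 / 2) : ℝ) * rexp (-(π * x j ^ 2 / τ))) =
      τ ^ (-((d : ℝ) / 2)) * rexp (-(π * eucNorm x ^ 2 / τ)) := by
  rw [Finset.prod_mul_distrib, ← Real.exp_sum, Finset.prod_const, ← Real.rpow_natCast,
    ← Real.rpow_mul hτ.le]
  congr 2
  · simp; ring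
  · rw [eucNorm_sq, Finset.sum_neg_distrib, ← Finset.sum_div, ← Finset.mul_sum]

lemma ftInv_gaussD {τ : ℝ} (hτ : 0 < τ) (x : Fin d → ℝ) :
    ftInv (fun ξ => (gaussD τ ξ : ℂ)) x =
      ((τ ^ (-((d : ℝ) / 2)) * rexp (-(π * eucNorm x ^ 2 / τ)) : ℝ) : ℂ) := by
  rw [ftInv_eq]
  have : (fun ξ : Fin d → ℝ => ech (dotP ξ x) * (gaussD τ ξ : ℂ)) =
      fun ξ => ∏ j, (fun t => ech (t * x j) * (gauss τ t : ℂ)) (ξ j) := by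
    ext ξ; rw [gaussD_eq_prod, dotP, ech_sum, Complex.ofReal_prod, ← Finset.prod_mul_distrib]
  rw [this, integral_fintype_prod_volume_eq_prod (f := fun j t => ech (t * x j) * (gauss τ t : ℂ))]
  simp_rw [integral_ech_gauss hτ]
  rw [← Complex.ofReal_prod, prod_gauss_dual hτ]

lemma ftInv_coord_mul_gaussD {τ : ℝ} (hτ : 0 < τ) (i : Fin d) (x : Fin d → ℝ) :
    ftInv (fun ξ => -Complex.I * ((ξ i * gaussD τ ξ : ℝ) : ℂ)) x = (heatK i τ x : ℂ) := by
  rw [ftInv_eq]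
  have : (fun ξ : Fin d → ℝ => ech (dotP ξ x) * (-Complex.I * ((ξ i * gaussD τ ξ : ℝ) : ℂ))) =
      fun ξ => -Complex.I * ∏ j, (fun t => ech (t * x j) *
        (((if j = i then t * gauss τ t else gauss τ t : ℝ)) : ℂ)) (ξ j) := by
    ext ξ
    have e : ∏ j, (((if j = i then ξ j * gauss τ (ξ j) else gauss τ (ξ j) : ℝ)) : ℂ) =
        (ξ i * gauss τ (ξ i)) * ∏ j ∈ Finset.univ.erase i, ((gauss τ (ξ j) : ℝ) : ℂ) := by
      rw [← Finset.mul_prod_erase _ _ (Finset.mem_univ i), if_pos rfl, Complex.ofReal_mul]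
      congr 1
      exact Finset.prod_congr rfl fun j hj => by rw [if_neg (Finset.ne_of_mem_erase hj)]
    rw [gaussD_eq_prod, dotP, ech_sum, Finset.prod_mul_distrib, e,
      ← Finset.mul_prod_erase _ (fun j => gauss τ (ξ j)) (Finset.mem_univ i)]
    push_cast; ring
  rw [this, integral_const_mul, integral_fintype_prod_volume_eq_prod
    (f := fun j t => ech (t * x j) * (((if j = i then t * gauss τ t else gauss τ t : ℝ)) : ℂ)),
    ← Finset.mul_prod_erase _ _ (Finset.mem_univ i)]
  simp only [if_true]
  rw [integral_ech_mul_gauss hτ, Finset.prod_congr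
    (g := fun j => ((τ ^ (-(1 / 2) : ℝ) * rexp (-(π * x j ^ 2 / τ)) : ℝ) : ℂ)) rfl fun j hj => by
      simp only [if_neg (Finset.ne_of_mem_erase hj)]; exact integral_ech_gauss hτ _]
  have h := prod_gauss_dual hτ x
  rw [← Finset.mul_prod_erase _ _ (Finset.mem_univ i)] at h
  rw [← Complex.ofReal_prod, heatK]
  have h3 : τ ^ (-((d : ℝ) / 2 + 1)) = τ ^ (-((d : ℝ) / 2)) / τ := by
    rw [neg_add, Real.rpow_add hτ, Real.rpow_neg_one]; rfl
  have key : ∀ a c : ℂ, -Complex.I * (Complex.I * a * c) = a * c := fun a c => by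
    linear_combination (-(a * c)) * Complex.I_mul_I
  rw [key, ← Complex.ofReal_mul, mul_assoc, h, h3]
  congr 1; ring
end gaussian

section regularizedKernel
open Real

lemma one_add_rpow_mul_exp_le (p : ℝ) {c : ℝ} (hc : 0 < c) :
    ∃ C : ℝ, 0 < C ∧ ∀ t : ℝ, 0 ≤ t → (1 + t) ^ p * rexp (-(c * t)) ≤ C := by
  set n := ⌈p⌉₊
  refine ⟨n.factorial * rexp c / c ^ n, by positivity, fun t ht => ?_⟩
  have h1 : (1 + t) ^ p ≤ (1 + t) ^ n := by
    rw [← Real.rpow_natCast]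
    exact Real.rpow_le_rpow_of_exponent_le (by linarith) (Nat.le_ceil p)
  have h2 := Real.pow_div_factorial_le_exp (c * (1 + t)) (by positivity) n
  have h3 : (1 + t) ^ n ≤ n.factorial * (rexp c * rexp (c * t)) / c ^ n := by
    rw [← Real.exp_add, le_div_iff₀ (by positivity)]
    rw [div_le_iff₀ (by positivity), mul_pow] at h2
    rw [show c + c * t = c * (1 + t) by ring]; linarith
  calc (1 + t) ^ p * rexp (-(c * t)) ≤ (n.factorial * (rexp c * rexp (c * t)) / c ^ n) * rexp (-(c * t)) := by
        gcongr; exact h1.trans h3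
    _ = n.factorial * rexp c / c ^ n * (rexp (c * t) * rexp (-(c * t))) := by ring
    _ = _ := by rw [← Real.exp_add]; simp

lemma rpow_neg_mul_exp_le (p q : ℝ) {c : ℝ} (hc : 0 < c) :
    ∃ C : ℝ, 0 < C ∧ ∀ ρ τ : ℝ, 0 ≤ ρ → 0 < τ →
      τ ^ (-p) * ((1 + ρ / τ) ^ q * rexp (-(c * (ρ / τ)))) ≤ C * (ρ + τ) ^ (-p) := by
  obtain ⟨C, hC, h⟩ := one_add_rpow_mul_exp_le (p + q) hc
  refine ⟨C, hC, fun ρ τ hρ hτ => ?_⟩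
  have hpos : 0 < 1 + ρ / τ := by positivity
  have e : (ρ + τ) ^ (-p) = τ ^ (-p) * (1 + ρ / τ) ^ (-p) := by
    rw [← Real.mul_rpow hτ.le hpos.le]; congr 1; field_simp; ring
  have h' := h (ρ / τ) (by positivity)
  rw [e]
  calc _ = τ ^ (-p) * (1 + ρ / τ) ^ (-p) * ((1 + ρ / τ) ^ (p + q) * rexp (-(c * (ρ / τ)))) := by
        rw [Real.rpow_add hpos, Real.rpow_neg hpos.le]; field_simp
    _ ≤ τ ^ (-p) * (1 + ρ / τ) ^ (-p) * C := by gcongr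
    _ = _ := by ring

lemma abs_exp_neg_sub_exp_neg_le (a b : ℝ) :
    |rexp (-a) - rexp (-b)| ≤ |a - b| * rexp (-(min a b)) := by
  wlog h : a ≤ b generalizing a b
  · rw [abs_sub_comm, abs_sub_comm a, min_comm]; exact this b a (le_of_not_ge h)
  rw [min_eq_left h, abs_of_nonneg (by simpa using h), abs_of_nonpos (by linarith)]
  have : rexp (-b) = rexp (-a) * rexp (a - b) := by rw [← Real.exp_add]; congr 1; ring
  rw [this]
  nlinarith [Real.add_one_le_exp (a - b), Real.exp_pos (-a)]

lemma integrableOn_rpow_mul_add_rpow {p ρ : ℝ} (hp : 1 / 2 < p) (hρ : 0 < ρ) :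
    IntegrableOn (fun s : ℝ => s ^ (-(1 / 2) : ℝ) * (ρ + s) ^ (-p)) (Ioi 0) := by
  have hm : AEStronglyMeasurable (fun s : ℝ => s ^ (-(1 / 2) : ℝ) * (ρ + s) ^ (-p)) volume :=
    (by fun_prop : Measurable _).aestronglyMeasurable
  rw [← Ioc_union_Ioi_eq_Ioi zero_le_one, integrableOn_union]
  constructor
  · have h1 : IntegrableOn (fun s : ℝ => ρ ^ (-p) * s ^ (-(1 / 2) : ℝ)) (Ioc 0 1) := by
      refine Integrable.const_mul ?_ _
      exact (intervalIntegrable_iff_integrableOn_Ioc_of_le zero_le_one).1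
        (intervalIntegral.intervalIntegrable_rpow' (by norm_num))
    refine h1.mono' hm.restrict ((ae_restrict_iff' measurableSet_Ioc).2
      (Eventually.of_forall fun s hs => ?_))
    have hs0 : 0 < s := hs.1
    rw [Real.norm_of_nonneg (by positivity), mul_comm]
    gcongr ?_ * _
    exact Real.rpow_le_rpow_of_nonpos hρ (by linarith) (by linarith)
  · refine (integrableOn_Ioi_rpow_of_lt (a := -(1 / 2) + -p) (by linarith) one_pos).mono' hm.restrict
      ((ae_restrict_iff' measurableSet_Ioi).2 (Eventually.of_forall fun s hs => ?_))
    have hs0 : 0 < s := one_pos.trans hs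
    rw [Real.norm_of_nonneg (by positivity), Real.rpow_add hs0]
    gcongr _ * ?_
    exact Real.rpow_le_rpow_of_nonpos hs0 (by linarith) (by linarith)

lemma integral_rpow_mul_add_rpow (p : ℝ) {ρ : ℝ} (hρ : 0 < ρ) :
    ∫ s in Ioi 0, s ^ (-(1 / 2) : ℝ) * (ρ + s) ^ (-p) =
      ρ ^ (1 / 2 - p) * ∫ s in Ioi 0, s ^ (-(1 / 2) : ℝ) * (1 + s) ^ (-p) := by
  have h := integral_comp_mul_left_Ioi (fun s : ℝ => s ^ (-(1 / 2) : ℝ) * (ρ + s) ^ (-p)) 0 hρ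
  rw [mul_zero, smul_eq_mul] at h
  rw [← mul_inv_cancel_left₀ hρ.ne' (∫ s in Ioi 0, s ^ (-(1 / 2) : ℝ) * (ρ + s) ^ (-p)), ← h,
    ← integral_const_mul, ← integral_const_mul]
  refine setIntegral_congr_fun measurableSet_Ioi fun s hs => ?_
  have hs : 0 < s := hs
  rw [show ρ + ρ * s = ρ * (1 + s) by ring, Real.mul_rpow hρ.le hs.le,
    Real.mul_rpow hρ.le (by positivity), sub_eq_add_neg, Real.rpow_add hρ]
  have : ρ * ρ ^ (-(1 / 2) : ℝ) = ρ ^ (1 / 2 : ℝ) := by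
    nth_rewrite 1 [← Real.rpow_one ρ]
    rw [← Real.rpow_add hρ]; norm_num
  rw [← this]; ring

variable {d : ℕ}

/-- The regularized Riesz kernel, whose Fourier transform is `-i ξ_i/|ξ| e^{-πε²|ξ|²}`. -/
def kreg (i : Fin d) (ε : ℝ) (x : Fin d → ℝ) : ℝ :=
  ∫ s in Ioi 0, s ^ (-(1 / 2) : ℝ) * heatK i (ε ^ 2 + s) x

/-- The multiplier of the `i`-th Riesz transform. -/
def mult (i : Fin d) (ξ : Fin d → ℝ) : ℂ := -Complex.I * ((ξ i / eucNorm ξ : ℝ) : ℂ)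

lemma heatK_eq (i : Fin d) (τ : ℝ) (x : Fin d → ℝ) :
    heatK i τ x = x i * (τ ^ (-((d : ℝ) / 2 + 1)) * rexp (-(π * (eucNorm x ^ 2 / τ)))) := by
  rw [heatK, mul_div_assoc]

lemma abs_heatK_le (d : ℕ) : ∃ C : ℝ, 0 < C ∧ ∀ (i : Fin d) (τ : ℝ) (x : Fin d → ℝ), 0 < τ →
    |heatK i τ x| ≤ C * eucNorm x * (eucNorm x ^ 2 + τ) ^ (-((d : ℝ) / 2 + 1)) := by
  obtain ⟨C, hC, h⟩ := rpow_neg_mul_exp_le ((d : ℝ) / 2 + 1) 0 pi_pos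
  refine ⟨C, hC, fun i τ x hτ => ?_⟩
  have h' := h (eucNorm x ^ 2) τ (by positivity) hτ
  rw [Real.rpow_zero, one_mul] at h'
  rw [heatK_eq, abs_mul, abs_of_nonneg (a := τ ^ _ * _) (by positivity), mul_comm C, mul_assoc]
  have := eucNorm_nonneg x
  gcongr
  exact abs_le_eucNorm x i

lemma measurable_heatK (i : Fin d) : Measurable fun p : ℝ × (Fin d → ℝ) => heatK i p.1 p.2 := by
  have : Measurable (eucNorm : (Fin d → ℝ) → ℝ) := continuous_eucNorm.measurable
  unfold heatK; fun_prop

lemma measurable_kreg (i : Fin d) (ε : ℝ) : Measurable (kreg i ε) := by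
  have hh := measurable_heatK i
  have : Measurable fun p : (Fin d → ℝ) × ℝ =>
      p.2 ^ (-(1 / 2) : ℝ) * heatK i (ε ^ 2 + p.2) p.1 := by
    refine Measurable.mul (by fun_prop) (hh.comp (f := fun p : (Fin d → ℝ) × ℝ => (ε ^ 2 + p.2, p.1))
      (by fun_prop))
  exact (this.stronglyMeasurable.integral_prod_right' (ν := volume.restrict (Ioi 0))).measurable

lemma integrableOn_kreg (i : Fin d) (ε : ℝ) (x : Fin d → ℝ) (h : ε ≠ 0 ∨ x ≠ 0) :
    IntegrableOn (fun s : ℝ => s ^ (-(1 / 2) : ℝ) * heatK i (ε ^ 2 + s) x) (Ioi 0) := by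
  obtain ⟨C, hC, hk⟩ := abs_heatK_le d
  have hρ : 0 < eucNorm x ^ 2 + ε ^ 2 := by
    rcases h with h | h
    · positivity
    · have := eucNorm_pos h; positivity
  refine ((integrableOn_rpow_mul_add_rpow (p := (d : ℝ) / 2 + 1) (by
    have : (0 : ℝ) ≤ d := by positivity
    linarith) hρ).const_mul (C * eucNorm x)).mono' ?_ ?_
  · refine Measurable.aestronglyMeasurable (Measurable.mul (by fun_prop) ?_)
    exact (measurable_heatK i).comp (f := fun s : ℝ => (ε ^ 2 + s, x)) (by fun_prop)
  · refine (ae_restrict_iff' measurableSet_Ioi).2 (Eventually.of_forall fun s hs => ?_)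
    have hs : 0 < s := hs
    rw [norm_mul, Real.norm_of_nonneg (by positivity), Real.norm_eq_abs, mul_left_comm]
    rw [add_assoc]
    gcongr
    exact hk i _ x (by positivity)

lemma sq_rpow_eq (x : ℝ) (hx : 0 ≤ x) (n : ℕ) : (x ^ 2) ^ (1 / 2 - ((n : ℝ) / 2 + 1)) = (x ^ (n + 1))⁻¹ := by
  rw [← Real.rpow_natCast x 2, ← Real.rpow_mul hx, ← Real.rpow_natCast, ← Real.rpow_neg hx]
  congr 1; push_cast; ring

lemma abs_kreg_le (d : ℕ) : ∃ C : ℝ, 0 < C ∧ ∀ (i : Fin d) (ε : ℝ) (x : Fin d → ℝ), 0 < ε →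
    |kreg i ε x| ≤ C * eucNorm x / ε ^ (d + 1) := by
  obtain ⟨C, hC, hk⟩ := abs_heatK_le d
  set J := ∫ s in Ioi (0 : ℝ), s ^ (-(1 / 2) : ℝ) * (1 + s) ^ (-((d : ℝ) / 2 + 1))
  have hJ : 0 ≤ J := setIntegral_nonneg measurableSet_Ioi fun s hs => by
    have hs : 0 < s := hs
    positivity
  refine ⟨C * (J + 1), by positivity, fun i ε x hε => ?_⟩
  have h1 : |kreg i ε x| ≤ ∫ s in Ioi 0, (C * eucNorm x) *
      (s ^ (-(1 / 2) : ℝ) * (ε ^ 2 + s) ^ (-((d : ℝ) / 2 + 1))) := by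
    rw [kreg, ← Real.norm_eq_abs]
    refine norm_integral_le_of_norm_le ((integrableOn_rpow_mul_add_rpow (by
      have : (0 : ℝ) ≤ d := by positivity
      linarith) (by positivity)).const_mul _) ?_
    refine (ae_restrict_iff' measurableSet_Ioi).2 (Eventually.of_forall fun s hs => ?_)
    have hs : 0 < s := hs
    have := eucNorm_nonneg x
    rw [norm_mul, Real.norm_of_nonneg (by positivity), Real.norm_eq_abs, mul_left_comm]
    refine mul_le_mul_of_nonneg_left ((hk i _ x (by positivity)).trans ?_) (by positivity)
    refine mul_le_mul_of_nonneg_left (Real.rpow_le_rpow_of_nonpos (by positivity) ?_ ?_)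
      (by positivity)
    · nlinarith [sq_nonneg (eucNorm x)]
    · have : (0 : ℝ) ≤ d := by positivity
      linarith
  rw [integral_const_mul, integral_rpow_mul_add_rpow _ (by positivity), sq_rpow_eq _ hε.le] at h1
  refine h1.trans (le_of_sub_nonneg ?_)
  have : C * (J + 1) * eucNorm x / ε ^ (d + 1) - C * eucNorm x * ((ε ^ (d + 1))⁻¹ * J)
    = C * eucNorm x * (ε ^ (d + 1))⁻¹ := by field_simp; ring
  rw [this]; have := eucNorm_nonneg x; positivity

lemma integral_rpow_mul_gaussD (ξ : Fin d → ℝ) (hξ : ξ ≠ 0) :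
    ∫ s in Ioi 0, s ^ (-(1 / 2) : ℝ) * rexp (-(π * eucNorm ξ ^ 2 * s)) = 1 / eucNorm ξ := by
  have hpos := eucNorm_pos hξ
  have h := Real.integral_rpow_mul_exp_neg_mul_Ioi (a := 1 / 2) (r := π * eucNorm ξ ^ 2)
    (by norm_num) (by positivity)
  rw [show (1 / 2 - 1 : ℝ) = -(1 / 2) by norm_num] at h
  rw [h, Real.Gamma_one_half_eq, ← Real.sqrt_eq_rpow, Real.sqrt_div zero_le_one, Real.sqrt_one,
    Real.sqrt_mul pi_pos.le, Real.sqrt_sq hpos.le]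
  have := Real.sqrt_pos.2 pi_pos
  field_simp

lemma kreg_zero (i : Fin d) (x : Fin d → ℝ) : kreg i 0 x = rieszKernel d x i := by
  rw [rieszKernel]
  split_ifs with hx
  · subst hx; simp [kreg, heatK]
  have hpos := eucNorm_pos hx
  have h := Real.integral_rpow_mul_exp_neg_mul_Ioi (a := ((d : ℝ) + 1) / 2) (r := π * eucNorm x ^ 2)
    (by positivity) (by positivity)
  rw [← integral_comp_rpow_Ioi _ (show (-1 : ℝ) ≠ 0 by norm_num)] at h
  have e : kreg i 0 x = x i * ((1 / (π * eucNorm x ^ 2)) ^ (((d : ℝ) + 1) / 2) *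
      Real.Gamma (((d : ℝ) + 1) / 2)) := by
    rw [← h, kreg, ← integral_const_mul]
    refine setIntegral_congr_fun measurableSet_Ioi fun s hs => ?_
    have hs : 0 < s := hs
    simp only [heatK, abs_neg, abs_one, one_mul, smul_eq_mul]
    rw [show (-1 - 1 : ℝ) = -2 by norm_num, zero_pow two_ne_zero, zero_add, ← Real.rpow_mul hs.le,
      mul_left_comm, Real.rpow_neg_one, ← div_eq_mul_inv, ← mul_assoc (s ^ _),
      ← mul_assoc (s ^ _), ← Real.rpow_add hs, ← Real.rpow_add hs]
    congr 3; ring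
  rw [e, rieszConst]
  have : (1 / (π * eucNorm x ^ 2)) ^ (((d : ℝ) + 1) / 2) =
      (π ^ (((d : ℝ) + 1) / 2))⁻¹ * (eucNorm x ^ (d + 1))⁻¹ := by
    rw [one_div, Real.inv_rpow (by positivity), Real.mul_rpow pi_pos.le (by positivity), mul_inv]
    congr 2
    rw [← Real.rpow_natCast _ 2, ← Real.rpow_mul hpos.le, ← Real.rpow_natCast]
    congr 1; push_cast; ring
  rw [this]; field_simp

end regularizedKernel

section kernelEstimates
open Real

variable {d : ℕ}

lemma heatK_neg (i : Fin d) (τ : ℝ) (x : Fin d → ℝ) : heatK i τ (-x) = -heatK i τ x := by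
  simp [heatK, eucNorm_neg]

lemma kreg_neg (i : Fin d) (ε : ℝ) (x : Fin d → ℝ) : kreg i ε (-x) = -kreg i ε x := by
  simp only [kreg, heatK_neg, mul_neg, integral_neg]

lemma abs_heatK_add_sub_le (d : ℕ) : ∃ C : ℝ, 0 < C ∧ ∀ (i : Fin d) (s h : ℝ) (x : Fin d → ℝ),
    0 < s → 0 ≤ h → |heatK i (h + s) x - heatK i s x| ≤
      C * eucNorm x * h * (eucNorm x ^ 2 + s) ^ (-((d : ℝ) / 2 + 2)) := by
  obtain ⟨C, hC, hk⟩ := rpow_neg_mul_exp_le ((d : ℝ) / 2 + 2) 1 pi_pos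
  set p : ℝ := (d : ℝ) / 2 + 1 with hp
  have hd : (0 : ℝ) ≤ d := by positivity
  refine ⟨(p + π) * C, by positivity, fun i s h x hs hh => ?_⟩
  set ρ := eucNorm x ^ 2 with hρ
  have hρ0 : 0 ≤ ρ := by positivity
  have hder : ∀ τ ∈ Icc s (h + s), HasDerivWithinAt
      (fun τ : ℝ => τ ^ (-p) * rexp (-(π * (ρ / τ))))
      (-p * τ ^ (-p - 1) * rexp (-(π * (ρ / τ))) +
        τ ^ (-p) * (rexp (-(π * (ρ / τ))) * (π * ρ / τ ^ 2))) (Icc s (h + s)) τ := fun τ hτ => by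
    have hτ0 : 0 < τ := hs.trans_le hτ.1
    have h1 := Real.hasDerivAt_rpow_const (x := τ) (p := -p) (Or.inl hτ0.ne')
    have h2 : HasDerivAt (fun τ : ℝ => -(π * (ρ / τ))) (π * ρ / τ ^ 2) τ :=
      ((((hasDerivAt_inv hτ0.ne').const_mul ρ).const_mul π).fun_neg).congr_deriv (by
        field_simp)
    exact (h1.mul h2.exp).hasDerivWithinAt
  have hbd : ∀ τ ∈ Icc s (h + s), ‖-p * τ ^ (-p - 1) * rexp (-(π * (ρ / τ))) +
        τ ^ (-p) * (rexp (-(π * (ρ / τ))) * (π * ρ / τ ^ 2))‖ ≤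
      (p + π) * (C * (ρ + s) ^ (-((d : ℝ) / 2 + 2))) := fun τ hτ => by
    have hτ0 : 0 < τ := hs.trans_le hτ.1
    have h1 := hk ρ τ hρ0 hτ0
    have e1 : τ ^ (-((d : ℝ) / 2 + 2)) = τ ^ (-p) / τ := by
      rw [← Real.rpow_sub_one hτ0.ne']; congr 1; rw [hp]; ring
    rw [Real.rpow_one, e1] at h1
    rw [Real.rpow_sub_one hτ0.ne']
    have h2 : (ρ + τ) ^ (-((d : ℝ) / 2 + 2)) ≤ (ρ + s) ^ (-((d : ℝ) / 2 + 2)) :=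
      Real.rpow_le_rpow_of_nonpos (by positivity) (by linarith [hτ.1]) (by linarith)
    have h3 : 0 ≤ τ ^ (-p) / τ * rexp (-(π * (ρ / τ))) := by positivity
    have hr : 0 ≤ ρ / τ := by positivity
    have e2 : -p * (τ ^ (-p) / τ) * rexp (-(π * (ρ / τ))) +
        τ ^ (-p) * (rexp (-(π * (ρ / τ))) * (π * ρ / τ ^ 2)) =
        (-p + π * (ρ / τ)) * (τ ^ (-p) / τ * rexp (-(π * (ρ / τ)))) := by
      field_simp
    have e3 : |-p + π * (ρ / τ)| ≤ (p + π) * (1 + ρ / τ) := by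
      have := pi_pos
      rw [abs_le]; constructor <;> nlinarith [mul_nonneg hr this.le, mul_nonneg hr (show 0 ≤ p by positivity)]
    rw [e2, norm_mul, Real.norm_eq_abs, Real.norm_of_nonneg h3]
    calc _ ≤ (p + π) * (1 + ρ / τ) * (τ ^ (-p) / τ * rexp (-(π * (ρ / τ)))) := by gcongr
      _ = (p + π) * (τ ^ (-p) / τ * ((1 + ρ / τ) * rexp (-(π * (ρ / τ))))) := by ring
      _ ≤ (p + π) * (C * (ρ + s) ^ (-((d : ℝ) / 2 + 2))) := by
        refine mul_le_mul_of_nonneg_left (h1.trans ?_) (by positivity)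
        exact mul_le_mul_of_nonneg_left h2 hC.le
  have hm := (convex_Icc s (h + s)).norm_image_sub_le_of_norm_hasDerivWithin_le hder hbd
    (left_mem_Icc.2 (by linarith)) (right_mem_Icc.2 (by linarith))
  rw [heatK_eq, heatK_eq, ← mul_sub, abs_mul]
  rw [Real.norm_eq_abs, Real.norm_eq_abs, add_sub_cancel_right, abs_of_nonneg hh] at hm
  have := abs_le_eucNorm x i
  calc _ ≤ eucNorm x * ((p + π) * (C * (ρ + s) ^ (-((d : ℝ) / 2 + 2))) * h) := by
        have := eucNorm_nonneg x
        gcongr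
    _ = _ := by ring

/-- Bounding a difference of integrals against `s^{-1/2}` on the half line. -/
lemma abs_integral_sub_le {f g : ℝ → ℝ} {A p ρ : ℝ} (hp : 1 / 2 < p) (hρ : 0 < ρ)
    (hf : IntegrableOn (fun s => s ^ (-(1 / 2) : ℝ) * f s) (Ioi 0))
    (hg : IntegrableOn (fun s => s ^ (-(1 / 2) : ℝ) * g s) (Ioi 0))
    (h : ∀ s, 0 < s → |f s - g s| ≤ A * (ρ + s) ^ (-p)) :
    |(∫ s in Ioi 0, s ^ (-(1 / 2) : ℝ) * f s) - ∫ s in Ioi 0, s ^ (-(1 / 2) : ℝ) * g s| ≤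
      A * (ρ ^ (1 / 2 - p) * ∫ s in Ioi (0 : ℝ), s ^ (-(1 / 2) : ℝ) * (1 + s) ^ (-p)) := by
  rw [← integral_rpow_mul_add_rpow p hρ, ← integral_const_mul, ← integral_sub hf hg,
    ← Real.norm_eq_abs]
  refine norm_integral_le_of_norm_le ((integrableOn_rpow_mul_add_rpow hp hρ).const_mul A) ?_
  refine (ae_restrict_iff' measurableSet_Ioi).2 (Eventually.of_forall fun s hs => ?_)
  have hs : 0 < s := hs
  rw [← mul_sub, norm_mul, Real.norm_of_nonneg (by positivity), Real.norm_eq_abs, mul_left_comm]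
  exact mul_le_mul_of_nonneg_left (h s hs) (by positivity)

lemma abs_kreg_sub_rieszKernel_le_far (d : ℕ) : ∃ C : ℝ, 0 < C ∧
    ∀ (i : Fin d) (ε : ℝ) (x : Fin d → ℝ), x ≠ 0 →
    |kreg i ε x - rieszKernel d x i| ≤ C * ε ^ 2 / eucNorm x ^ (d + 2) := by
  obtain ⟨C, hC, hk⟩ := abs_heatK_add_sub_le d
  set J := ∫ s in Ioi (0 : ℝ), s ^ (-(1 / 2) : ℝ) * (1 + s) ^ (-((d : ℝ) / 2 + 2)) with hJd
  have hJ : 0 ≤ J := setIntegral_nonneg measurableSet_Ioi fun s hs => by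
    have hs : 0 < s := hs
    positivity
  refine ⟨C * (J + 1), by positivity, fun i ε x hx => ?_⟩
  have hpos := eucNorm_pos hx
  have hd : (0 : ℝ) ≤ d := by positivity
  rw [← kreg_zero]
  have h := abs_integral_sub_le (A := C * eucNorm x * ε ^ 2) (p := (d : ℝ) / 2 + 2)
    (ρ := eucNorm x ^ 2) (by linarith) (by positivity)
    (integrableOn_kreg i ε x (Or.inr hx)) (integrableOn_kreg i 0 x (Or.inr hx)) fun s hs => by
      have := hk i s (ε ^ 2) x hs (by positivity)
      rwa [zero_pow two_ne_zero, zero_add]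
  refine h.trans ?_
  rw [← hJd]
  have e := sq_rpow_eq (eucNorm x) hpos.le (d + 2)
  rw [show (1 / 2 - (((d + 2 : ℕ) : ℝ) / 2 + 1)) = 1 / 2 - ((d : ℝ) / 2 + 2) by push_cast; ring] at e
  rw [e]
  have : C * eucNorm x * ε ^ 2 * ((eucNorm x ^ (d + 2 + 1))⁻¹ * J) =
      C * J * ε ^ 2 / eucNorm x ^ (d + 2) := by
    rw [pow_succ _ (d + 2)]; field_simp
  rw [this]; gcongr; linarith

/-- The kernel `ε/(ε+|x|)^{d+1}` dominating the error terms. -/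
def errK (ε : ℝ) (x : Fin d → ℝ) : ℝ := ε / (ε + eucNorm x) ^ (d + 1)

lemma abs_kreg_sub_trunc_le (d : ℕ) : ∃ C : ℝ, 0 < C ∧
    ∀ (i : Fin d) (ε : ℝ) (x : Fin d → ℝ), 0 < ε →
    |kreg i ε x - {y : Fin d → ℝ | ε < eucNorm y}.indicator (fun y => rieszKernel d y i) x| ≤
      C * errK ε x := by
  obtain ⟨C₁, hC₁, h₁⟩ := abs_kreg_sub_rieszKernel_le_far d
  obtain ⟨C₂, hC₂, h₂⟩ := abs_kreg_le d
  refine ⟨(C₁ + C₂) * 2 ^ (d + 1), by positivity, fun i ε x hε => ?_⟩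
  have hn := eucNorm_nonneg x
  by_cases hx : ε < eucNorm x
  · rw [indicator_of_mem (by exact hx)]
    have hpos : 0 < eucNorm x := hε.trans hx
    refine (h₁ i ε x fun h => by simp [h, eucNorm_zero] at hpos).trans ?_
    have a1 : C₁ * ε ^ 2 / eucNorm x ^ (d + 2) ≤ C₁ * ε / eucNorm x ^ (d + 1) := by
      rw [div_le_div_iff₀ (by positivity) (by positivity)]
      have : ε * eucNorm x ^ (d + 1) ≤ eucNorm x ^ (d + 2) := by
        rw [pow_succ _ (d + 1), mul_comm]; gcongr
      calc _ = C₁ * ε * (ε * eucNorm x ^ (d + 1)) := by ring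
        _ ≤ _ := by gcongr
    have a2 : (ε + eucNorm x) ^ (d + 1) ≤ 2 ^ (d + 1) * eucNorm x ^ (d + 1) := by
      rw [← mul_pow]; gcongr; linarith
    refine a1.trans ?_
    rw [errK, div_le_iff₀ (by positivity), mul_div_assoc', div_mul_eq_mul_div,
      le_div_iff₀ (by positivity)]
    calc C₁ * ε * (ε + eucNorm x) ^ (d + 1) ≤ (C₁ + C₂) * ε * (2 ^ (d + 1) * eucNorm x ^ (d + 1)) := by
          gcongr; linarith
      _ = _ := by ring
  · rw [indicator_of_notMem (by exact hx), sub_zero]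
    push Not at hx
    refine (h₂ i ε x hε).trans ?_
    have a2 : (ε + eucNorm x) ^ (d + 1) ≤ 2 ^ (d + 1) * ε ^ (d + 1) := by
      rw [← mul_pow]; gcongr; linarith
    rw [errK, div_le_iff₀ (by positivity), mul_div_assoc', div_mul_eq_mul_div,
      le_div_iff₀ (by positivity)]
    calc C₂ * eucNorm x * (ε + eucNorm x) ^ (d + 1) ≤ (C₁ + C₂) * ε * (2 ^ (d + 1) * ε ^ (d + 1)) := by
          gcongr; linarith
      _ = _ := by ring

lemma abs_heatK_sub_le (d : ℕ) : ∃ C : ℝ, 0 < C ∧ ∀ (i : Fin d) (τ : ℝ) (x x' : Fin d → ℝ),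
    0 < τ → 2 * eucNorm (x - x') ≤ eucNorm x → |heatK i τ x - heatK i τ x'| ≤
      C * eucNorm (x - x') * (eucNorm x ^ 2 + τ) ^ (-((d : ℝ) / 2 + 1)) := by
  obtain ⟨C, hC, hk⟩ := rpow_neg_mul_exp_le ((d : ℝ) / 2 + 1) 1 (c := π / 4) (by positivity)
  refine ⟨(1 + 4 * π) * C, by positivity, fun i τ x x' hτ hx => ?_⟩
  set δ := eucNorm (x - x') with hδ
  set r := eucNorm x with hr
  set r' := eucNorm x' with hr'
  have hδ0 : 0 ≤ δ := eucNorm_nonneg _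
  have hr0 : 0 ≤ r := eucNorm_nonneg _
  have hr'0 : 0 ≤ r' := eucNorm_nonneg _
  have habs : |r - r'| ≤ δ := abs_eucNorm_sub_le x x'
  have hab := abs_le.1 habs
  have h1 := hk (r ^ 2) τ (by positivity) hτ
  rw [Real.rpow_one] at h1
  have hi : |x i - x' i| ≤ δ := abs_le_eucNorm (x - x') i
  have hi' : |x' i| ≤ r' := abs_le_eucNorm x' i
  set p : ℝ := (d : ℝ) / 2 + 1
  set e := rexp (-(π / 4 * (r ^ 2 / τ))) with he
  have b1 : rexp (-(π * (r ^ 2 / τ))) ≤ e := by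
    rw [he]; refine Real.exp_le_exp.2 (neg_le_neg ?_); gcongr; linarith [pi_pos]
  have b2 : |rexp (-(π * (r ^ 2 / τ))) - rexp (-(π * (r' ^ 2 / τ)))| ≤
      (π * (5 / 2 * r * δ) / τ) * e := by
    refine (abs_exp_neg_sub_exp_neg_le _ _).trans ?_
    refine mul_le_mul ?_ ?_ (by positivity) (by positivity)
    · rw [← mul_sub, ← sub_div, abs_mul, abs_div, abs_of_pos pi_pos, abs_of_pos hτ, ← mul_div_assoc]
      gcongr
      rw [sq_sub_sq, abs_mul, abs_of_nonneg (by positivity : 0 ≤ r + r')]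
      refine mul_le_mul ?_ habs (abs_nonneg _) (by positivity)
      linarith
    · rw [he]; refine Real.exp_le_exp.2 (neg_le_neg ?_)
      refine le_min ?_ ?_
      · gcongr; linarith [pi_pos]
      · have h4 : (r / 2) ^ 2 ≤ r' ^ 2 := pow_le_pow_left₀ (by positivity) (by linarith) 2
        calc π / 4 * (r ^ 2 / τ) = π * ((r / 2) ^ 2 / τ) := by ring
          _ ≤ _ := by gcongr
  rw [heatK_eq, heatK_eq]
  have key : x i * (τ ^ (-p) * rexp (-(π * (r ^ 2 / τ)))) - x' i * (τ ^ (-p) * rexp (-(π * (r' ^ 2 / τ))))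
    = (x i - x' i) * (τ ^ (-p) * rexp (-(π * (r ^ 2 / τ)))) +
      x' i * (τ ^ (-p) * (rexp (-(π * (r ^ 2 / τ))) - rexp (-(π * (r' ^ 2 / τ))))) := by ring
  rw [key]
  refine (abs_add_le _ _).trans ?_
  rw [abs_mul, abs_mul, abs_mul, abs_mul, abs_of_pos (Real.exp_pos _),
    abs_of_pos (Real.rpow_pos_of_pos hτ _)]
  have c1 : |x' i| ≤ 3 / 2 * r := by linarith
  calc _ ≤ δ * (τ ^ (-p) * e) + 3 / 2 * r * (τ ^ (-p) * ((π * (5 / 2 * r * δ) / τ) * e)) := by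
        gcongr
    _ = (1 + 15 / 4 * π * (r ^ 2 / τ)) * δ * (τ ^ (-p) * e) := by field_simp; ring
    _ ≤ ((1 + 4 * π) * (1 + r ^ 2 / τ)) * δ * (τ ^ (-p) * e) := by
        gcongr
        have : 0 ≤ r ^ 2 / τ := by positivity
        nlinarith [pi_pos, mul_nonneg pi_pos.le this]
    _ = (1 + 4 * π) * δ * (τ ^ (-p) * ((1 + r ^ 2 / τ) * e)) := by ring
    _ ≤ (1 + 4 * π) * δ * (C * (r ^ 2 + τ) ^ (-p)) := by gcongr
    _ = _ := by ring

lemma abs_kreg_sub_le (d : ℕ) : ∃ C : ℝ, 0 < C ∧ ∀ (i : Fin d) (ε : ℝ) (x x' : Fin d → ℝ),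
    x ≠ 0 → 2 * eucNorm (x - x') ≤ eucNorm x →
    |kreg i ε x - kreg i ε x'| ≤ C * eucNorm (x - x') / eucNorm x ^ (d + 1) := by
  obtain ⟨C, hC, hk⟩ := abs_heatK_sub_le d
  set J := ∫ s in Ioi (0 : ℝ), s ^ (-(1 / 2) : ℝ) * (1 + s) ^ (-((d : ℝ) / 2 + 1)) with hJd
  have hJ : 0 ≤ J := setIntegral_nonneg measurableSet_Ioi fun s hs => by
    have hs : 0 < s := hs
    positivity
  refine ⟨C * (J + 1), by positivity, fun i ε x x' hx hxx => ?_⟩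
  have hpos := eucNorm_pos hx
  have hx' : x' ≠ 0 := by
    rintro rfl; rw [sub_zero] at hxx; linarith
  have hd : (0 : ℝ) ≤ d := by positivity
  have hn := eucNorm_nonneg (x - x')
  have h := abs_integral_sub_le (A := C * eucNorm (x - x')) (p := (d : ℝ) / 2 + 1)
    (ρ := eucNorm x ^ 2) (by linarith) (by positivity)
    (integrableOn_kreg i ε x (Or.inr hx)) (integrableOn_kreg i ε x' (Or.inr hx')) fun s hs => by
      refine (hk i (ε ^ 2 + s) x x' (by positivity) hxx).trans ?_
      refine mul_le_mul_of_nonneg_left (Real.rpow_le_rpow_of_nonpos (by positivity) ?_ ?_)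
        (by positivity)
      · nlinarith
      · linarith
  refine h.trans ?_
  rw [← hJd, sq_rpow_eq (eucNorm x) hpos.le d]
  have : C * eucNorm (x - x') * ((eucNorm x ^ (d + 1))⁻¹ * J) =
      C * J * eucNorm (x - x') / eucNorm x ^ (d + 1) := by field_simp
  rw [this]; gcongr; linarith

lemma gaussD_mul (σ τ : ℝ) (ξ : Fin d → ℝ) : gaussD σ ξ * gaussD τ ξ = gaussD (σ + τ) ξ := by
  rw [gaussD, gaussD, gaussD, ← Real.exp_add]; congr 1; ring

lemma norm_mult_le (i : Fin d) (ξ : Fin d → ℝ) : ‖mult i ξ‖ ≤ 1 := by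
  rw [mult, norm_mul, norm_neg, Complex.norm_I, one_mul, Complex.norm_real, Real.norm_eq_abs,
    abs_div, abs_of_nonneg (eucNorm_nonneg ξ)]
  exact div_le_one_of_le₀ (abs_le_eucNorm ξ i) (eucNorm_nonneg ξ)

@[fun_prop] lemma measurable_mult (i : Fin d) : Measurable (mult i) := by
  have : Measurable (eucNorm : (Fin d → ℝ) → ℝ) := continuous_eucNorm.measurable
  unfold mult; fun_prop

lemma integrable_mult_gaussD (i : Fin d) {τ : ℝ} (hτ : 0 < τ) :
    Integrable fun ξ : Fin d → ℝ => mult i ξ * (gaussD τ ξ : ℂ) :=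
  (integrable_gaussD hτ).ofReal.bdd_mul (c := 1) (measurable_mult i).aestronglyMeasurable
    (Eventually.of_forall (norm_mult_le i))

lemma integrableOn_rpow_mul_gaussD (ξ : Fin d → ℝ) (hξ : ξ ≠ 0) :
    IntegrableOn (fun s : ℝ => s ^ (-(1 / 2) : ℝ) * gaussD s ξ) (Ioi 0) := by
  refine Integrable.of_integral_ne_zero ?_
  have h := integral_rpow_mul_gaussD ξ hξ
  have : ∀ s : ℝ, gaussD s ξ = rexp (-(π * eucNorm ξ ^ 2 * s)) := fun s => by
    rw [gaussD]; congr 1; ring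
  simp only [this, h]
  have := eucNorm_pos hξ
  positivity

lemma setIntegral_rpow_mul_gaussD (ξ : Fin d → ℝ) (hξ : ξ ≠ 0) :
    ∫ s in Ioi 0, s ^ (-(1 / 2) : ℝ) * gaussD s ξ = 1 / eucNorm ξ := by
  rw [← integral_rpow_mul_gaussD ξ hξ]
  congr 1; ext s; rw [gaussD]; congr 2; ring

lemma kreg_eq_ftInv (i : Fin d) {ε : ℝ} (hε : 0 < ε) (x : Fin d → ℝ) :
    (kreg i ε x : ℂ) = ftInv (fun ξ => mult i ξ * (gaussD (ε ^ 2) ξ : ℂ)) x := by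
  set F : ℝ → (Fin d → ℝ) → ℂ := fun s ξ =>
    ech (dotP ξ x) * (-Complex.I * ((s ^ (-(1 / 2) : ℝ) * (ξ i * gaussD (ε ^ 2 + s) ξ) : ℝ) : ℂ))
  have hF : ∀ s ξ, F s ξ = ech (dotP ξ x) * (-Complex.I * ((ξ i * gaussD (ε ^ 2) ξ *
      (s ^ (-(1 / 2) : ℝ) * gaussD s ξ) : ℝ) : ℂ)) := fun s ξ => by
    simp only [F]; rw [← gaussD_mul]; congr 3; ring
  have hnorm : ∀ s ∈ Ioi (0 : ℝ), ∀ ξ, ‖F s ξ‖ = |ξ i| * gaussD (ε ^ 2) ξ *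
      (s ^ (-(1 / 2) : ℝ) * gaussD s ξ) := fun s hs ξ => by
    have hs : 0 < s := hs
    have g1 : ∀ t, 0 ≤ gaussD t ξ := fun t => (Real.exp_pos _).le
    rw [hF, norm_mul, norm_ech, norm_mul, norm_neg, Complex.norm_I, Complex.norm_real, norm_mul,
      norm_mul, norm_mul, Real.norm_of_nonneg (g1 _), Real.norm_of_nonneg (g1 _),
      Real.norm_of_nonneg (by positivity : 0 ≤ s ^ (-(1 / 2) : ℝ)), Real.norm_eq_abs]
    ring
  have hgm : Measurable fun p : ℝ × (Fin d → ℝ) => gaussD (ε ^ 2 + p.1) p.2 := by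
    have : Measurable (eucNorm : (Fin d → ℝ) → ℝ) := continuous_eucNorm.measurable
    unfold gaussD; fun_prop
  have hmeas : Measurable (Function.uncurry F) := by
    have h1 : Measurable fun p : ℝ × (Fin d → ℝ) => ech (dotP p.2 x) :=
      Continuous.measurable (by fun_prop)
    simp only [F, Function.uncurry_def]
    fun_prop
  have hint : Integrable (Function.uncurry F) ((volume.restrict (Ioi 0)).prod volume) := by
    rw [integrable_prod_iff' hmeas.aestronglyMeasurable]
    constructor
    · refine Eventually.of_forall fun ξ => ?_
      by_cases hξ : ξ = 0
      · simp [F, hξ]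
      · simp only [Function.uncurry_apply_pair, hF]
        exact (((integrableOn_rpow_mul_gaussD ξ hξ).const_mul _).ofReal.const_mul _).const_mul _
    · have : ∀ ξ, ∫ s in Ioi (0 : ℝ), ‖F s ξ‖ = |ξ i| / eucNorm ξ * gaussD (ε ^ 2) ξ := fun ξ => by
        rw [setIntegral_congr_fun measurableSet_Ioi fun s hs => hnorm s hs ξ, integral_const_mul]
        by_cases hξ : ξ = 0
        · simp [hξ]
        · rw [setIntegral_rpow_mul_gaussD ξ hξ]; ring
      simp only [Function.uncurry_apply_pair, this]
      refine ((integrable_mult_gaussD i (τ := ε ^ 2) (by positivity)).norm).congr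
        (Eventually.of_forall fun ξ => ?_)
      have g1 : 0 ≤ gaussD (ε ^ 2) ξ := (Real.exp_pos _).le
      simp only [mult, norm_mul, norm_neg, Complex.norm_I, one_mul, Complex.norm_real,
        Real.norm_of_nonneg g1, norm_div, Real.norm_of_nonneg (eucNorm_nonneg ξ), Real.norm_eq_abs]
  have hl : (kreg i ε x : ℂ) = ∫ s in Ioi (0 : ℝ), ∫ ξ, F s ξ := by
    rw [kreg, ← integral_complex_ofReal]
    refine setIntegral_congr_fun measurableSet_Ioi fun s hs => ?_
    have hs : 0 < s := hs
    simp only [Complex.ofReal_mul]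
    rw [← ftInv_coord_mul_gaussD (by positivity : 0 < ε ^ 2 + s) i x, ftInv_eq,
      ← integral_const_mul]
    congr 1; ext ξ; simp only [F]; push_cast; ring
  rw [hl, integral_integral_swap hint, ftInv_eq]
  congr 1; ext ξ
  simp only [hF]
  rw [integral_const_mul, integral_const_mul, integral_complex_ofReal, integral_const_mul]
  by_cases hξ : ξ = 0
  · simp [hξ, mult]
  · rw [setIntegral_rpow_mul_gaussD ξ hξ, mult]; push_cast; ring

end kernelEstimates

section approximateIdentity
open Real

variable {d : ℕ}

lemma errK_nonneg {ε : ℝ} (hε : 0 < ε) (x : Fin d → ℝ) : 0 ≤ errK ε x := by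
  have := eucNorm_nonneg x
  rw [errK]; positivity

lemma continuous_errK {ε : ℝ} (hε : 0 < ε) : Continuous (errK ε : (Fin d → ℝ) → ℝ) := by
  unfold errK
  refine continuous_const.div (by fun_prop) fun x => ?_
  have := eucNorm_nonneg x
  positivity

lemma errK_le {ε : ℝ} (hε : 0 < ε) (x : Fin d → ℝ) : errK ε x ≤ ε / ε ^ (d + 1) := by
  have := eucNorm_nonneg x
  rw [errK]; gcongr; linarith

lemma integrable_errK {ε : ℝ} (hε : 0 < ε) : Integrable (errK ε : (Fin d → ℝ) → ℝ) := by
  have h := integrable_one_add_norm (E := Fin d → ℝ) (μ := volume) (r := (d : ℝ) + 1) (by simp)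
  refine (h.const_mul (ε / min ε 1 ^ (d + 1))).mono' (continuous_errK hε).aestronglyMeasurable
    (Eventually.of_forall fun x => ?_)
  rw [Real.norm_of_nonneg (errK_nonneg hε x), Real.rpow_neg (by positivity),
    show (d : ℝ) + 1 = ((d + 1 : ℕ) : ℝ) by push_cast; rfl, Real.rpow_natCast, errK,
    ← div_eq_mul_inv, div_div, ← mul_pow]
  gcongr
  have h1 := norm_le_eucNorm x
  have h2 : min ε 1 ≤ ε := min_le_left _ _
  have h3 : min ε 1 ≤ 1 := min_le_right _ _
  have h4 := norm_nonneg x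
  nlinarith

lemma errK_le_shell {ε : ℝ} (hε : 0 < ε) (y : Fin d → ℝ) :
    ∃ n : ℕ, ‖y‖ ≤ 2 ^ n * ε ∧ errK ε y ≤ 2 ^ (d + 1) * (1 / 2) ^ n / (2 ^ n * ε) ^ d := by
  classical
  have hex : ∃ n : ℕ, ‖y‖ ≤ 2 ^ n * ε := by
    obtain ⟨n, hn⟩ := pow_unbounded_of_one_lt (‖y‖ / ε) one_lt_two
    exact ⟨n, ((div_lt_iff₀ hε).1 hn).le⟩
  refine ⟨Nat.find hex, Nat.find_spec hex, ?_⟩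
  have hy := norm_le_eucNorm y
  have hy0 := norm_nonneg y
  rcases h : Nat.find hex with _ | n
  · refine (errK_le hε y).trans ?_
    rw [pow_zero, pow_zero, one_mul, mul_one, pow_succ, div_le_div_iff₀ (by positivity) (by positivity)]
    have : (1 : ℝ) ≤ 2 ^ (d + 1) := one_le_pow₀ (by norm_num)
    calc ε * ε ^ d = 1 * (ε ^ d * ε) := by ring
      _ ≤ _ := by gcongr
  · have hlt : 2 ^ n * ε < ‖y‖ := by
      have := Nat.find_min hex (m := n) (by omega)
      push Not at this; exact this
    have h1 : (2 ^ n * ε) ^ (d + 1) ≤ (ε + eucNorm y) ^ (d + 1) := by gcongr; linarith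
    rw [errK]
    calc ε / (ε + eucNorm y) ^ (d + 1) ≤ ε / (2 ^ n * ε) ^ (d + 1) := by gcongr
      _ = _ := by
        rw [show (2 : ℝ) ^ (n + 1) * ε = 2 * (2 ^ n * ε) by ring, mul_pow (2 : ℝ) (2 ^ n * ε) d,
          one_div, inv_pow]
        field_simp
        ring

lemma ae_tendsto_integral_mul_errK {F : (Fin d → ℝ) → ℂ} (hF : Integrable F) :
    ∀ᵐ x : Fin d → ℝ, Tendsto (fun ε : ℝ => ∫ y, ‖F (x - y) - F x‖ * errK ε y) (𝓝[>] 0) (𝓝 0) := by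
  have hleb := IsUnifLocDoublingMeasure.ae_tendsto_average_norm_sub
    (volume : Measure (Fin d → ℝ)) hF.locallyIntegrable 1
  filter_upwards [hleb] with x hx
  set A : ℝ → ℝ := fun r => ⨍ y in Metric.closedBall x r, ‖F y - F x‖ with hA
  have hA0 : ∀ r, 0 ≤ A r := fun r => by
    rw [hA]; simp only [setAverage_eq, smul_eq_mul]
    exact mul_nonneg (by positivity) (integral_nonneg fun _ => norm_nonneg _)
  have hAt : Tendsto A (𝓝[>] 0) (𝓝 0) := by
    refine hx (l := 𝓝[>] (0 : ℝ)) (fun _ => x) id tendsto_id ?_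
    filter_upwards [self_mem_nhdsWithin] with r hr
    have hr : 0 < r := hr
    simpa using hr.le
  have hvol : ∀ r : ℝ, 0 < r → (volume (Metric.closedBall x r)).toReal = (2 * r) ^ d :=
    fun r hr => by
      rw [Real.volume_pi_closedBall _ hr.le, ENNReal.toReal_ofReal (by positivity), Fintype.card_fin]
  have hAi : ∀ r : ℝ, 0 < r → ∫ y in Metric.closedBall x r, ‖F y - F x‖ = (2 * r) ^ d * A r :=
    fun r hr => by
      rw [hA]; simp only [setAverage_eq, smul_eq_mul, Measure.real, hvol r hr]
      field_simp
  have hloc : ∀ r : ℝ, IntegrableOn (fun y => ‖F y - F x‖) (Metric.closedBall x r) := fun r =>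
    (hF.integrableOn.sub (integrableOn_const (by
      rw [← lt_top_iff_ne_top]; exact measure_closedBall_lt_top))).norm
  obtain ⟨M, hM⟩ : ∃ M, ∀ r, 0 < r → A r ≤ M := by
    have h1 : ∀ᶠ r in 𝓝[>] (0 : ℝ), A r < 1 := hAt.eventually_lt_const one_pos
    obtain ⟨r₀, hr₀, h⟩ := mem_nhdsGT_iff_exists_Ioo_subset.1 h1
    have hr₀ : 0 < r₀ := hr₀
    refine ⟨max 1 ((∫ y, ‖F y‖) / (2 * r₀) ^ d + ‖F x‖), fun r hr => ?_⟩
    by_cases hrr : r < r₀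
    · exact le_max_of_le_left (le_of_lt (h ⟨hr, hrr⟩))
    · refine le_max_of_le_right ?_
      push Not at hrr
      have h2 : (2 * r) ^ d * A r ≤ (∫ y, ‖F y‖) + (2 * r) ^ d * ‖F x‖ := by
        rw [← hAi r hr]
        have hc : IntegrableOn (fun _ : Fin d → ℝ => ‖F x‖) (Metric.closedBall x r) :=
          integrableOn_const (by rw [← lt_top_iff_ne_top]; exact measure_closedBall_lt_top)
        calc _ ≤ ∫ y in Metric.closedBall x r, (‖F y‖ + ‖F x‖) :=
              setIntegral_mono (hloc r) (hF.norm.integrableOn.add hc) fun y => norm_sub_le _ _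
          _ = (∫ y in Metric.closedBall x r, ‖F y‖) + (2 * r) ^ d * ‖F x‖ := by
              rw [integral_add hF.norm.integrableOn hc, setIntegral_const, Measure.real, hvol r hr,
                smul_eq_mul]
          _ ≤ _ := by
              have := setIntegral_le_integral (s := Metric.closedBall x r) hF.norm
                (Eventually.of_forall fun _ => norm_nonneg _)
              linarith
      have hpos : 0 < (2 * r) ^ d := by positivity
      have h3 : (∫ y, ‖F y‖) / (2 * r) ^ d ≤ (∫ y, ‖F y‖) / (2 * r₀) ^ d := by
        have : 0 ≤ ∫ y, ‖F y‖ := integral_nonneg fun _ => norm_nonneg _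
        gcongr
      have h4 : A r ≤ (∫ y, ‖F y‖) / (2 * r) ^ d + ‖F x‖ := by
        rw [← sub_le_iff_le_add, le_div_iff₀ hpos]; nlinarith
      linarith
  have hM0 : 0 ≤ M := (hA0 1).trans (hM 1 one_pos)
  have hsum : ∀ ε : ℝ, 0 < ε → Summable fun n : ℕ =>
      2 ^ (2 * d + 1) * ((1 / 2 : ℝ) ^ n * A (2 ^ n * ε)) := fun ε hε => by
    refine Summable.mul_left _ ?_
    refine Summable.of_nonneg_of_le (fun n => mul_nonneg (by positivity) (hA0 _)) (fun n => ?_)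
      (summable_geometric_two.mul_right M)
    gcongr; exact hM _ (by positivity)
  have hle : ∀ ε : ℝ, 0 < ε → ∫ y, ‖F (x - y) - F x‖ * errK ε y ≤
      ∑' n : ℕ, 2 ^ (2 * d + 1) * ((1 / 2 : ℝ) ^ n * A (2 ^ n * ε)) := fun ε hε => by
    have hFm : AEStronglyMeasurable (fun y => F (x - y)) volume :=
      (hF.comp_sub_left x).aestronglyMeasurable
    have hnn : ∀ y, 0 ≤ ‖F (x - y) - F x‖ * errK ε y := fun y =>
      mul_nonneg (norm_nonneg _) (errK_nonneg hε y)
    have hts : 0 ≤ ∑' n : ℕ, 2 ^ (2 * d + 1) * ((1 / 2 : ℝ) ^ n * A (2 ^ n * ε)) :=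
      tsum_nonneg fun n => mul_nonneg (by positivity) (mul_nonneg (by positivity) (hA0 _))
    have hmeas1 : AEMeasurable (fun y => ENNReal.ofReal ‖F (x - y) - F x‖) volume :=
      ((hFm.sub aestronglyMeasurable_const).norm.aemeasurable).ennreal_ofReal
    rw [integral_eq_lintegral_of_nonneg_ae (Eventually.of_forall hnn)
      ((hFm.sub aestronglyMeasurable_const).norm.mul (continuous_errK hε).aestronglyMeasurable)]
    refine ENNReal.toReal_le_of_le_ofReal hts ?_
    calc ∫⁻ y, ENNReal.ofReal (‖F (x - y) - F x‖ * errK ε y)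
        ≤ ∫⁻ y, ∑' n : ℕ, ENNReal.ofReal (2 ^ (d + 1) * (1 / 2) ^ n / (2 ^ n * ε) ^ d) *
            (Metric.closedBall 0 (2 ^ n * ε)).indicator
              (fun y => ENNReal.ofReal ‖F (x - y) - F x‖) y := by
          refine lintegral_mono fun y => ?_
          obtain ⟨n, hn, hle⟩ := errK_le_shell hε y
          refine le_trans ?_ (ENNReal.le_tsum n)
          rw [indicator_of_mem (by simpa using hn), ENNReal.ofReal_mul (norm_nonneg _), mul_comm]
          gcongr
      _ = ∑' n : ℕ, ENNReal.ofReal (2 ^ (d + 1) * (1 / 2) ^ n / (2 ^ n * ε) ^ d) *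
            ∫⁻ y in Metric.closedBall 0 (2 ^ n * ε), ENNReal.ofReal ‖F (x - y) - F x‖ := by
          rw [lintegral_tsum fun n =>
            (hmeas1.indicator Metric.isClosed_closedBall.measurableSet).const_mul _]
          congr 1; ext n
          rw [lintegral_const_mul'' _ (hmeas1.indicator Metric.isClosed_closedBall.measurableSet),
            lintegral_indicator Metric.isClosed_closedBall.measurableSet]
      _ = ∑' n : ℕ, ENNReal.ofReal (2 ^ (2 * d + 1) * ((1 / 2 : ℝ) ^ n * A (2 ^ n * ε))) := by
          congr 1; ext n
          have hr : 0 < 2 ^ n * ε := by positivity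
          have e1 : ∫⁻ y in Metric.closedBall 0 (2 ^ n * ε), ENNReal.ofReal ‖F (x - y) - F x‖ =
              ∫⁻ y in Metric.closedBall x (2 ^ n * ε), ENNReal.ofReal ‖F y - F x‖ := by
            have hmp := Measure.measurePreserving_sub_left (volume : Measure (Fin d → ℝ)) x
            have := hmp.setLIntegral_comp_preimage_emb (MeasurableEquiv.subLeft x).measurableEmbedding
              (fun y => ENNReal.ofReal ‖F y - F x‖) (Metric.closedBall x (2 ^ n * ε))
            rw [← this]; congr 2; ext y; simp [dist_eq_norm]
          rw [e1, ← ofReal_integral_eq_lintegral_ofReal (hloc _)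
            (Eventually.of_forall fun _ => norm_nonneg _), hAi _ hr,
            ← ENNReal.ofReal_mul (by positivity)]
          congr 1
          have : (2 * (2 ^ n * ε)) ^ d = 2 ^ d * (2 ^ n * ε) ^ d := mul_pow _ _ _
          rw [this]; field_simp; ring
      _ = _ := by
          rw [ENNReal.ofReal_tsum_of_nonneg (fun n =>
            mul_nonneg (by positivity) (mul_nonneg (by positivity) (hA0 _))) (hsum ε hε)]
  refine squeeze_zero' ?_ (eventually_nhdsWithin_of_forall fun ε hε => hle ε hε) ?_
  · filter_upwards [self_mem_nhdsWithin] with ε hε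
    exact integral_nonneg fun y => mul_nonneg (norm_nonneg _) (errK_nonneg hε y)
  · have := tendsto_tsum_of_dominated_convergence (𝓕 := 𝓝[>] (0 : ℝ))
      (f := fun ε (n : ℕ) => 2 ^ (2 * d + 1) * ((1 / 2 : ℝ) ^ n * A (2 ^ n * ε))) (g := fun _ => 0)
      (bound := fun n => 2 ^ (2 * d + 1) * ((1 / 2 : ℝ) ^ n * M))
      ((summable_geometric_two.mul_right M).mul_left _) (fun n => ?_) ?_
    · simpa using this
    · have h1 : Tendsto (fun ε : ℝ => 2 ^ n * ε) (𝓝[>] 0) (𝓝[>] 0) := by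
        refine tendsto_nhdsWithin_iff.2 ⟨?_, ?_⟩
        · have : Tendsto (fun ε : ℝ => 2 ^ n * ε) (𝓝 0) (𝓝 (2 ^ n * 0)) :=
            (continuous_const.mul continuous_id).tendsto 0
          rw [mul_zero] at this
          exact this.mono_left nhdsWithin_le_nhds
        · filter_upwards [self_mem_nhdsWithin] with ε hε
          have : 0 < ε := hε
          exact (by positivity : 0 < 2 ^ n * ε)
      have h2 := ((hAt.comp h1).const_mul ((1 / 2 : ℝ) ^ n)).const_mul (2 ^ (2 * d + 1) : ℝ)
      simpa using h2
    · filter_upwards [self_mem_nhdsWithin] with ε hε n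
      have hε : 0 < ε := hε
      rw [Real.norm_of_nonneg (mul_nonneg (by positivity) (mul_nonneg (by positivity) (hA0 _)))]
      gcongr; exact hM _ (by positivity)

lemma integrable_mul_of_errK_bound {F : (Fin d → ℝ) → ℂ} (hF : Integrable F) (x : Fin d → ℝ)
    {ε C : ℝ} (hε : 0 < ε) {D : (Fin d → ℝ) → ℝ} (hD : Measurable D)
    (hle : ∀ y, |D y| ≤ C * errK ε y) : Integrable fun y => F (x - y) * (D y : ℂ) := by
  have hC : 0 ≤ C := by
    have h := (abs_nonneg _).trans (hle 0)
    have : 0 < errK ε (0 : Fin d → ℝ) := by rw [errK, eucNorm_zero]; positivity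
    exact nonneg_of_mul_nonneg_left h this
  refine (hF.comp_sub_left x).mul_bdd (c := C * (ε / ε ^ (d + 1))) (by fun_prop)
    (Eventually.of_forall fun y => ?_)
  rw [Complex.norm_real]
  exact (hle y).trans (by gcongr; exact errK_le hε y)

lemma ae_tendsto_conv_sub {F : (Fin d → ℝ) → ℂ} (hF : Integrable F) :
    ∀ᵐ x : Fin d → ℝ, ∀ (C : ℝ) (D : ℝ → (Fin d → ℝ) → ℝ), (∀ ε, 0 < ε → Measurable (D ε)) →
      (∀ ε, 0 < ε → ∀ y, |D ε y| ≤ C * errK ε y) →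
      Tendsto (fun ε => (∫ y, F (x - y) * (D ε y : ℂ)) - F x * ((∫ y, D ε y : ℝ) : ℂ))
        (𝓝[>] 0) (𝓝 0) := by
  filter_upwards [ae_tendsto_integral_mul_errK hF] with x hx C D hDm hD
  refine squeeze_zero_norm' ?_ (by simpa using hx.const_mul C)
  filter_upwards [self_mem_nhdsWithin] with ε hε
  have hε : 0 < ε := hε
  have hDi : Integrable (D ε) := ((integrable_errK hε).const_mul C).mono'
    (hDm ε hε).aestronglyMeasurable (Eventually.of_forall (hD ε hε))
  have hi1 := integrable_mul_of_errK_bound hF x hε (hDm ε hε) (hD ε hε)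
  have hi2 : Integrable fun y => F x * (D ε y : ℂ) := hDi.ofReal.const_mul _
  rw [← integral_complex_ofReal, ← integral_const_mul, ← integral_sub hi1 hi2, ← integral_const_mul]
  refine norm_integral_le_of_norm_le ?_ (Eventually.of_forall fun y => ?_)
  · refine Integrable.const_mul ?_ C
    have h1 : Integrable fun y => ‖F (x - y)‖ * errK ε y :=
      (hF.comp_sub_left x).norm.mul_bdd (c := ε / ε ^ (d + 1))
        (continuous_errK hε).aestronglyMeasurable (Eventually.of_forall fun y => by
          rw [Real.norm_of_nonneg (errK_nonneg hε y)]; exact errK_le hε y)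
    have h2 : Integrable fun y : Fin d → ℝ => ‖F x‖ * errK ε y := (integrable_errK hε).const_mul _
    refine (h1.add h2).mono' ?_ (Eventually.of_forall fun y => ?_)
    · exact (((hF.comp_sub_left x).aestronglyMeasurable.sub aestronglyMeasurable_const).norm.mul
        (continuous_errK hε).aestronglyMeasurable)
    · have := errK_nonneg hε y
      rw [norm_mul, norm_norm, Real.norm_of_nonneg this]
      simp only [Pi.add_apply]
      rw [← add_mul]; gcongr; exact norm_sub_le _ _
  · rw [← sub_mul, norm_mul, Complex.norm_real, mul_left_comm]
    gcongr; exact hD ε hε y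

end approximateIdentity

section principalValue
open Real

variable {d : ℕ}

/-- Convolution with the regularized Riesz kernel. -/
def kconv (i : Fin d) (ε : ℝ) (f : (Fin d → ℝ) → ℂ) (x : Fin d → ℝ) : ℂ :=
  ∫ y, f (x - y) * (kreg i ε y : ℂ)

lemma abs_kreg_le_const (i : Fin d) {ε : ℝ} (hε : 0 < ε) (y : Fin d → ℝ) :
    |kreg i ε y| ≤ ∫ ξ : Fin d → ℝ, ‖mult i ξ * (gaussD (ε ^ 2) ξ : ℂ)‖ := by
  rw [← Real.norm_eq_abs, ← Complex.norm_real, kreg_eq_ftInv i hε]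
  exact norm_ftInv_le _ _

lemma integrable_mul_kreg {f : (Fin d → ℝ) → ℂ} (hf : Integrable f) (i : Fin d) {ε : ℝ}
    (hε : 0 < ε) (x : Fin d → ℝ) : Integrable fun y => f (x - y) * (kreg i ε y : ℂ) := by
  have hm := measurable_kreg i ε
  refine (hf.comp_sub_left x).mul_bdd (c := ∫ ξ : Fin d → ℝ, ‖mult i ξ * (gaussD (ε ^ 2) ξ : ℂ)‖)
    (by fun_prop) (Eventually.of_forall fun y => ?_)
  rw [Complex.norm_real]
  exact abs_kreg_le_const i hε y

lemma measurable_rieszKernel (i : Fin d) : Measurable fun y => rieszKernel d y i := by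
  simp only [← kreg_zero]; exact measurable_kreg i 0

lemma rieszKernel_neg (i : Fin d) (x : Fin d → ℝ) : rieszKernel d (-x) i = -rieszKernel d x i := by
  rw [← kreg_zero, ← kreg_zero, kreg_neg]

lemma measurableSet_eucNorm_gt (ε : ℝ) : MeasurableSet {y : Fin d → ℝ | ε < eucNorm y} :=
  (isOpen_lt continuous_const continuous_eucNorm).measurableSet

/-- The truncated Riesz kernel. -/
def truncKernel (i : Fin d) (ε : ℝ) : (Fin d → ℝ) → ℝ :=
  {y : Fin d → ℝ | ε < eucNorm y}.indicator fun y => rieszKernel d y i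

lemma measurable_truncKernel (i : Fin d) (ε : ℝ) : Measurable (truncKernel i ε) :=
  (measurable_rieszKernel i).indicator (measurableSet_eucNorm_gt ε)

lemma truncKernel_neg (i : Fin d) (ε : ℝ) (x : Fin d → ℝ) :
    truncKernel i ε (-x) = -truncKernel i ε x := by
  simp only [truncKernel, indicator, mem_ofPred_eq, eucNorm_neg, rieszKernel_neg]
  split_ifs <;> simp

lemma integrable_mul_truncKernel {f : (Fin d → ℝ) → ℂ} (hf : Integrable f) (i : Fin d) {ε : ℝ}
    (hε : 0 < ε) (x : Fin d → ℝ) : Integrable fun y => f (x - y) * (truncKernel i ε y : ℂ) := by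
  obtain ⟨C, hC, h⟩ := abs_kreg_sub_trunc_le d
  have h1 := integrable_mul_of_errK_bound hf x hε (C := C)
    (D := fun y => kreg i ε y - truncKernel i ε y)
    ((measurable_kreg i ε).sub (measurable_truncKernel i ε)) fun y => h i ε y hε
  refine ((integrable_mul_kreg hf i hε x).sub h1).congr (Eventually.of_forall fun y => ?_)
  simp only [Pi.sub_apply]; push_cast; ring

lemma truncRiesz_apply {f : (Fin d → ℝ) → ℂ} (hf : Integrable f) (i : Fin d) {ε : ℝ}
    (hε : 0 < ε) (x : Fin d → ℝ) :
    truncRiesz f x ε i = ∫ y, f (x - y) * (truncKernel i ε y : ℂ) := by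
  have e : ∀ j, ({y : Fin d → ℝ | ε < eucNorm y}.indicator
      fun y => f (x - y) * ((rieszKernel d y j : ℝ) : ℂ)) =
      fun y => f (x - y) * (truncKernel j ε y : ℂ) := fun j => by
    ext y; simp only [truncKernel, indicator]; split_ifs <;> simp
  rw [truncRiesz, eval_integral, ← integral_indicator (measurableSet_eucNorm_gt ε), e]
  intro j
  rw [← IntegrableOn, ← integrable_indicator_iff (measurableSet_eucNorm_gt ε), e]
  exact integrable_mul_truncKernel hf j hε x

lemma ae_tendsto_kconv_sub_truncRiesz {f : (Fin d → ℝ) → ℂ} (hf : Integrable f) :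
    ∀ᵐ x : Fin d → ℝ, ∀ i, Tendsto (fun ε => kconv i ε f x - truncRiesz f x ε i)
      (𝓝[>] 0) (𝓝 0) := by
  obtain ⟨C, hC, h⟩ := abs_kreg_sub_trunc_le d
  filter_upwards [ae_tendsto_conv_sub hf] with x hx i
  have := hx C (fun ε y => kreg i ε y - truncKernel i ε y)
    (fun ε _ => (measurable_kreg i ε).sub (measurable_truncKernel i ε)) fun ε hε y => h i ε y hε
  refine this.congr' ?_
  filter_upwards [self_mem_nhdsWithin] with ε hε
  have hε : 0 < ε := hε
  have h0 : ∫ y, (kreg i ε y - truncKernel i ε y) = 0 := by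
    have h1 := integral_neg_eq_self (fun y => kreg i ε y - truncKernel i ε y) volume
    simp only [kreg_neg, truncKernel_neg] at h1
    rw [show (fun x => -kreg i ε x - -truncKernel i ε x) =
      fun y => -(kreg i ε y - truncKernel i ε y) by ext; ring, integral_neg] at h1
    linarith
  rw [h0, truncRiesz_apply hf i hε, kconv, ← integral_sub (integrable_mul_kreg hf i hε x)
    (integrable_mul_truncKernel hf i hε x)]
  simp only [Complex.ofReal_zero, mul_zero, sub_zero]
  congr 1; ext y; push_cast; ring

/-- The scaled Gaussian approximate identity. -/
def heatG (ε : ℝ) (x : Fin d → ℝ) : ℝ :=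
  (ε ^ 2) ^ (-((d : ℝ) / 2)) * rexp (-(π * eucNorm x ^ 2 / ε ^ 2))

lemma heatG_eq_ftInv {ε : ℝ} (hε : 0 < ε) (x : Fin d → ℝ) :
    (heatG ε x : ℂ) = ftInv (fun ξ => (gaussD (ε ^ 2) ξ : ℂ)) x :=
  (ftInv_gaussD (by positivity) x).symm

lemma sq_rpow_neg_half {ε : ℝ} (hε : 0 < ε) : (ε ^ 2) ^ (-((d : ℝ) / 2)) = (ε ^ d)⁻¹ := by
  rw [← Real.rpow_natCast ε 2, ← Real.rpow_mul hε.le, ← Real.rpow_natCast, ← Real.rpow_neg hε.le]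
  congr 1; push_cast; ring

lemma continuous_heatG (ε : ℝ) : Continuous (heatG ε : (Fin d → ℝ) → ℝ) := by
  unfold heatG; fun_prop

lemma heatG_nonneg (ε : ℝ) (x : Fin d → ℝ) : 0 ≤ heatG ε x := by
  unfold heatG; positivity

lemma heatG_le (d : ℕ) : ∃ C : ℝ, 0 < C ∧ ∀ (ε : ℝ) (x : Fin d → ℝ), 0 < ε →
    |heatG ε x| ≤ C * errK ε x := by
  obtain ⟨C, hC, h⟩ := one_add_rpow_mul_exp_le ((d : ℝ) + 1) (c := 2 * π) (by positivity)
  refine ⟨C * rexp π, by positivity, fun ε x hε => ?_⟩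
  have hn := eucNorm_nonneg x
  set t := eucNorm x / ε with ht
  have h1 := h t (by positivity)
  rw [show (d : ℝ) + 1 = ((d + 1 : ℕ) : ℝ) by push_cast; rfl, Real.rpow_natCast] at h1
  rw [abs_of_nonneg (heatG_nonneg ε x), heatG, sq_rpow_neg_half hε, errK]
  have e1 : ε / (ε + eucNorm x) ^ (d + 1) = (ε ^ d)⁻¹ * ((1 + t) ^ (d + 1))⁻¹ := by
    have : ε + eucNorm x = ε * (1 + t) := by rw [ht]; field_simp
    rw [this, mul_pow, pow_succ ε]; field_simp
  have e2 : rexp (-(π * eucNorm x ^ 2 / ε ^ 2)) ≤ rexp π * rexp (-(2 * π * t)) := by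
    rw [← Real.exp_add, mul_div_assoc, ← div_pow]
    refine Real.exp_le_exp.2 ?_
    nlinarith [pi_pos, mul_nonneg pi_pos.le (sq_nonneg (t - 1))]
  rw [e1]
  have hp : 0 < (1 + t) ^ (d + 1) := by positivity
  calc _ ≤ (ε ^ d)⁻¹ * (rexp π * rexp (-(2 * π * t))) := by gcongr
    _ = (ε ^ d)⁻¹ * ((1 + t) ^ (d + 1))⁻¹ * (rexp π * ((1 + t) ^ (d + 1) * rexp (-(2 * π * t)))) := by
      field_simp
    _ ≤ (ε ^ d)⁻¹ * ((1 + t) ^ (d + 1))⁻¹ * (rexp π * C) := by gcongr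
    _ = _ := by ring

lemma integrable_heatG {ε : ℝ} (hε : 0 < ε) : Integrable (heatG ε : (Fin d → ℝ) → ℝ) := by
  obtain ⟨C, hC, h⟩ := heatG_le d
  exact ((integrable_errK hε).const_mul C).mono' (continuous_heatG ε).aestronglyMeasurable
    (Eventually.of_forall fun x => h ε x hε)

lemma ft_heatG {ε : ℝ} (hε : 0 < ε) (ξ : Fin d → ℝ) :
    ft (fun x => (heatG ε x : ℂ)) ξ = (gaussD (ε ^ 2) ξ : ℂ) := by
  have e : (fun x : Fin d → ℝ => (heatG ε x : ℂ)) = ftInv fun ξ => (gaussD (ε ^ 2) ξ : ℂ) :=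
    funext (heatG_eq_ftInv hε)
  have hG : Integrable fun ξ : Fin d → ℝ => (gaussD (ε ^ 2) ξ : ℂ) :=
    (integrable_gaussD (by positivity)).ofReal
  have hi : Integrable fun x : Fin d → ℝ => (heatG ε x : ℂ) := (integrable_heatG hε).ofReal
  have hc := continuous_gaussD (d := d) (ε ^ 2)
  rw [e] at hi ⊢
  exact ft_ftInv (by fun_prop) hG hi ξ

lemma integral_heatG {ε : ℝ} (hε : 0 < ε) : ∫ x : Fin d → ℝ, heatG ε x = 1 := by
  have := ft_heatG (d := d) hε 0
  rw [ft_zero, integral_complex_ofReal] at this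
  have h2 : gaussD (ε ^ 2) (0 : Fin d → ℝ) = 1 := by simp [gaussD, eucNorm_zero]
  rw [h2] at this; exact_mod_cast this

lemma integral_mul_ftInv_sub {f G : (Fin d → ℝ) → ℂ} (hf : Integrable f) (hG : Integrable G)
    (x : Fin d → ℝ) : ∫ y, f (x - y) * ftInv G y = ∫ ξ, ft f ξ * (ech (dotP ξ x) * G ξ) := by
  rw [integral_ft_mul hf ((integrable_ech_mul hG x).congr (Eventually.of_forall fun ξ => by simp only [dotP_comm])), ← integral_sub_left_eq_self _ volume x]
  congr 1; ext y
  rw [sub_sub_cancel, ftInv_eq, ft_eq]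
  congr 2; ext ξ
  rw [dotP_sub, sub_eq_add_neg, ech_add, dotP_comm y ξ]; ring

lemma ae_tendsto_kconv {f g : (Fin d → ℝ) → ℂ} (hf : Integrable f) (hg : Integrable g) (i : Fin d)
    (h : ∀ᵐ ξ, ft g ξ = mult i ξ * ft f ξ) :
    ∀ᵐ x : Fin d → ℝ, Tendsto (fun ε => kconv i ε f x) (𝓝[>] 0) (𝓝 (g x)) := by
  obtain ⟨C, hC, hle⟩ := heatG_le d
  filter_upwards [ae_tendsto_conv_sub hg] with x hx
  have := hx C heatG (fun ε _ => (continuous_heatG ε).measurable) fun ε hε y => hle ε y hε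
  have h2 := this.add_const (g x)
  rw [zero_add] at h2
  refine h2.congr' ?_
  filter_upwards [self_mem_nhdsWithin] with ε hε
  have hε : 0 < ε := hε
  rw [integral_heatG hε, Complex.ofReal_one, mul_one, sub_add_cancel, kconv]
  simp only [heatG_eq_ftInv hε, kreg_eq_ftInv i hε]
  have hG : Integrable fun ξ : Fin d → ℝ => (gaussD (ε ^ 2) ξ : ℂ) :=
    (integrable_gaussD (by positivity)).ofReal
  have hG' : Integrable fun ξ : Fin d → ℝ => mult i ξ * (gaussD (ε ^ 2) ξ : ℂ) :=
    integrable_mult_gaussD i (by positivity)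
  rw [integral_mul_ftInv_sub hg hG, integral_mul_ftInv_sub hf hG']
  refine integral_congr_ae ?_
  filter_upwards [h] with ξ hξ
  rw [hξ]; ring

/-- An integrable function whose Fourier transform is `-i ξ/|ξ| f̂` is the Riesz transform. -/
lemma hasRiesz_of_ft {f : (Fin d → ℝ) → ℂ} {g : (Fin d → ℝ) → Fin d → ℂ} (hf : Integrable f)
    (hg : Integrable g) (h : ∀ i, ∀ᵐ ξ, ft (fun x => g x i) ξ = mult i ξ * ft f ξ) :
    HasRiesz f g := by
  have h1 : ∀ᵐ x : Fin d → ℝ, ∀ i, Tendsto (fun ε => kconv i ε f x) (𝓝[>] 0) (𝓝 (g x i)) :=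
    ae_all_iff.2 fun i => ae_tendsto_kconv hf (hg.eval i) i (h i)
  filter_upwards [h1, ae_tendsto_kconv_sub_truncRiesz hf] with x hx hx'
  refine tendsto_pi_nhds.2 fun i => ?_
  simpa using (hx i).sub (hx' i)

lemma HasRiesz.ae_tendsto_kconv {f : (Fin d → ℝ) → ℂ} {g : (Fin d → ℝ) → Fin d → ℂ}
    (hf : Integrable f) (h : HasRiesz f g) (i : Fin d) :
    ∀ᵐ x : Fin d → ℝ, Tendsto (fun ε => kconv i ε f x) (𝓝[>] 0) (𝓝 (g x i)) := by
  filter_upwards [h, ae_tendsto_kconv_sub_truncRiesz hf] with x hx hx'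
  simpa using (tendsto_pi_nhds.1 hx i).add (hx' i)

lemma HasRiesz.ae_eq {f : (Fin d → ℝ) → ℂ} {g g' : (Fin d → ℝ) → Fin d → ℂ}
    (h : HasRiesz f g) (h' : HasRiesz f g') : g =ᵐ[volume] g' := by
  filter_upwards [h, h'] with x hx hx'
  exact tendsto_nhds_unique hx hx'

end principalValue

section plancherel
open Real

variable {d : ℕ}

lemma gaussD_nonneg (τ : ℝ) (ξ : Fin d → ℝ) : 0 ≤ gaussD τ ξ := (Real.exp_pos _).le

lemma gaussD_le_one {τ : ℝ} (hτ : 0 ≤ τ) (ξ : Fin d → ℝ) : gaussD τ ξ ≤ 1 := by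
  rw [gaussD, Real.exp_le_one_iff]
  have := sq_nonneg (eucNorm ξ)
  have := pi_pos
  simp only [Left.neg_nonpos_iff]; positivity

lemma enorm_mul_le_half_sq (a b : ℂ) : ‖a‖ₑ * ‖b‖ₑ ≤ 2⁻¹ * (‖a‖ₑ ^ 2 + ‖b‖ₑ ^ 2) := by
  have h : ‖a‖₊ * ‖b‖₊ ≤ 2⁻¹ * (‖a‖₊ ^ 2 + ‖b‖₊ ^ 2) := by
    rw [← NNReal.coe_le_coe]; push_cast
    nlinarith [sq_nonneg (‖a‖ - ‖b‖)]
  have := ENNReal.coe_le_coe.2 h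
  rw [ENNReal.coe_mul, ENNReal.coe_mul, ENNReal.coe_inv two_ne_zero] at this
  simpa [enorm] using this

lemma lintegral_heatG_sub {ε : ℝ} (hε : 0 < ε) (x : Fin d → ℝ) :
    ∫⁻ y : Fin d → ℝ, ENNReal.ofReal (heatG ε (y - x)) = 1 := by
  rw [lintegral_sub_right_eq_self (fun y => ENNReal.ofReal (heatG ε y)),
    ← ofReal_integral_eq_lintegral_ofReal (integrable_heatG hε)
      (Eventually.of_forall (heatG_nonneg ε)), integral_heatG hε, ENNReal.ofReal_one]

lemma heatG_neg (ε : ℝ) (x : Fin d → ℝ) : heatG ε (-x) = heatG ε x := by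
  simp [heatG, eucNorm_neg]

lemma integral_ft_mul_conj {w : (Fin d → ℝ) → ℂ} (hw : Integrable w) {ε : ℝ} (hε : 0 < ε) :
    ((∫ ξ, ‖ft w ξ‖ ^ 2 * gaussD (ε ^ 2) ξ : ℝ) : ℂ) =
      ∫ x, w x * ∫ y, (starRingEnd ℂ) (w y) * (heatG ε (y - x) : ℂ) := by
  have hG : Integrable fun ξ : Fin d → ℝ => (gaussD (ε ^ 2) ξ : ℂ) :=
    (integrable_gaussD (by positivity)).ofReal
  have hcw : Integrable fun x => (starRingEnd ℂ) (w x) :=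
    hw.norm.mono' (Complex.continuous_conj.comp_aestronglyMeasurable hw.1)
      (Eventually.of_forall fun x => by simp)
  have hconj : ∀ ξ, (starRingEnd ℂ) (ft w ξ) = ftInv (fun x => (starRingEnd ℂ) (w x)) ξ := fun ξ => by
    rw [ft_eq, ftInv_eq, ← integral_conj]
    congr 1; ext x
    rw [map_mul, ech_neg, Complex.conj_conj, dotP_comm]
  have hI : Integrable fun ξ => ftInv (fun x => (starRingEnd ℂ) (w x)) ξ * (gaussD (ε ^ 2) ξ : ℂ) :=
    hG.bdd_mul (c := ∫ x, ‖(starRingEnd ℂ) (w x)‖) (continuous_ftInv hcw).aestronglyMeasurable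
      (Eventually.of_forall (norm_ftInv_le _))
  calc ((∫ ξ, ‖ft w ξ‖ ^ 2 * gaussD (ε ^ 2) ξ : ℝ) : ℂ)
      = ∫ ξ, ft w ξ * (ftInv (fun x => (starRingEnd ℂ) (w x)) ξ * (gaussD (ε ^ 2) ξ : ℂ)) := by
        rw [← integral_complex_ofReal]
        congr 1; ext ξ
        rw [← hconj, ← mul_assoc, Complex.mul_conj, Complex.normSq_eq_norm_sq]; push_cast; rfl
    _ = ∫ x, w x * ∫ y, (starRingEnd ℂ) (w y) * (heatG ε (y - x) : ℂ) := by
        rw [integral_ft_mul hw hI]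
        congr 1; ext x; congr 1
        rw [ft_eq]
        have := integral_ftInv_mul hcw (integrable_ech_neg_mul hG x)
        simp only [heatG_eq_ftInv hε]
        calc _ = ∫ ξ, ftInv (fun x => (starRingEnd ℂ) (w x)) ξ *
              (ech (-dotP x ξ) * (gaussD (ε ^ 2) ξ : ℂ)) := by
              congr 1; ext ξ; ring
          _ = _ := this
          _ = _ := by
              congr 1; ext y; congr 1
              rw [ftInv_eq, ftInv_eq]; congr 1; ext ξ
              rw [dotP_sub, sub_eq_add_neg, ech_add, dotP_comm ξ x]; ring

lemma lintegral_sq_ft_mul_gaussD_le {w : (Fin d → ℝ) → ℂ} (hw : Integrable w) {ε : ℝ}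
    (hε : 0 < ε) :
    ∫⁻ ξ, ‖ft w ξ‖ₑ ^ 2 * ENNReal.ofReal (gaussD (ε ^ 2) ξ) ≤ ∫⁻ x, ‖w x‖ₑ ^ 2 := by
  have hI : Integrable fun ξ => ‖ft w ξ‖ ^ 2 * gaussD (ε ^ 2) ξ :=
    (integrable_gaussD (by positivity)).bdd_mul (c := (∫ x, ‖w x‖) ^ 2)
      ((continuous_ft hw).norm.pow 2).aestronglyMeasurable (Eventually.of_forall fun ξ => by
        rw [norm_pow, norm_norm]; gcongr; exact norm_ft_le w ξ)
  have e1 : ∫⁻ ξ, ‖ft w ξ‖ₑ ^ 2 * ENNReal.ofReal (gaussD (ε ^ 2) ξ) =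
      ‖((∫ ξ, ‖ft w ξ‖ ^ 2 * gaussD (ε ^ 2) ξ : ℝ) : ℂ)‖ₑ := by
    have h0 : ∀ ξ, 0 ≤ ‖ft w ξ‖ ^ 2 * gaussD (ε ^ 2) ξ := fun ξ =>
      mul_nonneg (by positivity) (gaussD_nonneg _ _)
    rw [← ofReal_norm, Complex.norm_real, Real.norm_of_nonneg (integral_nonneg h0),
      ofReal_integral_eq_lintegral_ofReal hI (Eventually.of_forall h0)]
    congr 1; ext ξ
    rw [ENNReal.ofReal_mul (by positivity), ENNReal.ofReal_pow (norm_nonneg _),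
      ofReal_norm]
  rw [e1, integral_ft_mul_conj hw hε]
  have hm := hw.1.enorm
  have hc := (continuous_heatG (d := d) ε).measurable
  have hJ : AEMeasurable (fun z : (Fin d → ℝ) × (Fin d → ℝ) =>
      ‖w z.2‖ₑ ^ 2 * ENNReal.ofReal (heatG ε (z.2 - z.1))) (volume.prod volume) := by
    refine AEMeasurable.mul ((hm.comp_quasiMeasurePreserving
      Measure.quasiMeasurePreserving_snd).pow_const 2) ?_
    fun_prop
  calc _ ≤ ∫⁻ x, ∫⁻ y, ‖w x‖ₑ * (‖w y‖ₑ * ENNReal.ofReal (heatG ε (y - x))) := by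
        refine (enorm_integral_le_lintegral_enorm _).trans (lintegral_mono fun x => ?_)
        rw [enorm_mul, lintegral_const_mul' _ _ enorm_ne_top]
        gcongr
        refine (enorm_integral_le_lintegral_enorm _).trans (lintegral_mono fun y => ?_)
        rw [enorm_mul, ← ofReal_norm, ← ofReal_norm, Complex.norm_real,
          Real.norm_of_nonneg (heatG_nonneg _ _), RCLike.norm_conj, ofReal_norm]
    _ ≤ ∫⁻ x, ∫⁻ y, (2⁻¹ * (‖w x‖ₑ ^ 2 * ENNReal.ofReal (heatG ε (y - x))) +
          2⁻¹ * (‖w y‖ₑ ^ 2 * ENNReal.ofReal (heatG ε (y - x)))) := by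
        refine lintegral_mono fun x => lintegral_mono fun y => ?_
        have := mul_le_mul' (enorm_mul_le_half_sq (w x) (w y))
          (le_refl (ENNReal.ofReal (heatG ε (y - x))))
        calc _ = ‖w x‖ₑ * ‖w y‖ₑ * ENNReal.ofReal (heatG ε (y - x)) := by ring
          _ ≤ _ := this
          _ = _ := by ring
    _ = (∫⁻ x, ∫⁻ y, 2⁻¹ * (‖w x‖ₑ ^ 2 * ENNReal.ofReal (heatG ε (y - x)))) +
          ∫⁻ x, ∫⁻ y, 2⁻¹ * (‖w y‖ₑ ^ 2 * ENNReal.ofReal (heatG ε (y - x))) := by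
        rw [← lintegral_add_left']
        · congr 1; ext x
          rw [lintegral_add_left]
          fun_prop
        · have : (fun x => ∫⁻ y, 2⁻¹ * (‖w x‖ₑ ^ 2 * ENNReal.ofReal (heatG ε (y - x)))) =
              fun x => 2⁻¹ * ‖w x‖ₑ ^ 2 := by
            ext x
            rw [lintegral_const_mul' _ _ (by simp), lintegral_const_mul' _ _ (by simp),
              lintegral_heatG_sub hε, mul_one]
          rw [this]; exact (hm.pow_const 2).const_mul _
    _ = 2⁻¹ * (∫⁻ x, ‖w x‖ₑ ^ 2) + 2⁻¹ * ∫⁻ x, ‖w x‖ₑ ^ 2 := by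
        congr 1
        · rw [← lintegral_const_mul' _ _ (by simp)]
          congr 1; ext x
          rw [lintegral_const_mul' _ _ (by simp), lintegral_const_mul' _ _ (by simp),
              lintegral_heatG_sub hε, mul_one]
        · rw [lintegral_lintegral_swap (hJ.const_mul _), ← lintegral_const_mul' _ _ (by simp)]
          congr 1; ext y
          rw [lintegral_const_mul' _ _ (by simp), lintegral_const_mul' _ _ (by simp)]
          have : ∀ x, heatG ε (y - x) = heatG ε (x - y) := fun x => by
            rw [← heatG_neg, neg_sub]
          simp only [this]
          rw [lintegral_heatG_sub hε, mul_one]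
    _ = _ := by rw [← add_mul, ENNReal.inv_two_add_inv_two, one_mul]

/-- The `L²` bound for the Fourier transform on `L¹`. -/
lemma lintegral_sq_ft_le {w : (Fin d → ℝ) → ℂ} (hw : Integrable w) :
    ∫⁻ ξ, ‖ft w ξ‖ₑ ^ 2 ≤ ∫⁻ x, ‖w x‖ₑ ^ 2 := by
  set e : ℕ → ℝ := fun n => 1 / ((n : ℝ) + 1)
  have he : Tendsto e atTop (𝓝 0) := tendsto_one_div_add_atTop_nhds_zero_nat
  have hlim : ∀ ξ, Tendsto (fun n => ‖ft w ξ‖ₑ ^ 2 * ENNReal.ofReal (gaussD (e n ^ 2) ξ)) atTop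
      (𝓝 (‖ft w ξ‖ₑ ^ 2)) := fun ξ => by
    have h1 : Tendsto (fun n => gaussD (e n ^ 2) ξ) atTop (𝓝 1) := by
      have hc : Continuous fun t : ℝ => gaussD (t ^ 2) ξ := by unfold gaussD; fun_prop
      have := (hc.tendsto 0).comp he
      simpa [gaussD, Function.comp_def] using this
    have h2 := ENNReal.tendsto_ofReal h1
    simpa using ENNReal.Tendsto.const_mul h2 (Or.inr (by finiteness))
  calc ∫⁻ ξ, ‖ft w ξ‖ₑ ^ 2 = ∫⁻ ξ, liminf (fun n => ‖ft w ξ‖ₑ ^ 2 *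
        ENNReal.ofReal (gaussD (e n ^ 2) ξ)) atTop := by
        congr 1; ext ξ; exact (hlim ξ).liminf_eq.symm
    _ ≤ liminf (fun n => ∫⁻ ξ, ‖ft w ξ‖ₑ ^ 2 * ENNReal.ofReal (gaussD (e n ^ 2) ξ)) atTop := by
        refine lintegral_liminf_le fun n => ?_
        have := (continuous_ft hw).measurable
        have := (continuous_gaussD (d := d) (e n ^ 2)).measurable
        fun_prop
    _ ≤ _ := by
        refine liminf_le_of_le (by isBoundedDefault) fun b hb => ?_
        obtain ⟨n, hn⟩ := hb.exists
        exact hn.trans (lintegral_sq_ft_mul_gaussD_le hw (by positivity))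

lemma lintegral_sq_ftInv_le {w : (Fin d → ℝ) → ℂ} (hw : Integrable w) :
    ∫⁻ ξ, ‖ftInv w ξ‖ₑ ^ 2 ≤ ∫⁻ x, ‖w x‖ₑ ^ 2 := by
  simp only [ftInv_eq_ft_neg]
  rw [lintegral_neg_eq_self (fun ξ => ‖ft w ξ‖ₑ ^ 2)]
  exact lintegral_sq_ft_le hw

lemma sq_lintegral_mul_le {X : Type*} [MeasurableSpace X] {μ : Measure X} {f g : X → ℝ≥0∞}
    (hf : AEMeasurable f μ) (hg : AEMeasurable g μ) :
    (∫⁻ x, f x * g x ∂μ) ≤ (∫⁻ x, f x ^ 2 ∂μ) ^ (1 / 2 : ℝ) * (∫⁻ x, g x ^ 2 ∂μ) ^ (1 / 2 : ℝ) := by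
  have := ENNReal.lintegral_mul_le_Lp_mul_Lq μ Real.HolderConjugate.two_two hf hg
  simpa using this

end plancherel

section calderonZygmund
open Real

variable {d : ℕ}

/-- Index of the dyadic cube of generation `n` containing a point. -/
def dyIdx (n : ℕ) (y : Fin d → ℝ) : Fin d → ℤ := fun i => ⌊(2 : ℝ) ^ n * y i⌋

/-- Dyadic cube. -/
def dyCube (n : ℕ) (k : Fin d → ℤ) : Set (Fin d → ℝ) := {y | dyIdx n y = k}

/-- Lower corner of a dyadic cube. -/
def dyCorner (n : ℕ) (k : Fin d → ℤ) : Fin d → ℝ := fun i => (k i : ℝ) / 2 ^ n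

lemma dyCube_eq_pi (n : ℕ) (k : Fin d → ℤ) : dyCube n k =
    pi univ fun i => Ico (dyCorner n k i) (((k i : ℝ) + 1) / 2 ^ n) := by
  ext y
  have h2 : (0 : ℝ) < 2 ^ n := by positivity
  simp only [dyCube, dyIdx, mem_ofPred_eq, funext_iff, Set.mem_pi, mem_univ, true_imp_iff, mem_Ico,
    Int.floor_eq_iff, dyCorner, div_le_iff₀ h2, lt_div_iff₀ h2, mul_comm (2 ^ n : ℝ)]

lemma mem_dyCube_self (n : ℕ) (y : Fin d → ℝ) : y ∈ dyCube n (dyIdx n y) := rfl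

lemma measurable_dyIdx (n : ℕ) : Measurable (dyIdx n : (Fin d → ℝ) → Fin d → ℤ) := by
  unfold dyIdx; fun_prop

lemma measurableSet_dyCube (n : ℕ) (k : Fin d → ℤ) : MeasurableSet (dyCube n k) :=
  measurable_dyIdx n (measurableSet_singleton k)

lemma volume_dyCube (n : ℕ) (k : Fin d → ℤ) :
    (2 ^ n : ℝ≥0∞) ^ d * volume (dyCube n k) = 1 := by
  rw [dyCube_eq_pi, Real.volume_pi_Ico]
  have : ∀ i, ENNReal.ofReal (((k i : ℝ) + 1) / 2 ^ n - dyCorner n k i) = (2 ^ n)⁻¹ := fun i => by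
    rw [dyCorner, ← sub_div, add_sub_cancel_left, one_div, ENNReal.ofReal_inv_of_pos (by positivity),
      ENNReal.ofReal_pow (by norm_num), ENNReal.ofReal_ofNat]
  simp only [this, Finset.prod_const, Finset.card_univ, Fintype.card_fin]
  rw [← mul_pow, ENNReal.mul_inv_cancel (by simp) (by simp), one_pow]

lemma dyIdx_eq_of_succ {n : ℕ} {y y' : Fin d → ℝ} (h : dyIdx (n + 1) y = dyIdx (n + 1) y') :
    dyIdx n y = dyIdx n y' := by
  have key : ∀ t : ℝ, ⌊(2 : ℝ) ^ n * t⌋ = ⌊(2 : ℝ) ^ (n + 1) * t⌋ / ((2 : ℕ) : ℤ) := fun t => by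
    rw [← Int.floor_div_natCast]; congr 1; push_cast; ring
  ext i
  have := congr_fun h i
  simp only [dyIdx] at this ⊢
  rw [key, key, this]

lemma dyIdx_eq_of_le {m n : ℕ} (hmn : m ≤ n) {y y' : Fin d → ℝ} (h : dyIdx n y = dyIdx n y') :
    dyIdx m y = dyIdx m y' := by
  induction n, hmn using Nat.le_induction with
  | base => exact h
  | succ n _ ih => exact ih (dyIdx_eq_of_succ h)

lemma norm_sub_dyCorner_le {n : ℕ} {k : Fin d → ℤ} {y : Fin d → ℝ} (hy : y ∈ dyCube n k) :
    ‖y - dyCorner n k‖ ≤ 1 / 2 ^ n := by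
  rw [dyCube_eq_pi] at hy
  refine (pi_norm_le_iff_of_nonneg (by positivity)).2 fun i => ?_
  have := hy i (mem_univ i)
  rw [Pi.sub_apply, Real.norm_eq_abs, abs_of_nonneg (by linarith [this.1])]
  have h2 := this.2
  rw [add_div] at h2
  simp only [dyCorner] at this ⊢
  linarith

/-- Average of `‖f‖` over the dyadic cube of generation `n` containing `y`. -/
def dyAvg (f : (Fin d → ℝ) → ℂ) (n : ℕ) (y : Fin d → ℝ) : ℝ≥0∞ :=
  (2 ^ n : ℝ≥0∞) ^ d * ∫⁻ x in dyCube n (dyIdx n y), ‖f x‖ₑ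

lemma dyAvg_congr (f : (Fin d → ℝ) → ℂ) {m n : ℕ} (hmn : m ≤ n) {y y' : Fin d → ℝ}
    (h : dyIdx n y = dyIdx n y') : dyAvg f m y = dyAvg f m y' := by
  rw [dyAvg, dyAvg, dyIdx_eq_of_le hmn h]

lemma measurable_dyAvg (f : (Fin d → ℝ) → ℂ) (n : ℕ) : Measurable (dyAvg f n) :=
  (measurable_of_countable fun k : Fin d → ℤ =>
    (2 ^ n : ℝ≥0∞) ^ d * ∫⁻ x in dyCube n k, ‖f x‖ₑ).comp (measurable_dyIdx n)

lemma dyAvg_succ_le (f : (Fin d → ℝ) → ℂ) (n : ℕ) (y : Fin d → ℝ) :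
    dyAvg f (n + 1) y ≤ 2 ^ d * dyAvg f n y := by
  rw [dyAvg, dyAvg, ← mul_assoc, ← mul_pow, ← pow_succ']
  gcongr
  exact fun z hz => dyIdx_eq_of_succ hz

lemma dyCube_ae_eq_closedBall (n : ℕ) (k : Fin d → ℤ) : dyCube n k =ᵐ[volume]
    Metric.closedBall (fun i => dyCorner n k i + 1 / 2 / 2 ^ n) (1 / 2 / 2 ^ n) := by
  rw [dyCube_eq_pi]
  refine (Measure.univ_pi_Ico_ae_eq_Icc (μ := fun _ : Fin d => (volume : Measure ℝ))).trans ?_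
  rw [closedBall_pi _ (by positivity), ← pi_univ_Icc]
  simp only [Real.closedBall_eq_Icc]
  refine Eventually.of_forall fun y => ?_
  congr 4; ext i
  rw [dyCorner]; ring_nf

lemma ae_tendsto_dyAvg {f : (Fin d → ℝ) → ℂ} (hf : Integrable f) :
    ∀ᵐ y, Tendsto (fun n => (dyAvg f n y).toReal) atTop (𝓝 ‖f y‖) := by
  have := IsUnifLocDoublingMeasure.ae_tendsto_average (μ := (volume : Measure (Fin d → ℝ)))
    hf.norm.locallyIntegrable 1
  filter_upwards [this] with y hy
  have hδ : Tendsto (fun n : ℕ => (1 / 2 / 2 ^ n : ℝ)) atTop (𝓝[>] 0) := by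
    refine tendsto_nhdsWithin_iff.2 ⟨?_, Eventually.of_forall fun n => ?_⟩
    · simpa [div_eq_mul_inv] using (tendsto_pow_atTop_nhds_zero_of_lt_one (r := (2 : ℝ)⁻¹)
        (by norm_num) (by norm_num)).const_mul (2 : ℝ)⁻¹
    · exact mem_Ioi.2 (by positivity)
  refine (hy (fun n i => dyCorner n (dyIdx n y) i + 1 / 2 / 2 ^ n) _ hδ
    (Eventually.of_forall fun n => ?_)).congr fun n => ?_
  · have := mem_dyCube_self n y
    rw [dyCube_eq_pi] at this
    rw [one_mul, closedBall_pi _ (by positivity)]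
    intro i _
    have := this i (mem_univ i)
    beta_reduce
    rw [Real.closedBall_eq_Icc]
    have h2 := this.2
    have h1 := this.1
    rw [add_div] at h2
    simp only [dyCorner] at h1 ⊢
    constructor
    · linarith
    · have : (1 : ℝ) / 2 ^ n = 1 / 2 / 2 ^ n + 1 / 2 / 2 ^ n := by ring
      linarith
  · have hae := dyCube_ae_eq_closedBall n (dyIdx n y)
    rw [setAverage_congr hae.symm, setAverage_eq, dyAvg, ENNReal.toReal_mul, smul_eq_mul,
      integral_norm_eq_lintegral_enorm hf.1.restrict]
    congr 1
    have h1 := volume_dyCube n (dyIdx n y)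
    have h2 := congr_arg ENNReal.toReal h1
    rw [ENNReal.toReal_mul, ENNReal.toReal_one] at h2
    rw [measureReal_def]
    exact (eq_inv_of_mul_eq_one_left h2).symm

/-- Stopping cells at level `L`. -/
def stopCell (f : (Fin d → ℝ) → ℂ) (L : ℝ≥0∞) (p : ℕ × (Fin d → ℤ)) : Set (Fin d → ℝ) :=
  {y | dyIdx p.1 y = p.2 ∧ L < dyAvg f p.1 y ∧ ∀ m < p.1, dyAvg f m y ≤ L}

lemma measurableSet_stopCell (f : (Fin d → ℝ) → ℂ) (L : ℝ≥0∞) (p : ℕ × (Fin d → ℤ)) :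
    MeasurableSet (stopCell f L p) := by
  refine (measurableSet_dyCube p.1 p.2).inter
    ((measurableSet_lt measurable_const (measurable_dyAvg f p.1)).inter ?_)
  refine MeasurableSet.congr (s := ⋂ m, ⋂ (_ : m < p.1), {y | dyAvg f m y ≤ L}) ?_ ?_
  · exact MeasurableSet.iInter fun m => MeasurableSet.iInter fun _ =>
      measurableSet_le (measurable_dyAvg f m) measurable_const
  · ext y; simp only [mem_iInter]; rfl

lemma stopCell_eq {f : (Fin d → ℝ) → ℂ} {L : ℝ≥0∞} {p : ℕ × (Fin d → ℤ)}
    {y : Fin d → ℝ} (hy : y ∈ stopCell f L p) : stopCell f L p = dyCube p.1 p.2 := by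
  obtain ⟨h1, h2, h3⟩ := hy
  ext z
  refine ⟨fun hz => hz.1, fun hz => ⟨hz, ?_, fun m hm => ?_⟩⟩
  · rwa [dyAvg_congr f le_rfl (hz.trans h1.symm)]
  · rw [dyAvg_congr f hm.le (hz.trans h1.symm)]; exact h3 m hm

lemma pairwise_disjoint_stopCell (f : (Fin d → ℝ) → ℂ) (L : ℝ≥0∞) :
    Pairwise (Function.onFun Disjoint (stopCell f L)) := by
  intro p q hpq
  refine Set.disjoint_left.2 fun y hp hq => hpq ?_
  have hn : p.1 = q.1 := by
    by_contra hne
    rcases lt_or_gt_of_ne hne with h | h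
    · exact absurd (hq.2.2 _ h) (not_le.2 hp.2.1)
    · exact absurd (hp.2.2 _ h) (not_le.2 hq.2.1)
  refine Prod.ext hn ?_
  rw [← hp.1, ← hq.1, hn]

lemma mem_iUnion_stopCell {f : (Fin d → ℝ) → ℂ} {L : ℝ≥0∞} {y : Fin d → ℝ} :
    y ∈ ⋃ p, stopCell f L p ↔ ∃ n, L < dyAvg f n y := by
  classical
  rw [mem_iUnion]
  refine ⟨fun ⟨p, hp⟩ => ⟨_, hp.2.1⟩, fun h => ⟨(Nat.find h, dyIdx (Nat.find h) y), rfl,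
    Nat.find_spec h, fun m hm => not_lt.1 (Nat.find_min h hm)⟩⟩

lemma lt_lintegral_stopCell {f : (Fin d → ℝ) → ℂ} {L : ℝ≥0∞} (p : ℕ × (Fin d → ℤ)) :
    L * volume (stopCell f L p) ≤ ∫⁻ x in stopCell f L p, ‖f x‖ₑ := by
  rcases (stopCell f L p).eq_empty_or_nonempty with h | ⟨y, hy⟩
  · simp [h]
  · rw [stopCell_eq hy]
    have h2 := hy.2.1.le
    rw [dyAvg, hy.1] at h2
    calc L * volume (dyCube p.1 p.2) ≤ _ := mul_le_mul' h2 le_rfl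
      _ = ((2 ^ p.1 : ℝ≥0∞) ^ d * volume (dyCube p.1 p.2)) * ∫⁻ x in dyCube p.1 p.2, ‖f x‖ₑ := by
        ring
      _ = _ := by rw [volume_dyCube, one_mul]

lemma dyAvg_le_of_mem_stopCell {f : (Fin d → ℝ) → ℂ} {L : ℝ≥0∞} (hL : ∫⁻ x, ‖f x‖ₑ ≤ L)
    {p : ℕ × (Fin d → ℤ)} {y : Fin d → ℝ} (hy : y ∈ stopCell f L p) :
    dyAvg f p.1 y ≤ 2 ^ d * L := by
  obtain ⟨-, h2, h3⟩ := hy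
  rcases Nat.eq_zero_or_pos p.1 with h | h
  · refine absurd (h ▸ h2) (not_lt.2 ?_)
    simp only [dyAvg, pow_zero, one_pow, one_mul]
    exact (setLIntegral_le_lintegral _ _).trans hL
  · obtain ⟨m, hm⟩ := Nat.exists_eq_succ_of_ne_zero h.ne'
    rw [hm]
    refine (dyAvg_succ_le f m y).trans ?_
    gcongr
    exact h3 m (by omega)

end calderonZygmund

section calderonZygmund
open Real

variable {d : ℕ}

lemma integral_errK_eq {r : ℝ} (hr : 0 < r) :
    ∫ x : Fin d → ℝ, errK r x = ∫ x : Fin d → ℝ, errK 1 x := by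
  have h : ∀ x : Fin d → ℝ, errK r x = (r ^ d)⁻¹ * errK 1 (r⁻¹ • x) := fun x => by
    have : r + eucNorm x = r * (1 + r⁻¹ * eucNorm x) := by field_simp
    have h0 := eucNorm_nonneg x
    have h1 : 0 < 1 + r⁻¹ * eucNorm x := by positivity
    rw [errK, errK, eucNorm_smul, abs_of_pos (by positivity : 0 < r⁻¹), this, mul_pow, pow_succ r]
    field_simp
  simp only [h]
  rw [integral_const_mul, Measure.integral_comp_inv_smul]
  simp only [Module.finrank_fintype_fun_eq_card, Fintype.card_fin, smul_eq_mul]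
  rw [abs_of_pos (by positivity)]
  field_simp

lemma lintegral_errK_sub {r : ℝ} (hr : 0 < r) (c : Fin d → ℝ) :
    ∫⁻ x : Fin d → ℝ, ENNReal.ofReal (errK r (x - c)) =
      ENNReal.ofReal (∫ x : Fin d → ℝ, errK 1 x) := by
  rw [lintegral_sub_right_eq_self (fun x => ENNReal.ofReal (errK r x)),
    ← ofReal_integral_eq_lintegral_ofReal (integrable_errK hr)
      (Eventually.of_forall (errK_nonneg hr)), integral_errK_eq hr]

lemma integrable_mul_kreg_sub {f : (Fin d → ℝ) → ℂ} (hf : Integrable f) (i : Fin d) {ε : ℝ}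
    (hε : 0 < ε) (x : Fin d → ℝ) : Integrable fun y => f y * (kreg i ε (x - y) : ℂ) := by
  simpa using (integrable_mul_kreg hf i hε x).comp_sub_left x

lemma kconv_eq (f : (Fin d → ℝ) → ℂ) (i : Fin d) (ε : ℝ) (x : Fin d → ℝ) :
    kconv i ε f x = ∫ y, f y * (kreg i ε (x - y) : ℂ) := by
  rw [kconv, ← integral_sub_left_eq_self _ volume x]
  simp

/-- Radius of the ball around the corner of a dyadic cube that is removed. -/
def dyRad (d n : ℕ) : ℝ := 2 * (d + 1) / 2 ^ n

lemma dyRad_pos (d n : ℕ) : 0 < dyRad d n := by unfold dyRad; positivity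

lemma enorm_setIntegral_mul_kreg_le (d : ℕ) : ∃ C : ℝ, 0 < C ∧ ∀ (B : (Fin d → ℝ) → ℂ)
    (n : ℕ) (k : Fin d → ℤ) (R : Set (Fin d → ℝ)) (i : Fin d) (ε : ℝ) (x : Fin d → ℝ), Integrable B →
    R ⊆ dyCube n k → MeasurableSet R → ∫ y in R, B y = 0 → 0 < ε → dyRad d n ≤ ‖x - dyCorner n k‖ →
    ‖∫ y in R, B y * (kreg i ε (x - y) : ℂ)‖ₑ ≤
      ENNReal.ofReal (C * errK (dyRad d n) (x - dyCorner n k)) * ∫⁻ y in R, ‖B y‖ₑ := by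
  obtain ⟨C, hC, hK⟩ := abs_kreg_sub_le d
  refine ⟨C * 2 ^ d, by positivity, fun B n k R i ε x hB hR hRm h0 hε hx => ?_⟩
  set c := dyCorner n k with hc
  set r := dyRad d n with hr
  have hr0 : 0 < r := dyRad_pos d n
  have hE : r ≤ eucNorm (x - c) := hx.trans (norm_le_eucNorm _)
  have hpt : ∀ y ∈ R, |kreg i ε (x - c) - kreg i ε (x - y)| ≤ C * 2 ^ d * errK r (x - c) := by
    intro y hy
    have hy1 := norm_sub_dyCorner_le (hR hy)
    have hy2 : eucNorm (y - c) ≤ r / 2 := by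
      refine (eucNorm_le_norm _).trans ?_
      rw [hr, dyRad]
      calc ((d : ℝ) + 1) * ‖y - c‖ ≤ (d + 1) * (1 / 2 ^ n) := by gcongr
        _ = _ := by ring
    have e : (x - c) - (x - y) = y - c := by abel
    have hne : x - c ≠ 0 := fun h => by rw [h, eucNorm_zero] at hE; linarith
    have h1 := hK i ε (x - c) (x - y) hne (by rw [e]; linarith)
    rw [e] at h1
    refine h1.trans ?_
    have hEp : 0 < eucNorm (x - c) := hr0.trans_le hE
    calc C * eucNorm (y - c) / eucNorm (x - c) ^ (d + 1)
        ≤ C * (r / 2) / eucNorm (x - c) ^ (d + 1) := by gcongr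
      _ = C * 2 ^ d * (r / (2 * eucNorm (x - c)) ^ (d + 1)) := by
        rw [mul_pow, pow_succ 2]; field_simp
      _ ≤ _ := by
        rw [errK]; gcongr; linarith
  have h2 : ∫ y in R, B y * (kreg i ε (x - y) : ℂ) =
      ∫ y in R, B y * ((kreg i ε (x - y) - kreg i ε (x - c) : ℝ) : ℂ) := by
    have : ∫ y in R, B y * (kreg i ε (x - c) : ℂ) = 0 := by
      rw [integral_mul_const, h0, zero_mul]
    rw [← sub_zero (∫ y in R, B y * (kreg i ε (x - y) : ℂ)), ← this,
      ← integral_sub (integrable_mul_kreg_sub hB i hε x).integrableOn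
        (hB.mul_const _).integrableOn]
    congr 1; ext y; push_cast; ring
  rw [h2]
  calc _ ≤ ∫⁻ y in R, ‖B y * ((kreg i ε (x - y) - kreg i ε (x - c) : ℝ) : ℂ)‖ₑ :=
        enorm_integral_le_lintegral_enorm _
    _ ≤ ∫⁻ y in R, ENNReal.ofReal (C * 2 ^ d * errK r (x - c)) * ‖B y‖ₑ := by
        refine setLIntegral_mono' hRm fun y hy => ?_
        rw [enorm_mul, mul_comm]
        gcongr
        rw [← ofReal_norm, Complex.norm_real, Real.norm_eq_abs, abs_sub_comm]
        exact ENNReal.ofReal_le_ofReal (hpt y hy)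
    _ = _ := lintegral_const_mul' _ _ ENNReal.ofReal_ne_top

/-- Complex average over a dyadic cube. -/
def dyMean (f : (Fin d → ℝ) → ℂ) (p : ℕ × (Fin d → ℤ)) : ℂ :=
  (((2 ^ p.1) ^ d : ℝ) : ℂ) * ∫ y in dyCube p.1 p.2, f y

lemma enorm_dyMean_le (f : (Fin d → ℝ) → ℂ) (p : ℕ × (Fin d → ℤ)) :
    ‖dyMean f p‖ₑ ≤ (2 ^ p.1 : ℝ≥0∞) ^ d * ∫⁻ y in dyCube p.1 p.2, ‖f y‖ₑ := by
  rw [dyMean, enorm_mul, ← ofReal_norm, Complex.norm_real, Real.norm_of_nonneg (by positivity),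
    ENNReal.ofReal_pow (by positivity), ENNReal.ofReal_pow (by positivity), ENNReal.ofReal_ofNat]
  gcongr
  exact enorm_integral_le_lintegral_enorm _

lemma dyMean_mul_volume (f : (Fin d → ℝ) → ℂ) (p : ℕ × (Fin d → ℤ)) :
    ∫ _y in dyCube p.1 p.2, dyMean f p = ∫ y in dyCube p.1 p.2, f y := by
  have h2 := congr_arg ENNReal.toReal (volume_dyCube p.1 p.2)
  rw [ENNReal.toReal_mul, ENNReal.toReal_one, ENNReal.toReal_pow, ENNReal.toReal_pow,
    ENNReal.toReal_ofNat] at h2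
  rw [setIntegral_const, dyMean, measureReal_def, Complex.real_smul, ← mul_assoc, ← Complex.ofReal_mul,
    mul_comm (ENNReal.toReal _), h2, Complex.ofReal_one, one_mul]

/-- The Calderón–Zygmund decomposition, with the bound for the regularized Riesz transforms of the
bad part. -/
lemma exists_calderonZygmund (d : ℕ) : ∃ K : ℝ≥0∞, K ≠ ⊤ ∧ ∀ (f : (Fin d → ℝ) → ℂ) (L : ℝ≥0∞),
    Integrable f → L ≠ ⊤ → ∫⁻ x, ‖f x‖ₑ ≤ L → ∃ (G B : (Fin d → ℝ) → ℂ) (Ω Ω' : Set (Fin d → ℝ)),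
      Integrable G ∧ Integrable B ∧ (∀ x, f x = G x + B x) ∧ MeasurableSet Ω ∧ MeasurableSet Ω' ∧
      ∫⁻ x, ‖G x‖ₑ ^ 2 ≤ K * L * ∫⁻ x, ‖f x‖ₑ ∧ L * volume Ω ≤ ∫⁻ x in Ω, ‖f x‖ₑ ∧
      volume Ω' ≤ K * volume Ω ∧ ∫⁻ x, ‖B x‖ₑ ≤ K * ∫⁻ x in Ω, ‖f x‖ₑ ∧
      ∀ (i : Fin d) (ε : ℝ), 0 < ε →
        ∫⁻ x in Ω'ᶜ, ‖kconv i ε B x‖ₑ ≤ K * ∫⁻ x in Ω, ‖f x‖ₑ := by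
  obtain ⟨C, hC, hfar⟩ := enorm_setIntegral_mul_kreg_le d
  set E₁ := ENNReal.ofReal (∫ x : Fin d → ℝ, errK 1 x) with hE₁
  set K : ℝ≥0∞ := 2 + 2 * 2 ^ d + ENNReal.ofReal (4 * (d + 1)) ^ d + 2 * (ENNReal.ofReal C * E₁)
    with hKdef
  have hK1 : (2 : ℝ≥0∞) ≤ K := by
    rw [hKdef, add_assoc, add_assoc]; exact le_self_add
  have hK2 : (2 : ℝ≥0∞) ^ d ≤ K := by
    rw [hKdef, two_mul, add_comm 2, add_assoc, add_assoc, add_assoc]; exact le_self_add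
  have hK3 : ENNReal.ofReal (4 * (d + 1)) ^ d ≤ K := by
    rw [hKdef, add_comm (2 + 2 * 2 ^ d), add_assoc]; exact le_self_add
  have hK4 : 2 * (ENNReal.ofReal C * E₁) ≤ K := by
    rw [hKdef]; exact le_add_self
  have hKtop : K ≠ ⊤ := by rw [hKdef]; finiteness
  clear_value K
  refine ⟨K, hKtop, fun f L hf hLtop hL => ?_⟩
  set R := stopCell f L with hR
  have hRm : ∀ p, MeasurableSet (R p) := measurableSet_stopCell f L
  have hRd : Pairwise (Function.onFun Disjoint R) := pairwise_disjoint_stopCell f L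
  set Ω := ⋃ p, R p with hΩ
  have hΩm : MeasurableSet Ω := MeasurableSet.iUnion hRm
  obtain ⟨M, hMm, hM⟩ := exists_measurable_piecewise R hRm (fun p _ => dyMean f p)
    (fun _ => measurable_const) fun p q hpq y hy => absurd hy.2 (Set.disjoint_left.1 (hRd hpq) hy.1)
  have hMle : ∀ y ∈ Ω, ‖M y‖ₑ ≤ 2 ^ d * L := fun y hy => by
    obtain ⟨p, hp⟩ := mem_iUnion.1 hy
    rw [hM p hp]
    refine (enorm_dyMean_le f p).trans ?_
    have := dyAvg_le_of_mem_stopCell hL hp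
    rwa [dyAvg, hp.1] at this
  have hMint : ∫⁻ y in Ω, ‖M y‖ₑ ≤ ∫⁻ y in Ω, ‖f y‖ₑ := by
    rw [hΩ, lintegral_iUnion hRm hRd, lintegral_iUnion hRm hRd]
    refine ENNReal.tsum_le_tsum fun p => ?_
    rcases (R p).eq_empty_or_nonempty with h | ⟨y, hy⟩
    · simp [h]
    · rw [setLIntegral_congr_fun (hRm p) fun y hy => by rw [hM p hy], hR, stopCell_eq hy,
        setLIntegral_const]
      calc _ ≤ (2 ^ p.1 : ℝ≥0∞) ^ d * (∫⁻ y in dyCube p.1 p.2, ‖f y‖ₑ) *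
            volume (dyCube p.1 p.2) := by gcongr; exact enorm_dyMean_le f p
        _ = ((2 ^ p.1 : ℝ≥0∞) ^ d * volume (dyCube p.1 p.2)) *
            ∫⁻ y in dyCube p.1 p.2, ‖f y‖ₑ := by ring
        _ = _ := by rw [volume_dyCube, one_mul]
  have hfΩ : ∫⁻ y in Ω, ‖f y‖ₑ < ⊤ := (setLIntegral_le_lintegral _ _).trans_lt hf.2
  have hMi : IntegrableOn M Ω := ⟨hMm.aestronglyMeasurable, hMint.trans_lt hfΩ⟩
  set B : (Fin d → ℝ) → ℂ := Ω.indicator fun y => f y - M y with hB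
  have hBi : Integrable B := (integrable_indicator_iff hΩm).2 (hf.integrableOn.sub hMi)
  have hBle : ∫⁻ x, ‖B x‖ₑ ≤ 2 * ∫⁻ x in Ω, ‖f x‖ₑ := by
    have : ∀ x, ‖B x‖ₑ = Ω.indicator (fun y => ‖f y - M y‖ₑ) x := fun x => by
      rw [hB, enorm_indicator_eq_indicator_enorm]
    simp only [this]
    rw [lintegral_indicator hΩm, two_mul]
    calc _ ≤ ∫⁻ x in Ω, (‖f x‖ₑ + ‖M x‖ₑ) := lintegral_mono fun x => enorm_sub_le
      _ = (∫⁻ x in Ω, ‖f x‖ₑ) + ∫⁻ x in Ω, ‖M x‖ₑ := lintegral_add_right _ hMm.enorm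
      _ ≤ _ := by gcongr
  have hB0 : ∀ p, ∫ y in R p, B y = 0 := fun p => by
    rcases (R p).eq_empty_or_nonempty with h | ⟨y, hy⟩
    · simp [h]
    · have e : ∀ z ∈ R p, B z = f z - dyMean f p := fun z hz => by
        rw [hB, indicator_of_mem (mem_iUnion.2 ⟨p, hz⟩), hM p hz]
      rw [setIntegral_congr_fun (hRm p) e, hR, stopCell_eq hy, integral_sub hf.integrableOn,
        dyMean_mul_volume, sub_self]
      refine integrableOn_const ?_
      intro h
      have := volume_dyCube p.1 p.2
      rw [h, ENNReal.mul_top (by positivity)] at this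
      exact ENNReal.top_ne_one this
  set Ω' := ⋃ p : {p // (R p).Nonempty}, Metric.ball (dyCorner p.1.1 p.1.2) (dyRad d p.1.1) with hΩ'
  have hvol : ∀ p : {p // (R p).Nonempty},
      volume (Metric.ball (dyCorner p.1.1 p.1.2) (dyRad d p.1.1)) =
        ENNReal.ofReal (4 * (d + 1)) ^ d * volume (R p) := fun p => by
    obtain ⟨y, hy⟩ := p.2
    have hcell : R p = dyCube p.1.1 p.1.2 := stopCell_eq hy
    rw [hcell, Real.volume_pi_ball _ (dyRad_pos _ _), Fintype.card_fin,
      ENNReal.ofReal_pow (by have := dyRad_pos d p.1.1; positivity)]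
    have : ENNReal.ofReal (2 * dyRad d p.1.1) =
        ENNReal.ofReal (4 * (d + 1)) * (2 ^ p.1.1)⁻¹ := by
      rw [dyRad, show 2 * (2 * ((d : ℝ) + 1) / 2 ^ p.1.1) = 4 * (d + 1) * (2 ^ p.1.1)⁻¹ by
        field_simp; norm_num, ENNReal.ofReal_mul (by positivity),
        ENNReal.ofReal_inv_of_pos (by positivity), ENNReal.ofReal_pow (by norm_num),
        ENNReal.ofReal_ofNat]
    rw [this, mul_pow]
    congr 1
    have h1 := volume_dyCube p.1.1 p.1.2
    rw [← ENNReal.inv_pow]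
    exact (ENNReal.eq_inv_of_mul_eq_one_left (by rwa [mul_comm])).symm
  refine ⟨fun x => f x - B x, B, Ω, Ω', hf.sub hBi, hBi, fun x => (sub_add_cancel _ _).symm, hΩm,
    MeasurableSet.iUnion fun p => measurableSet_ball, ?_, ?_, ?_, hBle.trans (by gcongr), ?_⟩
  · have hG : ∀ᵐ x, ‖f x - B x‖ₑ ≤ 2 ^ d * L := by
      filter_upwards [ae_tendsto_dyAvg hf] with x hx
      by_cases hxΩ : x ∈ Ω
      · rw [hB, indicator_of_mem hxΩ, sub_sub_cancel]; exact hMle x hxΩ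
      · rw [hB, indicator_of_notMem hxΩ, sub_zero]
        have h1 : ∀ n, dyAvg f n x ≤ L := fun n => by
          by_contra h
          exact hxΩ (mem_iUnion_stopCell.2 ⟨n, not_le.1 h⟩)
        have h2 : ‖f x‖ ≤ L.toReal := le_of_tendsto' hx fun n => ENNReal.toReal_mono hLtop (h1 n)
        calc ‖f x‖ₑ = ENNReal.ofReal ‖f x‖ := (ofReal_norm _).symm
          _ ≤ L := ENNReal.ofReal_le_of_le_toReal h2
          _ ≤ 2 ^ d * L := le_mul_of_one_le_left' (one_le_pow₀ one_le_two)
    have hGi : ∫⁻ x, ‖f x - B x‖ₑ ≤ ∫⁻ x, ‖f x‖ₑ := by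
      rw [← lintegral_add_compl _ hΩm, ← lintegral_add_compl (fun x => ‖f x‖ₑ) hΩm]
      gcongr ?_ + ?_
      · rw [setLIntegral_congr_fun hΩm fun x hx => by
          rw [hB, indicator_of_mem hx, sub_sub_cancel]]
        exact hMint
      · rw [setLIntegral_congr_fun hΩm.compl fun x hx => by
          rw [hB, indicator_of_notMem hx, sub_zero]]
    calc ∫⁻ x, ‖f x - B x‖ₑ ^ 2 ≤ ∫⁻ x, (2 ^ d * L) * ‖f x - B x‖ₑ := by
          refine lintegral_mono_ae ?_
          filter_upwards [hG] with x hx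
          rw [sq]; gcongr
      _ = 2 ^ d * L * ∫⁻ x, ‖f x - B x‖ₑ := lintegral_const_mul' _ _ (by finiteness)
      _ ≤ _ := by gcongr
  · rw [hΩ, measure_iUnion hRd hRm, lintegral_iUnion hRm hRd, ← ENNReal.tsum_mul_left]
    exact ENNReal.tsum_le_tsum fun p => lt_lintegral_stopCell p
  · calc volume Ω' ≤ ∑' p : {p // (R p).Nonempty},
          volume (Metric.ball (dyCorner p.1.1 p.1.2) (dyRad d p.1.1)) := measure_iUnion_le _
      _ = ∑' p : {p // (R p).Nonempty}, ENNReal.ofReal (4 * (d + 1)) ^ d * volume (R p) := by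
          simp only [hvol]
      _ = ENNReal.ofReal (4 * (d + 1)) ^ d * ∑' p : {p // (R p).Nonempty}, volume (R p) :=
          ENNReal.tsum_mul_left
      _ ≤ K * ∑' p, volume (R p) := by
          gcongr
          exact ENNReal.tsum_comp_le_tsum_of_injective Subtype.val_injective _
      _ = K * volume Ω := by rw [hΩ, measure_iUnion hRd hRm]
  · intro i ε hε
    have hpt : ∀ x ∈ Ω'ᶜ, ‖kconv i ε B x‖ₑ ≤ ∑' p : ℕ × (Fin d → ℤ),
        ENNReal.ofReal (C * errK (dyRad d p.1) (x - dyCorner p.1 p.2)) * ∫⁻ y in R p, ‖B y‖ₑ := by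
      intro x hx
      have e1 : kconv i ε B x = ∑' p, ∫ y in R p, B y * (kreg i ε (x - y) : ℂ) := by
        rw [kconv_eq, ← integral_iUnion hRm hRd (integrable_mul_kreg_sub hBi i hε x).integrableOn,
          setIntegral_eq_integral_of_forall_compl_eq_zero]
        intro y hy
        rw [hB, indicator_of_notMem hy, zero_mul]
      rw [e1]
      refine enorm_tsum_le_tsum_enorm.trans (ENNReal.tsum_le_tsum fun p => ?_)
      rcases (R p).eq_empty_or_nonempty with h | h
      · simp [h]
      · refine hfar B p.1 p.2 (R p) i ε x hBi (fun y hy => hy.1) (hRm p) (hB0 p) hε ?_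
        by_contra hlt
        refine hx (mem_iUnion.2 ⟨⟨p, h⟩, ?_⟩)
        rw [mem_ball_iff_norm]
        exact not_le.1 hlt
    have hcm : ∀ p : ℕ × (Fin d → ℤ), Measurable fun x =>
        ENNReal.ofReal (C * errK (dyRad d p.1) (x - dyCorner p.1 p.2)) := fun p => by
      have := (continuous_errK (d := d) (dyRad_pos d p.1)).measurable
      fun_prop
    calc _ ≤ ∫⁻ x in Ω'ᶜ, ∑' p : ℕ × (Fin d → ℤ),
          ENNReal.ofReal (C * errK (dyRad d p.1) (x - dyCorner p.1 p.2)) *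
            ∫⁻ y in R p, ‖B y‖ₑ :=
          setLIntegral_mono' (MeasurableSet.iUnion fun p => measurableSet_ball).compl hpt
      _ ≤ ∫⁻ x, ∑' p : ℕ × (Fin d → ℤ),
          ENNReal.ofReal (C * errK (dyRad d p.1) (x - dyCorner p.1 p.2)) *
            ∫⁻ y in R p, ‖B y‖ₑ := setLIntegral_le_lintegral _ _
      _ = ∑' p : ℕ × (Fin d → ℤ), ENNReal.ofReal C * E₁ * ∫⁻ y in R p, ‖B y‖ₑ := by
          rw [lintegral_tsum fun p => ((hcm p).mul_const _).aemeasurable]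
          congr 1; ext p
          rw [lintegral_mul_const _ (hcm p)]
          simp only [ENNReal.ofReal_mul hC.le]
          rw [lintegral_const_mul' _ _ ENNReal.ofReal_ne_top, lintegral_errK_sub (dyRad_pos _ _)]
      _ = ENNReal.ofReal C * E₁ * ∫⁻ y in Ω, ‖B y‖ₑ := by
          rw [ENNReal.tsum_mul_left, hΩ, lintegral_iUnion hRm hRd]
      _ ≤ ENNReal.ofReal C * E₁ * (2 * ∫⁻ x in Ω, ‖f x‖ₑ) := by
          gcongr; exact (setLIntegral_le_lintegral _ _).trans hBle
      _ = 2 * (ENNReal.ofReal C * E₁) * ∫⁻ x in Ω, ‖f x‖ₑ := by ring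
      _ ≤ _ := by gcongr

end calderonZygmund

lemma enorm_integral_split_le {X : Type*} [MeasurableSpace X] {μ : Measure X}
    {p q g φ : X → ℂ} {M : ℝ≥0∞} {S : Set X} (hS : MeasurableSet S)
    (hpm : AEStronglyMeasurable p μ)
    (hφm : AEStronglyMeasurable φ μ)
    (hMt : M ≠ ⊤) (hM : ∀ x, ‖φ x‖ₑ ≤ M) (hp : Integrable (fun x => p x * φ x) μ)
    (hq : Integrable (fun x => q x * φ x) μ) (hgφ : Integrable (fun x => g x * φ x) μ)
    {V : Set X} (hV : MeasurableSet V)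
    (hVu : ∀ x, x ∉ V → ‖p x + q x - g x‖ₑ ≤ 1) (hVu' : ∀ x ∈ V, 1 ≤ ‖p x + q x - g x‖ₑ) :
    ‖∫ x, (p x + q x - g x) * φ x ∂μ‖ₑ ≤
      (∫⁻ x, min ‖p x + q x - g x‖ₑ 1 * ‖φ x‖ₑ ∂μ) + ‖∫ x, q x * φ x ∂μ‖ₑ +
      M * (∫⁻ x in Sᶜ, ‖q x‖ₑ ∂μ) +
      (∫⁻ x, ‖p x‖ₑ ^ 2 ∂μ) ^ (1 / 2 : ℝ) *
        (M ^ 2 * μ S + M * ∫⁻ x, min ‖p x + q x - g x‖ₑ 1 * ‖φ x‖ₑ ∂μ) ^ (1 / 2 : ℝ) +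
      M * ((∫⁻ x in S, ‖g x‖ₑ ∂μ) + ∫⁻ x, min ‖p x + q x - g x‖ₑ 1 * ‖g x‖ₑ ∂μ) := by
  have hW := (hS.union hV)
  set W := S ∪ V with hWd
  have hu : Integrable (fun x => (p x + q x - g x) * φ x) μ := by
    refine ((hp.add hq).sub hgφ).congr (Eventually.of_forall fun x => ?_)
    simp only [Pi.add_apply, Pi.sub_apply]; ring
  have hVle : ∀ F : X → ℝ≥0∞, ∫⁻ x in V, F x ∂μ ≤ ∫⁻ x, min ‖p x + q x - g x‖ₑ 1 * F x ∂μ :=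
    fun F => by
      rw [← lintegral_indicator hV]
      refine lintegral_mono fun x => ?_
      by_cases hx : x ∈ V
      · rw [indicator_of_mem hx, min_eq_right (hVu' x hx), one_mul]
      · rw [indicator_of_notMem hx]; exact zero_le
  have hMl : ∀ (F : X → ℂ) (T : Set X), ∫⁻ x in T, ‖F x * φ x‖ₑ ∂μ ≤
      M * ∫⁻ x in T, ‖F x‖ₑ ∂μ := fun F T => by
    rw [← lintegral_const_mul' _ _ hMt]
    refine lintegral_mono fun x => ?_
    rw [enorm_mul, mul_comm]
    exact mul_le_mul' (hM x) le_rfl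
  have e1 : ∫ x, (p x + q x - g x) * φ x ∂μ = (∫ x in Wᶜ, (p x + q x - g x) * φ x ∂μ) +
      ((∫ x, q x * φ x ∂μ) - ∫ x in Wᶜ, q x * φ x ∂μ) + (∫ x in W, p x * φ x ∂μ) -
      ∫ x in W, g x * φ x ∂μ := by
    rw [← integral_add_compl hW hu, ← integral_add_compl hW hq]
    have : ∫ x in W, (p x + q x - g x) * φ x ∂μ = (∫ x in W, p x * φ x ∂μ) +
        (∫ x in W, q x * φ x ∂μ) - ∫ x in W, g x * φ x ∂μ := by
      rw [← integral_add hp.integrableOn hq.integrableOn,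
        ← integral_sub (f := fun x => p x * φ x + q x * φ x) (hp.add hq).integrableOn
          hgφ.integrableOn]
      exact integral_congr_ae (Eventually.of_forall fun x => by ring)
    rw [this]; ring
  have b1 : ‖∫ x in Wᶜ, (p x + q x - g x) * φ x ∂μ‖ₑ ≤
      ∫⁻ x, min ‖p x + q x - g x‖ₑ 1 * ‖φ x‖ₑ ∂μ := by
    refine (enorm_integral_le_lintegral_enorm _).trans ?_
    rw [← lintegral_indicator hW.compl]
    refine lintegral_mono fun x => ?_
    by_cases hx : x ∈ Wᶜ
    · rw [indicator_of_mem hx, enorm_mul, min_eq_left (hVu x fun h => hx (Or.inr h))]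
    · rw [indicator_of_notMem hx]; exact zero_le
  have b2 : ‖∫ x in Wᶜ, q x * φ x ∂μ‖ₑ ≤ M * ∫⁻ x in Sᶜ, ‖q x‖ₑ ∂μ := by
    refine (enorm_integral_le_lintegral_enorm _).trans ?_
    refine (lintegral_mono_set (compl_subset_compl.2 subset_union_left)).trans ?_
    exact hMl _ _
  have b3 : ‖∫ x in W, p x * φ x ∂μ‖ₑ ≤ (∫⁻ x, ‖p x‖ₑ ^ 2 ∂μ) ^ (1 / 2 : ℝ) *
        (M ^ 2 * μ S + M * ∫⁻ x, min ‖p x + q x - g x‖ₑ 1 * ‖φ x‖ₑ ∂μ) ^ (1 / 2 : ℝ) := by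
    refine (enorm_integral_le_lintegral_enorm _).trans ?_
    simp_rw [enorm_mul]
    refine (sq_lintegral_mul_le hpm.restrict.enorm hφm.restrict.enorm).trans ?_
    refine mul_le_mul' (ENNReal.rpow_le_rpow (lintegral_mono' Measure.restrict_le_self le_rfl)
      (by norm_num)) (ENNReal.rpow_le_rpow ?_ (by norm_num))
    refine (lintegral_union_le _ _ _).trans (add_le_add ?_ ?_)
    · rw [← setLIntegral_const]
      exact lintegral_mono fun x => by gcongr; exact hM x
    · refine le_trans ?_ (mul_le_mul' le_rfl (hVle _))
      simp_rw [sq, ← enorm_mul]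
      exact hMl _ _
  have b4 : ‖∫ x in W, g x * φ x ∂μ‖ₑ ≤
      M * ((∫⁻ x in S, ‖g x‖ₑ ∂μ) + ∫⁻ x, min ‖p x + q x - g x‖ₑ 1 * ‖g x‖ₑ ∂μ) := by
    refine (enorm_integral_le_lintegral_enorm _).trans ?_
    refine (lintegral_union_le _ _ _).trans ?_
    rw [mul_add]
    exact add_le_add (hMl _ _) ((hMl _ _).trans (mul_le_mul' le_rfl (hVle _)))
  rw [e1]
  refine (enorm_sub_le).trans ?_
  refine (add_le_add ((enorm_add_le _ _).trans (add_le_add ((enorm_add_le _ _).trans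
    (add_le_add b1 (enorm_sub_le.trans (add_le_add le_rfl b2)))) b3)) b4).trans ?_
  simp only [add_assoc, le_refl]

lemma heatG_le_const {d : ℕ} {τ : ℝ} (x : Fin d → ℝ) :
    heatG τ x ≤ (τ ^ 2) ^ (-((d : ℝ) / 2)) := by
  unfold heatG
  refine mul_le_of_le_one_right (Real.rpow_nonneg (sq_nonneg _) _) (Real.exp_le_one_iff.2 ?_)
  have : 0 ≤ Real.pi * eucNorm x ^ 2 / τ ^ 2 := by positivity
  linarith

lemma integrable_heatG_sub {d : ℕ} {τ : ℝ} (hτ : 0 < τ) (x₀ : Fin d → ℝ) :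
    Integrable (fun y : Fin d → ℝ => ((heatG τ (x₀ - y) : ℝ) : ℂ)) :=
  ((integrable_heatG hτ).comp_sub_left x₀).ofReal

lemma ftInv_heatG_sub {d : ℕ} {τ : ℝ} (hτ : 0 < τ) (x₀ ξ : Fin d → ℝ) :
    ftInv (fun y : Fin d → ℝ => ((heatG τ (x₀ - y) : ℝ) : ℂ)) ξ =
      ech (dotP ξ x₀) * (gaussD (τ ^ 2) ξ : ℂ) := by
  rw [ftInv_eq, ← ft_heatG hτ, ft_eq, ← integral_const_mul,
    ← integral_sub_left_eq_self _ volume x₀]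
  refine integral_congr_ae (Eventually.of_forall fun y => ?_)
  simp only [sub_sub_cancel]
  rw [← mul_assoc, ← ech_add, dotP_comm, sub_eq_add_neg, ← sub_eq_add_neg, dotP_sub]
  ring_nf

lemma integral_ftInv_mul_heatG {d : ℕ} {A : (Fin d → ℝ) → ℂ} (hA : Integrable A) {τ : ℝ}
    (hτ : 0 < τ) (x₀ : Fin d → ℝ) :
    ∫ y, ftInv A y * ((heatG τ (x₀ - y) : ℝ) : ℂ) =
      ∫ ξ, A ξ * (ech (dotP ξ x₀) * (gaussD (τ ^ 2) ξ : ℂ)) := by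
  rw [integral_ftInv_mul hA (integrable_heatG_sub hτ x₀)]
  simp_rw [ftInv_heatG_sub hτ]

lemma integral_mul_heatG {d : ℕ} {g : (Fin d → ℝ) → ℂ} (hg : Integrable g) {τ : ℝ}
    (hτ : 0 < τ) (x₀ : Fin d → ℝ) :
    ∫ y, g y * ((heatG τ (x₀ - y) : ℝ) : ℂ) =
      ∫ ξ, ft g ξ * (ech (dotP ξ x₀) * (gaussD (τ ^ 2) ξ : ℂ)) := by
  have hi : Integrable (fun ξ : Fin d → ℝ => (gaussD (τ ^ 2) ξ : ℂ)) :=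
    (integrable_gaussD (by positivity)).ofReal
  rw [← integral_mul_ftInv_sub hg hi x₀, ← integral_sub_left_eq_self _ volume x₀]
  simp_rw [heatG_eq_ftInv hτ, sub_sub_cancel]

lemma integrable_ft_mul {d : ℕ} {f A : (Fin d → ℝ) → ℂ} (hf : Integrable f)
    (hA : Integrable A) : Integrable fun ξ => ft f ξ * A ξ :=
  hA.bdd_mul (c := ∫ x, ‖f x‖) (continuous_ft hf).aestronglyMeasurable
    (Eventually.of_forall fun _ => norm_ft_le _ _)

lemma kconv_eq_ftInv {d : ℕ} {f : (Fin d → ℝ) → ℂ} (hf : Integrable f) (i : Fin d) {ε : ℝ}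
    (hε : 0 < ε) (x : Fin d → ℝ) :
    kconv i ε f x = ftInv (fun ξ => ft f ξ * (mult i ξ * (gaussD (ε ^ 2) ξ : ℂ))) x := by
  rw [kconv, ftInv_eq]
  simp_rw [kreg_eq_ftInv i hε]
  rw [integral_mul_ftInv_sub hf (integrable_mult_gaussD i (by positivity))]
  refine integral_congr_ae (Eventually.of_forall fun ξ => ?_)
  simp only
  rw [dotP_comm]; ring

lemma lintegral_sq_kconv_le {d : ℕ} {f : (Fin d → ℝ) → ℂ} (hf : Integrable f) (i : Fin d) {ε : ℝ}
    (hε : 0 < ε) : ∫⁻ x, ‖kconv i ε f x‖ₑ ^ 2 ≤ ∫⁻ x, ‖f x‖ₑ ^ 2 := by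
  simp_rw [kconv_eq_ftInv hf i hε]
  refine (lintegral_sq_ftInv_le (integrable_ft_mul hf
    (integrable_mult_gaussD i (by positivity)))).trans ((lintegral_mono fun ξ => ?_).trans
    (lintegral_sq_ft_le hf))
  gcongr
  rw [← ofReal_norm, ← ofReal_norm]
  refine ENNReal.ofReal_le_ofReal ?_
  rw [norm_mul]
  refine mul_le_of_le_one_right (norm_nonneg _) ?_
  rw [norm_mul, Complex.norm_real, Real.norm_of_nonneg (gaussD_nonneg _ _)]
  exact mul_le_one₀ (norm_mult_le _ _) (gaussD_nonneg _ _) (gaussD_le_one (by positivity) _)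

lemma ft_eq_of_tendsto_kconv_aux {d : ℕ} {f γ : (Fin d → ℝ) → ℂ} (hf : Integrable f)
    (hγ : Integrable γ) (hγm : StronglyMeasurable γ) (i : Fin d)
    (h : ∀ᵐ x, Tendsto (fun ε => kconv i ε f x) (𝓝[>] 0) (𝓝 (γ x))) {τ : ℝ} (hτ : 0 < τ)
    (x₀ : Fin d → ℝ) :
    ∫ ξ, (ft f ξ * mult i ξ) * (ech (dotP ξ x₀) * (gaussD (τ ^ 2) ξ : ℂ)) =
      ∫ ξ, ft γ ξ * (ech (dotP ξ x₀) * (gaussD (τ ^ 2) ξ : ℂ)) := by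
  have hgau : ∀ {t : ℝ}, 0 < t → Integrable (fun ξ : Fin d → ℝ => (gaussD (t ^ 2) ξ : ℂ)) :=
    fun ht => (integrable_gaussD (by positivity)).ofReal
  have hech : Integrable fun ξ => ech (dotP ξ x₀) * (gaussD (τ ^ 2) ξ : ℂ) := by
    simpa only [dotP_comm] using integrable_ech_mul (hgau hτ) x₀
  rw [← integral_mul_heatG hγ hτ, ← sub_eq_zero]
  set T := (∫ ξ, (ft f ξ * mult i ξ) * (ech (dotP ξ x₀) * (gaussD (τ ^ 2) ξ : ℂ))) -
    ∫ y, γ y * ((heatG τ (x₀ - y) : ℝ) : ℂ) with hT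
  set φ : (Fin d → ℝ) → ℂ := fun y => ((heatG τ (x₀ - y) : ℝ) : ℂ) with hφ
  have hφi : Integrable φ := integrable_heatG_sub hτ x₀
  set M : ℝ≥0∞ := ENNReal.ofReal ((τ ^ 2) ^ (-((d : ℝ) / 2))) with hM
  have hφM : ∀ y, ‖φ y‖ₑ ≤ M := fun y => by
    rw [← ofReal_norm, hφ, Complex.norm_real, Real.norm_of_nonneg (heatG_nonneg _ _)]
    exact ENNReal.ofReal_le_ofReal (heatG_le_const _)
  have hφMr : ∀ y, ‖φ y‖ ≤ (τ ^ 2) ^ (-((d : ℝ) / 2)) := fun y => by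
    rw [hφ, Complex.norm_real, Real.norm_of_nonneg (heatG_nonneg _ _)]
    exact heatG_le_const _
  have hA : ∀ {F : (Fin d → ℝ) → ℂ}, Integrable F → ∀ {ε : ℝ}, 0 < ε →
      Integrable fun ξ => ft F ξ * (mult i ξ * (gaussD (ε ^ 2) ξ : ℂ)) := fun hF _ hε =>
    integrable_ft_mul hF (integrable_mult_gaussD i (by positivity))
  have hkc : ∀ {F : (Fin d → ℝ) → ℂ}, Integrable F → ∀ {ε : ℝ}, 0 < ε →
      Continuous (kconv i ε F) := fun hF ε hε => by
    rw [funext (kconv_eq_ftInv hF i hε)]; exact continuous_ftInv (hA hF hε)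
  have hkφ : ∀ {F : (Fin d → ℝ) → ℂ}, Integrable F → ∀ {ε : ℝ}, 0 < ε →
      Integrable fun y => kconv i ε F y * φ y := fun {F} hF ε hε => by
    refine hφi.bdd_mul (c := ∫ ξ, ‖ft F ξ * (mult i ξ * (gaussD (ε ^ 2) ξ : ℂ))‖)
      (hkc hF hε).aestronglyMeasurable (Eventually.of_forall fun y => ?_)
    rw [kconv_eq_ftInv hF i hε]; exact norm_ftInv_le _ _
  have hγφ : Integrable fun y => γ y * φ y := hγ.mul_bdd (c := (τ ^ 2) ^ (-((d : ℝ) / 2)))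
    hφi.aestronglyMeasurable (Eventually.of_forall hφMr)
  have hkI : ∀ {F : (Fin d → ℝ) → ℂ}, Integrable F → ∀ {ε : ℝ}, 0 < ε →
      ∫ y, kconv i ε F y * φ y = ∫ ξ, (ft F ξ * (mult i ξ * (gaussD (ε ^ 2) ξ : ℂ))) *
        (ech (dotP ξ x₀) * (gaussD (τ ^ 2) ξ : ℂ)) := fun {F} hF ε hε => by
    simp_rw [kconv_eq_ftInv hF i hε, hφ]
    exact integral_ftInv_mul_heatG (hA hF hε) hτ x₀
  have hlim : Tendsto (fun ε => ∫ y, (kconv i ε f y - γ y) * φ y) (𝓝[>] 0) (𝓝 T) := by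
    have h1 : Tendsto (fun ε : ℝ => ∫ ξ, (ft f ξ * (mult i ξ * (gaussD (ε ^ 2) ξ : ℂ))) *
        (ech (dotP ξ x₀) * (gaussD (τ ^ 2) ξ : ℂ))) (𝓝[>] 0)
        (𝓝 (∫ ξ, (ft f ξ * mult i ξ) * (ech (dotP ξ x₀) * (gaussD (τ ^ 2) ξ : ℂ)))) := by
      refine tendsto_integral_filter_of_dominated_convergence
        (fun ξ => (∫ x, ‖f x‖) * gaussD (τ ^ 2) ξ) ?_ ?_
        ((integrable_gaussD (by positivity)).const_mul _) ?_
      · filter_upwards [self_mem_nhdsWithin] with ε hε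
        exact (hA hf hε).aestronglyMeasurable.mul hech.aestronglyMeasurable
      · filter_upwards [self_mem_nhdsWithin] with ε hε
        filter_upwards with ξ
        simp only [norm_mul, norm_ech, one_mul, Complex.norm_real,
          Real.norm_of_nonneg (gaussD_nonneg _ _)]
        have h1 := norm_ft_le f ξ
        have h2 := norm_mult_le i ξ
        have h3 := gaussD_le_one (sq_nonneg ε) ξ
        have h4 := gaussD_nonneg (ε ^ 2) ξ
        refine mul_le_mul_of_nonneg_right ?_ (gaussD_nonneg _ _)
        exact (mul_le_of_le_one_right (norm_nonneg _) (mul_le_one₀ h2 h4 h3)).trans h1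
      · filter_upwards with ξ
        have : Continuous fun ε : ℝ => (ft f ξ * (mult i ξ * (gaussD (ε ^ 2) ξ : ℂ))) *
            (ech (dotP ξ x₀) * (gaussD (τ ^ 2) ξ : ℂ)) := by
          unfold gaussD; fun_prop
        have := (this.tendsto 0).mono_left (nhdsWithin_le_nhds (s := Ioi 0))
        simpa [gaussD] using this
    have h2 := h1.sub_const (∫ y, γ y * φ y)
    refine h2.congr' ?_
    filter_upwards [self_mem_nhdsWithin] with ε hε
    rw [← hkI hf hε, ← integral_sub (hkφ hf hε) hγφ]
    exact integral_congr_ae (Eventually.of_forall fun y => by ring)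
  have hsmall : ∀ F : (Fin d → ℝ) → ℂ, Integrable F →
      Tendsto (fun ε => ∫⁻ y, min ‖kconv i ε f y - γ y‖ₑ 1 * ‖F y‖ₑ) (𝓝[>] 0) (𝓝 0) :=
    fun F hF => by
      have : Tendsto (fun ε => ∫⁻ y, min ‖kconv i ε f y - γ y‖ₑ 1 * ‖F y‖ₑ) (𝓝[>] 0)
          (𝓝 (∫⁻ _ : Fin d → ℝ, 0)) := by
        refine tendsto_lintegral_filter_of_dominated_convergence' (fun y => ‖F y‖ₑ) ?_ ?_
          hF.2.ne ?_
        · filter_upwards [self_mem_nhdsWithin] with ε hε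
          exact (((hkc hf hε).aestronglyMeasurable.sub hγ.1).enorm.min aemeasurable_const).mul
            hF.1.enorm
        · exact Eventually.of_forall fun ε => Eventually.of_forall fun y =>
            mul_le_of_le_one_left' (min_le_right _ _)
        · filter_upwards [h] with y hy
          have h1 : Tendsto (fun ε => kconv i ε f y - γ y) (𝓝[>] 0) (𝓝 0) := by
            simpa using hy.sub_const (γ y)
          have h2 : Tendsto (fun ε => min ‖kconv i ε f y - γ y‖ₑ 1) (𝓝[>] 0) (𝓝 0) := by
            simpa using h1.enorm.min (tendsto_const_nhds (x := (1 : ℝ≥0∞)))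
          simpa using ENNReal.Tendsto.mul_const h2 (Or.inr enorm_ne_top)
      simpa using this
  obtain ⟨K, hK, hCZ⟩ := exists_calderonZygmund d
  set N := ∫⁻ x, ‖f x‖ₑ with hN
  have hNt : N ≠ ⊤ := hf.2.ne
  set D := ∫⁻ ξ : Fin d → ℝ, ‖ech (dotP ξ x₀) * (gaussD (τ ^ 2) ξ : ℂ)‖ₑ with hD
  have hDt : D ≠ ⊤ := hech.2.ne
  have hMt : M ≠ ⊤ := ENNReal.ofReal_ne_top
  have key : ∀ n : ℕ, ∃ Ω Ω' : Set (Fin d → ℝ), MeasurableSet Ω ∧ MeasurableSet Ω' ∧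
      (N + n) * volume Ω ≤ ∫⁻ x in Ω, ‖f x‖ₑ ∧ volume Ω' ≤ K * volume Ω ∧
      ‖T‖ₑ ≤ K * (∫⁻ x in Ω, ‖f x‖ₑ) * D + M * (K * ∫⁻ x in Ω, ‖f x‖ₑ) +
        (K * N * M ^ 2 * K * ∫⁻ x in Ω, ‖f x‖ₑ) ^ (1 / 2 : ℝ) + M * ∫⁻ x in Ω', ‖γ x‖ₑ := by
    intro n
    obtain ⟨G, B, Ω, Ω', hG, hB, hGB, hΩ, hΩ', hG2, hΩL, hΩΩ', hB1, hBk⟩ :=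
      hCZ f (N + n) hf (by finiteness) le_self_add
    refine ⟨Ω, Ω', hΩ, hΩ', hΩL, hΩΩ', ?_⟩
    have hadd : ∀ ε, 0 < ε → ∀ y, kconv i ε f y = kconv i ε G y + kconv i ε B y :=
      fun ε hε y => by
        rw [kconv, kconv, kconv, ← integral_add (integrable_mul_kreg hG i hε y)
          (integrable_mul_kreg hB i hε y)]
        simp_rw [hGB, add_mul]
    have hβ := hsmall φ hφi
    have hrhs : Tendsto (fun ε =>
        (∫⁻ y, min ‖kconv i ε f y - γ y‖ₑ 1 * ‖φ y‖ₑ) + K * (∫⁻ x in Ω, ‖f x‖ₑ) * D +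
          M * (K * ∫⁻ x in Ω, ‖f x‖ₑ) + (K * (N + n) * N) ^ (1 / 2 : ℝ) *
          (M ^ 2 * volume Ω' + M * ∫⁻ y, min ‖kconv i ε f y - γ y‖ₑ 1 * ‖φ y‖ₑ) ^ (1 / 2 : ℝ) +
          M * ((∫⁻ x in Ω', ‖γ x‖ₑ) + ∫⁻ y, min ‖kconv i ε f y - γ y‖ₑ 1 * ‖γ y‖ₑ)) (𝓝[>] 0)
        (𝓝 (0 + K * (∫⁻ x in Ω, ‖f x‖ₑ) * D + M * (K * ∫⁻ x in Ω, ‖f x‖ₑ) +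
          (K * (N + n) * N) ^ (1 / 2 : ℝ) * (M ^ 2 * volume Ω' + M * 0) ^ (1 / 2 : ℝ) +
          M * ((∫⁻ x in Ω', ‖γ x‖ₑ) + 0))) := by
      refine Tendsto.add (Tendsto.add (Tendsto.add (Tendsto.add hβ tendsto_const_nhds)
        tendsto_const_nhds) (ENNReal.Tendsto.const_mul ?_ (Or.inr ?_)))
        (ENNReal.Tendsto.const_mul (tendsto_const_nhds.add (hsmall γ hγ)) (Or.inr hMt))
      · exact (ENNReal.continuous_rpow_const.tendsto _).comp
          (tendsto_const_nhds.add (ENNReal.Tendsto.const_mul hβ (Or.inr hMt)))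
      · finiteness
    refine (le_of_tendsto_of_tendsto hlim.enorm hrhs ?_).trans ?_
    · filter_upwards [self_mem_nhdsWithin] with ε hε
      have hVm : MeasurableSet {y | 1 < ‖kconv i ε f y - γ y‖ₑ} :=
        measurableSet_lt measurable_const
          ((hkc hf hε).measurable.sub hγm.measurable).enorm
      have := enorm_integral_split_le (p := kconv i ε G) (q := kconv i ε B) (g := γ) (φ := φ)
        hΩ' (hkc hG hε).aestronglyMeasurable hφi.1 hMt hφM (hkφ hG hε) (hkφ hB hε) hγφ
        (V := {y | 1 < ‖kconv i ε f y - γ y‖ₑ}) hVm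
        (fun y hy => by rw [← hadd ε hε]; exact not_lt.1 hy)
        (fun y hy => by rw [← hadd ε hε]; exact le_of_lt hy)
      simp_rw [← hadd ε hε] at this
      refine this.trans ?_
      have hBφ : ‖∫ y, kconv i ε B y * φ y‖ₑ ≤ K * (∫⁻ x in Ω, ‖f x‖ₑ) * D := by
        rw [hkI hB hε]
        refine (enorm_integral_le_lintegral_enorm _).trans ?_
        rw [hD, ← lintegral_const_mul' _ _ (by
          refine ENNReal.mul_ne_top hK ((setLIntegral_le_lintegral _ _).trans_lt hf.2).ne)]
        refine lintegral_mono fun ξ => ?_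
        rw [enorm_mul]
        refine mul_le_mul' (le_trans ?_ hB1) le_rfl
        rw [← ofReal_norm, ← ofReal_integral_norm_eq_lintegral_enorm hB]
        refine ENNReal.ofReal_le_ofReal ?_
        rw [norm_mul, norm_mul, Complex.norm_real, Real.norm_of_nonneg (gaussD_nonneg _ _)]
        exact (mul_le_of_le_one_right (norm_nonneg _) (mul_le_one₀ (norm_mult_le i ξ)
          (gaussD_nonneg _ _) (gaussD_le_one (sq_nonneg ε) ξ))).trans (norm_ft_le B ξ)
      refine add_le_add (add_le_add (add_le_add (add_le_add le_rfl hBφ)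
        (mul_le_mul' le_rfl (hBk i ε hε))) (mul_le_mul' (ENNReal.rpow_le_rpow
        ((lintegral_sq_kconv_le hG i hε).trans hG2) (by norm_num)) le_rfl)) le_rfl
    · rw [zero_add, mul_zero, add_zero, add_zero,
        ← ENNReal.mul_rpow_of_nonneg _ _ (by norm_num : (0 : ℝ) ≤ 1 / 2)]
      refine add_le_add (add_le_add le_rfl (ENNReal.rpow_le_rpow ?_ (by norm_num))) le_rfl
      calc K * (N + n) * N * (M ^ 2 * volume Ω')
          ≤ K * (N + n) * N * (M ^ 2 * (K * volume Ω)) := by gcongr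
        _ = K * N * M ^ 2 * K * ((N + n) * volume Ω) := by ring
        _ ≤ _ := by gcongr
  choose Ω Ω' hΩ hΩ' hΩL hΩΩ' hT' using key
  have hvol : Tendsto (fun n => volume (Ω n)) atTop (𝓝 0) := by
    refine tendsto_of_tendsto_of_tendsto_of_le_of_le' tendsto_const_nhds
      (h := fun n : ℕ => N / n) ?_ (Eventually.of_forall fun _ => zero_le) ?_
    · simpa using ENNReal.Tendsto.const_div ENNReal.tendsto_nat_nhds_top (Or.inr hNt)
    · filter_upwards [eventually_gt_atTop 0] with n hn
      rw [ENNReal.le_div_iff_mul_le (Or.inl (by positivity)) (Or.inl (by finiteness))]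
      calc volume (Ω n) * n ≤ (N + n) * volume (Ω n) := by
            rw [mul_comm]; gcongr; exact le_add_self
        _ ≤ _ := (hΩL n).trans (setLIntegral_le_lintegral _ _)
  have hvol' : Tendsto (fun n => volume (Ω' n)) atTop (𝓝 0) := by
    refine tendsto_of_tendsto_of_tendsto_of_le_of_le tendsto_const_nhds
      (h := fun n : ℕ => K * volume (Ω n)) ?_ (fun _ => zero_le) hΩΩ'
    simpa using ENNReal.Tendsto.const_mul hvol (Or.inr hK)
  have hw : Tendsto (fun n => ∫⁻ x in Ω n, ‖f x‖ₑ) atTop (𝓝 0) :=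
    tendsto_setLIntegral_zero hNt hvol
  have hw' : Tendsto (fun n => ∫⁻ x in Ω' n, ‖γ x‖ₑ) atTop (𝓝 0) :=
    tendsto_setLIntegral_zero hγ.2.ne hvol'
  have hfin : Tendsto (fun n => K * (∫⁻ x in Ω n, ‖f x‖ₑ) * D + M * (K * ∫⁻ x in Ω n, ‖f x‖ₑ) +
        (K * N * M ^ 2 * K * ∫⁻ x in Ω n, ‖f x‖ₑ) ^ (1 / 2 : ℝ) + M * ∫⁻ x in Ω' n, ‖γ x‖ₑ)
        atTop (𝓝 (K * 0 * D + M * (K * 0) + (K * N * M ^ 2 * K * 0) ^ (1 / 2 : ℝ) + M * 0)) := by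
    have h1 := ENNReal.Tendsto.const_mul hw (Or.inr hK)
    refine Tendsto.add (Tendsto.add (Tendsto.add (ENNReal.Tendsto.mul_const h1 (Or.inr hDt))
      (ENNReal.Tendsto.const_mul h1 (Or.inr hMt))) ?_) (ENNReal.Tendsto.const_mul hw' (Or.inr hMt))
    exact (ENNReal.continuous_rpow_const.tendsto _).comp
      (ENNReal.Tendsto.const_mul hw (Or.inr (by finiteness)))
  have h0 := ge_of_tendsto' hfin hT'
  simpa using h0

lemma continuousOn_mult {d : ℕ} (i : Fin d) : ContinuousOn (mult i) {(0 : Fin d → ℝ)}ᶜ := by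
  unfold mult
  refine continuousOn_const.mul (Complex.continuous_ofReal.comp_continuousOn ?_)
  exact (continuous_apply i).continuousOn.div continuous_eucNorm.continuousOn
    fun ξ hξ => (eucNorm_pos hξ).ne'

lemma HasRiesz.ft_eq {d : ℕ} {f : (Fin d → ℝ) → ℂ} {g : (Fin d → ℝ) → Fin d → ℂ}
    (hf : Integrable f) (hg : Integrable g) (h : HasRiesz f g) (i : Fin d) {ξ : Fin d → ℝ}
    (hξ : ξ ≠ 0) : ft (fun x => g x i) ξ = mult i ξ * ft f ξ := by
  have hgi : Integrable (fun x => g x i) := hg.eval i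
  set γ := hgi.1.mk (fun x => g x i) with hγ
  have hγe : (fun x => g x i) =ᵐ[volume] γ := hgi.1.ae_eq_mk
  have hγi : Integrable γ := hgi.congr hγe
  have ht : ∀ᵐ x, Tendsto (fun ε => kconv i ε f x) (𝓝[>] 0) (𝓝 (γ x)) := by
    filter_upwards [h.ae_tendsto_kconv hf i, hγe] with x hx hx'
    rwa [← hx']
  have hG : Integrable (fun ξ : Fin d → ℝ => (gaussD (1 ^ 2) ξ : ℂ)) :=
    (integrable_gaussD (by norm_num)).ofReal
  have hi1 : Integrable fun ξ => ft γ ξ * (gaussD (1 ^ 2) ξ : ℂ) := integrable_ft_mul hγi hG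
  have hi2 : Integrable fun ξ => ft f ξ * (mult i ξ * (gaussD (1 ^ 2) ξ : ℂ)) :=
    integrable_ft_mul hf (integrable_mult_gaussD i (by norm_num))
  have hae : (fun ξ => ft γ ξ * (gaussD (1 ^ 2) ξ : ℂ)) =ᵐ[volume]
      fun ξ => ft f ξ * (mult i ξ * (gaussD (1 ^ 2) ξ : ℂ)) := by
    refine ae_eq_of_ft_eq hi1 hi2 (Eventually.of_forall fun x => ?_)
    have := ft_eq_of_tendsto_kconv_aux hf hγi hgi.1.stronglyMeasurable_mk i ht one_pos (-x)
    rw [AffinePaper.ft_eq, AffinePaper.ft_eq]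
    simp only [dotP_neg] at this
    simp only [dotP_comm x]
    convert this.symm using 3 <;> ring
  have hae' : ∀ᵐ ξ, ft γ ξ = mult i ξ * ft f ξ := by
    filter_upwards [hae] with ξ hξ
    have h0 : (gaussD (1 ^ 2) ξ : ℂ) ≠ 0 := by
      rw [Complex.ofReal_ne_zero]; exact (Real.exp_pos _).ne'
    refine mul_right_cancel₀ h0 ?_
    rw [hξ]; ring
  rw [ft_congr_ae hγe]
  exact Measure.eqOn_open_of_ae_eq (ae_restrict_of_ae hae') isOpen_compl_singleton
    (continuous_ft hγi).continuousOn
    ((continuousOn_mult i).mul (continuous_ft hf).continuousOn) hξ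

abbrev EC (d : ℕ) : Type := EuclideanSpace ℂ (Option (Fin d))

abbrev LE (d : ℕ) : Type := Lp (EC d) 1 (volume : Measure (Fin d → ℝ))

section VectorSetup

variable {d : ℕ}

lemma LE.integrable (F : LE d) : Integrable (fun x => F x) := L1.integrable_coeFn F

lemma LE.integrable_apply (F : LE d) (o : Option (Fin d)) : Integrable (fun x => F x o) :=
  (EuclideanSpace.proj (𝕜 := ℂ) o).integrable_comp F.integrable

lemma LE.norm_eq (F : LE d) : ‖F‖ = ∫ x, ‖F x‖ := L1.norm_eq_integral_norm F

lemma continuous_dotP_left (ξ : Fin d → ℝ) : Continuous fun x => dotP ξ x := by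
  unfold dotP; fun_prop

lemma LE.integrable_ech_smul (F : LE d) (ξ : Fin d → ℝ) :
    Integrable fun x => ech (-dotP ξ x) • F x := by
  refine (integrable_norm_iff ?_).1 ?_
  · exact (continuous_ech.comp (continuous_dotP_left ξ).neg).aestronglyMeasurable.smul
      F.integrable.1
  · simpa only [norm_smul, norm_ech, one_mul] using F.integrable.norm

/-- The vector-valued Fourier transform at a point. -/
def vft (ξ : Fin d → ℝ) : LE d →L[ℂ] EC d :=
  LinearMap.mkContinuous
    { toFun := fun F => ∫ x, ech (-dotP ξ x) • F x
      map_add' := fun F G => by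
        rw [← integral_add (F.integrable_ech_smul ξ) (G.integrable_ech_smul ξ)]
        refine integral_congr_ae ?_
        filter_upwards [Lp.coeFn_add F G] with x hx
        rw [hx, Pi.add_apply, smul_add]
      map_smul' := fun c F => by
        rw [RingHom.id_apply, ← integral_smul]
        refine integral_congr_ae ?_
        filter_upwards [Lp.coeFn_smul c F] with x hx
        rw [hx, Pi.smul_apply, smul_comm] } 1 (fun F => by
      refine (norm_integral_le_integral_norm _).trans ?_
      simp only [norm_smul, norm_ech, one_mul]
      exact (LE.norm_eq F).ge)

lemma vft_eq (ξ : Fin d → ℝ) (F : LE d) : vft ξ F = ∫ x, ech (-dotP ξ x) • F x := rfl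

lemma norm_vft_le (ξ : Fin d → ℝ) (F : LE d) : ‖vft ξ F‖ ≤ ‖F‖ := by
  refine (norm_integral_le_integral_norm _).trans ?_
  simp only [norm_smul, norm_ech, one_mul]
  exact (LE.norm_eq F).ge

lemma vft_apply (ξ : Fin d → ℝ) (F : LE d) (o : Option (Fin d)) :
    vft ξ F o = ft (fun x => F x o) ξ := by
  rw [vft_eq, ft_eq]
  have := (EuclideanSpace.proj (𝕜 := ℂ) o : EC d →L[ℂ] ℂ).integral_comp_comm
    (F.integrable_ech_smul ξ)
  simpa using this.symm

lemma continuous_vft (F : LE d) : Continuous fun ξ => vft ξ F := by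
  have : (fun ξ => vft ξ F) = fun ξ => WithLp.toLp 2 fun o => ft (fun x => F x o) ξ := by
    ext ξ o; simp [vft_apply]
  rw [this]
  exact (PiLp.continuous_toLp 2 _).comp (continuous_pi fun o => continuous_ft (F.integrable_apply o))

lemma LE.ext_of_apply {F G : LE d} (h : ∀ o, (fun x => F x o) =ᵐ[volume] fun x => G x o) :
    F = G := by
  refine Lp.ext ?_
  filter_upwards [eventually_countable_forall.2 h] with x hx
  ext o; exact hx o

lemma LE.ext_of_vft {F G : LE d} (h : ∀ᵐ ξ, vft ξ F = vft ξ G) : F = G :=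
  LE.ext_of_apply fun o => ae_eq_of_ft_eq (F.integrable_apply o) (G.integrable_apply o) <| by
    filter_upwards [h] with ξ hξ
    rw [← vft_apply, ← vft_apply, hξ]

/-- The Fourier transform of `F` is that of a scalar function together with its Riesz
transforms. -/
def Rz (F : LE d) : Prop :=
  ∀ ξ : Fin d → ℝ, ξ ≠ 0 → ∀ i, vft ξ F (some i) = mult i ξ * vft ξ F none

lemma ae_ne_zero_of_fin (i : Fin d) : ∀ᵐ ξ : Fin d → ℝ, ξ ≠ 0 := by
  have : Nonempty (Fin d) := ⟨i⟩
  exact Measure.ae_ne volume 0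

lemma Rz.ext {F G : LE d} (hF : Rz F) (hG : Rz G)
    (h : (fun x => F x none) =ᵐ[volume] fun x => G x none) : F = G :=
  LE.ext_of_apply fun o => by
    cases o with
    | none => exact h
    | some i =>
      refine ae_eq_of_ft_eq (F.integrable_apply _) (G.integrable_apply _) ?_
      filter_upwards [ae_ne_zero_of_fin i] with ξ hξ
      rw [← vft_apply, ← vft_apply, hF ξ hξ, hG ξ hξ, vft_apply, vft_apply, ft_congr_ae h]

lemma Rz.zero : Rz (0 : LE d) := fun ξ _ i => by simp

lemma Rz.add {F G : LE d} (hF : Rz F) (hG : Rz G) : Rz (F + G) := fun ξ hξ i => by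
  simp only [map_add, PiLp.add_apply, hF ξ hξ, hG ξ hξ]; ring

lemma Rz.smul {F : LE d} (hF : Rz F) (c : ℂ) : Rz (c • F) := fun ξ hξ i => by
  simp only [map_smul, PiLp.smul_apply, hF ξ hξ, smul_eq_mul]; ring

lemma Rz.sub {F G : LE d} (hF : Rz F) (hG : Rz G) : Rz (F - G) := by
  simpa [sub_eq_add_neg] using hF.add (hG.smul (-1))

lemma Rz.sum {ι : Type*} {F : ι → LE d} (s : Finset ι) (hF : ∀ i ∈ s, Rz (F i)) :
    Rz (∑ i ∈ s, F i) := by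
  classical
  induction s using Finset.induction_on with
  | empty => simpa using Rz.zero
  | insert a s ha ih =>
    rw [Finset.sum_insert ha]
    exact (hF a (by simp)).add (ih fun i hi => hF i (by simp [hi]))

lemma integrable_toLp {u : (Fin d → ℝ) → Option (Fin d) → ℂ} (h : ∀ o, Integrable fun x => u x o) :
    Integrable fun x => (WithLp.toLp 2 (u x) : EC d) :=
  (PiLp.continuousLinearEquiv 2 ℂ (fun _ : Option (Fin d) => ℂ)).symm.toContinuousLinearMap
    |>.integrable_comp (Integrable.of_eval h)

lemma exists_LE {u : (Fin d → ℝ) → Option (Fin d) → ℂ} (h : ∀ o, Integrable fun x => u x o) :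
    ∃ F : LE d, ∀ o, (fun x => F x o) =ᵐ[volume] fun x => u x o :=
  ⟨(integrable_toLp h).toL1 _, fun o => by
    filter_upwards [(integrable_toLp h).coeFn_toL1] with x hx
    rw [hx]⟩

/-- `F` is a lift of the function `f`, i.e. consists of `f` and its Riesz transforms. -/
def IsLift (F : LE d) (f : (Fin d → ℝ) → ℂ) : Prop :=
  Rz F ∧ f =ᵐ[volume] fun x => F x none

lemma IsLift.integrable {F : LE d} {f : (Fin d → ℝ) → ℂ} (h : IsLift F f) : Integrable f :=
  (F.integrable_apply none).congr h.2.symm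

lemma IsLift.sub {F G : LE d} {f g : (Fin d → ℝ) → ℂ} (hF : IsLift F f) (hG : IsLift G g) :
    IsLift (F - G) fun x => f x - g x :=
  ⟨hF.1.sub hG.1, by
    filter_upwards [hF.2, hG.2, Lp.coeFn_sub F G] with x h1 h2 h3
    rw [h3, Pi.sub_apply, PiLp.sub_apply, h1, h2]⟩

lemma IsLift.sum {ι : Type*} {F : ι → LE d} {f : ι → (Fin d → ℝ) → ℂ} (s : Finset ι)
    (h : ∀ i, IsLift (F i) (f i)) : IsLift (∑ i ∈ s, F i) fun x => ∑ i ∈ s, f i x := by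
  refine ⟨Rz.sum s fun i _ => (h i).1, ?_⟩
  classical
  induction s using Finset.induction_on with
  | empty =>
    filter_upwards [Lp.coeFn_zero (EC d) 1 (volume : Measure (Fin d → ℝ))] with x hx
    simp
  | insert a s ha ih =>
    filter_upwards [ih, (h a).2, Lp.coeFn_add (F a) (∑ i ∈ s, F i)] with x h1 h2 h3
    rw [Finset.sum_insert ha, Finset.sum_insert ha, h3, Pi.add_apply, PiLp.add_apply, ← h1, ← h2]

lemma IsLift.hasRiesz {F : LE d} {f : (Fin d → ℝ) → ℂ} (h : IsLift F f) :
    HasRiesz f (fun x i => F x (some i)) :=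
  hasRiesz_of_ft h.integrable (Integrable.of_eval fun i => F.integrable_apply (some i))
    fun i => by
      filter_upwards [ae_ne_zero_of_fin i] with ξ hξ
      rw [← vft_apply, h.1 ξ hξ, vft_apply, ft_congr_ae h.2]

lemma IsLift.memH1 {F : LE d} {f : (Fin d → ℝ) → ℂ} (h : IsLift F f) : MemH1 f :=
  ⟨h.integrable, _, Integrable.of_eval fun i => F.integrable_apply (some i), h.hasRiesz⟩

lemma exists_isLift_of_hasRiesz {f : (Fin d → ℝ) → ℂ} {g : (Fin d → ℝ) → Fin d → ℂ}
    (hf : Integrable f) (hg : Integrable g) (h : HasRiesz f g) :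
    ∃ F : LE d, IsLift F f ∧ ∀ i, (fun x => F x (some i)) =ᵐ[volume] fun x => g x i := by
  obtain ⟨F, hF⟩ := exists_LE (u := fun x o => o.elim (f x) (g x)) (fun o => by
    cases o with
    | none => exact hf
    | some i => exact hg.eval i)
  refine ⟨F, ⟨fun ξ hξ i => ?_, (hF none).symm⟩, fun i => hF (some i)⟩
  rw [vft_apply, vft_apply, ft_congr_ae (hF none), ft_congr_ae (hF (some i))]
  exact h.ft_eq hf hg i hξ

lemma MemH1.exists_isLift {f : (Fin d → ℝ) → ℂ} (h : MemH1 f) : ∃ F : LE d, IsLift F f := by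
  obtain ⟨hf, g, hg, hfg⟩ := h
  obtain ⟨F, hF, -⟩ := exists_isLift_of_hasRiesz hf hg hfg
  exact ⟨F, hF⟩

lemma EC.norm_none_le (v : EC d) : ‖v none‖ ≤ ‖v‖ := PiLp.norm_apply_le v none

lemma EC.norm_some_le (v : EC d) : ‖fun i => v (some i)‖ ≤ ‖v‖ :=
  (pi_norm_le_iff_of_nonneg (norm_nonneg _)).2 fun i => PiLp.norm_apply_le v (some i)

lemma EC.norm_le_sum (v : EC d) : ‖v‖ ≤ ‖v none‖ + ∑ i, ‖v (some i)‖ := by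
  rw [← Fintype.sum_option (fun o => ‖v o‖), EuclideanSpace.norm_eq]
  refine Real.sqrt_le_iff.2 ⟨by positivity, ?_⟩
  exact Finset.sum_sq_le_sq_sum_of_nonneg fun o _ => norm_nonneg _

lemma EC.norm_le (v : EC d) : ‖v‖ ≤ ‖v none‖ + d * ‖fun i => v (some i)‖ := by
  refine (EC.norm_le_sum v).trans (add_le_add le_rfl ?_)
  refine (Finset.sum_le_sum fun i _ => norm_le_pi_norm (fun i => v (some i)) i).trans ?_
  simp

lemma IsLift.integrable_riesz {F : LE d} {f : (Fin d → ℝ) → ℂ} (_h : IsLift F f) :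
    Integrable fun x (i : Fin d) => F x (some i) :=
  Integrable.of_eval fun i => F.integrable_apply (some i)

lemma IsLift.hardyNorm_eq {F : LE d} {f : (Fin d → ℝ) → ℂ} (h : IsLift F f) :
    hardyNorm f = ENNReal.ofReal (∫ x, ‖F x none‖) +
      ENNReal.ofReal (∫ x, ‖fun i => F x (some i)‖) := by
  have e : ∫ x, ‖f x‖ = ∫ x, ‖F x none‖ := integral_congr_ae (h.2.fun_comp norm)
  rw [hardyNorm, e]
  congr 1
  refine le_antisymm (sInf_le ⟨_, h.integrable_riesz, h.hasRiesz, rfl⟩) (le_sInf ?_)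
  rintro r ⟨g, -, hfg, rfl⟩
  exact (congrArg ENNReal.ofReal
    (integral_congr_ae ((h.hasRiesz.ae_eq hfg).fun_comp norm))).le

lemma IsLift.hardyNorm_le {F : LE d} {f : (Fin d → ℝ) → ℂ} (h : IsLift F f) :
    hardyNorm f ≤ 2 * ENNReal.ofReal ‖F‖ := by
  rw [two_mul, LE.norm_eq, h.hardyNorm_eq]
  refine add_le_add (ENNReal.ofReal_le_ofReal ?_) (ENNReal.ofReal_le_ofReal ?_)
  · exact integral_mono (F.integrable_apply none).norm F.integrable.norm
      fun x => EC.norm_none_le _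
  · exact integral_mono h.integrable_riesz.norm F.integrable.norm fun x => EC.norm_some_le _

lemma IsLift.norm_le {F : LE d} {f : (Fin d → ℝ) → ℂ} (h : IsLift F f) :
    ENNReal.ofReal ‖F‖ ≤ (d + 1) * hardyNorm f := by
  rw [h.hardyNorm_eq]
  have h2 : ‖F‖ ≤ (∫ x, ‖F x none‖) + d * ∫ x, ‖fun i => F x (some i)‖ := by
    have hi := h.integrable_riesz.norm.const_mul (d : ℝ)
    rw [LE.norm_eq, ← integral_const_mul, ← integral_add (F.integrable_apply none).norm hi]
    exact integral_mono F.integrable.norm ((F.integrable_apply none).norm.add hi)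
      fun x => EC.norm_le _
  refine (ENNReal.ofReal_le_ofReal h2).trans ?_
  rw [ENNReal.ofReal_add (by positivity) (by positivity), ENNReal.ofReal_mul (by positivity),
    ENNReal.ofReal_natCast, mul_add]
  refine add_le_add (le_mul_of_one_le_left' le_add_self) ?_
  gcongr; exact le_self_add

end VectorSetup

section Operators

variable {d : ℕ}

/-- Translation by `y` as an isometry of `L¹`. -/
def trL (y : Fin d → ℝ) : LE d →ₗᵢ[ℂ] LE d :=
  Lp.compMeasurePreservingₗᵢ ℂ (fun x => x - y) (measurePreserving_sub_right volume y)

lemma trL_ae (y : Fin d → ℝ) (F : LE d) : trL y F =ᵐ[volume] fun x => F (x - y) :=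
  Lp.coeFn_compMeasurePreserving F (measurePreserving_sub_right volume y)

lemma trL_apply_ae (y : Fin d → ℝ) (F : LE d) (o : Option (Fin d)) :
    (fun x => trL y F x o) =ᵐ[volume] fun x => F (x - y) o := by
  filter_upwards [trL_ae y F] with x hx
  rw [hx]

lemma continuous_trL (F : LE d) : Continuous fun y => trL y F := by
  let g : (Fin d → ℝ) → C(Fin d → ℝ, Fin d → ℝ) :=
    fun y => ⟨fun x => x - y, continuous_id.sub continuous_const⟩
  have hg : Continuous g := by
    refine ContinuousMap.continuous_of_continuous_uncurry _ ?_
    exact continuous_snd.sub continuous_fst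
  exact (continuous_const (y := F)).compMeasurePreservingLp hg
    (fun y => measurePreserving_sub_right volume y) ENNReal.one_ne_top

lemma vft_trL (y ξ : Fin d → ℝ) (F : LE d) :
    vft ξ (trL y F) = ech (-dotP ξ y) • vft ξ F := by
  ext o
  rw [vft_apply, ft_congr_ae (trL_apply_ae y F o), ft_translate (fun x => F x o), PiLp.smul_apply,
    vft_apply, smul_eq_mul]

lemma Rz.trL {F : LE d} (hF : Rz F) (y : Fin d → ℝ) : Rz (trL y F) := fun ξ hξ i => by
  simp only [vft_trL, PiLp.smul_apply, hF ξ hξ, smul_eq_mul]; ring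

lemma trL_zero (F : LE d) : trL 0 F = F :=
  LE.ext_of_vft (ae_of_all _ fun ξ => by rw [vft_trL, dotP_zero, neg_zero, ech_zero, one_smul])

/-- Multiplies the components other than the first one by the sign of `a`. -/
def sgnE (a : ℝ) (v : EC d) : EC d :=
  WithLp.toLp 2 fun o => o.elim (v none) fun i => ((a / |a| : ℝ) : ℂ) * v (some i)

@[simp] lemma sgnE_none (a : ℝ) (v : EC d) : sgnE a v none = v none := rfl

@[simp] lemma sgnE_some (a : ℝ) (v : EC d) (i : Fin d) :
    sgnE a v (some i) = ((a / |a| : ℝ) : ℂ) * v (some i) := rfl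

lemma norm_sgnE {a : ℝ} (ha : a ≠ 0) (v : EC d) : ‖sgnE a v‖ = ‖v‖ := by
  have h : abs (a / |a|) = 1 := by rw [abs_div, abs_abs, div_self (abs_ne_zero.2 ha)]
  rw [EuclideanSpace.norm_eq, EuclideanSpace.norm_eq, Fintype.sum_option, Fintype.sum_option]
  simp only [sgnE_none, sgnE_some, norm_mul, Complex.norm_real, Real.norm_eq_abs, h, one_mul]

lemma sgnE_add (a : ℝ) (v w : EC d) : sgnE a (v + w) = sgnE a v + sgnE a w := by
  ext o; cases o <;> simp [mul_add]

lemma sgnE_smul (a : ℝ) (c : ℂ) (v : EC d) : sgnE a (c • v) = c • sgnE a v := by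
  ext o; cases o <;> simp [mul_left_comm]

lemma quasiMeasurePreserving_smul {a : ℝ} (ha : a ≠ 0) :
    Measure.QuasiMeasurePreserving (fun x : Fin d → ℝ => a • x) :=
  ⟨measurable_const_smul a, by
    rw [Measure.map_addHaar_smul _ ha]
    exact Measure.smul_absolutelyContinuous⟩

lemma integrable_dil {a : ℝ} (ha : a ≠ 0) (F : LE d) :
    Integrable fun x : Fin d → ℝ => ((|a| ^ d : ℝ) : ℂ) • sgnE a (F (a • x)) := by
  have h : ∀ o, Integrable fun x : Fin d → ℝ => sgnE a (F (a • x)) o := fun o => by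
    have h1 : ∀ o, Integrable fun x : Fin d → ℝ => F (a • x) o := fun o =>
      (F.integrable_apply o).comp_smul ha
    cases o with
    | none => exact h1 none
    | some i => exact (h1 (some i)).const_mul _
  exact (integrable_toLp (u := fun x o => sgnE a (F (a • x)) o) h).smul ((|a| ^ d : ℝ) : ℂ)

/-- The `L¹`-normalized dilation by `a`, compatible with the Riesz transforms. -/
def dil (a : ℝ) (ha : a ≠ 0) : LE d →ₗᵢ[ℂ] LE d where
  toFun F := (integrable_dil ha F).toL1 _
  map_add' F G := by
    refine Lp.ext ?_
    filter_upwards [(integrable_dil ha (F + G)).coeFn_toL1, (integrable_dil ha F).coeFn_toL1,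
      (integrable_dil ha G).coeFn_toL1, Lp.coeFn_add ((integrable_dil ha F).toL1 _)
        ((integrable_dil ha G).toL1 _),
      (quasiMeasurePreserving_smul ha).ae (Lp.coeFn_add F G)] with x h1 h2 h3 h4 h5
    rw [h1, h4, Pi.add_apply, h2, h3, h5, Pi.add_apply, sgnE_add, smul_add]
  map_smul' c F := by
    refine Lp.ext ?_
    filter_upwards [(integrable_dil ha (c • F)).coeFn_toL1, (integrable_dil ha F).coeFn_toL1,
      Lp.coeFn_smul c ((integrable_dil ha F).toL1 _),
      (quasiMeasurePreserving_smul ha).ae (Lp.coeFn_smul c F)] with x h1 h2 h4 h5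
    rw [h1, RingHom.id_apply, h4, Pi.smul_apply, h2, h5, Pi.smul_apply, sgnE_smul, smul_comm]
  norm_map' F := by
    change ‖(integrable_dil ha F).toL1 _‖ = _
    have h2 := Measure.integral_comp_smul (volume : Measure (Fin d → ℝ)) (fun x => ‖F x‖) a
    have h0 : |a| ^ d ≠ 0 := pow_ne_zero _ (abs_ne_zero.2 ha)
    have h1 : ∫ x, ‖(integrable_dil ha F).toL1 _ x‖
        = ∫ x : Fin d → ℝ, ‖((|a| ^ d : ℝ) : ℂ) • sgnE a (F (a • x))‖ :=
      integral_congr_ae ((integrable_dil ha F).coeFn_toL1.fun_comp norm)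
    rw [LE.norm_eq, LE.norm_eq, h1]
    simp only [norm_smul, norm_sgnE ha, Complex.norm_real, integral_const_mul, h2, smul_eq_mul,
      norm_pow, Real.norm_eq_abs, abs_abs, Module.finrank_fin_fun, abs_inv, abs_pow]
    field_simp

lemma dil_ae {a : ℝ} (ha : a ≠ 0) (F : LE d) :
    dil a ha F =ᵐ[volume] fun x => ((|a| ^ d : ℝ) : ℂ) • sgnE a (F (a • x)) :=
  (integrable_dil ha F).coeFn_toL1

lemma vft_dil {a : ℝ} (ha : a ≠ 0) (F : LE d) (ξ : Fin d → ℝ) :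
    vft ξ (dil a ha F) = sgnE a (vft (a⁻¹ • ξ) F) := by
  ext o
  have h : (fun x => dil a ha F x o) =ᵐ[volume]
      fun x => (((|a| ^ d : ℝ) : ℂ) • sgnE a (F (a • x))) o := by
    filter_upwards [dil_ae ha F] with x hx
    rw [hx]
  rw [vft_apply, ft_congr_ae h]
  cases o with
  | none => exact (ft_dilate (fun x => F x none) ha ξ).trans (vft_apply _ F none).symm
  | some i =>
    simp only [PiLp.smul_apply, sgnE_some, smul_eq_mul, mul_left_comm _ ((a / |a| : ℝ) : ℂ)]
    rw [ft_const_mul, ft_dilate (fun x => F x (some i)) ha ξ, vft_apply]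

lemma mult_smul (a : ℝ) (i : Fin d) (ξ : Fin d → ℝ) :
    mult i (a • ξ) = ((a / |a| : ℝ) : ℂ) * mult i ξ := by
  rw [mult, mult, eucNorm_smul, Pi.smul_apply, smul_eq_mul, mul_div_mul_comm]
  push_cast; ring

lemma Rz.dil {F : LE d} (hF : Rz F) {a : ℝ} (ha : a ≠ 0) : Rz (dil a ha F) := fun ξ hξ i => by
  rw [vft_dil, sgnE_some, sgnE_none, hF _ (smul_ne_zero (inv_ne_zero ha) hξ), ← mul_assoc,
    ← mult_smul, smul_smul, mul_inv_cancel₀ ha, one_smul]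

lemma sgnE_sgnE_inv {a : ℝ} (ha : a ≠ 0) (v : EC d) : sgnE a (sgnE a⁻¹ v) = v := by
  have h : (a / |a|) * (a⁻¹ / |a⁻¹|) = 1 := by
    rw [abs_inv]; field_simp
  ext o
  cases o with
  | none => rfl
  | some i => rw [sgnE_some, sgnE_some, ← mul_assoc, ← Complex.ofReal_mul, h]; simp

lemma dil_dil_inv {a : ℝ} (ha : a ≠ 0) (F : LE d) :
    dil a ha (dil a⁻¹ (inv_ne_zero ha) F) = F :=
  LE.ext_of_vft (ae_of_all _ fun ξ => by
    rw [vft_dil, vft_dil, sgnE_sgnE_inv ha, smul_smul, inv_inv, mul_inv_cancel₀ ha, one_smul])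

lemma trL_dil {a : ℝ} (ha : a ≠ 0) (t : Fin d → ℝ) (F : LE d) :
    trL t (dil a ha F) = dil a ha (trL (a • t) F) :=
  LE.ext_of_vft (ae_of_all _ fun ξ => by
    rw [vft_dil, vft_trL, vft_trL, vft_dil, sgnE_smul, smul_dotP, dotP_smul, ← mul_assoc,
      inv_mul_cancel₀ ha, one_mul])

lemma integrable_smul_trL {Φ : (Fin d → ℝ) → ℂ} (hΦ : Integrable Φ) (F : LE d) :
    Integrable fun t => Φ t • trL t F := by
  refine (hΦ.norm.mul_const ‖F‖).mono'
    (hΦ.1.smul (continuous_trL F).aestronglyMeasurable) (ae_of_all _ fun t => ?_)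
  rw [norm_smul, LinearIsometry.norm_map]

/-- Convolution of a scalar function with an element of `L¹`. -/
def cv (Φ : (Fin d → ℝ) → ℂ) (F : LE d) : LE d := ∫ t, Φ t • trL t F

lemma norm_cv_le (Φ : (Fin d → ℝ) → ℂ) (F : LE d) : ‖cv Φ F‖ ≤ (∫ t, ‖Φ t‖) * ‖F‖ := by
  refine (norm_integral_le_integral_norm _).trans ?_
  simp only [norm_smul, LinearIsometry.norm_map, integral_mul_const, le_refl]

lemma vft_cv {Φ : (Fin d → ℝ) → ℂ} (hΦ : Integrable Φ) (F : LE d) (ξ : Fin d → ℝ) :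
    vft ξ (cv Φ F) = ft Φ ξ • vft ξ F := by
  rw [cv, ← (vft ξ).integral_comp_comm (integrable_smul_trL hΦ F), ft_eq,
    ← integral_smul_const]
  simp only [map_smul, vft_trL, smul_smul, mul_comm]

lemma Rz.cv {F : LE d} (hF : Rz F) {Φ : (Fin d → ℝ) → ℂ} (hΦ : Integrable Φ) : Rz (cv Φ F) :=
  fun ξ hξ i => by
    simp only [vft_cv hΦ, PiLp.smul_apply, hF ξ hξ, smul_eq_mul]; ring

/-- Convolution with dilates of a function of integral one is an approximate identity. -/
lemma tendsto_dil_cv_dil {Φ : (Fin d → ℝ) → ℂ} (hΦ : Integrable Φ) (hΦ1 : ∫ t, Φ t = 1)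
    {α : ℕ → ℝ} (hα : ∀ j, α j ≠ 0) (hαtop : Tendsto (fun j => |α j|) atTop atTop) (F : LE d) :
    Tendsto (fun j => dil (α j) (hα j) (cv Φ (dil (α j)⁻¹ (inv_ne_zero (hα j)) F))) atTop
      (𝓝 F) := by
  have key : ∀ j, dil (α j) (hα j) (cv Φ (dil (α j)⁻¹ (inv_ne_zero (hα j)) F))
      = ∫ t, Φ t • trL ((α j)⁻¹ • t) F := fun j => by
    rw [cv]
    have := (dil (d := d) (α j) (hα j)).toContinuousLinearMap.integral_comp_comm
      (integrable_smul_trL hΦ (dil (α j)⁻¹ (inv_ne_zero (hα j)) F))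
    simp only [LinearIsometry.coe_toContinuousLinearMap] at this
    rw [← this]
    simp only [map_smul, trL_dil, dil_dil_inv]
  simp_rw [key]
  have hF : F = ∫ t, Φ t • F := by rw [integral_smul_const, hΦ1, one_smul]
  nth_rw 2 [hF]
  refine tendsto_integral_of_dominated_convergence (fun t => ‖Φ t‖ * ‖F‖) (fun j => ?_)
    (hΦ.norm.mul_const _) (fun j => ae_of_all _ fun t => ?_) (ae_of_all _ fun t => ?_)
  · exact hΦ.1.smul ((continuous_trL F).comp (continuous_const_smul _)).aestronglyMeasurable
  · rw [norm_smul, LinearIsometry.norm_map]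
  · refine Tendsto.const_smul ?_ _
    have h1 : Tendsto (fun j => (α j)⁻¹ • t) atTop (𝓝 0) := by
      have : Tendsto (fun j => (α j)⁻¹) atTop (𝓝 0) :=
        tendsto_zero_iff_abs_tendsto_zero _ |>.2 (by
          simpa only [Function.comp_def, abs_inv] using tendsto_inv_atTop_zero.comp hαtop)
      simpa using this.smul_const t
    simpa [trL_zero, Function.comp_def] using ((continuous_trL F).tendsto 0).comp h1

end Operators

section CubeFourier

variable {d : ℕ}

local instance : MeasureSpace UnitAddCircle := ⟨AddCircle.haarAddCircle⟩

local instance : Measure.IsAddHaarMeasure (volume : Measure UnitAddCircle) :=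
  inferInstanceAs <| Measure.IsAddHaarMeasure AddCircle.haarAddCircle

local instance : IsProbabilityMeasure (volume : Measure UnitAddCircle) :=
  inferInstanceAs <| IsProbabilityMeasure AddCircle.haarAddCircle

lemma mFourier_coe (n : Fin d → ℤ) (x : Fin d → ℝ) :
    UnitAddTorus.mFourier n (fun i => (x i : UnitAddCircle)) = ech (dotP x (intVec n)) := by
  simp only [UnitAddTorus.mFourier, ContinuousMap.coe_mk, fourier_coe_apply, ech, dotP, intVec]
  rw [← Complex.exp_sum]
  congr 1
  push_cast
  rw [Finset.mul_sum, Finset.sum_mul]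
  refine Finset.sum_congr rfl fun i _ => ?_
  simp; ring

lemma intVec_sub (n m : Fin d → ℤ) : intVec (n - m) = intVec n - intVec m := by
  ext i; simp [intVec]

lemma setOf_forall_Ioc_ae_eq_centeredCube :
    {x : Fin d → ℝ | ∀ i, x i ∈ Ioc ((fun _ => -(1/2) : Fin d → ℝ) i)
      ((fun _ => -(1/2) : Fin d → ℝ) i + 1)} =ᵐ[volume] centeredCube d := by
  have h1 : {x : Fin d → ℝ | ∀ i, x i ∈ Ioc ((fun _ => -(1/2) : Fin d → ℝ) i)
      ((fun _ => -(1/2) : Fin d → ℝ) i + 1)} = univ.pi fun _ => Ioc (-(1/2) : ℝ) (1/2) := by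
    ext x; simp only [mem_univ_pi, Set.mem_ofPred_eq]; norm_num
  rw [h1, centeredCube]
  exact Measure.univ_pi_Ioc_ae_eq_Icc.trans Measure.univ_pi_Ioo_ae_eq_Icc.symm

lemma measurableSet_centeredCube : MeasurableSet (centeredCube d) :=
  MeasurableSet.univ_pi fun _ => measurableSet_Ioo

lemma volume_centeredCube : volume (centeredCube d) = 1 := by
  rw [centeredCube, volume_pi_pi]
  simp only [Real.volume_Ioo]
  norm_num

lemma ae_eq_zero_of_cube_coeff_eq_zero {v : (Fin d → ℝ) → ℂ} (hv : Measurable v) {M : ℝ}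
    (hM : ∀ ω, ‖v ω‖ ≤ M)
    (h : ∀ k : Fin d → ℤ, ∫ ω in centeredCube d, ech (dotP ω (intVec k)) * v ω = 0) :
    ∀ᵐ ω ∂(volume.restrict (centeredCube d)), v ω = 0 := by
  set a : Fin d → ℝ := fun _ => -(1/2) with ha
  set f : UnitAddTorus (Fin d) → ℂ := fun x => v (UnitAddTorus.measurableEquivPiIoc a x).1 with hf
  have hfm : Measurable f :=
    hv.comp (measurable_subtype_coe.comp (UnitAddTorus.measurableEquivPiIoc a).measurable)
  have hf2 : MemLp f 2 volume := MemLp.of_bound hfm.aestronglyMeasurable M (ae_of_all _ fun x => hM _)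
  have hfx : ∀ x : Fin d → ℝ, (∀ i, x i ∈ Ioc (a i) (a i + 1)) →
      f (fun i => (x i : UnitAddCircle)) = v x := fun x hx => by
    have := (UnitAddTorus.measurableEquivPiIoc a).apply_symm_apply ⟨x, hx⟩
    rw [UnitAddTorus.coe_symm_measurableEquivPiIoc_apply] at this
    simp only [hf]; rw [this]
  have hbox : MeasurableSet {x : Fin d → ℝ | ∀ i, x i ∈ Ioc (a i) (a i + 1)} :=
    MeasurableSet.univ_pi' fun _ => measurableSet_Ioc
  have hc : ∀ n, UnitAddTorus.mFourierCoeff f n = 0 := fun n => by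
    rw [UnitAddTorus.mFourierCoeff_eq_integral f n a, ← h (-n),
      ← setIntegral_congr_set setOf_forall_Ioc_ae_eq_centeredCube]
    refine setIntegral_congr_fun hbox fun x hx => ?_
    simp only [smul_eq_mul]
    rw [mFourier_coe, hfx x hx]
  have hz : hf2.toLp f = 0 := by
    have h0 : UnitAddTorus.mFourierBasis.repr (hf2.toLp f) = 0 := by
      ext n
      rw [UnitAddTorus.mFourierBasis_repr, lp.coeFn_zero, Pi.zero_apply, ← hc n]
      refine integral_congr_ae ?_
      filter_upwards [hf2.coeFn_toLp] with x hx
      rw [hx]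
    simpa using h0
  have hz2 : f =ᵐ[volume] 0 := by
    have := hf2.coeFn_toLp
    rw [hz] at this
    exact this.symm.trans (Lp.coeFn_zero _ _ _)
  have hz3 : ∫⁻ x, ‖f x‖ₑ = 0 := by
    rw [lintegral_eq_zero_iff hfm.enorm]
    filter_upwards [hz2] with x hx
    simp [hx]
  rw [UnitAddTorus.lintegral_preimage _ a, setLIntegral_congr_fun hbox
    (g := fun x => ‖v x‖ₑ) (fun x hx => by simp only; rw [hfx x hx]),
    setLIntegral_congr setOf_forall_Ioc_ae_eq_centeredCube, lintegral_eq_zero_iff hv.enorm] at hz3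
  filter_upwards [hz3] with x hx
  simpa using hx

lemma integral_cube_ech (m : Fin d → ℤ) :
    ∫ ω in centeredCube d, ech (dotP ω (intVec m)) = if m = 0 then 1 else 0 := by
  have h := orthonormal_iff_ite.1 (UnitAddTorus.orthonormal_mFourier (d := Fin d)) 0 m
  rw [ContinuousMap.inner_toLp] at h
  rw [← setIntegral_congr_set setOf_forall_Ioc_ae_eq_centeredCube]
  simp only [← mFourier_coe]
  rw [← UnitAddTorus.integral_preimage (fun x => UnitAddTorus.mFourier m x)]
  simpa [eq_comm, UnitAddTorus.mFourier_zero] using h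

/-- The Fourier series with coefficients `D`. -/
def dser (D : (Fin d → ℤ) → ℂ) (ω : Fin d → ℝ) : ℂ :=
  ∑' k, ech (-dotP ω (intVec k)) * D k

lemma continuous_dser {D : (Fin d → ℤ) → ℂ} (hD : Summable fun k => ‖D k‖) :
    Continuous (dser D) := by
  refine continuous_tsum (fun k => ?_) hD fun k ω => ?_
  · have : Continuous fun ω : Fin d → ℝ => dotP ω (intVec k) := by unfold dotP; fun_prop
    exact (continuous_ech.comp this.neg).mul continuous_const
  · rw [norm_mul, norm_ech, one_mul]

lemma norm_dser_le {D : (Fin d → ℤ) → ℂ} (hD : Summable fun k => ‖D k‖) (ω : Fin d → ℝ) :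
    ‖dser D ω‖ ≤ ∑' k, ‖D k‖ := by
  have h : (fun k => ‖ech (-dotP ω (intVec k)) * D k‖) = fun k => ‖D k‖ := by
    ext k; rw [norm_mul, norm_ech, one_mul]
  have := norm_tsum_le_tsum_norm (f := fun k => ech (-dotP ω (intVec k)) * D k) (by rwa [h])
  rwa [h] at this

lemma hasSum_cube_dser_mul {D : (Fin d → ℤ) → ℂ} (hD : Summable fun k => ‖D k‖)
    {v : (Fin d → ℝ) → ℂ} (hv : IntegrableOn v (centeredCube d)) (k : Fin d → ℤ) :
    HasSum (fun m => D m * ∫ ω in centeredCube d, ech (dotP ω (intVec (k - m))) * v ω)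
      (∫ ω in centeredCube d, ech (dotP ω (intVec k)) * (dser D ω * v ω)) := by
  set μ := volume.restrict (centeredCube d) with hμ
  have hi : ∀ m : Fin d → ℤ,
      Integrable (fun ω => D m * (ech (dotP ω (intVec (k - m))) * v ω)) μ := fun m => by
    refine Integrable.const_mul ?_ _
    refine Integrable.bdd_mul (c := 1) hv (Continuous.aestronglyMeasurable ?_)
      (ae_of_all _ fun ω => (norm_ech _).le)
    unfold dotP; exact continuous_ech.comp (by fun_prop)
  have hn : ∀ (m : Fin d → ℤ) (ω : Fin d → ℝ),
      ‖D m * (ech (dotP ω (intVec (k - m))) * v ω)‖ = ‖D m‖ * ‖v ω‖ := fun m ω => by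
    rw [norm_mul, norm_mul, norm_ech, one_mul]
  have h := hasSum_integral_of_summable_integral_norm (E := ℂ) hi (by
    simp only [hn, integral_const_mul]
    exact hD.mul_right _)
  simp only [integral_const_mul] at h
  have e : ∫ ω, ech (dotP ω (intVec k)) * (dser D ω * v ω) ∂μ
      = ∫ ω, ∑' m, D m * (ech (dotP ω (intVec (k - m))) * v ω) ∂μ := by
    refine integral_congr_ae (ae_of_all _ fun ω => ?_)
    simp only
    rw [← mul_assoc, dser, ← tsum_mul_left, ← tsum_mul_right]
    refine tsum_congr fun m => ?_
    rw [intVec_sub, dotP_sub, sub_eq_add_neg, ech_add]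
    ring
  rw [e]
  exact h

lemma integral_cube_dser {D : (Fin d → ℤ) → ℂ} (hD : Summable fun k => ‖D k‖)
    (k : Fin d → ℤ) :
    ∫ ω in centeredCube d, ech (dotP ω (intVec k)) * dser D ω = D k := by
  have h := hasSum_cube_dser_mul hD (v := fun _ => 1)
    (integrableOn_const (by rw [volume_centeredCube]; exact ENNReal.one_ne_top)) k
  simp only [mul_one, integral_cube_ech] at h
  refine h.unique ?_
  convert hasSum_single k fun m hm => ?_ using 1
  · simp
  · rw [if_neg (sub_ne_zero.2 hm.symm), mul_zero]

lemma dser_ae_eq_of_coeff {v : (Fin d → ℝ) → ℂ} (hv : Measurable v) {M : ℝ}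
    (hM : ∀ ω, ‖v ω‖ ≤ M) {D : (Fin d → ℤ) → ℂ} (hD : Summable fun k => ‖D k‖)
    (h : ∀ k, D k = ∫ ω in centeredCube d, ech (dotP ω (intVec k)) * v ω) :
    ∀ᵐ ω ∂(volume.restrict (centeredCube d)), dser D ω = v ω := by
  have hfin : ∀ w : (Fin d → ℝ) → ℂ, Measurable w → (∀ ω, ‖w ω‖ ≤ M + ∑' k, ‖D k‖) → ∀ k,
      IntegrableOn (fun ω => ech (dotP ω (intVec k)) * w ω) (centeredCube d) := fun w hw hb k => by
    refine Measure.integrableOn_of_bounded (M := M + ∑' k, ‖D k‖)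
      (by rw [volume_centeredCube]; exact ENNReal.one_ne_top) ?_ (ae_of_all _ fun ω => ?_)
    · refine (Continuous.measurable ?_).aestronglyMeasurable.mul hw.aestronglyMeasurable
      unfold dotP; exact continuous_ech.comp (by fun_prop)
    · rw [norm_mul, norm_ech, one_mul]; exact hb ω
  have h0 : 0 ≤ ∑' k, ‖D k‖ := tsum_nonneg fun _ => norm_nonneg _
  have hM0 : 0 ≤ M := (norm_nonneg _).trans (hM 0)
  have key := ae_eq_zero_of_cube_coeff_eq_zero (v := fun ω => dser D ω - v ω)
    ((continuous_dser hD).measurable.sub hv) (M := (∑' k, ‖D k‖) + M)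
    (fun ω => (norm_sub_le _ _).trans (add_le_add (norm_dser_le hD ω) (hM ω))) fun k => by
      simp only [mul_sub]
      rw [integral_sub (hfin _ (continuous_dser hD).measurable
        (fun ω => (norm_dser_le hD ω).trans (by linarith)) k)
        (hfin v hv (fun ω => (hM ω).trans (by linarith)) k), integral_cube_dser hD, ← h k, sub_self]
  filter_upwards [key] with ω hω
  exact sub_eq_zero.1 hω

end CubeFourier

section Lattice

variable {d : ℕ}

lemma summable_one_add_abs_int : Summable fun m : ℤ => ((1 + |(m : ℝ)|) ^ 2)⁻¹ := by
  refine Summable.of_norm_bounded_eventually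
    ((Real.summable_one_div_int_pow (p := 2)).2 one_lt_two) ?_
  filter_upwards [(Set.finite_singleton (0 : ℤ)).compl_mem_cofinite] with m hm
  have hm : m ≠ 0 := hm
  have h1 : (0 : ℝ) < |(m : ℝ)| := by positivity
  rw [norm_inv, Real.norm_of_nonneg (by positivity), one_div, ← sq_abs (m : ℝ)]
  gcongr
  linarith

lemma summable_one_add_norm_intVec :
    Summable fun k : Fin d → ℤ => ((1 + ‖intVec k‖) ^ (2 * d))⁻¹ := by
  set u : ℤ → ℝ := fun m => ((1 + |(m : ℝ)|) ^ 2)⁻¹ with hu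
  have hu0 : ∀ m, 0 ≤ u m := fun m => by positivity
  refine summable_of_sum_le (c := ∏ _i : Fin d, ∑' m, u m) (fun k => by positivity) fun s => ?_
  classical
  have h1 : ∀ k : Fin d → ℤ, ((1 + ‖intVec k‖) ^ (2 * d))⁻¹ ≤ ∏ i, u (k i) := fun k => by
    simp only [hu, Finset.prod_inv_distrib]
    have h2 : ∏ i, (1 + |(k i : ℝ)|) ^ 2 ≤ ∏ _i : Fin d, (1 + ‖intVec k‖) ^ 2 := by
      refine Finset.prod_le_prod (fun i _ => by positivity) fun i _ => ?_
      gcongr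
      exact norm_le_pi_norm (intVec k) i
    rw [Finset.prod_const, Finset.card_univ, Fintype.card_fin, ← pow_mul] at h2
    exact inv_anti₀ (Finset.prod_pos fun i _ => by positivity) h2
  refine (Finset.sum_le_sum fun k _ => h1 k).trans ?_
  have h3 : s ⊆ Fintype.piFinset fun i => s.image fun k => k i := fun k hk =>
    Fintype.mem_piFinset.2 fun i => Finset.mem_image_of_mem _ hk
  refine (Finset.sum_le_sum_of_subset_of_nonneg h3
    fun k _ _ => Finset.prod_nonneg fun i _ => hu0 _).trans ?_
  rw [← Finset.prod_univ_sum (fun i => s.image fun k => k i) fun _ m => u m]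
  exact Finset.prod_le_prod (fun i _ => Finset.sum_nonneg fun m _ => hu0 m)
    fun i _ => summable_one_add_abs_int.sum_le_tsum _ fun m _ => hu0 m

lemma exists_norm_mulVec_le (b : Matrix (Fin d) (Fin d) ℝ) :
    ∃ B : ℝ, 0 ≤ B ∧ ∀ x : Fin d → ℝ, ‖b *ᵥ x‖ ≤ B * ‖x‖ :=
  ⟨‖(Matrix.toLin' b).toContinuousLinearMap‖, norm_nonneg _,
    (Matrix.toLin' b).toContinuousLinearMap.le_opNorm⟩

lemma exists_lattice_sum_le {b : Matrix (Fin d) (Fin d) ℝ} (hb : b.det ≠ 0) :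
    ∃ C : ℝ, 0 ≤ C ∧ ∀ y : Fin d → ℝ,
      Summable (fun k : Fin d → ℤ => ((1 + ‖b *ᵥ intVec k - y‖) ^ (2 * d))⁻¹) ∧
      ∑' k : Fin d → ℤ, ((1 + ‖b *ᵥ intVec k - y‖) ^ (2 * d))⁻¹ ≤ C := by
  obtain ⟨B, hB0, hB⟩ := exists_norm_mulVec_le b⁻¹
  have hbu : IsUnit b.det := isUnit_iff_ne_zero.2 hb
  set S := ∑' k : Fin d → ℤ, ((1 + ‖intVec k‖) ^ (2 * d))⁻¹ with hS
  refine ⟨(2 + B) ^ (2 * d) * S, mul_nonneg (by positivity)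
    (tsum_nonneg fun k => by positivity), fun y => ?_⟩
  set t := b⁻¹ *ᵥ y with ht
  set m : Fin d → ℤ := fun i => ⌊t i⌋ with hm
  have htm : ‖t - intVec m‖ ≤ 1 := (pi_norm_le_iff_of_nonneg zero_le_one).2 fun i => by
    have h1 := Int.floor_le (t i)
    have h2 := Int.lt_floor_add_one (t i)
    rw [Real.norm_eq_abs, abs_le, Pi.sub_apply]
    constructor <;> simp only [intVec, hm] <;> linarith
  have hle : ∀ k : Fin d → ℤ, ((1 + ‖b *ᵥ intVec k - y‖) ^ (2 * d))⁻¹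
      ≤ (2 + B) ^ (2 * d) * ((1 + ‖intVec (k - m)‖) ^ (2 * d))⁻¹ := fun k => by
    have e : intVec (k - m) = b⁻¹ *ᵥ (b *ᵥ intVec k - y) + (t - intVec m) := by
      rw [mulVec_sub, mulVec_mulVec, nonsing_inv_mul b hbu, one_mulVec, intVec_sub]
      abel
    have h1 : 1 + ‖intVec (k - m)‖ ≤ (2 + B) * (1 + ‖b *ᵥ intVec k - y‖) := by
      have h2 := norm_add_le (b⁻¹ *ᵥ (b *ᵥ intVec k - y)) (t - intVec m)
      rw [← e] at h2
      have h3 := hB (b *ᵥ intVec k - y)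
      nlinarith [norm_nonneg (b *ᵥ intVec k - y)]
    rw [← div_eq_mul_inv, inv_eq_one_div, div_le_div_iff₀ (by positivity) (by positivity), one_mul,
      ← mul_pow]
    gcongr
  have hs : Summable fun k : Fin d → ℤ =>
      (2 + B) ^ (2 * d) * ((1 + ‖intVec (k - m)‖) ^ (2 * d))⁻¹ :=
    ((Equiv.subRight m).summable_iff.2 summable_one_add_norm_intVec).mul_left _
  have hs2 := Summable.of_nonneg_of_le (fun k => by positivity) hle hs
  refine ⟨hs2, (hs2.tsum_le_tsum hle hs).trans ?_⟩
  rw [tsum_mul_left]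
  exact mul_le_mul_of_nonneg_left
    ((Equiv.subRight m).tsum_eq fun k : Fin d → ℤ => ((1 + ‖intVec k‖) ^ (2 * d))⁻¹).le
    (by positivity)

lemma zetaFn_apply (b : Matrix (Fin d) (Fin d) ℝ) (ν : (Fin d → ℝ) → ℝ) (ω : Fin d → ℝ)
    (i : Fin d) : zetaFn b ν ω i = mult i (ω ᵥ* b⁻¹) * (ν ω : ℂ) := rfl

lemma continuous_vecMul_const (b : Matrix (Fin d) (Fin d) ℝ) :
    Continuous fun ω : Fin d → ℝ => ω ᵥ* b := by
  have : (fun ω : Fin d → ℝ => ω ᵥ* b) = fun ω => bᵀ *ᵥ ω := by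
    ext ω; rw [mulVec_transpose]
  rw [this]
  exact (Matrix.toLin' bᵀ).continuous_of_finiteDimensional

lemma IsCutoff.exists_bound {ν : (Fin d → ℝ) → ℝ} (hν : IsCutoff d ν) :
    ∃ M : ℝ, ∀ ω, ‖ν ω‖ ≤ M := by
  refine (hν.smooth.continuous).bounded_above_of_compact_support ?_
  refine HasCompactSupport.of_support_subset_isCompact
    (isCompact_univ_pi fun _ : Fin d => isCompact_Icc (a := (-(1/2) : ℝ)) (b := 1/2)) ?_
  exact (subset_tsupport _).trans (hν.supp.trans (pi_mono fun _ _ => Ioo_subset_Icc_self))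

lemma measurable_zetaFn (b : Matrix (Fin d) (Fin d) ℝ) {ν : (Fin d → ℝ) → ℝ} (hν : IsCutoff d ν)
    (i : Fin d) : Measurable fun ω => zetaFn b ν ω i := by
  simp only [zetaFn_apply]
  exact ((measurable_mult i).comp (continuous_vecMul_const b⁻¹).measurable).mul
    (Complex.measurable_ofReal.comp hν.smooth.continuous.measurable)

lemma norm_zetaFn_le (b : Matrix (Fin d) (Fin d) ℝ) {ν : (Fin d → ℝ) → ℝ} {M : ℝ}
    (hM : ∀ ω, ‖ν ω‖ ≤ M) (i : Fin d) (ω : Fin d → ℝ) : ‖zetaFn b ν ω i‖ ≤ M := by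
  rw [zetaFn_apply, norm_mul, Complex.norm_real]
  exact (mul_le_of_le_one_left (norm_nonneg _) (norm_mult_le _ _)).trans (hM ω)

lemma integrableOn_zetaFn (b : Matrix (Fin d) (Fin d) ℝ) {ν : (Fin d → ℝ) → ℝ} (hν : IsCutoff d ν)
    (i : Fin d) : IntegrableOn (fun ω => zetaFn b ν ω i) (centeredCube d) := by
  obtain ⟨M, hM⟩ := hν.exists_bound
  exact Measure.integrableOn_of_bounded (M := M)
    (by rw [volume_centeredCube]; exact ENNReal.one_ne_top)
    (measurable_zetaFn b hν i).aestronglyMeasurable (ae_of_all _ fun ω => norm_zetaFn_le b hM i ω)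

lemma zKernel_apply (b : Matrix (Fin d) (Fin d) ℝ) {ν : (Fin d → ℝ) → ℝ} (hν : IsCutoff d ν)
    (k : Fin d → ℤ) (i : Fin d) :
    zKernel b ν k i = ∫ ω in centeredCube d, ech (dotP ω (intVec k)) * zetaFn b ν ω i := by
  refine eval_integral (fun j => ?_) i
  refine Integrable.bdd_mul (c := 1) (integrableOn_zetaFn b hν j)
    (Continuous.aestronglyMeasurable ?_) (ae_of_all _ fun ω => (norm_ech (dotP ω (intVec k))).le)
  fun_prop

lemma dConv_eq_integral {b : Matrix (Fin d) (Fin d) ℝ} {ν : (Fin d → ℝ) → ℝ} (hν : IsCutoff d ν)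
    {s : (Fin d → ℤ) → ℂ} (hs : Summable fun k => ‖s k‖) (k : Fin d → ℤ) (i : Fin d) :
    dConv s (zKernel b ν) k i = ∫ ω in centeredCube d,
      ech (dotP ω (intVec k)) * (dser s ω * zetaFn b ν ω i) := by
  have h : ∀ i, HasSum (fun l => (s (k - l) • zKernel b ν l) i) (∫ ω in centeredCube d,
      ech (dotP ω (intVec k)) * (dser s ω * zetaFn b ν ω i)) := fun i => by
    have h1 := hasSum_cube_dser_mul hs (integrableOn_zetaFn b hν i) k
    rw [← (Equiv.subLeft k).hasSum_iff] at h1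
    convert h1 using 2 with l
    simp only [Function.comp, Equiv.subLeft_apply, sub_sub_cancel, Pi.smul_apply, smul_eq_mul,
      zKernel_apply b hν]
  rw [dConv, tsum_apply (Pi.summable.2 fun i => (h i).summable), (h i).tsum_eq]

lemma h1Norm_ne_top {b : Matrix (Fin d) (Fin d) ℝ} {ν : (Fin d → ℝ) → ℝ} {s : (Fin d → ℤ) → ℂ}
    (h : h1Norm b ν s ≠ ⊤) :
    (Summable fun k => ‖s k‖) ∧ (Summable fun k => ‖dConv s (zKernel b ν) k‖) ∧
      h1Norm b ν s = ENNReal.ofReal ((∑' k, ‖s k‖) + ∑' k, ‖dConv s (zKernel b ν) k‖) := by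
  rw [h1Norm, ENNReal.add_ne_top] at h
  have h1 := ENNReal.tsum_coe_ne_top_iff_summable.1 h.1
  have h2 := ENNReal.tsum_coe_ne_top_iff_summable.1 h.2
  refine ⟨NNReal.summable_coe.2 h1, NNReal.summable_coe.2 h2, ?_⟩
  rw [ENNReal.ofReal_add (tsum_nonneg fun _ => norm_nonneg _) (tsum_nonneg fun _ => norm_nonneg _),
    h1Norm, ← ENNReal.coe_tsum h1, ← ENNReal.coe_tsum h2]
  simp only [← coe_nnnorm, ← NNReal.coe_tsum, ENNReal.ofReal_coe_nnreal]

lemma h1Norm_eq {b : Matrix (Fin d) (Fin d) ℝ} {ν : (Fin d → ℝ) → ℝ} {s : (Fin d → ℤ) → ℂ}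
    (h1 : Summable fun k => ‖s k‖) (h2 : Summable fun k => ‖dConv s (zKernel b ν) k‖) :
    h1Norm b ν s = ENNReal.ofReal ((∑' k, ‖s k‖) + ∑' k, ‖dConv s (zKernel b ν) k‖) := by
  refine (h1Norm_ne_top ?_).2.2
  rw [h1Norm, ENNReal.add_ne_top]
  exact ⟨ENNReal.tsum_coe_ne_top_iff_summable.2 (NNReal.summable_coe.1 h1),
    ENNReal.tsum_coe_ne_top_iff_summable.2 (NNReal.summable_coe.1 h2)⟩

/-- The vector of the coefficients and their discrete Riesz transforms. -/
def coefE (b : Matrix (Fin d) (Fin d) ℝ) (ν : (Fin d → ℝ) → ℝ) (s : (Fin d → ℤ) → ℂ)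
    (k : Fin d → ℤ) : EC d :=
  WithLp.toLp 2 fun o => o.elim (s k) (dConv s (zKernel b ν) k)

lemma norm_coefE_le (b : Matrix (Fin d) (Fin d) ℝ) (ν : (Fin d → ℝ) → ℝ) (s : (Fin d → ℤ) → ℂ)
    (k : Fin d → ℤ) : ‖coefE b ν s k‖ ≤ ‖s k‖ + d * ‖dConv s (zKernel b ν) k‖ :=
  EC.norm_le (coefE b ν s k)

lemma dser_dConv_ae {b : Matrix (Fin d) (Fin d) ℝ} {ν : (Fin d → ℝ) → ℝ} (hν : IsCutoff d ν)
    {s : (Fin d → ℤ) → ℂ} (h1 : Summable fun k => ‖s k‖)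
    (h2 : Summable fun k => ‖dConv s (zKernel b ν) k‖) (i : Fin d) :
    ∀ᵐ ω ∂(volume.restrict (centeredCube d)),
      dser (fun k => dConv s (zKernel b ν) k i) ω = dser s ω * zetaFn b ν ω i := by
  obtain ⟨M, hM⟩ := hν.exists_bound
  refine dser_ae_eq_of_coeff (M := (∑' k, ‖s k‖) * M)
    ((continuous_dser h1).measurable.mul (measurable_zetaFn b hν i)) (fun ω => ?_)
    (h2.of_nonneg_of_le (fun k => norm_nonneg _) fun k => norm_le_pi_norm _ i)
    fun k => dConv_eq_integral hν h1 k i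
  rw [Pi.mul_apply, norm_mul]
  exact mul_le_mul (norm_dser_le h1 ω) (norm_zetaFn_le b hM i ω) (norm_nonneg _)
    (tsum_nonneg fun _ => norm_nonneg _)

lemma quasiMeasurePreserving_vecMul {b : Matrix (Fin d) (Fin d) ℝ} (hb : b.det ≠ 0) :
    Measure.QuasiMeasurePreserving (fun ω : Fin d → ℝ => ω ᵥ* b) :=
  ⟨(continuous_vecMul_const b).measurable, by
    have : (fun ω : Fin d → ℝ => ω ᵥ* b) = Matrix.toLin' bᵀ := by
      ext ω; rw [Matrix.toLin'_apply, mulVec_transpose]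
    rw [this, Real.map_matrix_volume_pi_eq_smul_volume_pi (by rwa [det_transpose])]
    exact Measure.smul_absolutelyContinuous⟩

lemma exists_bump {b : Matrix (Fin d) (Fin d) ℝ} {ν : (Fin d → ℝ) → ℝ}
    (hν : IsCutoff d ν) :
    ∃ χ : (Fin d → ℝ) → ℂ, Continuous χ ∧ HasCompactSupport χ ∧ χ 0 = 1 ∧
      (∀ ξ, χ ξ ≠ 0 → ξ ᵥ* b ∈ centeredCube d ∧ ν (ξ ᵥ* b) = 1) ∧
      ∀ N : ℕ, ∃ C : ℝ, 0 ≤ C ∧ ∀ x, ‖ftInv χ x‖ ≤ C * ((1 + ‖x‖) ^ N)⁻¹ := by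
  have hs : {ξ : EuclideanSpace ℝ (Fin d) | (WithLp.ofLp ξ) ᵥ* b ∈ centeredCube d ∧
      ν (WithLp.ofLp ξ ᵥ* b) = 1} ∈ 𝓝 0 := by
    have h1 : Tendsto (fun ξ : EuclideanSpace ℝ (Fin d) => (WithLp.ofLp ξ) ᵥ* b) (𝓝 0) (𝓝 0) := by
      have := ((continuous_vecMul_const b).comp
        (PiLp.continuous_ofLp 2 fun _ : Fin d => ℝ)).tendsto 0
      simpa [Function.comp_def] using this
    have h2 : centeredCube d ∈ 𝓝 (0 : Fin d → ℝ) :=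
      (isOpen_set_pi finite_univ fun _ _ => isOpen_Ioo).mem_nhds fun i _ => by
        simp
    exact h1.eventually ((eventually_mem_set.2 h2).and hν.one_near_zero)
  obtain ⟨f, hf1, hf2, hf3, -, hf4⟩ := exists_contDiff_tsupport_subset (n := ⊤) hs
  set g : EuclideanSpace ℝ (Fin d) → ℂ := fun v => (f v : ℂ) with hg
  have hg2 : HasCompactSupport g := hf2.comp_left (g := fun t : ℝ => (t : ℂ)) Complex.ofReal_zero
  have hg3 : ContDiff ℝ ((⊤ : ℕ∞) : WithTop ℕ∞) g := Complex.ofRealCLM.contDiff.comp hf3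
  set Φ := FourierTransform.fourierInv (hg2.toSchwartzMap hg3) with hΦ
  refine ⟨fun ξ => (f (WithLp.toLp 2 ξ) : ℂ), ?_, ?_, ?_, fun ξ hξ => ?_, fun N => ?_⟩
  · exact Complex.continuous_ofReal.comp (hf3.continuous.comp (PiLp.continuous_toLp 2 _))
  · exact hg2.comp_homeomorph (EuclideanSpace.equiv (Fin d) ℝ).symm.toHomeomorph
  · simp [hf4]
  · exact hf1 (subset_tsupport f (by simpa using hξ) : WithLp.toLp 2 ξ ∈ tsupport f)
  · have h := fun x => SchwartzMap.one_add_le_sup_seminorm_apply (𝕜 := ℝ) (m := (N, 0))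
      (le_refl N) (le_refl 0) Φ x
    set C := 2 ^ (N, 0).1 * (Finset.Iic (N, 0)).sup
      (fun m : ℕ × ℕ => SchwartzMap.seminorm ℝ m.1 m.2) Φ with hC
    have hC0 : 0 ≤ C := mul_nonneg (by positivity) (apply_nonneg _ _)
    refine ⟨C, hC0, fun x => ?_⟩
    have h1 := h (WithLp.toLp 2 x)
    rw [norm_iteratedFDeriv_zero] at h1
    have h2 : ftInv (fun ξ => (f (WithLp.toLp 2 ξ) : ℂ)) x = Φ (WithLp.toLp 2 x) := by
      rw [ftInv_eq_fourierInv, hΦ, SchwartzMap.fourierInv_coe]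
      rfl
    rw [h2, ← div_eq_mul_inv, le_div_iff₀ (by positivity), mul_comm]
    refine (mul_le_mul_of_nonneg_right ?_ (norm_nonneg _)).trans h1
    gcongr
    rw [← eucNorm_eq_norm]
    exact norm_le_eucNorm x

end Lattice

section Increments

variable {d : ℕ}

lemma Rz.of_ae {F : LE d} (h : ∀ᵐ ξ, ∀ i, vft ξ F (some i) = mult i ξ * vft ξ F none) : Rz F := by
  intro ξ hξ i
  have hd : Dense {ξ : Fin d → ℝ | vft ξ F (some i) = mult i ξ * vft ξ F none} :=
    Measure.dense_of_ae (h.mono fun ξ hξ => hξ i)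
  have hc : ∀ o, Continuous fun ξ => vft ξ F o := fun o =>
    (EuclideanSpace.proj o : EC d →L[ℂ] ℂ).continuous.comp (continuous_vft F)
  by_contra hne
  have hco : ContinuousOn (fun ξ => (vft ξ F (some i) : ℂ) - mult i ξ * vft ξ F none)
      {(0 : Fin d → ℝ)}ᶜ :=
    ContinuousOn.sub (G := ℂ) (hc _).continuousOn
      ((continuousOn_mult i).mul (hc none).continuousOn)
  have ho := hco.isOpen_inter_preimage isOpen_compl_singleton
    (isOpen_compl_singleton (x := (0 : ℂ)))
  obtain ⟨ζ, h1, h2⟩ := hd.inter_open_nonempty _ ho ⟨ξ, hξ, fun h => hne (sub_eq_zero.1 h)⟩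
  exact h1.2 (sub_eq_zero.2 h2)

lemma Rz.integral {X : Type*} [MeasurableSpace X] {μ : Measure X} {G : X → LE d}
    (hG : Integrable G μ) (h : ∀ x, Rz (G x)) : Rz (∫ x, G x ∂μ) := by
  intro ξ hξ i
  have e : ∀ o, vft ξ (∫ x, G x ∂μ) o = ∫ x, vft ξ (G x) o ∂μ := fun o =>
    (((EuclideanSpace.proj o : EC d →L[ℂ] ℂ).comp (vft ξ)).integral_comp_comm hG).symm
  rw [e, e, ← integral_const_mul]
  simp only [fun x => h x ξ hξ i]

lemma IsLift.trL {F : LE d} {f : (Fin d → ℝ) → ℂ} (h : IsLift F f) (y : Fin d → ℝ) :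
    IsLift (trL y F) fun x => f (x - y) :=
  ⟨h.1.trL y, by
    have h1 := (measurePreserving_sub_right volume y).quasiMeasurePreserving.ae_eq_comp h.2
    filter_upwards [h1, trL_apply_ae y F none] with x hx1 hx2
    rw [hx2]; exact hx1⟩

lemma IsLift.add {F G : LE d} {f g : (Fin d → ℝ) → ℂ} (hF : IsLift F f) (hG : IsLift G g) :
    IsLift (F + G) fun x => f x + g x :=
  ⟨hF.1.add hG.1, by
    filter_upwards [hF.2, hG.2, Lp.coeFn_add F G] with x h1 h2 h3
    rw [h3, Pi.add_apply, PiLp.add_apply, h1, h2]⟩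

lemma IsLift.congr {F : LE d} {f g : (Fin d → ℝ) → ℂ} (h : IsLift F f) (hfg : f =ᵐ[volume] g) :
    IsLift F g := ⟨h.1, hfg.symm.trans h.2⟩

lemma IsLift.unique {F G : LE d} {f : (Fin d → ℝ) → ℂ} (hF : IsLift F f) (hG : IsLift G f) :
    F = G := hF.1.ext hG.1 (hF.2.symm.trans hG.2)

lemma IsLift.vft_none {F : LE d} {f : (Fin d → ℝ) → ℂ} (h : IsLift F f) (ξ : Fin d → ℝ) :
    vft ξ F none = ft f ξ := by
  rw [vft_apply, ft_congr_ae h.2]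

lemma integrable_inv_one_add_norm_pow {N : ℕ} (hN : d < N) :
    Integrable fun x : Fin d → ℝ => ((1 + ‖x‖) ^ N)⁻¹ := by
  have h := integrable_one_add_norm (E := Fin d → ℝ) (μ := volume) (r := N)
    (by simpa using hN)
  refine h.congr (Eventually.of_forall fun x => ?_)
  simp only [Real.rpow_neg (by positivity : (0 : ℝ) ≤ 1 + ‖x‖), Real.rpow_natCast]

/-- `‖ψ - ψ(·-y)‖_{H¹} → 0` as `y → 0`. -/
def HasContIncr (ψ : (Fin d → ℝ) → ℂ) : Prop :=
  ∀ ε : ℝ, 0 < ε → ∃ δ : ℝ, 0 < δ ∧ ∀ y : Fin d → ℝ, eucNorm y < δ →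
    ∃ g : (Fin d → ℝ) → Fin d → ℂ, Integrable g volume ∧
      HasRiesz (fun x => ψ x - ψ (x - y)) g ∧
      (∫ x : Fin d → ℝ, ‖ψ x - ψ (x - y)‖) + (∫ x : Fin d → ℝ, ‖g x‖) < ε

variable {ψ : (Fin d → ℝ) → ℂ}

lemma HasContIncr.exists_isLift (hψ : Integrable ψ) (h : HasContIncr ψ) {ε : ℝ} (hε : 0 < ε) :
    ∃ δ : ℝ, 0 < δ ∧ ∀ y : Fin d → ℝ, ‖y‖ < δ →
      ∃ F : LE d, IsLift F (fun x => ψ x - ψ (x - y)) ∧ ‖F‖ ≤ ε := by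
  obtain ⟨δ, hδ, H⟩ := h (ε / (d + 1)) (by positivity)
  refine ⟨δ / (d + 1), by positivity, fun y hy => ?_⟩
  have hy' : eucNorm y < δ := (eucNorm_le_norm y).trans_lt (by
    rw [lt_div_iff₀ (by positivity)] at hy; linarith)
  obtain ⟨g, hg1, hg2, hg3⟩ := H y hy'
  obtain ⟨F, hF, hFg⟩ := exists_isLift_of_hasRiesz (hψ.sub (hψ.comp_sub_right y)) hg1 hg2
  refine ⟨F, hF, ?_⟩
  have h1 := hF.norm_le
  rw [hF.hardyNorm_eq] at h1
  have e1 : ∫ x, ‖F x none‖ = ∫ x, ‖ψ x - ψ (x - y)‖ :=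
    integral_congr_ae (hF.2.symm.fun_comp norm)
  have hFg' : (fun x (i : Fin d) => F x (some i)) =ᵐ[volume] g := by
    filter_upwards [ae_all_iff.2 hFg] with x hx
    exact funext hx
  have e2 : ∫ x, ‖fun i => F x (some i)‖ = ∫ x, ‖g x‖ :=
    integral_congr_ae (hFg'.fun_comp norm)
  rw [e1, e2, ← ENNReal.ofReal_add (integral_nonneg fun _ => norm_nonneg _)
    (integral_nonneg fun _ => norm_nonneg _),
    show ((d : ℝ≥0∞) + 1) = ENNReal.ofReal (d + 1) by
      rw [ENNReal.ofReal_add (by positivity) (by positivity)]; simp,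
    ← ENNReal.ofReal_mul (by positivity)] at h1
  have h2 := (ENNReal.ofReal_le_ofReal_iff (mul_nonneg (by positivity)
    (add_nonneg (integral_nonneg fun _ => norm_nonneg _)
    (integral_nonneg fun _ => norm_nonneg _)))).1 h1
  rw [lt_div_iff₀ (by positivity)] at hg3
  linarith

lemma exists_isLift_nsmul {y : Fin d → ℝ} {F : LE d} {ε : ℝ}
    (hF : IsLift F (fun x => ψ x - ψ (x - y))) (hε : ‖F‖ ≤ ε) (n : ℕ) :
    ∃ G : LE d, IsLift G (fun x => ψ x - ψ (x - (n : ℝ) • y)) ∧ ‖G‖ ≤ n * ε := by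
  induction n with
  | zero =>
    refine ⟨0, ⟨Rz.zero, ?_⟩, by simp⟩
    filter_upwards [Lp.coeFn_zero (EC d) 1 (volume : Measure (Fin d → ℝ))] with x hx
    rw [hx]; simp
  | succ n ih =>
    obtain ⟨G, hG1, hG2⟩ := ih
    refine ⟨G + trL ((n : ℝ) • y) F, ?_, ?_⟩
    · have := hG1.add (hF.trL ((n : ℝ) • y))
      convert this using 2 with x
      rw [sub_sub x, Nat.cast_succ, add_smul, one_smul]; ring
    · refine (norm_add_le _ _).trans ?_
      rw [LinearIsometry.norm_map]
      push_cast; linarith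

/-- The lifts of the increments of `ψ`. -/
lemma exists_increments (hψ : Integrable ψ) (h : HasContIncr ψ) :
    ∃ D : (Fin d → ℝ) → LE d, (∀ y, IsLift (D y) fun x => ψ x - ψ (x - y)) ∧ Continuous D ∧
      ∃ C : ℝ, 0 ≤ C ∧ ∀ y, ‖D y‖ ≤ C * (1 + ‖y‖) := by
  obtain ⟨δ, hδ, H⟩ := h.exists_isLift hψ one_pos
  have h1 : ∀ y : Fin d → ℝ, ∃ G : LE d, IsLift G (fun x => ψ x - ψ (x - y)) ∧
      ‖G‖ ≤ (1 + δ⁻¹) * (1 + ‖y‖) := fun y => by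
    set n := ⌊δ⁻¹ * ‖y‖⌋₊ + 1 with hn
    have hn0 : (0 : ℝ) < n := by rw [hn]; positivity
    have hlt : δ⁻¹ * ‖y‖ < n := by rw [hn]; exact_mod_cast Nat.lt_floor_add_one (δ⁻¹ * ‖y‖)
    have hle : (n : ℝ) ≤ δ⁻¹ * ‖y‖ + 1 := by
      rw [hn]; push_cast; linarith [Nat.floor_le (show 0 ≤ δ⁻¹ * ‖y‖ by positivity)]
    obtain ⟨F, hF1, hF2⟩ := H ((n : ℝ)⁻¹ • y) (by
      rw [norm_smul, norm_inv, Real.norm_of_nonneg hn0.le, inv_mul_lt_iff₀ hn0]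
      rwa [inv_mul_lt_iff₀ hδ, mul_comm] at hlt)
    obtain ⟨G, hG1, hG2⟩ := exists_isLift_nsmul hF1 hF2 n
    rw [smul_inv_smul₀ hn0.ne'] at hG1
    refine ⟨G, hG1, hG2.trans ?_⟩
    have : 0 ≤ δ⁻¹ := by positivity
    nlinarith [norm_nonneg y]
  choose D hD1 hD2 using h1
  refine ⟨D, hD1, ?_, 1 + δ⁻¹, by positivity, hD2⟩
  have hadd : ∀ y z, D (y + z) = D y + trL y (D z) := fun y z => by
    refine (hD1 (y + z)).unique ?_
    convert (hD1 y).add ((hD1 z).trL y) using 2 with x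
    rw [sub_sub x]; ring
  refine Metric.continuous_iff.2 fun y ε hε => ?_
  obtain ⟨δ', hδ', H'⟩ := h.exists_isLift hψ (half_pos hε)
  refine ⟨δ', hδ', fun z hz => ?_⟩
  rw [dist_eq_norm] at hz ⊢
  obtain ⟨F, hF1, hF2⟩ := H' _ hz
  have : D z = D y + trL y (D (z - y)) := by rw [← hadd]; congr 1; abel
  rw [this, add_sub_cancel_left, LinearIsometry.norm_map, (hD1 _).unique hF1]
  linarith

/-- The remainder `ψ - ψ * η`, lifted. -/
lemma exists_remainder (hψ : Integrable ψ) (h : HasContIncr ψ) {χ : (Fin d → ℝ) → ℂ}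
    (hχc : Continuous χ) (hχi : Integrable χ) (hχ0 : χ 0 = 1)
    (hη : ∀ N : ℕ, ∃ C : ℝ, 0 ≤ C ∧ ∀ x, ‖ftInv χ x‖ ≤ C * ((1 + ‖x‖) ^ N)⁻¹) :
    ∃ H : LE d, Rz H ∧ (∀ ξ, vft ξ H none = ft ψ ξ * (1 - χ ξ)) ∧ vft 0 H = 0 := by
  obtain ⟨D, hD1, hDc, A, hA, hD2⟩ := exists_increments hψ h
  obtain ⟨C, hC, hηC⟩ := hη (d + 2)
  have hηc : Continuous (ftInv χ) := continuous_ftInv hχi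
  have hηi : Integrable (ftInv χ) :=
    ((integrable_inv_one_add_norm_pow (by omega)).const_mul C).mono' hηc.aestronglyMeasurable
      (Eventually.of_forall hηC)
  have hi : Integrable fun y => ftInv χ y • D y := by
    refine ((integrable_inv_one_add_norm_pow (N := d + 1) (by omega)).const_mul (C * A)).mono'
      (hηc.smul hDc).aestronglyMeasurable (Eventually.of_forall fun y => ?_)
    rw [norm_smul]
    refine (mul_le_mul (hηC y) (hD2 y) (norm_nonneg _) (by positivity)).trans (le_of_eq ?_)
    have : (1 + ‖y‖) ≠ 0 := by positivity
    rw [pow_succ]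
    field_simp
  have hft : ∀ ξ, ∫ y, ech (-dotP ξ y) * ftInv χ y = χ ξ := fun ξ => by
    rw [← ft_eq, ft_ftInv hχc hχi hηi]
  have hη1 : ∫ y, ftInv χ y = 1 := by
    have := hft 0
    simpa only [zero_dotP, neg_zero, ech_zero, one_mul, hχ0] using this
  have hnone : ∀ ξ, vft ξ (∫ y, ftInv χ y • D y) none = ft ψ ξ * (1 - χ ξ) := fun ξ => by
    have e : vft ξ (∫ y, ftInv χ y • D y) none = ∫ y, vft ξ (ftInv χ y • D y) none :=
      (((EuclideanSpace.proj none : EC d →L[ℂ] ℂ).comp (vft ξ)).integral_comp_comm hi).symm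
    have e2 : ∀ y, vft ξ (ftInv χ y • D y) none =
        ft ψ ξ * (ftInv χ y - ech (-dotP ξ y) * ftInv χ y) := fun y => by
      rw [map_smul, PiLp.smul_apply, (hD1 y).vft_none, ft_sub hψ (hψ.comp_sub_right y),
        ft_translate, smul_eq_mul]
      ring
    rw [e]
    simp only [e2]
    rw [integral_const_mul, integral_sub hηi (integrable_ech_neg_mul hηi ξ), hη1, hft]
  have hR : Rz (∫ y, ftInv χ y • D y) := Rz.integral hi fun y => (hD1 y).1.smul _
  refine ⟨_, hR, hnone, ?_⟩
  set H := ∫ y, ftInv χ y • D y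
  have hc : ∀ o, Continuous fun ξ => vft ξ H o := fun o =>
    (EuclideanSpace.proj o : EC d →L[ℂ] ℂ).continuous.comp (continuous_vft H)
  have h0 : vft 0 H none = 0 := by rw [hnone, hχ0, sub_self, mul_zero]
  ext o
  cases o with
  | none => exact h0
  | some i =>
    have : Nonempty (Fin d) := ⟨i⟩
    have t1 : Tendsto (fun ξ => vft ξ H (some i)) (𝓝[≠] 0) (𝓝 (vft 0 H (some i))) :=
      ((hc _).tendsto 0).mono_left nhdsWithin_le_nhds
    have t2 : Tendsto (fun ξ => vft ξ H none) (𝓝[≠] 0) (𝓝 0) := by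
      have := ((hc none).tendsto 0).mono_left (nhdsWithin_le_nhds (s := {0}ᶜ))
      rwa [h0] at this
    refine tendsto_nhds_unique t1 (squeeze_zero_norm' ?_ (tendsto_zero_iff_norm_tendsto_zero.1 t2))
    filter_upwards [self_mem_nhdsWithin] with ξ hξ
    rw [hR ξ hξ i, norm_mul]
    exact mul_le_of_le_one_left (norm_nonneg _) (norm_mult_le i ξ)

end Increments

section Synthesis

variable {d : ℕ}

lemma continuous_vft_apply (F : LE d) (o : Option (Fin d)) : Continuous fun ξ => vft ξ F o :=
  (EuclideanSpace.proj o : EC d →L[ℂ] ℂ).continuous.comp (continuous_vft F)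

/-- The sum over the lattice of the translates of a family. -/
def syn (b : Matrix (Fin d) (Fin d) ℝ) (G : (Fin d → ℤ) → LE d) : LE d :=
  ∑' k, trL (b *ᵥ intVec k) (G k)

variable {b : Matrix (Fin d) (Fin d) ℝ}

lemma summable_trL {G : (Fin d → ℤ) → LE d} (hG : Summable fun k => ‖G k‖) :
    Summable fun k => ‖trL (b *ᵥ intVec k) (G k)‖ := by
  simpa only [LinearIsometry.norm_map] using hG

lemma norm_syn_le {G : (Fin d → ℤ) → LE d} (hG : Summable fun k => ‖G k‖) :
    ‖syn b G‖ ≤ ∑' k, ‖G k‖ := by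
  refine (norm_tsum_le_tsum_norm (summable_trL hG)).trans (le_of_eq ?_)
  simp only [LinearIsometry.norm_map]

lemma vft_syn {G : (Fin d → ℤ) → LE d} (hG : Summable fun k => ‖G k‖) (ξ : Fin d → ℝ)
    (o : Option (Fin d)) :
    vft ξ (syn b G) o = ∑' k, ech (-dotP (ξ ᵥ* b) (intVec k)) * vft ξ (G k) o := by
  have h := ((EuclideanSpace.proj o : EC d →L[ℂ] ℂ).comp (vft ξ)).map_tsum
    (summable_trL (b := b) hG).of_norm
  refine h.trans (tsum_congr fun k => ?_)
  rw [← dotP_mulVec]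
  change vft ξ (trL (b *ᵥ intVec k) (G k)) o = _
  rw [vft_trL, PiLp.smul_apply, smul_eq_mul]

lemma syn_ae {G : (Fin d → ℤ) → LE d} (hG : Summable fun k => ‖G k‖) :
    ∀ᵐ x, ∀ o, HasSum (fun k => G k (x - b *ᵥ intVec k) o) (syn b G x o) := by
  have h1 : ∑' k, ‖trL (b *ᵥ intVec k) (G k)‖ₑ ≠ ⊤ := by
    have := (summable_trL (b := b) hG)
    simp only [enorm_eq_nnnorm]
    exact ENNReal.tsum_coe_ne_top_iff_summable.2 (NNReal.summable_coe.1 this)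
  filter_upwards [Lp.hasSum_coeFn_tsum h1, ae_all_iff.2 fun k => trL_ae (b *ᵥ intVec k) (G k)]
    with x hx hx2 o
  have h2 := (EuclideanSpace.proj o : EC d →L[ℂ] ℂ).hasSum hx
  have e : (fun k => G k (x - b *ᵥ intVec k) o) =
      fun k => trL (b *ᵥ intVec k) (G k) x o := funext fun k => by rw [hx2 k]
  rw [e]
  exact h2

lemma vft_syn_smul {s : (Fin d → ℤ) → ℂ} (hs : Summable fun k => ‖s k‖) (F : LE d)
    (ξ : Fin d → ℝ) (o : Option (Fin d)) :
    vft ξ (syn b fun k => s k • F) o = dser s (ξ ᵥ* b) * vft ξ F o := by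
  rw [vft_syn (by simpa only [norm_smul] using hs.mul_right ‖F‖), dser, ← tsum_mul_right]
  refine tsum_congr fun k => ?_
  rw [map_smul, PiLp.smul_apply, smul_eq_mul, mul_assoc]

/-- The vector valued function `x ↦ Φ x • v`. -/
def ten {Φ : (Fin d → ℝ) → ℂ} (hΦ : Integrable Φ) (v : EC d) : LE d := (hΦ.smul_const v).toL1 _

lemma ten_ae {Φ : (Fin d → ℝ) → ℂ} (hΦ : Integrable Φ) (v : EC d) :
    ten hΦ v =ᵐ[volume] fun x => Φ x • v := Integrable.coeFn_toL1 _

lemma norm_ten {Φ : (Fin d → ℝ) → ℂ} (hΦ : Integrable Φ) (v : EC d) :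
    ‖ten hΦ v‖ = (∫ x, ‖Φ x‖) * ‖v‖ := by
  have e : ∫ x, ‖ten hΦ v x‖ = ∫ x, ‖Φ x • v‖ := integral_congr_ae ((ten_ae hΦ v).fun_comp norm)
  rw [LE.norm_eq, e]
  simp only [norm_smul, integral_mul_const]

lemma vft_ten {Φ : (Fin d → ℝ) → ℂ} (hΦ : Integrable Φ) (v : EC d) (ξ : Fin d → ℝ) :
    vft ξ (ten hΦ v) = ft Φ ξ • v := by
  rw [vft_eq, ft_eq, ← integral_smul_const]
  refine integral_congr_ae ?_
  filter_upwards [ten_ae hΦ v] with x hx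
  rw [hx, smul_smul]

lemma summable_norm_ten {Φ : (Fin d → ℝ) → ℂ} (hΦ : Integrable Φ) {v : (Fin d → ℤ) → EC d}
    (hv : Summable fun k => ‖v k‖) : Summable fun k => ‖ten hΦ (v k)‖ := by
  simpa only [norm_ten] using hv.mul_left _

lemma vft_syn_ten {Φ : (Fin d → ℝ) → ℂ} (hΦ : Integrable Φ) {v : (Fin d → ℤ) → EC d}
    (hv : Summable fun k => ‖v k‖) (ξ : Fin d → ℝ) (o : Option (Fin d)) :
    vft ξ (syn b fun k => ten hΦ (v k)) o = ft Φ ξ * dser (fun k => v k o) (ξ ᵥ* b) := by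
  rw [vft_syn (summable_norm_ten hΦ hv), dser, ← tsum_mul_left]
  refine tsum_congr fun k => ?_
  rw [vft_ten, PiLp.smul_apply, smul_eq_mul]; ring

lemma LE.ae_eq_of_vft {F G : LE d} {o : Option (Fin d)} (h : ∀ ξ, vft ξ F o = vft ξ G o) :
    (fun x => F x o) =ᵐ[volume] fun x => G x o :=
  ae_eq_of_ft_eq (F.integrable_apply o) (G.integrable_apply o)
    (Eventually.of_forall fun ξ => by rw [← vft_apply, ← vft_apply, h])

/-- The discrete Riesz relation transported to the dual lattice. -/
lemma coefE_relation (hb : b.det ≠ 0) {ν : (Fin d → ℝ) → ℝ} (hν : IsCutoff d ν)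
    {χ : (Fin d → ℝ) → ℂ} (hχ : ∀ ξ, χ ξ ≠ 0 → ξ ᵥ* b ∈ centeredCube d ∧ ν (ξ ᵥ* b) = 1)
    {s : (Fin d → ℤ) → ℂ} (h1 : Summable fun k => ‖s k‖)
    (h2 : Summable fun k => ‖dConv s (zKernel b ν) k‖) :
    ∀ᵐ ξ, ∀ i, χ ξ * dser (fun k => coefE b ν s k (some i)) (ξ ᵥ* b) =
      mult i ξ * (χ ξ * dser (fun k => coefE b ν s k none) (ξ ᵥ* b)) := by
  refine ae_all_iff.2 fun i => ?_
  have h := (ae_restrict_iff' measurableSet_centeredCube).1 (dser_dConv_ae hν h1 h2 i)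
  filter_upwards [(quasiMeasurePreserving_vecMul hb).ae h] with ξ hξ
  by_cases h0 : χ ξ = 0
  · simp [h0]
  obtain ⟨h3, h4⟩ := hχ ξ h0
  have h5 := hξ h3
  rw [zetaFn_apply, h4, vecMul_vecMul, mul_nonsing_inv _ hb.isUnit, vecMul_one] at h5
  change χ ξ * dser (fun k => dConv s (zKernel b ν) k i) (ξ ᵥ* b) = mult i ξ * (χ ξ * dser s (ξ ᵥ* b))
  rw [h5, Complex.ofReal_one]; ring

lemma summable_norm_coefE {ν : (Fin d → ℝ) → ℝ} {s : (Fin d → ℤ) → ℂ}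
    (h1 : Summable fun k => ‖s k‖) (h2 : Summable fun k => ‖dConv s (zKernel b ν) k‖) :
    Summable fun k => ‖coefE b ν s k‖ :=
  (h1.add (h2.mul_left (d : ℝ))).of_nonneg_of_le (fun _ => norm_nonneg _)
    (norm_coefE_le b ν s)

lemma tsum_norm_coefE_le {ν : (Fin d → ℝ) → ℝ} {s : (Fin d → ℤ) → ℂ}
    (h1 : Summable fun k => ‖s k‖) (h2 : Summable fun k => ‖dConv s (zKernel b ν) k‖) :
    ∑' k, ‖coefE b ν s k‖ ≤ (∑' k, ‖s k‖) + d * ∑' k, ‖dConv s (zKernel b ν) k‖ := by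
  rw [← tsum_mul_left, ← h1.tsum_add (h2.mul_left (d : ℝ))]
  exact (summable_norm_coefE h1 h2).tsum_le_tsum (norm_coefE_le b ν s) (h1.add (h2.mul_left _))

/-- The lift of a synthesis sum at unit scale. -/
lemma isLift_synthesis (hb : b.det ≠ 0) {ν : (Fin d → ℝ) → ℝ} (hν : IsCutoff d ν)
    {χ η ψ : (Fin d → ℝ) → ℂ} (hη : Integrable η) (hψ : Integrable ψ) (hft : ∀ ξ, ft η ξ = χ ξ)
    (hχ : ∀ ξ, χ ξ ≠ 0 → ξ ᵥ* b ∈ centeredCube d ∧ ν (ξ ᵥ* b) = 1)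
    {H : LE d} (hH : Rz H) (hHn : ∀ ξ, vft ξ H none = ft ψ ξ * (1 - χ ξ))
    {s : (Fin d → ℤ) → ℂ} (h1 : Summable fun k => ‖s k‖)
    (h2 : Summable fun k => ‖dConv s (zKernel b ν) k‖) :
    IsLift (syn b (fun k => s k • H) + cv ψ (syn b fun k => ten hη (coefE b ν s k)))
      fun x => ∑' k, s k * ψ (x - b *ᵥ intVec k) := by
  have hC := summable_norm_coefE h1 h2
  have hR1 : Rz (syn b fun k => s k • H) := fun ξ hξ i => by
    rw [vft_syn_smul h1, vft_syn_smul h1, hH ξ hξ]; ring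
  have hR2 : Rz (syn b fun k => ten hη (coefE b ν s k)) := Rz.of_ae (by
    filter_upwards [coefE_relation hb hν hχ h1 h2] with ξ hξ i
    rw [vft_syn_ten hη hC, vft_syn_ten hη hC, hft, hξ i])
  refine ⟨hR1.add (hR2.cv hψ), ?_⟩
  obtain ⟨P, hP⟩ := exists_LE (u := fun x o => if o = none then ψ x else 0) (fun o => by
    by_cases h : o = none
    · simpa [h] using hψ
    · simp [h])
  have hPn := hP none
  have hs : Summable fun k => ‖s k • P‖ := by simpa only [norm_smul] using h1.mul_right ‖P‖
  have e1 : (fun x => ∑' k, s k * ψ (x - b *ᵥ intVec k)) =ᵐ[volume]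
      fun x => syn b (fun k => s k • P) x none := by
    have h3 : ∀ k, ∀ᵐ x, (s k • P : LE d) (x - b *ᵥ intVec k) none
        = s k * ψ (x - b *ᵥ intVec k) := fun k => by
      have h4 : ∀ᵐ x, (s k • P : LE d) x none = s k * ψ x := by
        filter_upwards [Lp.coeFn_smul (s k) P, hPn] with x hx hx2
        rw [hx, Pi.smul_apply, PiLp.smul_apply, hx2, smul_eq_mul, if_pos rfl]
      exact (measurePreserving_sub_right volume (b *ᵥ intVec k)).quasiMeasurePreserving.ae h4
    filter_upwards [syn_ae hs, ae_all_iff.2 h3] with x hx hx3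
    rw [← (hx none).tsum_eq]
    exact (tsum_congr hx3).symm
  refine e1.trans (LE.ae_eq_of_vft fun ξ => ?_)
  have hPft : vft ξ P none = ft ψ ξ := by
    rw [vft_apply]
    exact ft_congr_ae (by simpa using hPn) ξ
  rw [map_add, PiLp.add_apply, vft_cv hψ, PiLp.smul_apply, vft_syn_smul h1, vft_syn_smul h1,
    vft_syn_ten hη hC, hft, hHn, hPft, smul_eq_mul]
  change _ = _ + ft ψ ξ * (χ ξ * dser s (ξ ᵥ* b))
  ring

lemma IsLift.dil {F : LE d} {f : (Fin d → ℝ) → ℂ} (h : IsLift F f) {a : ℝ} (ha : a ≠ 0) :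
    IsLift (dil a ha F) fun x => ((|a| ^ d : ℝ) : ℂ) * f (a • x) :=
  ⟨h.1.dil ha, by
    have h1 := (quasiMeasurePreserving_smul (d := d) ha).ae_eq_comp h.2
    filter_upwards [h1, dil_ae ha F] with x hx1 hx2
    rw [hx2, PiLp.smul_apply, sgnE_none, smul_eq_mul]
    exact congrArg _ hx1⟩

lemma norm_synthesis_le {ν : (Fin d → ℝ) → ℝ} {η ψ : (Fin d → ℝ) → ℂ} (hη : Integrable η)
    {H : LE d} {s : (Fin d → ℤ) → ℂ} (h1 : Summable fun k => ‖s k‖)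
    (h2 : Summable fun k => ‖dConv s (zKernel b ν) k‖) :
    ‖syn b (fun k => s k • H) + cv ψ (syn b fun k => ten hη (coefE b ν s k))‖ ≤
      (‖H‖ + (d + 1) * ((∫ t, ‖ψ t‖) * ∫ t, ‖η t‖)) *
        ((∑' k, ‖s k‖) + ∑' k, ‖dConv s (zKernel b ν) k‖) := by
  have hC := summable_norm_coefE h1 h2
  have e1 : ‖syn b (fun k => s k • H)‖ ≤ (∑' k, ‖s k‖) * ‖H‖ := by
    refine (norm_syn_le (by simpa only [norm_smul] using h1.mul_right ‖H‖)).trans (le_of_eq ?_)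
    simp only [norm_smul, tsum_mul_right]
  have e2 : ‖syn b fun k => ten hη (coefE b ν s k)‖ ≤
      (∫ t, ‖η t‖) * ((∑' k, ‖s k‖) + d * ∑' k, ‖dConv s (zKernel b ν) k‖) := by
    refine (norm_syn_le (summable_norm_ten hη hC)).trans ?_
    simp only [norm_ten, tsum_mul_left]
    exact mul_le_mul_of_nonneg_left (tsum_norm_coefE_le h1 h2)
      (integral_nonneg fun _ => norm_nonneg _)
  have hψ0 : 0 ≤ ∫ t, ‖ψ t‖ := integral_nonneg fun _ => norm_nonneg _
  have hη0 : 0 ≤ ∫ t, ‖η t‖ := integral_nonneg fun _ => norm_nonneg _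
  have hs0 : 0 ≤ ∑' k, ‖s k‖ := tsum_nonneg fun _ => norm_nonneg _
  have hc0 : 0 ≤ ∑' k, ‖dConv s (zKernel b ν) k‖ := tsum_nonneg fun _ => norm_nonneg _
  have e3 := (norm_cv_le ψ (syn b fun k => ten hη (coefE b ν s k))).trans
    (mul_le_mul_of_nonneg_left e2 hψ0)
  refine (norm_add_le _ _).trans ((add_le_add e1 e3).trans ?_)
  set S := ∑' k, ‖s k‖
  set T := ∑' k, ‖dConv s (zKernel b ν) k‖
  set p := ∫ t, ‖ψ t‖
  set q := ∫ t, ‖η t‖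
  have hd : (0 : ℝ) ≤ d := Nat.cast_nonneg d
  have a1 : 0 ≤ ‖H‖ * T := mul_nonneg (norm_nonneg _) hc0
  have a2 : 0 ≤ d * (p * q * S) := mul_nonneg hd (mul_nonneg (mul_nonneg hψ0 hη0) hs0)
  have a3 : 0 ≤ p * q * T := mul_nonneg (mul_nonneg hψ0 hη0) hc0
  nlinarith

end Synthesis

section Analysis

variable {d : ℕ} {b : Matrix (Fin d) (Fin d) ℝ}

/-- Bounded overlap of the lattice translates of a rapidly decaying function. -/
def LatticeBdd (b : Matrix (Fin d) (Fin d) ℝ) (η : (Fin d → ℝ) → ℂ) (B : ℝ) : Prop :=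
  ∀ y : Fin d → ℝ, Summable (fun k : Fin d → ℤ => ‖η (b *ᵥ intVec k - y)‖) ∧
    ∑' k : Fin d → ℤ, ‖η (b *ᵥ intVec k - y)‖ ≤ B

lemma exists_latticeBdd_const (hb : b.det ≠ 0) :
    ∃ A : ℝ, 0 ≤ A ∧ ∀ (η : (Fin d → ℝ) → ℂ) (C : ℝ),
      (∀ x, ‖η x‖ ≤ C * ((1 + ‖x‖) ^ (2 * d))⁻¹) → LatticeBdd b η (C * A) := by
  obtain ⟨A, hA, h⟩ := exists_lattice_sum_le hb
  refine ⟨A, hA, fun η C hη y => ?_⟩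
  have hs : Summable (fun k : Fin d → ℤ => ‖η (b *ᵥ intVec k - y)‖) :=
    ((h y).1.mul_left C).of_nonneg_of_le (fun _ => norm_nonneg _) fun k => hη _
  have hC : 0 ≤ C := by
    have := (norm_nonneg _).trans (hη 0)
    simpa using this
  refine ⟨hs, (hs.tsum_le_tsum (fun k => hη _) ((h y).1.mul_left C)).trans ?_⟩
  rw [tsum_mul_left]
  exact mul_le_mul_of_nonneg_left (h y).2 hC

lemma exists_latticeBdd (hb : b.det ≠ 0) {η : (Fin d → ℝ) → ℂ} {C : ℝ}
    (hη : ∀ x, ‖η x‖ ≤ C * ((1 + ‖x‖) ^ (2 * d))⁻¹) : ∃ B : ℝ, 0 ≤ B ∧ LatticeBdd b η B := by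
  obtain ⟨A, -, h⟩ := exists_latticeBdd_const hb
  exact ⟨_, (tsum_nonneg fun _ => norm_nonneg _).trans (h η C hη 0).2, h η C hη⟩

/-- The local averages of a vector valued function over the lattice. -/
def anaE (b : Matrix (Fin d) (Fin d) ℝ) (η : (Fin d → ℝ) → ℂ) (F : LE d) (k : Fin d → ℤ) : EC d :=
  ((|b.det| : ℝ) : ℂ) • ∫ y, η (b *ᵥ intVec k - y) • F y

variable {η : (Fin d → ℝ) → ℂ}

lemma LatticeBdd.norm_le {B : ℝ} (h : LatticeBdd b η B) (x : Fin d → ℝ) : ‖η x‖ ≤ B := by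
  have h1 := (h (-x)).1.le_tsum 0 fun _ _ => norm_nonneg _
  refine le_trans (le_of_eq ?_) (h1.trans (h (-x)).2)
  have : (intVec 0 : Fin d → ℝ) = 0 := by ext; simp [intVec]
  rw [this, mulVec_zero, zero_sub, neg_neg]

lemma LatticeBdd.integrable_smul {B : ℝ} (h : LatticeBdd b η B) (hη : Continuous η) {E : Type*}
    [NormedAddCommGroup E] [NormedSpace ℂ E] {F : (Fin d → ℝ) → E} (hF : Integrable F)
    (x : Fin d → ℝ) : Integrable fun y => η (x - y) • F y :=
  Integrable.bdd_smul hF B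
    (hη.comp (continuous_const.sub continuous_id)).aestronglyMeasurable
    (Eventually.of_forall fun _ => h.norm_le _)

lemma LatticeBdd.sum_integral_le {B : ℝ} (h : LatticeBdd b η B) (hη : Continuous η) {E : Type*}
    [NormedAddCommGroup E] [NormedSpace ℂ E] {F : (Fin d → ℝ) → E} (hF : Integrable F) (a : ℝ)
    (u : Finset (Fin d → ℤ)) :
    ∑ k ∈ u, ‖∫ y, η (b *ᵥ intVec k - a • y) • F y‖ ≤ B * ∫ y, ‖F y‖ := by
  have hi : ∀ k : Fin d → ℤ, Integrable fun y => ‖η (b *ᵥ intVec k - a • y)‖ * ‖F y‖ := fun k =>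
    Integrable.bdd_mul (c := B) hF.norm
      (hη.comp (continuous_const.sub (continuous_const_smul a))).norm.aestronglyMeasurable
      (Eventually.of_forall fun y => by rw [norm_norm]; exact h.norm_le _)
  calc ∑ k ∈ u, ‖∫ y, η (b *ᵥ intVec k - a • y) • F y‖
      ≤ ∑ k ∈ u, ∫ y, ‖η (b *ᵥ intVec k - a • y)‖ * ‖F y‖ := by
        refine Finset.sum_le_sum fun k _ => (norm_integral_le_integral_norm _).trans (le_of_eq ?_)
        simp only [norm_smul]
    _ = ∫ y, ∑ k ∈ u, ‖η (b *ᵥ intVec k - a • y)‖ * ‖F y‖ :=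
        (integral_finsetSum u fun k _ => hi k).symm
    _ ≤ ∫ y, B * ‖F y‖ := by
        refine integral_mono (integrable_finsetSum u fun k _ => hi k) (hF.norm.const_mul B)
          fun y => ?_
        change ∑ k ∈ u, ‖η (b *ᵥ intVec k - a • y)‖ * ‖F y‖ ≤ B * ‖F y‖
        rw [← Finset.sum_mul]
        exact mul_le_mul_of_nonneg_right
          (((h (a • y)).1.sum_le_tsum u fun _ _ => norm_nonneg _).trans (h (a • y)).2)
          (norm_nonneg _)
    _ = B * ∫ y, ‖F y‖ := integral_const_mul _ _

lemma anaE_sum_le {B : ℝ} (h : LatticeBdd b η B) (hη : Continuous η) (F : LE d) :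
    (Summable fun k => ‖anaE b η F k‖) ∧ ∑' k, ‖anaE b η F k‖ ≤ |b.det| * B * ‖F‖ := by
  have hs : ∀ u : Finset (Fin d → ℤ), ∑ k ∈ u, ‖anaE b η F k‖ ≤ |b.det| * B * ‖F‖ := fun u => by
    have := h.sum_integral_le hη F.integrable 1 u
    simp only [one_smul] at this
    simp only [anaE, norm_smul, Complex.norm_real, Real.norm_eq_abs, abs_abs]
    rw [← Finset.mul_sum, mul_assoc, LE.norm_eq]
    exact mul_le_mul_of_nonneg_left this (abs_nonneg _)
  have hs1 := summable_of_sum_le (fun k => norm_nonneg (anaE b η F k)) hs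
  exact ⟨hs1, hs1.tsum_le_of_sum_le hs⟩

lemma integral_comp_vecMul_inv (hb : b.det ≠ 0) (g : (Fin d → ℝ) → ℂ) :
    ((|b.det| : ℝ) : ℂ) * ∫ ξ, g ξ = ∫ ω : Fin d → ℝ, g (ω ᵥ* b⁻¹) := by
  have hb' : (b⁻¹).det ≠ 0 := by
    rw [det_nonsing_inv, Ring.inverse_eq_inv']; exact inv_ne_zero hb
  have e : (fun ω : Fin d → ℝ => ω ᵥ* b⁻¹) = Matrix.toLin' (b⁻¹)ᵀ := by
    ext ω; rw [Matrix.toLin'_apply, mulVec_transpose]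
  have hinj : Function.Injective fun ω : Fin d → ℝ => ω ᵥ* b⁻¹ := fun x y hxy => by
    have := congrArg (fun v => v ᵥ* b) hxy
    simpa only [vecMul_vecMul, nonsing_inv_mul _ hb.isUnit, vecMul_one] using this
  have hme : MeasurableEmbedding fun ω : Fin d → ℝ => ω ᵥ* b⁻¹ :=
    (continuous_vecMul_const _).measurableEmbedding hinj
  rw [← hme.integral_map, e, Real.map_matrix_volume_pi_eq_smul_volume_pi (by rwa [det_transpose]),
    integral_smul_measure, det_transpose, det_nonsing_inv, Ring.inverse_eq_inv', inv_inv,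
    ENNReal.toReal_ofReal (abs_nonneg _), Complex.real_smul]

/-- The local averages as Fourier coefficients. -/
lemma anaE_apply (hb : b.det ≠ 0) {χ : (Fin d → ℝ) → ℂ} (hχi : Integrable χ)
    (hχ : ∀ ξ, χ ξ ≠ 0 → ξ ᵥ* b ∈ centeredCube d) {B : ℝ} (h : LatticeBdd b (ftInv χ) B)
    (F : LE d) (k : Fin d → ℤ) (o : Option (Fin d)) :
    anaE b (ftInv χ) F k o = ∫ ω in centeredCube d,
      ech (dotP ω (intVec k)) * (vft (ω ᵥ* b⁻¹) F o * χ (ω ᵥ* b⁻¹)) := by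
  have hi := h.integrable_smul (continuous_ftInv hχi) F.integrable (b *ᵥ intVec k)
  have e1 : anaE b (ftInv χ) F k o = ((|b.det| : ℝ) : ℂ) *
      ∫ y, F (b *ᵥ intVec k - y) o * ftInv χ y := by
    rw [anaE, PiLp.smul_apply, smul_eq_mul]
    have : (∫ y, ftInv χ (b *ᵥ intVec k - y) • F y) o
        = ∫ y, (ftInv χ (b *ᵥ intVec k - y) • F y) o :=
      ((EuclideanSpace.proj o : EC d →L[ℂ] ℂ).integral_comp_comm hi).symm
    rw [this, ← integral_sub_left_eq_self _ volume (b *ᵥ intVec k)]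
    simp only [PiLp.smul_apply, smul_eq_mul, sub_sub_cancel, mul_comm]
  rw [e1, integral_mul_ftInv_sub (F.integrable_apply o) hχi, integral_comp_vecMul_inv hb,
    ← setIntegral_eq_integral_of_forall_compl_eq_zero (s := centeredCube d)]
  · congr 1
    ext ω
    rw [dotP_mulVec, vecMul_vecMul, nonsing_inv_mul _ hb.isUnit, vecMul_one, vft_apply]
    ring
  · intro ω hω
    have : χ (ω ᵥ* b⁻¹) = 0 := by
      by_contra h0
      have := hχ _ h0
      rw [vecMul_vecMul, nonsing_inv_mul _ hb.isUnit, vecMul_one] at this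
      exact hω this
    rw [this, mul_zero, mul_zero]

lemma dser_anaE (hb : b.det ≠ 0) {χ : (Fin d → ℝ) → ℂ} (hχc : Continuous χ) (hχi : Integrable χ)
    {K : ℝ} (hχK : ∀ ξ, ‖χ ξ‖ ≤ K)
    (hχ : ∀ ξ, χ ξ ≠ 0 → ξ ᵥ* b ∈ centeredCube d) {B : ℝ} (h : LatticeBdd b (ftInv χ) B)
    (F : LE d) (o : Option (Fin d)) :
    ∀ᵐ ω ∂(volume.restrict (centeredCube d)),
      dser (fun k => anaE b (ftInv χ) F k o) ω = vft (ω ᵥ* b⁻¹) F o * χ (ω ᵥ* b⁻¹) := by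
  have hs := (anaE_sum_le h (continuous_ftInv hχi) F).1
  refine dser_ae_eq_of_coeff (v := fun ω => vft (ω ᵥ* b⁻¹) F o * χ (ω ᵥ* b⁻¹)) (M := ‖F‖ * K)
    (((continuous_vft_apply F o).comp (continuous_vecMul_const _)).mul
      (hχc.comp (continuous_vecMul_const _))).measurable (fun ω => ?_)
    (hs.of_nonneg_of_le (fun _ => norm_nonneg _) fun k => PiLp.norm_apply_le _ o)
    fun k => anaE_apply hb hχi hχ h F k o
  rw [norm_mul]
  exact mul_le_mul ((PiLp.norm_apply_le _ o).trans (norm_vft_le _ F)) (hχK _) (norm_nonneg _)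
    (norm_nonneg _)

lemma coefE_anaE (hb : b.det ≠ 0) {ν : (Fin d → ℝ) → ℝ} (hν : IsCutoff d ν)
    {χ : (Fin d → ℝ) → ℂ} (hχc : Continuous χ) (hχi : Integrable χ)
    {K : ℝ} (hχK : ∀ ξ, ‖χ ξ‖ ≤ K)
    (hχ : ∀ ξ, χ ξ ≠ 0 → ξ ᵥ* b ∈ centeredCube d ∧ ν (ξ ᵥ* b) = 1) {B : ℝ}
    (h : LatticeBdd b (ftInv χ) B) {F : LE d} (hF : Rz F) :
    coefE b ν (fun k => anaE b (ftInv χ) F k none) = anaE b (ftInv χ) F := by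
  have hs := (anaE_sum_le h (continuous_ftInv hχi) F).1
  ext k o
  cases o with
  | none => rfl
  | some i =>
    change dConv (fun k => anaE b (ftInv χ) F k none) (zKernel b ν) k i = _
    rw [dConv_eq_integral hν (hs.of_nonneg_of_le (fun _ => norm_nonneg _)
      fun k => PiLp.norm_apply_le _ none), anaE_apply hb hχi (fun ξ hξ => (hχ ξ hξ).1) h]
    refine integral_congr_ae ?_
    filter_upwards [dser_anaE hb hχc hχi hχK (fun ξ hξ => (hχ ξ hξ).1) h F none,
      ae_restrict_of_ae (ae_ne_zero_of_fin i)] with ω hω hω0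
    have h0 : ω ᵥ* b⁻¹ ≠ 0 := fun h0 => hω0 (by
      have := congrArg (fun v => v ᵥ* b) h0
      simpa only [vecMul_vecMul, nonsing_inv_mul _ hb.isUnit, vecMul_one, zero_vecMul] using this)
    rw [hω, zetaFn_apply, hF _ h0]
    by_cases hc : χ (ω ᵥ* b⁻¹) = 0
    · simp [hc]
    have h1 := (hχ _ hc).2
    rw [vecMul_vecMul, nonsing_inv_mul _ hb.isUnit, vecMul_one] at h1
    rw [h1, Complex.ofReal_one]; ring

lemma syn_anaE (hb : b.det ≠ 0) {χ : (Fin d → ℝ) → ℂ} (hχc : Continuous χ) (hχi : Integrable χ)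
    {K : ℝ} (hχK : ∀ ξ, ‖χ ξ‖ ≤ K) (hη : Integrable (ftInv χ))
    (hχ : ∀ ξ, χ ξ ≠ 0 → ξ ᵥ* b ∈ centeredCube d) {B : ℝ}
    (h : LatticeBdd b (ftInv χ) B) (F : LE d) :
    syn b (fun k => ten hη (anaE b (ftInv χ) F k)) = cv (ftInv χ) (cv (ftInv χ) F) := by
  have hs := (anaE_sum_le h (continuous_ftInv hχi) F).1
  have h1 : ∀ o, ∀ᵐ ξ, ξ ᵥ* b ∈ centeredCube d →
      dser (fun k => anaE b (ftInv χ) F k o) (ξ ᵥ* b) = vft ξ F o * χ ξ := fun o => by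
    have h2 := (ae_restrict_iff' measurableSet_centeredCube).1 (dser_anaE hb hχc hχi hχK hχ h F o)
    filter_upwards [(quasiMeasurePreserving_vecMul hb).ae h2] with ξ hξ
    rwa [vecMul_vecMul, mul_nonsing_inv _ hb.isUnit, vecMul_one] at hξ
  refine LE.ext_of_vft ?_
  filter_upwards [ae_all_iff.2 h1] with ξ hξ
  ext o
  rw [vft_syn_ten hη hs, vft_cv hη, vft_cv hη, PiLp.smul_apply, PiLp.smul_apply, smul_eq_mul,
    smul_eq_mul, ft_ftInv hχc hχi hη]
  by_cases hc : χ ξ = 0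
  · simp [hc]
  rw [hξ o (hχ ξ hc), mul_comm (vft ξ F o)]

lemma sums_of_coefE {ν : (Fin d → ℝ) → ℝ} {s : (Fin d → ℤ) → ℂ} {A : ℝ}
    (hs : Summable fun k => ‖coefE b ν s k‖) (hle : ∑' k, ‖coefE b ν s k‖ ≤ A) :
    (Summable fun k => ‖s k‖) ∧ (Summable fun k => ‖dConv s (zKernel b ν) k‖) ∧
    (∑' k, ‖s k‖) + ∑' k, ‖dConv s (zKernel b ν) k‖ ≤ 2 * A := by
  have h1 : ∀ k, ‖s k‖ ≤ ‖coefE b ν s k‖ := fun k => EC.norm_none_le (coefE b ν s k)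
  have h2 : ∀ k, ‖dConv s (zKernel b ν) k‖ ≤ ‖coefE b ν s k‖ := fun k =>
    EC.norm_some_le (coefE b ν s k)
  have hs1 := hs.of_nonneg_of_le (fun _ => norm_nonneg _) h1
  have hs2 := hs.of_nonneg_of_le (fun _ => norm_nonneg _) h2
  refine ⟨hs1, hs2, ?_⟩
  linarith [hs1.tsum_le_tsum h1 hs, hs2.tsum_le_tsum h2 hs]

end Analysis

section Sampling

variable {d : ℕ} {b : Matrix (Fin d) (Fin d) ℝ}

/-- Weighted samples of `f` over the dilated lattice. -/
def smp (b : Matrix (Fin d) (Fin d) ℝ) (η : (Fin d → ℝ) → ℂ) (a : ℝ) (f : (Fin d → ℝ) → ℂ)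
    (k : Fin d → ℤ) : ℂ :=
  ((|b.det| : ℝ) : ℂ) * ∫ y, η (b *ᵥ intVec k - a • y) • f y

variable {η η' : (Fin d → ℝ) → ℂ} {B B' : ℝ} {f f' : (Fin d → ℝ) → ℂ}

lemma smp_sum_le (h : LatticeBdd b η B) (hη : Continuous η) (hf : Integrable f) (a : ℝ) :
    (Summable fun k => ‖smp b η a f k‖) ∧ ∑' k, ‖smp b η a f k‖ ≤ |b.det| * B * ∫ y, ‖f y‖ := by
  have hs : ∀ u : Finset (Fin d → ℤ), ∑ k ∈ u, ‖smp b η a f k‖ ≤ |b.det| * B * ∫ y, ‖f y‖ :=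
    fun u => by
      simp only [smp, norm_mul, Complex.norm_real, Real.norm_eq_abs, abs_abs]
      rw [← Finset.mul_sum, mul_assoc]
      exact mul_le_mul_of_nonneg_left (h.sum_integral_le hη hf a u) (abs_nonneg _)
  have hs1 := summable_of_sum_le (fun k => norm_nonneg (smp b η a f k)) hs
  exact ⟨hs1, hs1.tsum_le_of_sum_le hs⟩

lemma LatticeBdd.integrable_smp (h : LatticeBdd b η B) (hη : Continuous η) (hf : Integrable f)
    (a : ℝ) (x : Fin d → ℝ) : Integrable fun y => η (x - a • y) • f y :=
  Integrable.bdd_smul hf B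
    (hη.comp (continuous_const.sub (continuous_const_smul a))).aestronglyMeasurable
    (Eventually.of_forall fun _ => h.norm_le _)

lemma smp_sub_left (h : LatticeBdd b η B) (hη : Continuous η) (h' : LatticeBdd b η' B')
    (hη' : Continuous η') (hf : Integrable f) (a : ℝ) (k : Fin d → ℤ) :
    smp b η a f k - smp b η' a f k = smp b (fun x => η x - η' x) a f k := by
  simp only [smp, sub_smul]
  rw [integral_sub (h.integrable_smp hη hf a _) (h'.integrable_smp hη' hf a _), mul_sub]

lemma smp_sub_right (h : LatticeBdd b η B) (hη : Continuous η) (hf : Integrable f)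
    (hf' : Integrable f') (a : ℝ) (k : Fin d → ℤ) :
    smp b η a f k - smp b η a f' k = smp b η a (fun x => f x - f' x) k := by
  simp only [smp, smul_sub]
  rw [integral_sub (h.integrable_smp hη hf a _) (h.integrable_smp hη hf' a _), mul_sub]

/-- The lattice sum of translates of `H`, weighted by samples of `f`. -/
def osc (b : Matrix (Fin d) (Fin d) ℝ) (η : (Fin d → ℝ) → ℂ) (f : (Fin d → ℝ) → ℂ) (H : LE d)
    (a : ℝ) : LE d :=
  syn b fun k => smp b η a f k • H

lemma norm_syn_smul_le {s : (Fin d → ℤ) → ℂ} (hs : Summable fun k => ‖s k‖) (H : LE d) :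
    ‖syn b fun k => s k • H‖ ≤ (∑' k, ‖s k‖) * ‖H‖ := by
  refine (norm_syn_le (by simpa only [norm_smul] using hs.mul_right ‖H‖)).trans (le_of_eq ?_)
  simp only [norm_smul, tsum_mul_right]

lemma syn_smul_sub_left {s t : (Fin d → ℤ) → ℂ} (hs : Summable fun k => ‖s k‖)
    (ht : Summable fun k => ‖t k‖) (H : LE d) :
    (syn b fun k => s k • H) - (syn b fun k => t k • H) = syn b fun k => (s k - t k) • H := by
  have h1 := (summable_trL (b := b) (G := fun k => s k • H)
    (by simpa only [norm_smul] using hs.mul_right ‖H‖)).of_norm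
  have h2 := (summable_trL (b := b) (G := fun k => t k • H)
    (by simpa only [norm_smul] using ht.mul_right ‖H‖)).of_norm
  rw [syn, syn, syn, ← h1.tsum_sub h2]
  simp only [sub_smul, map_sub]

lemma syn_smul_sub_right {s : (Fin d → ℤ) → ℂ} (hs : Summable fun k => ‖s k‖) (H H' : LE d) :
    (syn b fun k => s k • H) - (syn b fun k => s k • H') = syn b fun k => s k • (H - H') := by
  have h1 := (summable_trL (b := b) (G := fun k => s k • H)
    (by simpa only [norm_smul] using hs.mul_right ‖H‖)).of_norm
  have h2 := (summable_trL (b := b) (G := fun k => s k • H')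
    (by simpa only [norm_smul] using hs.mul_right ‖H'‖)).of_norm
  rw [syn, syn, syn, ← h1.tsum_sub h2]
  simp only [smul_sub, map_sub]

lemma norm_osc_sub_le {D : ℝ} (h : LatticeBdd b η B) (hη : Continuous η) (h' : LatticeBdd b η' B')
    (hη' : Continuous η') (hD : LatticeBdd b (fun x => η x - η' x) D) (hf : Integrable f)
    (hf' : Integrable f') (H H' : LE d) (a : ℝ) :
    ‖osc b η f H a - osc b η' f' H' a‖ ≤ |b.det| * (D * (∫ y, ‖f y‖) * ‖H‖ +
      B' * (∫ y, ‖f y - f' y‖) * ‖H‖ + B' * (∫ y, ‖f' y‖) * ‖H - H'‖) := by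
  obtain ⟨s1, -⟩ := smp_sum_le h hη hf a
  obtain ⟨s2, -⟩ := smp_sum_le h' hη' hf a
  obtain ⟨s3, l3⟩ := smp_sum_le h' hη' hf' a
  obtain ⟨s4, l4⟩ := smp_sum_le hD (hη.sub hη') hf a
  obtain ⟨s5, l5⟩ := smp_sum_le h' hη' (hf.sub hf') a
  have e1 : osc b η f H a - osc b η' f H a = syn b fun k => smp b (fun x => η x - η' x) a f k • H :=
    by simp only [osc, syn_smul_sub_left s1 s2, smp_sub_left h hη h' hη' hf]
  have e2 : osc b η' f H a - osc b η' f' H a =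
      syn b fun k => smp b η' a (fun x => f x - f' x) k • H := by
    simp only [osc, syn_smul_sub_left s2 s3, smp_sub_right h' hη' hf hf']
  have e3 : osc b η' f' H a - osc b η' f' H' a = syn b fun k => smp b η' a f' k • (H - H') :=
    syn_smul_sub_right s3 H H'
  have e : osc b η f H a - osc b η' f' H' a = (osc b η f H a - osc b η' f H a) +
      (osc b η' f H a - osc b η' f' H a) + (osc b η' f' H a - osc b η' f' H' a) := by abel
  rw [e, e1, e2, e3]
  refine (norm_add₃_le).trans ?_
  have n1 := (norm_syn_smul_le (b := b) s4 H).trans (mul_le_mul_of_nonneg_right l4 (norm_nonneg _))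
  have n2 := (norm_syn_smul_le (b := b) s5 H).trans (mul_le_mul_of_nonneg_right l5 (norm_nonneg _))
  have n3 := (norm_syn_smul_le (b := b) s3 (H - H')).trans
    (mul_le_mul_of_nonneg_right l3 (norm_nonneg _))
  refine (add_le_add (add_le_add n1 n2) n3).trans (le_of_eq ?_)
  simp only [Pi.sub_apply]
  ring

lemma smp_eq_anaE {a : ℝ} (ha : a ≠ 0) (h : LatticeBdd b η B) (hη : Continuous η) (F : LE d)
    (k : Fin d → ℤ) :
    anaE b η (dil a⁻¹ (inv_ne_zero ha) F) k none = smp b η a (fun x => F x none) k := by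
  have hi := h.integrable_smul hη (dil a⁻¹ (inv_ne_zero ha) F).integrable (b *ᵥ intVec k)
  have e0 : (∫ y, η (b *ᵥ intVec k - y) • (dil a⁻¹ (inv_ne_zero ha) F) y) none
      = ∫ y, (η (b *ᵥ intVec k - y) • (dil a⁻¹ (inv_ne_zero ha) F) y) none :=
    ((EuclideanSpace.proj none : EC d →L[ℂ] ℂ).integral_comp_comm hi).symm
  have e1 : ∫ y, (η (b *ᵥ intVec k - y) • (dil a⁻¹ (inv_ne_zero ha) F) y) none =
      ∫ y, ((|a⁻¹| ^ d : ℝ) : ℂ) * (η (b *ᵥ intVec k - a • (a⁻¹ • y)) * F (a⁻¹ • y) none) := by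
    refine integral_congr_ae ?_
    filter_upwards [dil_ae (inv_ne_zero ha) F] with y hy
    rw [PiLp.smul_apply, hy, PiLp.smul_apply, sgnE_none, smul_inv_smul₀ ha, smul_eq_mul,
      smul_eq_mul]
    ring
  rw [anaE, smp, PiLp.smul_apply, smul_eq_mul, e0, e1, integral_const_mul,
    Measure.integral_comp_smul volume
      (fun y : Fin d → ℝ => η (b *ᵥ intVec k - a • y) * F y none) a⁻¹]
  congr 1
  simp only [Module.finrank_fin_fun, inv_pow, inv_inv, abs_inv, smul_eq_mul, abs_pow]
  rw [Complex.real_smul, ← mul_assoc, ← Complex.ofReal_mul,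
    inv_mul_cancel₀ (pow_ne_zero _ (abs_ne_zero.2 ha)), Complex.ofReal_one, one_mul]

end Sampling

section CompactOsc

variable {d : ℕ} {b : Matrix (Fin d) (Fin d) ℝ}

lemma finite_lattice_ball (hb : b.det ≠ 0) (R : ℝ) : {k : Fin d → ℤ | ‖b *ᵥ intVec k‖ ≤ R}.Finite := by
  obtain ⟨C, -, hC⟩ := exists_lattice_sum_le hb
  rcases lt_or_ge R 0 with h | hR
  · convert Set.finite_empty (α := Fin d → ℤ)
    refine Set.eq_empty_of_forall_notMem fun k (hk : ‖b *ᵥ intVec k‖ ≤ R) => ?_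
    linarith [norm_nonneg (b *ᵥ intVec k)]
  have h := (hC 0).1.tendsto_cofinite_zero.eventually
    (gt_mem_nhds (show (0 : ℝ) < ((1 + R) ^ (2 * d))⁻¹ by positivity))
  refine (Filter.eventually_cofinite.1 h).subset fun k (hk : ‖b *ᵥ intVec k‖ ≤ R) => ?_
  simp only [sub_zero, Set.mem_ofPred_eq, not_lt]
  gcongr

/-- The lattice points in the closed ball of radius `R`. -/
def latBall (hb : b.det ≠ 0) (R : ℝ) : Finset (Fin d → ℤ) := (finite_lattice_ball hb R).toFinset

lemma mem_latBall (hb : b.det ≠ 0) {R : ℝ} {k : Fin d → ℤ} :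
    k ∈ latBall hb R ↔ ‖b *ᵥ intVec k‖ ≤ R := by
  simp [latBall]

lemma exists_decay_of_hasCompactSupport {E : Type*} [NormedAddCommGroup E]
    {η : (Fin d → ℝ) → E} (hη : Continuous η) (hs : HasCompactSupport η) (N : ℕ) :
    ∃ C : ℝ, ∀ x, ‖η x‖ ≤ C * ((1 + ‖x‖) ^ N)⁻¹ := by
  have h1 : Continuous fun x : Fin d → ℝ => (((1 + ‖x‖) ^ N : ℝ)) * ‖η x‖ := by fun_prop
  obtain ⟨C, hC⟩ := (hs.norm.mul_left (f := fun x => ((1 + ‖x‖) ^ N : ℝ))).exists_bound_of_continuous h1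
  refine ⟨C, fun x => ?_⟩
  have h2 : (0 : ℝ) < (1 + ‖x‖) ^ N := by positivity
  rw [← div_eq_mul_inv, le_div_iff₀ h2, mul_comm]
  exact (le_abs_self _).trans (hC x)

variable {η f : (Fin d → ℝ) → ℂ} {u : (Fin d → ℝ) → EC d}

lemma sgnE_zero (a : ℝ) : sgnE a (0 : EC d) = 0 := by
  ext o; cases o <;> simp

lemma inner_sgnE (a : ℝ) (v w : EC d) : inner ℂ v (sgnE a w) = inner ℂ (sgnE a v) w := by
  simp only [PiLp.inner_apply, Fintype.sum_option, sgnE_none, sgnE_some]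
  congr 1
  refine Finset.sum_congr rfl fun i _ => ?_
  simp only [RCLike.inner_apply, map_mul, Complex.conj_ofReal]
  ring

lemma continuous_sgnE (a : ℝ) : Continuous (sgnE a : EC d → EC d) := by
  refine (PiLp.continuous_toLp 2 _).comp (continuous_pi fun o => ?_)
  cases o
  · exact (EuclideanSpace.proj none : EC d →L[ℂ] ℂ).continuous
  · exact continuous_const.mul (EuclideanSpace.proj (some _) : EC d →L[ℂ] ℂ).continuous

lemma integrable_comp_sub_smul (hη : Integrable η) {a : ℝ} (ha : a ≠ 0) (x : Fin d → ℝ) :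
    Integrable fun y => η (x - a • y) :=
  (hη.comp_sub_left x).comp_smul ha

lemma norm_smp_le (hη : Integrable η) {M : ℝ} (hf : ∀ x, ‖f x‖ ≤ M) {a : ℝ} (ha : a ≠ 0)
    (k : Fin d → ℤ) :
    |a| ^ d * ‖smp b η a f k‖ ≤ |b.det| * (M * ∫ x, ‖η x‖) := by
  have h1 : ‖∫ y, η (b *ᵥ intVec k - a • y) • f y‖ ≤ ∫ y, M * ‖η (b *ᵥ intVec k - a • y)‖ := by
    refine norm_integral_le_of_norm_le
      ((integrable_comp_sub_smul hη ha (b *ᵥ intVec k)).norm.const_mul M) (ae_of_all _ fun y => ?_)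
    rw [norm_smul, mul_comm]
    exact mul_le_mul_of_nonneg_right (hf y) (norm_nonneg _)
  have h2 : ∫ y, M * ‖η (b *ᵥ intVec k - a • y)‖ = M * ((|a| ^ d)⁻¹ * ∫ x, ‖η x‖) := by
    rw [integral_const_mul,
      Measure.integral_comp_smul volume (fun y : Fin d → ℝ => ‖η (b *ᵥ intVec k - y)‖) a,
      integral_sub_left_eq_self (fun x => ‖η x‖) volume]
    simp [abs_inv, abs_pow]
  rw [h2] at h1
  have h3 : |a| ^ d ≠ 0 := pow_ne_zero _ (abs_ne_zero.2 ha)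
  rw [smp, norm_mul, Complex.norm_real, Real.norm_eq_abs, abs_abs]
  calc |a| ^ d * (|b.det| * ‖∫ y, η (b *ᵥ intVec k - a • y) • f y‖)
      ≤ |a| ^ d * (|b.det| * (M * ((|a| ^ d)⁻¹ * ∫ x, ‖η x‖))) := by gcongr
    _ = |b.det| * (M * ∫ x, ‖η x‖) := by field_simp

lemma smp_eq_zero {Rη Rf : ℝ} (hη : ∀ x, Rη ≤ ‖x‖ → η x = 0) (hf : ∀ x, Rf ≤ ‖x‖ → f x = 0)
    {a : ℝ} {k : Fin d → ℤ} (hk : Rη + |a| * Rf < ‖b *ᵥ intVec k‖) : smp b η a f k = 0 := by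
  have h : (fun y => η (b *ᵥ intVec k - a • y) • f y) = fun _ => 0 := by
    funext y
    rcases le_or_gt Rf ‖y‖ with h | h
    · rw [hf y h, smul_zero]
    · rw [hη, zero_smul]
      have h1 : ‖b *ᵥ intVec k‖ ≤ ‖b *ᵥ intVec k - a • y‖ + ‖a • y‖ := by
        simpa using norm_add_le (b *ᵥ intVec k - a • y) (a • y)
      rw [norm_smul, Real.norm_eq_abs] at h1
      have := mul_le_mul_of_nonneg_left h.le (abs_nonneg a)
      linarith
  rw [smp, h, integral_zero, mul_zero]

/-- A continuous representative of the dilated lattice sum `osc` for compactly supported data. -/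
def oscFun (b : Matrix (Fin d) (Fin d) ℝ) (η f : (Fin d → ℝ) → ℂ) (u : (Fin d → ℝ) → EC d)
    (K : Finset (Fin d → ℤ)) (a : ℝ) (x : Fin d → ℝ) : EC d :=
  ((|a| ^ d : ℝ) : ℂ) • ∑ k ∈ K, smp b η a f k • sgnE a (u (a • x - b *ᵥ intVec k))

lemma continuous_oscFun (hu : Continuous u) (K : Finset (Fin d → ℤ)) (a : ℝ) :
    Continuous (oscFun b η f u K a) := by
  have h : ∀ k, Continuous fun x => sgnE a (u (a • x - b *ᵥ intVec k)) := fun k =>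
    (continuous_sgnE a).comp (hu.comp (by fun_prop))
  unfold oscFun
  fun_prop

lemma dil_osc_ae {B : ℝ} (h : LatticeBdd b η B) (hη : Continuous η) (hf : Integrable f) {a : ℝ}
    (ha : a ≠ 0) {K : Finset (Fin d → ℤ)} (hK : ∀ k ∉ K, smp b η a f k = 0) {U : LE d}
    (hU : U =ᵐ[volume] u) :
    dil a ha (osc b η f U a) =ᵐ[volume] oscFun b η f u K a := by
  have hs : Summable fun k => ‖smp b η a f k • U‖ := by
    simpa only [norm_smul] using (smp_sum_le h hη hf a).1.mul_right ‖U‖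
  have h1 : osc b η f U a =ᵐ[volume]
      fun x => ∑ k ∈ K, smp b η a f k • u (x - b *ᵥ intVec k) := by
    have hae : ∀ᵐ x : Fin d → ℝ, ∀ k : Fin d → ℤ,
        (smp b η a f k • U : LE d) (x - b *ᵥ intVec k)
          = smp b η a f k • u (x - b *ᵥ intVec k) :=
      ae_all_iff.2 fun k => by
        have h2 : ∀ᵐ x : Fin d → ℝ, (smp b η a f k • U : LE d) x = smp b η a f k • u x := by
          filter_upwards [Lp.coeFn_smul (smp b η a f k) U, hU] with x h1 h2
          rw [h1, Pi.smul_apply, h2]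
        exact (measurePreserving_sub_right volume
          (b *ᵥ intVec k)).quasiMeasurePreserving.ae h2
    filter_upwards [syn_ae (b := b) hs, hae] with x hx hx'
    ext o
    refine (hx o).unique ?_
    simp only [hx']
    have := hasSum_sum_of_ne_finset_zero (s := K)
      (L := SummationFilter.unconditional _)
      (f := fun k => (smp b η a f k • u (x - b *ᵥ intVec k)) o) fun k hk => by simp [hK k hk]
    simpa using this
  filter_upwards [dil_ae ha (osc b η f U a), (quasiMeasurePreserving_smul ha).ae h1] with x hx hx'
  rw [hx, hx', oscFun]
  congr 1
  have : ∀ s : Finset (Fin d → ℤ), sgnE a (∑ k ∈ s, smp b η a f k • u (a • x - b *ᵥ intVec k))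
      = ∑ k ∈ s, smp b η a f k • sgnE a (u (a • x - b *ᵥ intVec k)) := fun s => by
    induction s using Finset.cons_induction with
    | empty => simp [sgnE_zero]
    | cons k s hk ih => rw [Finset.sum_cons, Finset.sum_cons, sgnE_add, sgnE_smul, ih]
  exact this K

lemma oscFun_eq_zero {Ru R : ℝ} (hu : ∀ x, Ru ≤ ‖x‖ → u x = 0) {K : Finset (Fin d → ℤ)}
    (hK : ∀ k ∈ K, ‖b *ᵥ intVec k‖ ≤ R) {a : ℝ} {x : Fin d → ℝ} (hx : R + Ru ≤ |a| * ‖x‖) :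
    oscFun b η f u K a x = 0 := by
  rw [oscFun, Finset.sum_eq_zero, smul_zero]
  intro k hk
  rw [hu, sgnE_zero, smul_zero]
  have h1 : ‖a • x‖ ≤ ‖a • x - b *ᵥ intVec k‖ + ‖b *ᵥ intVec k‖ := by
    simpa using norm_add_le (a • x - b *ᵥ intVec k) (b *ᵥ intVec k)
  rw [norm_smul, Real.norm_eq_abs] at h1
  linarith [hK k hk]

lemma norm_oscFun_le {A B : ℝ} {a : ℝ} (ha : a ≠ 0)
    (hA : ∀ k, |a| ^ d * ‖smp b η a f k‖ ≤ A)
    (hB : ∀ y, ∀ K : Finset (Fin d → ℤ), ∑ k ∈ K, ‖u (y - b *ᵥ intVec k)‖ ≤ B)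
    (K : Finset (Fin d → ℤ)) (x : Fin d → ℝ) : ‖oscFun b η f u K a x‖ ≤ A * B := by
  have hA0 : 0 ≤ A := le_trans (by positivity) (hA 0)
  rw [oscFun, Finset.smul_sum]
  refine (norm_sum_le _ _).trans ?_
  refine le_trans (Finset.sum_le_sum fun k _ => ?_)
    (le_trans (Finset.mul_sum K (fun k => ‖u (a • x - b *ᵥ intVec k)‖) A).ge
      (mul_le_mul_of_nonneg_left (hB (a • x) K) hA0))
  rw [norm_smul, norm_smul, norm_sgnE ha, ← mul_assoc, Complex.norm_real, Real.norm_eq_abs,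
    abs_pow, abs_abs]
  exact mul_le_mul_of_nonneg_right (hA k) (norm_nonneg _)

lemma integral_inner_dilate (hu : Continuous u) (hus : HasCompactSupport u) (hu0 : ∫ x, u x = 0)
    {g : (Fin d → ℝ) → EC d} (hg : Continuous g) {Ru : ℝ} (hRu : ∀ x, Ru ≤ ‖x‖ → u x = 0)
    {a δ : ℝ} (ha : a ≠ 0) (hgδ : ∀ p y : Fin d → ℝ, ‖y‖ ≤ Ru → ‖g (p + a⁻¹ • y) - g p‖ ≤ δ)
    (k : Fin d → ℤ) :
    |a| ^ d * ‖∫ x, inner ℂ (g x) (sgnE a (u (a • x - b *ᵥ intVec k)))‖ ≤ δ * ∫ x, ‖u x‖ := by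
  set p : Fin d → ℝ := a⁻¹ • (b *ᵥ intVec k) with hp
  have hui : Integrable u := hu.integrable_of_hasCompactSupport hus
  have e1 : ∫ x, inner ℂ (g x) (sgnE a (u (a • x - b *ᵥ intVec k)))
      = (((|a| ^ d)⁻¹ : ℝ) : ℂ) * ∫ y, inner ℂ (g (p + a⁻¹ • y)) (sgnE a (u y)) := by
    have h1 := Measure.integral_comp_smul volume
      (fun y : Fin d → ℝ => inner ℂ (g (a⁻¹ • y)) (sgnE a (u (y - b *ᵥ intVec k)))) a
    simp only [inv_smul_smul₀ ha] at h1
    rw [h1, ← integral_sub_right_eq_self (fun y => inner ℂ (g (p + a⁻¹ • y)) (sgnE a (u y)))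
      (b *ᵥ intVec k)]
    simp only [hp, smul_sub, add_sub_cancel, Module.finrank_fin_fun, abs_inv, abs_pow,
      Complex.real_smul]
  have e2 : ∫ y, inner ℂ (g (p + a⁻¹ • y)) (sgnE a (u y))
      = ∫ y, inner ℂ (g (p + a⁻¹ • y) - g p) (sgnE a (u y)) := by
    have h0 : ∫ y, inner ℂ (g p) (sgnE a (u y)) = 0 := by
      simp only [inner_sgnE]
      rw [integral_inner hui, hu0, inner_zero_right]
    have i1 : Integrable fun y => inner ℂ (g p) (sgnE a (u y)) := by
      simp only [inner_sgnE]
      exact hui.const_inner _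
    have i2 : Integrable fun y => inner ℂ (g (p + a⁻¹ • y)) (sgnE a (u y)) := by
      refine Continuous.integrable_of_hasCompactSupport ?_ ?_
      · exact (hg.comp (by fun_prop)).inner ((continuous_sgnE a).comp hu)
      · exact hus.mono fun y hy h => hy (by
          simp [show u y = 0 from h, sgnE_zero])
    simp only [inner_sub_left]
    rw [integral_sub i2 i1, h0, sub_zero]
  have h3 : ‖∫ y, inner ℂ (g (p + a⁻¹ • y) - g p) (sgnE a (u y))‖ ≤ ∫ y, δ * ‖u y‖ := by
    refine norm_integral_le_of_norm_le (hui.norm.const_mul δ) (ae_of_all _ fun y => ?_)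
    rcases le_or_gt Ru ‖y‖ with h | h
    · simp [hRu y h, sgnE_zero]
    · refine (norm_inner_le_norm _ _).trans ?_
      rw [norm_sgnE ha]
      exact mul_le_mul_of_nonneg_right (hgδ p y h.le) (norm_nonneg _)
  rw [integral_const_mul] at h3
  rw [e1, e2, norm_mul, Complex.norm_real, Real.norm_eq_abs, abs_inv, abs_pow, abs_abs, ← mul_assoc,
    mul_inv_cancel₀ (pow_ne_zero _ (abs_ne_zero.2 ha)), one_mul]
  exact h3

lemma norm_integral_inner_oscFun_le (hu : Continuous u) (hus : HasCompactSupport u)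
    {g : (Fin d → ℝ) → EC d} (hg : Continuous g) {a D A : ℝ} (ha : a ≠ 0)
    (hD : ∀ k, |a| ^ d * ‖∫ x, inner ℂ (g x) (sgnE a (u (a • x - b *ᵥ intVec k)))‖ ≤ D)
    {K : Finset (Fin d → ℤ)} (hA : ∑ k ∈ K, ‖smp b η a f k‖ ≤ A) :
    ‖∫ x, inner ℂ (g x) (oscFun b η f u K a x)‖ ≤ A * D := by
  have hD0 : 0 ≤ D := le_trans (by positivity) (hD 0)
  have hi : ∀ k ∈ K, Integrable fun x =>
      smp b η a f k * inner ℂ (g x) (sgnE a (u (a • x - b *ᵥ intVec k))) := fun k _ => by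
    refine Integrable.const_mul ?_ _
    refine Continuous.integrable_of_hasCompactSupport
      (hg.inner ((continuous_sgnE a).comp (hu.comp (by fun_prop)))) ?_
    have h1 : HasCompactSupport fun x : Fin d → ℝ => u (a • x - b *ᵥ intVec k) :=
      hus.comp_homeomorph ((Homeomorph.smulOfNeZero a ha).trans
        (Homeomorph.subRight (b *ᵥ intVec k)))
    exact h1.mono fun y hy h => hy (by simp [show u (a • y - b *ᵥ intVec k) = 0 from h, sgnE_zero])
  have e : ∫ x, inner ℂ (g x) (oscFun b η f u K a x) = ((|a| ^ d : ℝ) : ℂ) * ∑ k ∈ K,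
      smp b η a f k * ∫ x, inner ℂ (g x) (sgnE a (u (a • x - b *ᵥ intVec k))) := by
    simp only [oscFun, inner_smul_right, inner_sum]
    rw [integral_const_mul, integral_finsetSum _ hi]
    simp only [integral_const_mul]
  rw [e, Finset.mul_sum]
  refine (norm_sum_le _ _).trans (le_trans (Finset.sum_le_sum fun k _ => ?_)
    (le_trans (Finset.sum_mul K (fun k => ‖smp b η a f k‖) D).ge
      (mul_le_mul_of_nonneg_right hA hD0)))
  rw [norm_mul, norm_mul, Complex.norm_real, Real.norm_eq_abs, abs_pow, abs_abs, mul_left_comm]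
  exact mul_le_mul_of_nonneg_left (hD k) (norm_nonneg _)

end CompactOsc

section Averaging

lemma exists_finset_norm_sum_sq_le {E : Type*} [NormedAddCommGroup E] [InnerProductSpace ℂ E]
    {v : ℕ → E} {M : ℝ} (hM : ∀ j, ‖v j‖ ≤ M)
    (hv : ∀ i, Tendsto (fun j => inner ℂ (v i) (v j)) atTop (𝓝 0)) (n : ℕ) :
    ∃ Λ : Finset ℕ, Λ.card = n ∧ ‖∑ j ∈ Λ, v j‖ ^ 2 ≤ n * (M ^ 2 + 2) := by
  induction n with
  | zero => exact ⟨∅, by simp⟩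
  | succ n ih =>
    obtain ⟨Λ, hΛ, hle⟩ := ih
    have h1 : Tendsto (fun j => inner ℂ (∑ i ∈ Λ, v i) (v j)) atTop (𝓝 0) := by
      simp only [sum_inner]
      simpa using tendsto_finsetSum Λ fun i _ => hv i
    obtain ⟨j, hj, hj1⟩ := ((eventually_gt_atTop (Λ.sup id)).and
      (h1.norm.eventually (gt_mem_nhds (by simp : ‖(0 : ℂ)‖ < 1)))).exists
    have hjΛ : j ∉ Λ := fun h => absurd (Finset.le_sup (f := id) h) (not_le.2 hj)
    refine ⟨Finset.cons j Λ hjΛ, by rw [Finset.card_cons, hΛ], ?_⟩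
    rw [Finset.sum_cons, add_comm, @norm_add_sq ℂ]
    have h2 := (RCLike.re_le_norm (inner ℂ (∑ i ∈ Λ, v i) (v j))).trans hj1.le
    have h3 : ‖v j‖ ^ 2 ≤ M ^ 2 := pow_le_pow_left₀ (norm_nonneg _) (hM j) 2
    push_cast
    linarith

lemma Lp.coeFn_sum {X E ι : Type*} [MeasurableSpace X] {μ : Measure X} [NormedAddCommGroup E]
    {p : ℝ≥0∞} (s : Finset ι) (F : ι → Lp E p μ) :
    ⇑(∑ i ∈ s, F i) =ᵐ[μ] fun x => ∑ i ∈ s, F i x := by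
  classical
  induction s using Finset.induction_on with
  | empty =>
    filter_upwards [Lp.coeFn_zero E p μ] with x hx
    simpa using hx
  | insert i s hi ih =>
    filter_upwards [ih, Lp.coeFn_add (F i) (∑ i ∈ s, F i)] with x h1 h2
    rw [Finset.sum_insert hi, Finset.sum_insert hi, h2, Pi.add_apply, h1]

variable {d : ℕ}

/-- Uniformly bounded functions with a common bounded support that are asymptotically orthogonal
have means of arbitrarily small `L¹` norm. -/
lemma exists_norm_sum_le {e : ℕ → (Fin d → ℝ) → EC d} {W : ℕ → LE d} {R M : ℝ}
    (hc : ∀ j, Continuous (e j)) (h0 : ∀ j x, R ≤ ‖x‖ → e j x = 0) (hM : ∀ j x, ‖e j x‖ ≤ M)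
    (hw : ∀ i, Tendsto (fun j => ∫ x, inner ℂ (e i x) (e j x)) atTop (𝓝 0))
    (hW : ∀ j, W j =ᵐ[volume] e j) {ε : ℝ} (hε : 0 < ε) :
    ∃ Λ : Finset ℕ, Λ.Nonempty ∧ ‖∑ j ∈ Λ, W j‖ ≤ ε * Λ.card := by
  set s : Set (Fin d → ℝ) := Metric.closedBall 0 R
  set μ : Measure (Fin d → ℝ) := volume.restrict s
  have hμ : IsFiniteMeasure μ :=
    ⟨by rw [Measure.restrict_apply_univ]; exact measure_closedBall_lt_top⟩
  have hL : ∀ j, MemLp (e j) 2 μ := fun j =>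
    MemLp.of_bound (hc j).aestronglyMeasurable M (ae_of_all _ (hM j))
  have hout : ∀ j, ∀ x ∉ s, e j x = 0 := fun j x hx => h0 j x (by
    simp only [s, Metric.mem_closedBall, dist_zero_right, not_le] at hx
    exact hx.le)
  set v : ℕ → Lp (EC d) 2 μ := fun j => (hL j).toLp (e j)
  have hv : ∀ j, v j =ᵐ[μ] e j := fun j => (hL j).coeFn_toLp
  have hin : ∀ i j, inner ℂ (v i) (v j) = ∫ x, inner ℂ (e i x) (e j x) := fun i j => by
    rw [L2.inner_def, ← setIntegral_eq_integral_of_forall_compl_eq_zero (s := s) (μ := volume)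
      (f := fun x => inner ℂ (e i x) (e j x)) fun x hx => by rw [hout j x hx, inner_zero_right]]
    refine integral_congr_ae ?_
    filter_upwards [hv i, hv j] with x h1 h2
    rw [h1, h2]
  have hM0 : 0 ≤ M := (norm_nonneg _).trans (hM 0 0)
  set M' : ℝ := measureUnivNNReal μ ^ (2 : ℝ≥0∞).toReal⁻¹ * M
  have hvM : ∀ j, ‖v j‖ ≤ M' := fun j => Lp.norm_le_of_ae_bound hM0 (by
    filter_upwards [hv j] with x hx
    rw [hx]; exact hM j x)
  set q : ℝ := (μ Set.univ ^ (1 / (1 : ℝ≥0∞).toReal - 1 / (2 : ℝ≥0∞).toReal)).toReal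
  have hq : ∀ Λ : Finset ℕ, ‖∑ j ∈ Λ, W j‖ ≤ ‖∑ j ∈ Λ, v j‖ * q := fun Λ => by
    have e1 : ‖∑ j ∈ Λ, W j‖ = ∫ x, ‖∑ j ∈ Λ, e j x‖ := by
      rw [LE.norm_eq]
      refine integral_congr_ae ?_
      filter_upwards [Lp.coeFn_sum Λ W, ae_all_iff.2 hW] with x h1 h2
      rw [h1]; simp only [h2]
    have e2 : ∫ x, ‖∑ j ∈ Λ, e j x‖ = ∫ x, ‖(∑ j ∈ Λ, v j) x‖ ∂μ := by
      rw [← setIntegral_eq_integral_of_forall_compl_eq_zero (s := s) (μ := volume)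
        (f := fun x => ‖∑ j ∈ Λ, e j x‖) fun x hx => by
          rw [Finset.sum_eq_zero fun j _ => hout j x hx, norm_zero]]
      refine integral_congr_ae ?_
      filter_upwards [Lp.coeFn_sum Λ v, ae_all_iff.2 hv] with x h1 h2
      rw [h1]; simp only [h2]
    rw [e1, e2, integral_norm_eq_lintegral_enorm (Lp.aestronglyMeasurable _),
      ← eLpNorm_one_eq_lintegral_enorm, Lp.norm_def, ← ENNReal.toReal_mul]
    refine ENNReal.toReal_mono (ENNReal.mul_ne_top (Lp.eLpNorm_ne_top _) ?_)
      (eLpNorm_le_eLpNorm_mul_rpow_measure_univ (by norm_num) (Lp.aestronglyMeasurable _))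
    exact ENNReal.rpow_ne_top_of_nonneg (by norm_num) (measure_ne_top _ _)
  have hq0 : 0 ≤ q := ENNReal.toReal_nonneg
  obtain ⟨n, hn⟩ := exists_nat_gt ((M' ^ 2 + 2) * q ^ 2 / ε ^ 2)
  obtain ⟨Λ, hΛ, hle⟩ := exists_finset_norm_sum_sq_le hvM (fun i => by simpa only [hin] using hw i) (n + 1)
  refine ⟨Λ, Finset.card_pos.1 (by omega), (hq Λ).trans ?_⟩
  rw [hΛ]
  refine abs_le_of_sq_le_sq' ?_ (by positivity) |>.2
  rw [div_lt_iff₀ (by positivity)] at hn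
  rw [mul_pow, mul_pow]
  calc ‖∑ j ∈ Λ, v j‖ ^ 2 * q ^ 2 ≤ ((n + 1 : ℕ) * (M' ^ 2 + 2)) * q ^ 2 := by gcongr
    _ = (n + 1 : ℕ) * ((M' ^ 2 + 2) * q ^ 2) := by ring
    _ ≤ (n + 1 : ℕ) * (n * ε ^ 2) := by gcongr
    _ ≤ ε ^ 2 * (n + 1 : ℕ) ^ 2 := by
      push_cast
      nlinarith [sq_nonneg ε, mul_nonneg (sq_nonneg ε) (Nat.cast_nonneg (α := ℝ) n)]

variable {b : Matrix (Fin d) (Fin d) ℝ} {η f : (Fin d → ℝ) → ℂ} {u : (Fin d → ℝ) → EC d}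

lemma exists_latticeBdd_of_hasCompactSupport (hb : b.det ≠ 0) (hη : Continuous η)
    (hηs : HasCompactSupport η) : ∃ B : ℝ, 0 ≤ B ∧ LatticeBdd b η B := by
  obtain ⟨C, hC⟩ := exists_decay_of_hasCompactSupport hη hηs (2 * d)
  exact exists_latticeBdd hb hC

lemma exists_sum_translates_le (hb : b.det ≠ 0) (hu : Continuous u) (hus : HasCompactSupport u) :
    ∃ B : ℝ, ∀ y, ∀ K : Finset (Fin d → ℤ), ∑ k ∈ K, ‖u (y - b *ᵥ intVec k)‖ ≤ B := by
  obtain ⟨B, -, hB⟩ := exists_latticeBdd_of_hasCompactSupport (b := b)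
    (η := fun x => ((‖u (-x)‖ : ℝ) : ℂ)) hb (by fun_prop)
    ((hus.comp_homeomorph (Homeomorph.neg _)).mono fun x hx h => hx (by
      simp [show u (-x) = 0 from h]))
  refine ⟨B, fun y K => ?_⟩
  have h1 := hB y
  simp only [neg_sub, Complex.norm_real, norm_norm] at h1
  exact (h1.1.sum_le_tsum K fun _ _ => norm_nonneg _).trans h1.2

lemma exists_norm_sum_osc_le_of_compact (hb : b.det ≠ 0) (hη : Continuous η)
    (hηs : HasCompactSupport η) (hf : Continuous f) (hfs : HasCompactSupport f)
    (hu : Continuous u) (hus : HasCompactSupport u) (hu0 : ∫ x, u x = 0) {U : LE d}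
    (hU : U =ᵐ[volume] u) {α : ℕ → ℝ} (hα : ∀ j, α j ≠ 0) (hα1 : ∀ j, 1 ≤ |α j|)
    (hαtop : Tendsto (fun j => |α j|) atTop atTop) {ε : ℝ} (hε : 0 < ε) :
    ∃ Λ : Finset ℕ, Λ.Nonempty ∧
      ‖∑ j ∈ Λ, dil (α j) (hα j) (osc b η f U (α j))‖ ≤ ε * Λ.card := by
  obtain ⟨B, -, hB⟩ := exists_latticeBdd_of_hasCompactSupport hb hη hηs
  obtain ⟨Bu, hBu⟩ := exists_sum_translates_le hb hu hus
  obtain ⟨Rη, hRη0, hRη⟩ := hηs.exists_pos_le_norm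
  obtain ⟨Rf, hRf0, hRf⟩ := hfs.exists_pos_le_norm
  obtain ⟨Ru, hRu0, hRu⟩ := hus.exists_pos_le_norm
  obtain ⟨Mf, hMf⟩ := hfs.exists_bound_of_continuous hf
  have hfi := hf.integrable_of_hasCompactSupport (μ := volume) hfs
  have hηi := hη.integrable_of_hasCompactSupport (μ := volume) hηs
  set K : ℕ → Finset (Fin d → ℤ) := fun j => latBall hb (Rη + |α j| * Rf)
  have hK : ∀ j, ∀ k ∉ K j, smp b η (α j) f k = 0 := fun j k hk => by
    rw [mem_latBall, not_le] at hk
    exact smp_eq_zero hRη hRf hk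
  have hcont : ∀ j, Continuous (oscFun b η f u (K j) (α j)) := fun j => continuous_oscFun hu _ _
  have hzero : ∀ j x, Rη + Rf + Ru ≤ ‖x‖ → oscFun b η f u (K j) (α j) x = 0 := fun j x hx => by
    refine oscFun_eq_zero hRu (fun k hk => (mem_latBall hb).1 hk) ?_
    have h1 := mul_le_mul_of_nonneg_left hx (abs_nonneg (α j))
    have h2 := mul_le_mul_of_nonneg_right (hα1 j) (add_pos hRη0 hRu0).le
    linarith
  refine exists_norm_sum_le hcont hzero
    (fun j x => norm_oscFun_le (hα j) (norm_smp_le hηi hMf (hα j)) hBu (K j) x)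
    (fun i => ?_) (fun j => dil_osc_ae hB hη hfi (hα j) (hK j) hU) hε
  have hgs : HasCompactSupport (oscFun b η f u (K i) (α i)) :=
    HasCompactSupport.of_support_subset_isCompact
      (isCompact_closedBall (0 : Fin d → ℝ) (Rη + Rf + Ru)) fun x hx => by
        by_contra h
        simp only [Metric.mem_closedBall, dist_zero_right, not_le] at h
        exact hx (hzero i x h.le)
  have huc := hgs.uniformContinuous_of_continuous (hcont i)
  set A := |b.det| * B * ∫ y, ‖f y‖
  have hsum : ∀ j, ∑ k ∈ K j, ‖smp b η (α j) f k‖ ≤ A := fun j =>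
    ((smp_sum_le hB hη hfi (α j)).1.sum_le_tsum _ fun _ _ => norm_nonneg _).trans
      (smp_sum_le hB hη hfi (α j)).2
  have hA0 : 0 ≤ A := (Finset.sum_nonneg fun _ _ => norm_nonneg _).trans (hsum 0)
  set Iu := ∫ x, ‖u x‖
  have hIu : 0 ≤ Iu := integral_nonneg fun _ => norm_nonneg _
  rw [Metric.tendsto_nhds]
  intro ρ hρ
  obtain ⟨δ, hδ, hδu⟩ := Metric.uniformContinuous_iff.1 huc (ρ / (A * Iu + 1)) (by positivity)
  filter_upwards [hαtop.eventually_gt_atTop (Ru / δ)] with j hj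
  rw [dist_zero_right]
  rw [div_lt_iff₀ hδ] at hj
  have hαj : 0 < |α j| := abs_pos.2 (hα j)
  have hosc : ∀ p y : Fin d → ℝ, ‖y‖ ≤ Ru → ‖oscFun b η f u (K i) (α i) (p + (α j)⁻¹ • y)
      - oscFun b η f u (K i) (α i) p‖ ≤ ρ / (A * Iu + 1) := fun p y hy => by
    rw [← dist_eq_norm]
    refine (hδu ?_).le
    rw [dist_eq_norm, add_sub_cancel_left, norm_smul, norm_inv, Real.norm_eq_abs,
      inv_mul_lt_iff₀ hαj]
    exact hy.trans_lt hj
  refine (norm_integral_inner_oscFun_le hu hus (hcont i) (hα j)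
    (fun k => integral_inner_dilate hu hus hu0 (hcont i) hRu (hα j) hosc k) (hsum j)).trans_lt ?_
  have h0 : 0 < A * Iu + 1 := by positivity
  calc A * (ρ / (A * Iu + 1) * Iu) = ρ * ((A * Iu) / (A * Iu + 1)) := by field_simp
    _ < ρ * 1 := by
      refine mul_lt_mul_of_pos_left ?_ hρ
      rw [div_lt_one h0]; linarith
    _ = ρ := mul_one ρ

end Averaging

section Oscillation

variable {d : ℕ} {b : Matrix (Fin d) (Fin d) ℝ} {η f : (Fin d → ℝ) → ℂ}

lemma exists_compactSupport_approx {E : Type*} [NormedAddCommGroup E] [NormedSpace ℂ E]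
    [CompleteSpace E] {H : (Fin d → ℝ) → E} (hH : Integrable H) (hH0 : ∫ x, H x = 0) {ε : ℝ}
    (hε : 0 < ε) : ∃ u : (Fin d → ℝ) → E, Continuous u ∧ HasCompactSupport u ∧
      ∫ x, u x = 0 ∧ ∫ x, ‖H x - u x‖ ≤ ε := by
  obtain ⟨u, hus, hu, huc, hui⟩ := hH.exists_hasCompactSupport_integral_sub_le (half_pos hε)
  let φ : ContDiffBump (0 : Fin d → ℝ) := ⟨1, 2, one_pos, one_lt_two⟩
  set g := φ.normed (volume : Measure (Fin d → ℝ))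
  have hgc : Continuous g := φ.continuous_normed
  have hgs : HasCompactSupport g := φ.hasCompactSupport_normed
  have hgi : Integrable g := hgc.integrable_of_hasCompactSupport hgs
  have hg1 : ∫ x, g x = 1 := φ.integral_normed
  set v := ∫ x, u x
  have hv : ‖v‖ ≤ ε / 2 := by
    have e : v = -∫ x, (H x - u x) := by rw [integral_sub hH hui, hH0, zero_sub, neg_neg]
    rw [e, norm_neg]
    exact (norm_integral_le_integral_norm _).trans hu
  have hgv : Integrable fun x => ((g x : ℝ) : ℂ) • v := hgi.ofReal.smul_const v
  refine ⟨fun x => u x - ((g x : ℝ) : ℂ) • v, by fun_prop, ?_, ?_, ?_⟩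
  · refine hus.sub (hgs.mono fun x hx h => hx ?_)
    simp [show g x = 0 from h]
  · rw [integral_sub hui hgv, integral_smul_const, integral_complex_ofReal, hg1]
    simp [v]
  · have h1 : ∀ x, ‖H x - (u x - ((g x : ℝ) : ℂ) • v)‖ ≤ ‖H x - u x‖ + g x * ‖v‖ := fun x => by
      rw [sub_sub_eq_add_sub, add_sub_right_comm]
      refine (norm_add_le _ _).trans (le_of_eq ?_)
      rw [norm_smul, Complex.norm_real, Real.norm_eq_abs, abs_of_nonneg (φ.nonneg_normed x)]
    refine (integral_mono (hH.sub (hui.sub hgv)).norm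
      ((hH.sub hui).norm.add (hgi.mul_const ‖v‖)) h1).trans ?_
    rw [integral_add' (hH.sub hui).norm (hgi.mul_const ‖v‖), integral_mul_const, hg1]
    simp only [Pi.sub_apply]
    linarith

lemma exists_compactSupport_latticeBdd (hb : b.det ≠ 0) (hη : Continuous η) {C : ℝ}
    (hC : ∀ x, ‖η x‖ ≤ C * ((1 + ‖x‖) ^ (2 * d + 1))⁻¹) {ε : ℝ} (hε : 0 < ε) :
    ∃ η' : (Fin d → ℝ) → ℂ, Continuous η' ∧ HasCompactSupport η' ∧
      LatticeBdd b (fun x => η x - η' x) ε := by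
  obtain ⟨A, hA, h⟩ := exists_latticeBdd_const hb
  have hC0 : 0 ≤ C := by
    have := (norm_nonneg _).trans (hC 0)
    simpa using this
  obtain ⟨R, hR⟩ := exists_nat_gt (C * A / ε)
  rw [div_lt_iff₀ hε] at hR
  set ρ : (Fin d → ℝ) → ℝ := fun x => max 0 (min 1 (R + 1 - ‖x‖))
  have hρ : Continuous ρ := by fun_prop
  have hD : LatticeBdd b (fun x => η x - (ρ x : ℂ) * η x) (C / (1 + R) * A) := by
    refine h _ _ fun x => ?_
    have hx0 := norm_nonneg x
    rcases le_or_gt ‖x‖ R with hx | hx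
    · have : ρ x = 1 := by
        simp only [ρ]
        rw [min_eq_left (by linarith), max_eq_right zero_le_one]
      rw [this, Complex.ofReal_one, one_mul, sub_self, norm_zero]
      positivity
    · have h1 : ‖η x - (ρ x : ℂ) * η x‖ ≤ ‖η x‖ := by
        have e : η x - (ρ x : ℂ) * η x = ((1 - ρ x : ℝ) : ℂ) * η x := by push_cast; ring
        rw [e, norm_mul, Complex.norm_real, Real.norm_eq_abs]
        refine mul_le_of_le_one_left (norm_nonneg _) ?_
        rw [abs_le]
        have : 0 ≤ ρ x := le_max_left _ _
        have : ρ x ≤ 1 := max_le zero_le_one (min_le_left _ _)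
        constructor <;> linarith
      refine (h1.trans (hC x)).trans ?_
      rw [pow_succ, mul_inv, mul_comm (((1 + ‖x‖) ^ (2 * d))⁻¹), ← mul_assoc, ← div_eq_mul_inv]
      refine mul_le_mul_of_nonneg_right (div_le_div_of_nonneg_left hC0 ?_ ?_) (by positivity) <;>
        linarith [Nat.cast_nonneg (α := ℝ) R]
  have hle : C / (1 + R) * A ≤ ε := by
    rw [div_mul_eq_mul_div, div_le_iff₀ (by positivity)]
    nlinarith
  refine ⟨fun x => (ρ x : ℂ) * η x, by fun_prop, ?_, fun y => ⟨(hD y).1, (hD y).2.trans hle⟩⟩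
  refine HasCompactSupport.of_support_subset_isCompact
    (isCompact_closedBall (0 : Fin d → ℝ) (R + 1)) fun x hx => ?_
  by_contra hx'
  simp only [Metric.mem_closedBall, dist_zero_right, not_le] at hx'
  refine hx ?_
  have : ρ x = 0 := max_eq_left ((min_le_right _ _).trans (by linarith))
  simp [this]

lemma mul_div_add_one_le {x ρ : ℝ} (hx : 0 ≤ x) (hρ : 0 ≤ ρ) : x * (ρ / (x + 1)) ≤ ρ := by
  rw [mul_div_assoc', div_le_iff₀ (by positivity)]
  nlinarith

/-- Means of the dilated lattice sums `osc` over suitable sets of scales are arbitrarily small. -/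
lemma exists_norm_sum_osc_le (hb : b.det ≠ 0) (hη : Continuous η) {C : ℝ}
    (hC : ∀ x, ‖η x‖ ≤ C * ((1 + ‖x‖) ^ (2 * d + 1))⁻¹) {B : ℝ} (hB : LatticeBdd b η B)
    (hf : Integrable f) {H : LE d} (hH : vft 0 H = 0) {α : ℕ → ℝ} (hα : ∀ j, α j ≠ 0)
    (hαtop : Tendsto (fun j => |α j|) atTop atTop) {ε : ℝ} (hε : 0 < ε) (J : ℕ) :
    ∃ Λ : Finset ℕ, Λ.Nonempty ∧ (∀ j ∈ Λ, J ≤ j) ∧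
      ‖∑ j ∈ Λ, dil (α j) (hα j) (osc b η f H (α j))‖ ≤ ε * Λ.card := by
  have hε6 : 0 < ε / 6 := by positivity
  set δ := |b.det|
  have hδ : 0 ≤ δ := abs_nonneg _
  have hf0 : 0 ≤ ∫ y, ‖f y‖ := integral_nonneg fun _ => norm_nonneg _
  obtain ⟨η', hη', hηs', hD⟩ := exists_compactSupport_latticeBdd (b := b) hb hη hC
    (ε := ε / 6 / (δ * ((∫ y, ‖f y‖) * ‖H‖) + 1)) (by positivity)
  obtain ⟨B', hB0', hB'⟩ := exists_latticeBdd_of_hasCompactSupport (b := b) hb hη' hηs'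
  obtain ⟨f', hfs', hff', hfc', hfi'⟩ := hf.exists_hasCompactSupport_integral_sub_le
    (ε := ε / 6 / (δ * (B' * ‖H‖) + 1)) (by positivity)
  have hf0' : 0 ≤ ∫ y, ‖f' y‖ := integral_nonneg fun _ => norm_nonneg _
  obtain ⟨u, hu, hus, hu0, hHu⟩ := exists_compactSupport_approx H.integrable
    (by simpa only [vft_eq, zero_dotP, neg_zero, ech_zero, one_smul] using hH)
    (ε := ε / 6 / (δ * (B' * ∫ y, ‖f' y‖) + 1)) (by positivity)
  have hui := hu.integrable_of_hasCompactSupport (μ := volume) hus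
  set U : LE d := hui.toL1 u
  have hU : U =ᵐ[volume] u := hui.coeFn_toL1
  have hHU : ‖H - U‖ ≤ ε / 6 / (δ * (B' * ∫ y, ‖f' y‖) + 1) := by
    have e : ∫ x, ‖(H - U) x‖ = ∫ x, ‖H x - u x‖ := by
      refine integral_congr_ae ?_
      filter_upwards [Lp.coeFn_sub H U, hU] with x h1 h2
      rw [h1, Pi.sub_apply, h2]
    rw [LE.norm_eq, e]
    exact hHu
  have hdiff : ∀ a, ‖osc b η f H a - osc b η' f' U a‖ ≤ ε / 2 := fun a => by
    refine (norm_osc_sub_le hB hη hB' hη' hD hf hfi' H U a).trans ?_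
    have h1 := mul_div_add_one_le (x := δ * ((∫ y, ‖f y‖) * ‖H‖)) (by positivity) hε6.le
    have h2 := (mul_le_mul_of_nonneg_left hff' (show 0 ≤ δ * (B' * ‖H‖) by positivity)).trans
      (mul_div_add_one_le (by positivity) hε6.le)
    have h3 := (mul_le_mul_of_nonneg_left hHU
      (show 0 ≤ δ * (B' * ∫ y, ‖f' y‖) by positivity)).trans
      (mul_div_add_one_le (by positivity) hε6.le)
    linarith
  obtain ⟨J₁, hJ₁⟩ := eventually_atTop.1 ((hαtop.eventually_ge_atTop 1).and (eventually_ge_atTop J))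
  have hsh : Tendsto (fun j => J₁ + j) atTop atTop := tendsto_atTop_mono (fun j => Nat.le_add_left j J₁) tendsto_id
  obtain ⟨Λ, hΛ, hle⟩ := exists_norm_sum_osc_le_of_compact hb hη' hηs' hfc' hfs' hu hus hu0 hU
    (α := fun j => α (J₁ + j)) (fun j => hα _) (fun j => (hJ₁ _ (by omega)).1) (hαtop.comp hsh)
    (half_pos hε)
  refine ⟨Λ.map (addLeftEmbedding J₁), hΛ.map, fun j hj => ?_, ?_⟩
  · obtain ⟨i, -, rfl⟩ := Finset.mem_map.1 hj
    exact (hJ₁ _ (Nat.le_add_right _ _)).2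
  rw [Finset.sum_map, Finset.card_map]
  simp only [addLeftEmbedding_apply]
  have e : ∑ j ∈ Λ, dil (α (J₁ + j)) (hα _) (osc b η f H (α (J₁ + j))) =
      ∑ j ∈ Λ, dil (α (J₁ + j)) (hα _) (osc b η' f' U (α (J₁ + j))) +
      ∑ j ∈ Λ, dil (α (J₁ + j)) (hα _) (osc b η f H (α (J₁ + j)) - osc b η' f' U (α (J₁ + j))) := by
    rw [← Finset.sum_add_distrib]
    simp only [← map_add, add_sub_cancel]
  rw [e]
  refine (norm_add_le _ _).trans ?_
  have h2 : ‖∑ j ∈ Λ, dil (α (J₁ + j)) (hα _)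
      (osc b η f H (α (J₁ + j)) - osc b η' f' U (α (J₁ + j)))‖ ≤ Λ.card * (ε / 2) := by
    refine (norm_sum_le _ _).trans ?_
    refine (Finset.sum_le_card_nsmul Λ _ (ε / 2) fun j _ => ?_).trans (by rw [nsmul_eq_mul])
    rw [LinearIsometry.norm_map]
    exact hdiff _
  linarith

end Oscillation

section Scales

variable {d : ℕ}

lemma dil_inv_dil {a : ℝ} (ha : a ≠ 0) (F : LE d) :
    dil a⁻¹ (inv_ne_zero ha) (dil a ha F) = F :=
  (dil a ha).injective (dil_dil_inv ha _)

lemma cv_sub {Φ : (Fin d → ℝ) → ℂ} (hΦ : Integrable Φ) (F G : LE d) :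
    cv Φ (F - G) = cv Φ F - cv Φ G :=
  LE.ext_of_vft (ae_of_all _ fun ξ => by
    rw [vft_cv hΦ, map_sub, map_sub, vft_cv hΦ, vft_cv hΦ, smul_sub])

lemma tendsto_dil_cv_dil_of_tendsto {Φ : (Fin d → ℝ) → ℂ} (hΦ : Integrable Φ)
    (hΦ1 : ∫ t, Φ t = 1) {α : ℕ → ℝ} (hα : ∀ j, α j ≠ 0)
    (hαtop : Tendsto (fun j => |α j|) atTop atTop) {X : ℕ → LE d} {F : LE d}
    (hX : Tendsto X atTop (𝓝 F)) :
    Tendsto (fun j => dil (α j) (hα j) (cv Φ (dil (α j)⁻¹ (inv_ne_zero (hα j)) (X j)))) atTop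
      (𝓝 F) := by
  have h1 : Tendsto (fun j => dil (α j) (hα j)
      (cv Φ (dil (α j)⁻¹ (inv_ne_zero (hα j)) (X j - F)))) atTop (𝓝 0) := by
    refine squeeze_zero_norm (a := fun j => (∫ t, ‖Φ t‖) * ‖X j - F‖) (fun j => ?_) ?_
    · rw [LinearIsometry.norm_map]
      exact (norm_cv_le _ _).trans_eq (by rw [LinearIsometry.norm_map])
    · simpa using (tendsto_iff_norm_sub_tendsto_zero.1 hX).const_mul (∫ t, ‖Φ t‖)
  have h2 := h1.add (tendsto_dil_cv_dil hΦ hΦ1 hα hαtop F)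
  rw [zero_add] at h2
  refine h2.congr fun j => ?_
  rw [map_sub, cv_sub hΦ, map_sub, sub_add_cancel]

lemma tendsto_dil_cv_cv_cv_dil {ψ η : (Fin d → ℝ) → ℂ} (hψ : Integrable ψ) (hψ1 : ∫ t, ψ t = 1)
    (hη : Integrable η) (hη1 : ∫ t, η t = 1) {α : ℕ → ℝ} (hα : ∀ j, α j ≠ 0)
    (hαtop : Tendsto (fun j => |α j|) atTop atTop) (F : LE d) :
    Tendsto (fun j => dil (α j) (hα j)
      (cv ψ (cv η (cv η (dil (α j)⁻¹ (inv_ne_zero (hα j)) F))))) atTop (𝓝 F) := by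
  have h := tendsto_dil_cv_dil_of_tendsto hψ hψ1 hα hαtop
    (tendsto_dil_cv_dil_of_tendsto hη hη1 hα hαtop (tendsto_dil_cv_dil hη hη1 hα hαtop F))
  simpa only [dil_inv_dil] using h

variable {b : Matrix (Fin d) (Fin d) ℝ} {ν : (Fin d → ℝ) → ℝ} {α : ℕ → ℝ} {ψ : (Fin d → ℝ) → ℂ}

/-- The part of the synthesis series at scale `j`. -/
def scaleTerm (α : ℕ → ℝ) (b : Matrix (Fin d) (Fin d) ℝ) (ψ : (Fin d → ℝ) → ℂ) (j : ℕ)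
    (s : (Fin d → ℤ) → ℂ) (x : Fin d → ℝ) : ℂ :=
  ∑' k : Fin d → ℤ, s k * rescH α b ψ j k x

lemma scaleTerm_eq (j : ℕ) (s : (Fin d → ℤ) → ℂ) (x : Fin d → ℝ) :
    scaleTerm α b ψ j s x =
      ((|α j| ^ d : ℝ) : ℂ) * ∑' k, s k * ψ (α j • x - b *ᵥ intVec k) := by
  rw [scaleTerm, ← tsum_mul_left]
  exact tsum_congr fun k => by rw [rescH]; ring

lemma scaleTerm_smul (j : ℕ) (c : ℂ) (s : (Fin d → ℤ) → ℂ) :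
    scaleTerm α b ψ j (c • s) = fun x => c * scaleTerm α b ψ j s x := by
  funext x
  rw [scaleTerm, scaleTerm, ← tsum_mul_left]
  exact tsum_congr fun k => by rw [Pi.smul_apply, smul_eq_mul, mul_assoc]

lemma IsLift.const_mul {F : LE d} {f : (Fin d → ℝ) → ℂ} (h : IsLift F f) (c : ℂ) :
    IsLift (c • F) fun x => c * f x :=
  ⟨h.1.smul c, by
    filter_upwards [h.2, Lp.coeFn_smul c F] with x hx hx2
    rw [hx2, hx, Pi.smul_apply, PiLp.smul_apply, smul_eq_mul]⟩

lemma isLift_zero : IsLift (0 : LE d) fun _ => 0 := by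
  refine ⟨Rz.zero, ?_⟩
  filter_upwards [Lp.coeFn_zero (EC d) 1 (volume : Measure (Fin d → ℝ))] with x hx
  rw [hx]; rfl

lemma h1Norm_smul (c : ℂ) (s : (Fin d → ℤ) → ℂ) : h1Norm b ν (c • s) = ‖c‖ₑ * h1Norm b ν s := by
  have e : ∀ k, dConv (c • s) (zKernel b ν) k = c • dConv s (zKernel b ν) k := fun k => by
    rw [dConv, dConv, ← tsum_const_smul'']
    exact tsum_congr fun l => by rw [Pi.smul_apply, smul_assoc]
  simp only [h1Norm, e, Pi.smul_apply, nnnorm_smul, ENNReal.coe_mul, ENNReal.tsum_mul_left,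
    mul_add, enorm_eq_nnnorm]

lemma h1Norm_zero : h1Norm b ν (0 : (Fin d → ℤ) → ℂ) = 0 := by
  simpa using h1Norm_smul (b := b) (ν := ν) 0 (0 : (Fin d → ℤ) → ℂ)

lemma scaleTerm_zero (j : ℕ) : scaleTerm α b ψ j 0 = fun _ => 0 := by
  funext x
  simp [scaleTerm]

theorem exists_lift_bound_and_samples (hb : b.det ≠ 0) (hα : ∀ j, α j ≠ 0)
    (hαtop : Tendsto (fun j => |α j|) atTop atTop) (hν : IsCutoff d ν) (hψ : Integrable ψ)
    (hint : ∫ x, ψ x = 1) (hcont : HasContIncr ψ) :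
    (∃ A : ℝ, 0 < A ∧ ∀ j s, h1Norm b ν s ≠ ⊤ →
      ∃ G : LE d, IsLift G (scaleTerm α b ψ j s) ∧ ‖G‖ ≤ A * (h1Norm b ν s).toReal) ∧
    ∃ C : ℝ, 0 ≤ C ∧ ∀ F : LE d, Rz F → ∃ (s : ℕ → (Fin d → ℤ) → ℂ) (G : ℕ → LE d),
      (∀ j, h1Norm b ν (s j) ≤ ENNReal.ofReal (C * ‖F‖) ∧
        IsLift (G j) (scaleTerm α b ψ j (s j))) ∧
      ∀ ε : ℝ, 0 < ε → ∀ J : ℕ, ∃ Λ : Finset ℕ, Λ.Nonempty ∧ (∀ j ∈ Λ, J ≤ j) ∧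
        ‖(Λ.card : ℂ) • F - ∑ j ∈ Λ, G j‖ ≤ ε * Λ.card := by
  obtain ⟨χ, hχc, hχs, hχ0, hχ, hη⟩ := exists_bump (b := b) hν
  have hχi : Integrable χ := hχc.integrable_of_hasCompactSupport hχs
  obtain ⟨K, hK⟩ := hχs.exists_bound_of_continuous hχc
  obtain ⟨H, hH, hHn, hH0⟩ := exists_remainder hψ hcont hχc hχi hχ0 hη
  have hηc : Continuous (ftInv χ) := continuous_ftInv hχi
  obtain ⟨C, -, hC⟩ := hη (2 * d + 1)
  obtain ⟨C', -, hC'⟩ := hη (2 * d)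
  obtain ⟨B, hB0, hB⟩ := exists_latticeBdd hb hC'
  have hηi : Integrable (ftInv χ) :=
    ((integrable_inv_one_add_norm_pow (show d < 2 * d + 1 by lia)).const_mul C).mono'
      hηc.aestronglyMeasurable (ae_of_all _ hC)
  have hft : ∀ ξ, ft (ftInv χ) ξ = χ ξ := ft_ftInv hχc hχi hηi
  have hη1 : ∫ x, ftInv χ x = 1 := by rw [← ft_zero, hft, hχ0]
  have lift : ∀ j s, (Summable fun k => ‖s k‖) → (Summable fun k => ‖dConv s (zKernel b ν) k‖) →
      IsLift (dil (α j) (hα j) (syn b (fun k => s k • H) +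
        cv ψ (syn b fun k => ten hηi (coefE b ν s k)))) (scaleTerm α b ψ j s) := fun j s h1 h2 => by
    rw [show scaleTerm α b ψ j s = _ from funext (scaleTerm_eq j s)]
    exact (isLift_synthesis hb hν hηi hψ hft hχ hH hHn h1 h2).dil (hα j)
  refine ⟨⟨‖H‖ + (d + 1) * ((∫ t, ‖ψ t‖) * ∫ t, ‖ftInv χ t‖) + 1, by positivity,
    fun j s hs => ?_⟩, 2 * (|b.det| * B), by positivity, fun F hF => ?_⟩
  · obtain ⟨h1, h2, h3⟩ := h1Norm_ne_top hs
    refine ⟨_, lift j s h1 h2, ?_⟩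
    have h0 : 0 ≤ (∑' k, ‖s k‖) + ∑' k, ‖dConv s (zKernel b ν) k‖ := by positivity
    rw [LinearIsometry.norm_map, h3, ENNReal.toReal_ofReal h0]
    refine (norm_synthesis_le hηi h1 h2).trans ?_
    exact mul_le_mul_of_nonneg_right (le_add_of_nonneg_right zero_le_one) h0
  · have hs : ∀ j, coefE b ν (smp b (ftInv χ) (α j) fun x => F x none) =
        anaE b (ftInv χ) (dil (α j)⁻¹ (inv_ne_zero (hα j)) F) := fun j => by
      rw [← coefE_anaE hb hν hχc hχi hK hχ hB (hF.dil (inv_ne_zero (hα j)))]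
      exact congrArg _ (funext fun k => (smp_eq_anaE (hα j) hB hηc F k).symm)
    have hsum : ∀ j, _ := fun j =>
      sums_of_coefE (b := b) (ν := ν) (s := smp b (ftInv χ) (α j) fun x => F x none)
        (A := |b.det| * B * ‖F‖) (by
          rw [hs]; exact (anaE_sum_le hB hηc _).1) (by
          rw [hs]
          exact (anaE_sum_le hB hηc _).2.trans_eq (by rw [LinearIsometry.norm_map]))
    have hG : ∀ j, dil (α j) (hα j) (syn b (fun k =>
        smp b (ftInv χ) (α j) (fun x => F x none) k • H) + cv ψ (syn b fun k => ten hηi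
          (coefE b ν (smp b (ftInv χ) (α j) fun x => F x none) k))) =
        dil (α j) (hα j) (osc b (ftInv χ) (fun x => F x none) H (α j)) +
        dil (α j) (hα j) (cv ψ (cv (ftInv χ) (cv (ftInv χ)
          (dil (α j)⁻¹ (inv_ne_zero (hα j)) F)))) := fun j => by
      rw [hs, syn_anaE hb hχc hχi hK hηi (fun ξ h => (hχ ξ h).1) hB, map_add]; rfl
    refine ⟨fun j => smp b (ftInv χ) (α j) fun x => F x none, _, fun j => ⟨?_,
      lift j _ (hsum j).1 (hsum j).2.1⟩, fun ε hε J => ?_⟩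
    · rw [h1Norm_eq (hsum j).1 (hsum j).2.1]
      exact ENNReal.ofReal_le_ofReal ((hsum j).2.2.trans_eq (by ring))
    · simp only [hG]
      have ht := Metric.tendsto_atTop.1
        (tendsto_dil_cv_cv_cv_dil hψ hint hηi hη1 hα hαtop F) (ε / 2) (half_pos hε)
      obtain ⟨J', hJ'⟩ := ht
      obtain ⟨Λ, hΛ, hJ, hn⟩ := exists_norm_sum_osc_le hb hηc hC hB (F.integrable_apply none)
        hH0 hα hαtop (half_pos hε) (max J J')
      refine ⟨Λ, hΛ, fun j hj => (le_max_left _ _).trans (hJ j hj), ?_⟩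
      have e : (Λ.card : ℂ) • F = ∑ _j ∈ Λ, F := by
        rw [Finset.sum_const, Nat.cast_smul_eq_nsmul]
      rw [e, Finset.sum_add_distrib, sub_add_eq_sub_sub_swap, ← Finset.sum_sub_distrib]
      refine (norm_sub_le _ _).trans ?_
      have h2 : ‖∑ j ∈ Λ, (F - dil (α j) (hα j) (cv ψ (cv (ftInv χ) (cv (ftInv χ)
          (dil (α j)⁻¹ (inv_ne_zero (hα j)) F)))))‖ ≤ Λ.card * (ε / 2) := by
        rw [← nsmul_eq_mul]
        refine norm_sum_le_of_le _ (fun j hj => ?_) |>.trans_eq (Finset.sum_const _)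
        rw [← dist_eq_norm, dist_comm]
        exact (hJ' j ((le_max_right _ _).trans (hJ j hj))).le
      linarith

end Scales

section Assembly

variable {d : ℕ} {b : Matrix (Fin d) (Fin d) ℝ} {ν : (Fin d → ℝ) → ℝ} {α : ℕ → ℝ}
  {ψ : (Fin d → ℝ) → ℂ}

lemma exists_halving_step (hb : b.det ≠ 0) (hα : ∀ j, α j ≠ 0)
    (hαtop : Tendsto (fun j => |α j|) atTop atTop) (hν : IsCutoff d ν) (hψ : Integrable ψ)
    (hint : ∫ x, ψ x = 1) (hcont : HasContIncr ψ) :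
    ∃ C : ℝ, 0 ≤ C ∧ ∀ F : LE d, Rz F → ∀ J : ℕ,
      ∃ (c : ℕ → (Fin d → ℤ) → ℂ) (G : ℕ → LE d) (J' : ℕ), J < J' ∧
        (∀ j, IsLift (G j) (scaleTerm α b ψ j (c j))) ∧
        ∑ j ∈ Finset.Ico J J', h1Norm b ν (c j) ≤ ENNReal.ofReal (C * ‖F‖) ∧
        ‖F - ∑ j ∈ Finset.Ico J J', G j‖ ≤ ‖F‖ / 2 := by
  obtain ⟨-, C, hC, h⟩ := exists_lift_bound_and_samples hb hα hαtop hν hψ hint hcont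
  refine ⟨C, hC, fun F hF J => ?_⟩
  obtain hF0 | hF0 := eq_or_lt_of_le (norm_nonneg F)
  · refine ⟨fun _ => 0, fun _ => 0, J + 1, J.lt_succ_self, fun j => ?_, ?_, ?_⟩
    · rw [scaleTerm_zero]; exact isLift_zero
    · simp [h1Norm_zero]
    · simp [← hF0]
  obtain ⟨s, G, hs, hG⟩ := h F hF
  obtain ⟨Λ, hΛ, hJ, hn⟩ := hG (‖F‖ / 2) (half_pos hF0) J
  have hcard : (0 : ℝ) < Λ.card := by exact_mod_cast hΛ.card_pos
  set w : ℂ := (Λ.card : ℂ)⁻¹ with hw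
  have hwc : w * Λ.card = 1 := inv_mul_cancel₀ (by exact_mod_cast hcard.ne')
  have hwn : ‖w‖ = (Λ.card : ℝ)⁻¹ := by simp [hw]
  have hsub : Λ ⊆ Finset.Ico J (Λ.sup id + 1 + J) := fun j hj =>
    Finset.mem_Ico.2 ⟨hJ j hj, by have : j ≤ Λ.sup id := Finset.le_sup (f := id) hj; lia⟩
  refine ⟨fun j => if j ∈ Λ then w • s j else 0, fun j => if j ∈ Λ then w • G j else 0,
    Λ.sup id + 1 + J, by lia, fun j => ?_, ?_, ?_⟩
  · by_cases hj : j ∈ Λ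
    · simp only [hj, if_true]
      rw [scaleTerm_smul]
      exact (hs j).2.const_mul w
    · simp only [hj, if_false]
      rw [scaleTerm_zero]; exact isLift_zero
  · rw [← Finset.sum_subset hsub fun j _ hj => by simp only [hj, if_false, h1Norm_zero]]
    calc ∑ j ∈ Λ, h1Norm b ν (if j ∈ Λ then w • s j else 0)
        ≤ ∑ _j ∈ Λ, ENNReal.ofReal ((Λ.card : ℝ)⁻¹ * (C * ‖F‖)) :=
          Finset.sum_le_sum fun j hj => by
            rw [if_pos hj, h1Norm_smul, ← ofReal_norm, hwn,
              ENNReal.ofReal_mul (by positivity)]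
            exact mul_le_mul' le_rfl (hs j).1
      _ = ENNReal.ofReal (C * ‖F‖) := by
          rw [Finset.sum_const, ← ENNReal.ofReal_nsmul, nsmul_eq_mul,
            mul_inv_cancel_left₀ hcard.ne']
  · rw [← Finset.sum_subset hsub fun j _ hj => by simp only [hj, if_false],
      Finset.sum_congr rfl fun j hj => if_pos hj, ← Finset.smul_sum]
    have e : F - w • ∑ j ∈ Λ, G j = w • ((Λ.card : ℂ) • F - ∑ j ∈ Λ, G j) := by
      rw [smul_sub, smul_smul, hwc, one_smul]
    rw [e, norm_smul, hwn]
    calc (Λ.card : ℝ)⁻¹ * ‖(Λ.card : ℂ) • F - ∑ j ∈ Λ, G j‖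
        ≤ (Λ.card : ℝ)⁻¹ * (‖F‖ / 2 * Λ.card) := by gcongr
      _ = ‖F‖ / 2 := by field_simp

/-- A greedy expansion of a lift into parts of the synthesis series. -/
lemma exists_expansion (hb : b.det ≠ 0) (hα : ∀ j, α j ≠ 0)
    (hαtop : Tendsto (fun j => |α j|) atTop atTop) (hν : IsCutoff d ν) (hψ : Integrable ψ)
    (hint : ∫ x, ψ x = 1) (hcont : HasContIncr ψ) :
    ∃ C : ℝ, 0 ≤ C ∧ ∀ F : LE d, Rz F → ∃ (c : ℕ → (Fin d → ℤ) → ℂ) (G : ℕ → LE d),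
      (∀ j, IsLift (G j) (scaleTerm α b ψ j (c j))) ∧
      l1h1Norm b ν c ≤ ENNReal.ofReal (C * ‖F‖) ∧
      ∃ N : ℕ → ℕ, StrictMono N ∧
        Tendsto (fun n => ∑ j ∈ Finset.range (N n), G j) atTop (𝓝 F) := by
  obtain ⟨C, hC, h⟩ := exists_halving_step (ν := ν) hb hα hαtop hν hψ hint hcont
  choose c G N hN hG hc hF using h
  refine ⟨C * 2, by positivity, fun F₀ hF₀ => ?_⟩
  let st : ℕ → {F : LE d // Rz F} × ℕ := fun n => Nat.rec (⟨F₀, hF₀⟩, 0) (fun _ p =>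
    (⟨p.1.1 - ∑ j ∈ Finset.Ico p.2 (N p.1.1 p.1.2 p.2), G p.1.1 p.1.2 p.2 j,
      p.1.2.sub (Rz.sum _ fun j _ => (hG p.1.1 p.1.2 p.2 j).1)⟩, N p.1.1 p.1.2 p.2)) n
  let R : ℕ → LE d := fun n => (st n).1.1
  have hR : ∀ n, Rz (R n) := fun n => (st n).1.2
  let M : ℕ → ℕ := fun n => (st n).2
  have hM0 : M 0 = 0 := rfl
  have hR0 : R 0 = F₀ := rfl
  have hM : ∀ n, M (n + 1) = N (R n) (hR n) (M n) := fun n => rfl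
  have hRs : ∀ n, R (n + 1) = R n - ∑ j ∈ Finset.Ico (M n) (M (n + 1)), G (R n) (hR n) (M n) j :=
    fun n => rfl
  have hmono : StrictMono M := strictMono_nat_of_lt_succ fun n => (hM n).symm ▸ hN _ _ _
  have hnorm : ∀ n, ‖R n‖ ≤ ‖F₀‖ * (1 / 2) ^ n := fun n => by
    induction n with
    | zero => simp [hR0]
    | succ n ih =>
      rw [hRs, hM]
      refine (hF (R n) (hR n) (M n)).trans ?_
      rw [pow_succ]; linarith
  let q : ℕ → ℕ := fun j => Nat.findGreatest (fun n => M n ≤ j) j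
  have hq : ∀ n, ∀ j ∈ Finset.Ico (M n) (M (n + 1)), q j = n := fun n j hj => by
    obtain ⟨h1, h2⟩ := Finset.mem_Ico.1 hj
    refine le_antisymm ?_ (Nat.le_findGreatest ((hmono.id_le n).trans h1) h1)
    have h3 : M (q j) ≤ j :=
      Nat.findGreatest_spec (P := fun n => M n ≤ j) (Nat.zero_le j) (by rw [hM0]; exact j.zero_le)
    exact Nat.lt_succ_iff.1 (hmono.lt_iff_lt.1 (h3.trans_lt h2))
  let c' : ℕ → (Fin d → ℤ) → ℂ := fun j => c (R (q j)) (hR (q j)) (M (q j)) j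
  let G' : ℕ → LE d := fun j => G (R (q j)) (hR (q j)) (M (q j)) j
  have hc' : ∀ n, ∀ j ∈ Finset.Ico (M n) (M (n + 1)), c' j = c (R n) (hR n) (M n) j :=
    fun n j hj => congrArg (fun n => c (R n) (hR n) (M n) j) (hq n j hj)
  have hG' : ∀ n, ∀ j ∈ Finset.Ico (M n) (M (n + 1)), G' j = G (R n) (hR n) (M n) j :=
    fun n j hj => congrArg (fun n => G (R n) (hR n) (M n) j) (hq n j hj)
  refine ⟨c', G', fun j => hG _ _ _ j, ?_, M, hmono, ?_⟩
  · have key : ∀ n, ∑ j ∈ Finset.range (M n), h1Norm b ν (c' j) ≤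
        ENNReal.ofReal (∑ m ∈ Finset.range n, C * (‖F₀‖ * (1 / 2) ^ m)) := fun n => by
      induction n with
      | zero => simp [hM0]
      | succ n ih =>
        rw [Finset.range_eq_Ico, ← Finset.sum_Ico_consecutive _ (Nat.zero_le _)
          (hmono n.lt_succ_self).le, Finset.sum_range_succ,
          ENNReal.ofReal_add (by positivity) (by positivity), ← Finset.range_eq_Ico]
        refine add_le_add ih ?_
        rw [Finset.sum_congr rfl fun j hj => by rw [hc' n j hj], hM]
        refine (hc _ _ _).trans (ENNReal.ofReal_le_ofReal ?_)
        gcongr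
        exact hnorm n
    refine ENNReal.tsum_le_of_sum_range_le fun n => ?_
    refine (Finset.sum_le_sum_of_subset (Finset.range_subset_range.2 (hmono.id_le n))).trans
      ((key n).trans (ENNReal.ofReal_le_ofReal ?_))
    rw [← Finset.mul_sum, ← Finset.mul_sum, mul_assoc, mul_comm 2]
    gcongr
    exact sum_geometric_two_le n
  · have key : ∀ n, ∑ j ∈ Finset.range (M n), G' j = F₀ - R n := fun n => by
      induction n with
      | zero => simp [hM0, hR0]
      | succ n ih =>
        rw [Finset.range_eq_Ico, ← Finset.sum_Ico_consecutive _ (Nat.zero_le _)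
          (hmono n.lt_succ_self).le, ← Finset.range_eq_Ico, ih, hRs,
          Finset.sum_congr rfl fun j hj => hG' n j hj]
        abel
    simp only [key]
    have h0 : Tendsto R atTop (𝓝 0) := by
      refine squeeze_zero_norm hnorm ?_
      simpa using (tendsto_pow_atTop_nhds_zero_of_lt_one (by norm_num : (0 : ℝ) ≤ 1 / 2)
        (by norm_num)).const_mul ‖F₀‖
    simpa using h0.const_sub F₀

lemma summable_integral_norm_rescH (hα : ∀ j, α j ≠ 0) {s : (Fin d → ℤ) → ℂ}
    (hs : Summable fun k => ‖s k‖) (j : ℕ) :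
    Summable fun k => ∫ x, ‖s k * rescH α b ψ j k x‖ := by
  have e : ∀ k, ∫ x, ‖s k * rescH α b ψ j k x‖ = ‖s k‖ * ∫ x, ‖ψ x‖ := fun k => by
    have h0 : |α j| ^ d ≠ 0 := pow_ne_zero _ (abs_ne_zero.2 (hα j))
    simp only [rescH, norm_mul, integral_const_mul]
    rw [Measure.integral_comp_smul volume (fun x => ‖ψ (x - b *ᵥ intVec k)‖) (α j),
      integral_sub_right_eq_self (fun x => ‖ψ x‖), Module.finrank_fin_fun, smul_eq_mul,
      Complex.norm_real, Real.norm_eq_abs, abs_pow, abs_abs, abs_inv, abs_pow,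
      mul_inv_cancel_left₀ h0]
  simpa only [e] using hs.mul_right _

lemma h1SynthesisTo_of_hasSum (hα : ∀ j, α j ≠ 0) {c : ℕ → (Fin d → ℤ) → ℂ} {G : ℕ → LE d}
    (hc : ∀ j, h1Norm b ν (c j) ≠ ⊤) (hG : ∀ j, IsLift (G j) (scaleTerm α b ψ j (c j)))
    (hs : Summable fun j => ‖G j‖) {F : LE d} {f : (Fin d → ℝ) → ℂ} (hF : IsLift F f)
    (h : HasSum G F) : H1SynthesisTo α b ψ c f := by
  refine ⟨fun j => summable_integral_norm_rescH hα (h1Norm_ne_top (hc j)).1 j,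
    fun j => (hG j).memH1, ?_, ?_⟩
  · refine (hs.mul_left 2).of_nonneg_of_le (fun _ => ENNReal.toReal_nonneg) fun j => ?_
    refine ENNReal.toReal_le_of_le_ofReal (by positivity) ?_
    rw [ENNReal.ofReal_mul zero_le_two, ENNReal.ofReal_ofNat]
    exact (hG j).hardyNorm_le
  · have hl : ∀ J, IsLift (F - ∑ j ∈ Finset.range J, G j) fun x =>
        f x - ∑ j ∈ Finset.range J, scaleTerm α b ψ j (c j) x := fun J =>
      hF.sub (IsLift.sum _ hG)
    refine tendsto_of_tendsto_of_tendsto_of_le_of_le tendsto_const_nhds ?_ (fun _ => zero_le)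
      fun J => (hl J).hardyNorm_le
    have h1 : Tendsto (fun J => ‖F - ∑ j ∈ Finset.range J, G j‖) atTop (𝓝 0) := by
      simpa using (h.tendsto_sum_nat.const_sub F).norm
    have h2 := ENNReal.Tendsto.const_mul (a := 2) (ENNReal.tendsto_ofReal h1) (Or.inr (by simp))
    simpa using h2

lemma hardyNorm_le_of_h1SynthesisTo {A : ℝ} (hA : 0 ≤ A)
    (h : ∀ j s, h1Norm b ν s ≠ ⊤ →
      ∃ G : LE d, IsLift G (scaleTerm α b ψ j s) ∧ ‖G‖ ≤ A * (h1Norm b ν s).toReal)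
    {c : ℕ → (Fin d → ℤ) → ℂ} (hc : l1h1Norm b ν c ≠ ⊤) {f : (Fin d → ℝ) → ℂ} (hf : MemH1 f)
    (hs : H1SynthesisTo α b ψ c f) : hardyNorm f ≤ ENNReal.ofReal (2 * A) * l1h1Norm b ν c := by
  obtain ⟨F, hF⟩ := hf.exists_isLift
  have hcj : ∀ j, h1Norm b ν (c j) ≠ ⊤ := ENNReal.ne_top_of_tsum_ne_top hc
  choose G hG hGn using fun j => h j (c j) (hcj j)
  have hl : ∀ J, IsLift (F - ∑ j ∈ Finset.range J, G j) fun x =>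
      f x - ∑ j ∈ Finset.range J, scaleTerm α b ψ j (c j) x := fun J =>
    hF.sub (IsLift.sum _ hG)
  have h0 : Tendsto (fun J => ENNReal.ofReal ‖F - ∑ j ∈ Finset.range J, G j‖) atTop (𝓝 0) := by
    refine tendsto_of_tendsto_of_tendsto_of_le_of_le tendsto_const_nhds ?_ (fun _ => zero_le)
      fun J => (hl J).norm_le
    have := ENNReal.Tendsto.const_mul (a := (d + 1 : ℝ≥0∞)) hs.2.2.2 (Or.inr (by finiteness))
    rwa [mul_zero] at this
  have hsum : ∀ J, ENNReal.ofReal ‖F‖ ≤ ENNReal.ofReal ‖F - ∑ j ∈ Finset.range J, G j‖ +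
      ENNReal.ofReal A * l1h1Norm b ν c := fun J => by
    have h1 : ENNReal.ofReal ‖∑ j ∈ Finset.range J, G j‖ ≤
        ENNReal.ofReal A * l1h1Norm b ν c := by
      calc ENNReal.ofReal ‖∑ j ∈ Finset.range J, G j‖
          ≤ ENNReal.ofReal (∑ j ∈ Finset.range J, A * (h1Norm b ν (c j)).toReal) :=
            ENNReal.ofReal_le_ofReal (norm_sum_le_of_le _ fun j _ => hGn j)
        _ = ENNReal.ofReal A * ∑ j ∈ Finset.range J, h1Norm b ν (c j) := by
            rw [← Finset.mul_sum, ENNReal.ofReal_mul hA,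
              ← ENNReal.toReal_sum fun j _ => hcj j, ENNReal.ofReal_toReal]
            exact (ENNReal.sum_lt_top.2 fun j _ => (hcj j).lt_top).ne
        _ ≤ _ := mul_le_mul' le_rfl (ENNReal.sum_le_tsum _)
    refine le_trans ?_ (add_le_add le_rfl h1)
    rw [← ENNReal.ofReal_add (norm_nonneg _) (norm_nonneg _)]
    exact ENNReal.ofReal_le_ofReal (norm_le_norm_sub_add F _)
  have hle : ENNReal.ofReal ‖F‖ ≤ ENNReal.ofReal A * l1h1Norm b ν c := by
    have := ge_of_tendsto' (h0.add_const (ENNReal.ofReal A * l1h1Norm b ν c)) hsum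
    rwa [zero_add] at this
  refine hF.hardyNorm_le.trans ?_
  rw [ENNReal.ofReal_mul zero_le_two, ENNReal.ofReal_ofNat, mul_assoc]
  exact mul_le_mul' le_rfl hle

lemma sInf_l1h1Norm_le (hα : ∀ j, α j ≠ 0) {A C : ℝ}
    (h : ∀ j s, h1Norm b ν s ≠ ⊤ →
      ∃ G : LE d, IsLift G (scaleTerm α b ψ j s) ∧ ‖G‖ ≤ A * (h1Norm b ν s).toReal)
    (hC : 0 ≤ C) (hexp : ∀ F : LE d, Rz F → ∃ (c : ℕ → (Fin d → ℤ) → ℂ) (G : ℕ → LE d),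
      (∀ j, IsLift (G j) (scaleTerm α b ψ j (c j))) ∧
      l1h1Norm b ν c ≤ ENNReal.ofReal (C * ‖F‖) ∧
      ∃ N : ℕ → ℕ, StrictMono N ∧
        Tendsto (fun n => ∑ j ∈ Finset.range (N n), G j) atTop (𝓝 F))
    {f : (Fin d → ℝ) → ℂ} (hf : MemH1 f) :
    sInf {r : ℝ≥0∞ | ∃ c : ℕ → (Fin d → ℤ) → ℂ,
      l1h1Norm b ν c ≠ ⊤ ∧ H1SynthesisTo α b ψ c f ∧ r = l1h1Norm b ν c} ≤
      (ENNReal.ofReal C * (d + 1)) * hardyNorm f := by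
  obtain ⟨F, hF⟩ := hf.exists_isLift
  obtain ⟨c, G, hG, hc, N, hN, ht⟩ := hexp F hF.1
  have hctop : l1h1Norm b ν c ≠ ⊤ := ne_top_of_le_ne_top ENNReal.ofReal_ne_top hc
  have hcj : ∀ j, h1Norm b ν (c j) ≠ ⊤ := ENNReal.ne_top_of_tsum_ne_top hctop
  have hs : Summable fun j => ‖G j‖ := by
    refine ((ENNReal.summable_toReal hctop).mul_left A).of_nonneg_of_le
      (fun _ => norm_nonneg _) fun j => ?_
    obtain ⟨G', hG', hn⟩ := h j (c j) (hcj j)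
    rwa [(hG j).unique hG']
  have hsum : HasSum G F := by
    have h1 := hs.of_norm.hasSum
    rwa [tendsto_nhds_unique ht (h1.tendsto_sum_nat.comp hN.tendsto_atTop)]
  refine le_trans (sInf_le ⟨c, hctop, h1SynthesisTo_of_hasSum hα hcj hG hs hF hsum, rfl⟩)
    (hc.trans ?_)
  rw [ENNReal.ofReal_mul hC, mul_assoc]
  exact mul_le_mul' le_rfl hF.norm_le

end Assembly

/-- Corollary: Synthesis norm for `H¹`.
Isotropic expanding dilations.  If `ψ ∈ L¹`, `∫ ψ = 1` and `‖ψ - ψ(·-y)‖_{H¹} → 0` as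
`y → 0`, then `‖f‖_{H¹} ≈ inf { ‖c‖_{ℓ¹(h¹)} : f = Sc }` for all `f ∈ H¹`. -/
theorem statement9
    (d : ℕ) (b : Matrix (Fin d) (Fin d) ℝ) (hb : b.det ≠ 0)
    (α : ℕ → ℝ) (hα : ∀ j, α j ≠ 0) (hαtop : Tendsto (fun j => |α j|) atTop atTop)
    (ν : (Fin d → ℝ) → ℝ) (hν : IsCutoff d ν)
    (ψ : (Fin d → ℝ) → ℂ) (hψ : Integrable ψ volume)
    (hint : ∫ x : Fin d → ℝ, ψ x = 1)
    (hcont : ∀ ε : ℝ, 0 < ε → ∃ δ : ℝ, 0 < δ ∧ ∀ y : Fin d → ℝ, eucNorm y < δ →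
      ∃ g : (Fin d → ℝ) → Fin d → ℂ, Integrable g volume ∧
        HasRiesz (fun x => ψ x - ψ (x - y)) g ∧
        (∫ x : Fin d → ℝ, ‖ψ x - ψ (x - y)‖) + (∫ x : Fin d → ℝ, ‖g x‖) < ε) :
    ∃ C₁ C₂ : ℝ≥0∞, 0 < C₁ ∧ C₂ ≠ ⊤ ∧
      ∀ f : (Fin d → ℝ) → ℂ, MemH1 f →
        C₁ * hardyNorm f ≤
            sInf {r : ℝ≥0∞ | ∃ c : ℕ → (Fin d → ℤ) → ℂ,
              l1h1Norm b ν c ≠ ⊤ ∧ H1SynthesisTo α b ψ c f ∧ r = l1h1Norm b ν c} ∧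
          sInf {r : ℝ≥0∞ | ∃ c : ℕ → (Fin d → ℤ) → ℂ,
              l1h1Norm b ν c ≠ ⊤ ∧ H1SynthesisTo α b ψ c f ∧ r = l1h1Norm b ν c} ≤
            C₂ * hardyNorm f := by
  obtain ⟨⟨A, hA, hlift⟩, -⟩ := exists_lift_bound_and_samples hb hα hαtop hν hψ hint hcont
  obtain ⟨C, hC, hexp⟩ := exists_expansion (ν := ν) hb hα hαtop hν hψ hint hcont
  refine ⟨(ENNReal.ofReal (2 * A))⁻¹, ENNReal.ofReal C * (d + 1),
    ENNReal.inv_pos.2 ENNReal.ofReal_ne_top, by finiteness, fun f hf => ⟨?_, ?_⟩⟩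
  · refine le_sInf ?_
    rintro r ⟨c, hc, hs, rfl⟩
    have hA' : ENNReal.ofReal (2 * A) ≠ 0 := by simpa using hA
    rw [mul_comm, ← div_eq_mul_inv]
    exact ENNReal.div_le_of_le_mul' (hardyNorm_le_of_h1SynthesisTo hA.le hlift hc hf hs)
  · exact sInf_l1h1Norm_le hα hlift hC hexp hf

end AffinePaper
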